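/- Let n ≥ 2 be an integer, let Γ ∈ 𝒰, and let K be a homogeneous Calderón–Zygmund kernel on ℝ^n. If p ∈ (1,∞), r ∈ (2,∞) and r > p′/n (p′ = p/(p−1)), then there exist constants ε > 0 and C such that for every integer l ≥ 1 and every Schwartz function f on ℝ^n one has ‖ ( ∑_{j∈ℤ} ‖ u ↦ χ(u) H_{l+j_*}^{(2^j u)}f(x) ‖_{B_{r,1}^{1/r}(ℝ)}^r )^{1/r} ‖_{L^p(ℝ^n, dx)} ≤ C · 2^{−εl} ‖f‖_{L^p(ℝ^n)}, where j_* := sup{ m ∈ ℤ : 2^j Γ(2^m) ≤ 1 }, and ε, C are independent of l. -/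

import Mathlib

open MeasureTheory Filter Set
open scoped ENNReal NNReal FourierTransform Topology

noncomputable section

/-- `ℝⁿ` as a Euclidean space. -/
abbrev Rn (n : ℕ) := EuclideanSpace ℝ (Fin n)

/-- The class `𝒰` of phase functions: `Γ` is continuous on `[0,∞)`, smooth on `(0,∞)`,
`Γ(0) = 0`, `Γ′ > 0` on `(0,∞)`, with the bounds `c_{1,j} ≤ |s^j Γ^{(j)}(s)/Γ(s)|` for
`j = 1, 2` and `|s^j Γ^{(j)}(s)/Γ(s)| ≤ c_{2,j}` for all `j ≥ 1`. -/
structure IsGammaU (Γ : ℝ → ℝ) : Prop where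
  continuousOn : ContinuousOn Γ (Set.Ici 0)
  smooth : ContDiffOn ℝ (⊤ : ℕ∞) Γ (Set.Ioi 0)
  map_zero : Γ 0 = 0
  deriv_pos : ∀ s > (0 : ℝ), 0 < deriv Γ s
  lower : ∀ j ∈ ({1, 2} : Set ℕ), ∃ c > (0 : ℝ), ∀ s > (0 : ℝ),
    c ≤ |s ^ j * iteratedDeriv j Γ s / Γ s|
  upper : ∀ j : ℕ, 1 ≤ j → ∃ c > (0 : ℝ), ∀ s > (0 : ℝ),
    |s ^ j * iteratedDeriv j Γ s / Γ s| ≤ c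

/-- `K` is a homogeneous Calderón–Zygmund kernel on `ℝⁿ`: `K(t) = Ω(t)/‖t‖ⁿ` with `Ω` smooth
away from the origin, homogeneous of degree `0`, and of mean value zero on the unit sphere. -/
def IsHomCZKernel (n : ℕ) (K : Rn n → ℝ) : Prop :=
  ∃ Ω : Rn n → ℝ,
    ContDiffOn ℝ (⊤ : ℕ∞) Ω {x : Rn n | x ≠ 0} ∧
    (∀ c : ℝ, 0 < c → ∀ t : Rn n, Ω (c • t) = Ω t) ∧
    (∫ θ : Metric.sphere (0 : Rn n) 1, Ω θ ∂((volume : Measure (Rn n)).toSphere) = 0) ∧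
    (∀ t : Rn n, t ≠ 0 → K t = Ω t / ‖t‖ ^ n)

/-- The `r`-variation of a family `(a_u)_{u ∈ 𝒦}`. -/
def variation {ι : Type*} [LinearOrder ι] (r : ℝ) (𝒦 : Set ι) (a : ι → ℂ) : ℝ≥0∞ :=
  ⨆ (J : ℕ) (u : Fin (J + 1) → ι) (_ : StrictMono u) (_ : ∀ i, u i ∈ 𝒦),
    (∑ i : Fin J, (‖a (u i.succ) - a (u i.castSucc)‖₊ : ℝ≥0∞) ^ r) ^ (1 / r)

/-- The `λ`-jump counting function of a family `(a_u)_{u ∈ 𝒦}`. -/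
def jumpCount {ι : Type*} [LinearOrder ι] (lam : ℝ) (𝒦 : Set ι) (a : ι → ℂ) : ℝ≥0∞ :=
  ⨆ (J : ℕ) (s : Fin J → ι) (t : Fin J → ι) (_ : ∀ i, s i ∈ 𝒦) (_ : ∀ i, t i ∈ 𝒦)
    (_ : ∀ i, s i < t i) (_ : ∀ i j : Fin J, i < j → t i < s j)
    (_ : ∀ i, lam < ‖a (t i) - a (s i)‖), (J : ℝ≥0∞)

/-- The `L^p` norm of an `ℝ≥0∞`-valued function. -/
def lpNormENN {α : Type*} [MeasurableSpace α] (p : ℝ) (g : α → ℝ≥0∞) (μ : Measure α) : ℝ≥0∞ :=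
  (∫⁻ x, g x ^ p ∂μ) ^ (1 / p)

/-- The fixed Littlewood–Paley cutoff `ψ : ℝ → [0,1]`, supported in `{1/2 ≤ |s| ≤ 2}`,
with `∑_{l ∈ ℤ} ψ(2^{-l} s) = 1` for `s ≠ 0`. -/
def IsLPCutoff (ψ : ℝ → ℝ) : Prop :=
  ContDiff ℝ (⊤ : ℕ∞) ψ ∧ (∀ s, ψ s ∈ Set.Icc (0 : ℝ) 1) ∧
    (∀ s, ψ s ≠ 0 → |s| ∈ Set.Icc (1/2 : ℝ) 2) ∧
    (∀ s : ℝ, s ≠ 0 → HasSum (fun l : ℤ => ψ ((2 : ℝ) ^ (-l) * s)) 1)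

/-- `k_* = sup{ m ∈ ℤ : 2^k Γ(2^m) ≤ 1 }`. -/
def kstar (Γ : ℝ → ℝ) (k : ℤ) : ℤ :=
  sSup {m : ℤ | (2 : ℝ) ^ k * Γ ((2 : ℝ) ^ m) ≤ 1}

/-- The localized modulated integral `H_l^{(u)} f(x) = ∫ f(x−t) e^{iuΓ(|t|)} ψ_l(t) K(t) dt`. -/
def Hloc {n : ℕ} (Γ : ℝ → ℝ) (K : Rn n → ℝ) (ψ : ℝ → ℝ) (u : ℝ) (l : ℤ)
    (f : Rn n → ℂ) (x : Rn n) : ℂ :=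
  ∫ t : Rn n, f (x - t) * Complex.exp (Complex.I * Complex.ofReal (u * Γ ‖t‖)) *
    Complex.ofReal (ψ ((2 : ℝ) ^ (-l) * ‖t‖) * K t)

/-- The fixed cutoff `χ : ℝ → [0,1]`, supported in `[1/2, 4]` and equal to `1` on `[1,2]`. -/
def IsChiCutoff (χ : ℝ → ℝ) : Prop :=
  ContDiff ℝ (⊤ : ℕ∞) χ ∧ (∀ u, χ u ∈ Set.Icc (0 : ℝ) 1) ∧
    (∀ u, χ u ≠ 0 → u ∈ Set.Icc (1/2 : ℝ) 4) ∧ (∀ u ∈ Set.Icc (1 : ℝ) 2, χ u = 1)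

/-- The Littlewood–Paley piece `Δ_i g` (`i ≥ 0`) on `ℝ`. -/
def deltaHigh (ψ : ℝ → ℝ) (i : ℕ) (g : ℝ → ℂ) : ℝ → ℂ :=
  𝓕⁻ fun τ : ℝ => Complex.ofReal (ψ ((2 : ℝ) ^ (-(i : ℤ)) * |τ|)) * 𝓕 g τ

/-- The low-frequency piece `Δ_{-1} g` on `ℝ`. -/
def deltaLow (ψ : ℝ → ℝ) (g : ℝ → ℂ) : ℝ → ℂ :=
  𝓕⁻ fun τ : ℝ => Complex.ofReal (1 - ∑' i : ℕ, ψ ((2 : ℝ) ^ (-(i : ℤ)) * |τ|)) * 𝓕 g τ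

/-- The Besov norm `‖g‖_{B_{r,1}^{1/r}(ℝ)} = ‖Δ_{-1}g‖_{L^r} + ∑_{i≥0} 2^{i/r} ‖Δ_i g‖_{L^r}`. -/
def besovNorm (ψ : ℝ → ℝ) (r : ℝ) (g : ℝ → ℂ) : ℝ≥0∞ :=
  eLpNorm (deltaLow ψ g) (ENNReal.ofReal r) volume +
    ∑' i : ℕ, ENNReal.ofReal ((2 : ℝ) ^ ((i : ℝ) / r)) *
      eLpNorm (deltaHigh ψ i g) (ENNReal.ofReal r) volume

/-- Real powers of two in `ℝ≥0∞`. -/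
abbrev tp (s : ℝ) : ℝ≥0∞ := (2 : ℝ≥0∞) ^ s

lemma tp_add (s t : ℝ) : tp (s + t) = tp s * tp t :=
  ENNReal.rpow_add _ _ (by norm_num) (by norm_num)

lemma tp_zero : tp 0 = 1 := ENNReal.rpow_zero

lemma tp_ne_zero (s : ℝ) : tp s ≠ 0 := by
  simp [tp, ENNReal.rpow_eq_zero_iff]

lemma tp_ne_top (s : ℝ) : tp s ≠ ⊤ := by
  simp [tp, ENNReal.rpow_eq_top_iff]

lemma tp_pos (s : ℝ) : 0 < tp s := pos_iff_ne_zero.2 (tp_ne_zero s)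

lemma tp_mono {s t : ℝ} (h : s ≤ t) : tp s ≤ tp t :=
  ENNReal.rpow_le_rpow_of_exponent_le (by norm_num) h

lemma tp_rpow (s t : ℝ) : tp s ^ t = tp (s * t) := (ENNReal.rpow_mul _ _ _).symm

lemma tp_eq_ofReal (s : ℝ) : tp s = ENNReal.ofReal ((2 : ℝ) ^ s) := by
  rw [tp, ← ENNReal.ofReal_rpow_of_pos (by norm_num)]
  norm_num

lemma tp_mul_neg (s : ℝ) : tp s * tp (-s) = 1 := by
  rw [← tp_add]; simp

lemma tsum_tp_neg_abs_ne_top {γ : ℝ} (hγ : 0 < γ) :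
    ∑' i : ℤ, tp (-γ * |(i : ℝ)|) ≠ ⊤ := by
  have key : ∑' n : ℕ, tp (-γ * n) ≠ ⊤ := by
    have : ∀ n : ℕ, tp (-γ * n) = (tp (-γ)) ^ n := by
      intro n
      rw [← tp_rpow, ENNReal.rpow_natCast]
    simp_rw [this]
    rw [ENNReal.tsum_geometric]
    have h1 : tp (-γ) < 1 := by
      rw [← tp_zero]
      exact ENNReal.rpow_lt_rpow_of_exponent_lt (by norm_num) (by norm_num) (by linarith)
    exact ENNReal.inv_ne_top.2 (tsub_pos_of_lt h1).ne'
  have h := HasSum.of_nat_of_neg_add_one (f := fun i : ℤ => tp (-γ * |(i : ℝ)|))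
    ENNReal.summable.hasSum ENNReal.summable.hasSum
  rw [h.tsum_eq]
  refine ENNReal.add_ne_top.2 ⟨?_, ?_⟩
  · simpa using key
  · refine ne_top_of_le_ne_top key (ENNReal.tsum_le_tsum fun n => tp_mono ?_)
    push_cast
    have : |(-((n : ℝ) + 1))| = n + 1 := by
      rw [abs_neg, abs_of_nonneg (by positivity)]
    rw [this]; nlinarith

lemma tsum_tp_shift (γ : ℝ) (m : ℤ) :
    ∑' i : ℤ, tp (-γ * |(i : ℝ) - m|) = ∑' i : ℤ, tp (-γ * |(i : ℝ)|) := by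
  rw [← (Equiv.addRight m).tsum_eq]
  refine tsum_congr fun i => ?_
  simp

lemma exists_tp_Ioc {a : ℝ≥0∞} (h0 : a ≠ 0) (h1 : a ≠ ⊤) :
    ∃ m : ℤ, tp m < a ∧ a ≤ tp (m + 1) := by
  obtain ⟨m, hm⟩ := ENNReal.exists_mem_Ioc_zpow (x := a) (y := 2) h0 h1 (by norm_num) (by norm_num)
  refine ⟨m, ?_, ?_⟩
  · have := hm.1
    rwa [← ENNReal.rpow_intCast] at this
  · have := hm.2
    rw [← ENNReal.rpow_intCast] at this
    push_cast at this
    exact this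

lemma exists_tp_Ico {a : ℝ≥0∞} (h0 : a ≠ 0) (h1 : a ≠ ⊤) :
    ∃ m : ℤ, tp m ≤ a ∧ a < tp (m + 1) := by
  obtain ⟨m, hm⟩ := ENNReal.exists_mem_Ico_zpow (x := a) (y := 2) h0 h1 (by norm_num) (by norm_num)
  refine ⟨m, ?_, ?_⟩
  · have := hm.1
    rwa [← ENNReal.rpow_intCast] at this
  · have := hm.2
    rw [← ENNReal.rpow_intCast] at this
    push_cast at this
    exact this

lemma rpow_le_tsum_levels {s : ℝ} (hs : 0 < s) (a : ℝ≥0∞) :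
    a ^ s ≤ ∑' i : ℤ, tp ((i + 1) * s) * (Ioi (tp i)).indicator 1 a := by
  rcases eq_or_ne a 0 with rfl | h0
  · simp [hs]
  rcases eq_or_ne a ⊤ with rfl | h1
  · have : ∀ i : ℤ, (Ioi (tp i)).indicator (1 : ℝ≥0∞ → ℝ≥0∞) ⊤ = 1 := by
      intro i
      rw [indicator_of_mem (by exact lt_top_iff_ne_top.2 (tp_ne_top _))]; rfl
    simp only [this, mul_one]
    rw [ENNReal.top_rpow_of_pos hs, top_le_iff]
    by_contra hcon
    have hle : ∀ N : ℕ, (N : ℝ≥0∞) ≤ ∑' i : ℤ, tp ((i + 1) * s) := by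
      intro N
      calc (N : ℝ≥0∞) =
          ∑ i ∈ (Finset.range N).map ⟨(fun n : ℕ => (n : ℤ)), Nat.cast_injective⟩, 1 := by
            simp
        _ ≤ ∑ i ∈ (Finset.range N).map ⟨(fun n : ℕ => (n : ℤ)), Nat.cast_injective⟩,
              tp ((i + 1) * s) := by
            refine Finset.sum_le_sum fun i hi => ?_
            obtain ⟨n, -, rfl⟩ := Finset.mem_map.1 hi
            rw [← tp_zero]
            refine tp_mono ?_
            simp only [Function.Embedding.coeFn_mk, Int.cast_natCast]
            positivity
        _ ≤ _ := ENNReal.sum_le_tsum _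
    obtain ⟨N, hN⟩ := ENNReal.exists_nat_gt hcon
    exact absurd (hle N) (not_le.2 hN)
  obtain ⟨m, hm1, hm2⟩ := exists_tp_Ioc h0 h1
  calc a ^ s ≤ (tp (m + 1)) ^ s := ENNReal.rpow_le_rpow hm2 hs.le
    _ = tp ((m + 1) * s) * (Ioi (tp m)).indicator 1 a := by
        rw [tp_rpow, indicator_of_mem (by exact hm1)]; simp
    _ ≤ _ := ENNReal.le_tsum (f := fun i : ℤ => tp ((i + 1) * s) * (Ioi (tp i)).indicator 1 a) m

lemma tsum_levels_le {σ : ℝ} (hσ : 0 < σ) (a : ℝ≥0∞) :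
    ∑' i : ℤ, tp (i * σ) * (Ioi (tp i)).indicator 1 a ≤
      (∑' i : ℤ, tp (-σ * |(i : ℝ)|)) * a ^ σ := by
  rcases eq_or_ne a 0 with rfl | h0
  · simp
  rcases eq_or_ne a ⊤ with rfl | h1
  · rw [ENNReal.top_rpow_of_pos hσ, ENNReal.mul_top]
    · exact le_top
    · refine (lt_of_lt_of_le ?_ (ENNReal.le_tsum 0)).ne'
      exact tp_pos _
  obtain ⟨m, hm1, hm2⟩ := exists_tp_Ioc h0 h1
  rw [← tsum_tp_shift σ m, ← ENNReal.tsum_mul_right]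
  refine ENNReal.tsum_le_tsum fun i => ?_
  by_cases hi : tp i < a
  · rw [indicator_of_mem (by exact hi)]
    have him : i ≤ m := by
      by_contra hcon
      have : (m : ℝ) + 1 ≤ i := by exact_mod_cast (not_le.1 hcon)
      exact absurd (lt_of_lt_of_le hi hm2) (not_lt.2 (tp_mono this))
    have him' : (i : ℝ) ≤ m := by exact_mod_cast him
    simp only [Pi.one_apply, mul_one]
    calc tp (i * σ) = tp (-σ * |(i : ℝ) - m|) * (tp m) ^ σ := by
          rw [tp_rpow, ← tp_add, abs_of_nonpos (by linarith)]
          congr 1; ring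
      _ ≤ _ := by gcongr
  · rw [indicator_of_notMem (by exact hi)]; simp

/-- A two-sided geometric sum. -/
lemma tsum_min_tent_le {α β : ℝ} (hα : 0 < α) (hβ : 0 < β) {Y : ℝ≥0∞} (h0 : Y ≠ 0) (h1 : Y ≠ ⊤)
    (g : ℤ → ℝ≥0∞) (hg1 : ∀ i : ℤ, g i ≤ Y ^ (1 - α) * tp (i * α))
    (hg2 : ∀ i : ℤ, g i ≤ Y ^ (1 + β) * tp (-(i * β))) :
    ∑' i, g i ≤ tp β * (∑' i : ℤ, tp (-(min α β) * |(i : ℝ)|)) * Y := by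
  obtain ⟨m, hm1, hm2⟩ := exists_tp_Ioc h0 h1
  rw [← tsum_tp_shift _ m, ← ENNReal.tsum_mul_left, ← ENNReal.tsum_mul_right]
  refine ENNReal.tsum_le_tsum fun i => ?_
  rcases le_total i m with him | him
  · have him' : (i : ℝ) ≤ m := by exact_mod_cast him
    calc g i ≤ Y ^ (1 - α) * tp (i * α) := hg1 i
      _ = Y * (Y ^ (-α) * tp (i * α)) := by
          rw [sub_eq_add_neg, ENNReal.rpow_add _ _ h0 h1, ENNReal.rpow_one, mul_assoc]
      _ ≤ Y * ((tp m) ^ (-α) * tp (i * α)) := by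
          gcongr 1
          gcongr 1
          rw [ENNReal.rpow_neg, ENNReal.rpow_neg]
          exact ENNReal.inv_le_inv.2 (ENNReal.rpow_le_rpow hm1.le hα.le)
      _ = Y * tp (-α * |(i : ℝ) - m|) := by
          rw [tp_rpow, ← tp_add, abs_of_nonpos (by linarith)]
          congr 2; ring
      _ ≤ Y * (tp β * tp (-(min α β) * |(i : ℝ) - m|)) := by
          gcongr 1
          rw [← tp_add]
          refine tp_mono ?_
          have := min_le_left α β
          nlinarith [abs_nonneg ((i : ℝ) - m)]
      _ = _ := by ring
  · have him' : (m : ℝ) ≤ i := by exact_mod_cast him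
    calc g i ≤ Y ^ (1 + β) * tp (-(i * β)) := hg2 i
      _ = Y * (Y ^ β * tp (-(i * β))) := by
          rw [ENNReal.rpow_add _ _ h0 h1, ENNReal.rpow_one, mul_assoc]
      _ ≤ Y * ((tp (m + 1)) ^ β * tp (-(i * β))) := by gcongr
      _ = Y * (tp β * tp (-β * |(i : ℝ) - m|)) := by
          rw [tp_rpow, ← tp_add, ← tp_add, abs_of_nonneg (by linarith)]
          congr 2; ring
      _ ≤ Y * (tp β * tp (-(min α β) * |(i : ℝ) - m|)) := by
          gcongr 2
          refine tp_mono ?_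
          have := min_le_right α β
          nlinarith [abs_nonneg ((i : ℝ) - m)]
      _ = _ := by ring

/-- The pointwise inequality behind restricted-type interpolation. -/
lemma tsum_le_interp {p p₁ p₂ : ℝ} (h₁ : 0 < p₁) (h₁p : p₁ < p) (hp₂ : p < p₂) :
    ∃ C : ℝ≥0∞, C ≠ ⊤ ∧ ∀ g : ℤ → ℝ≥0∞,
      (∑' i, g i) ^ p ≤ C * ∑' i : ℤ, tp (i * p) *
        ((g i * tp (-i)) ^ p₁ + (g i * tp (-i)) ^ p₂) := by
  have hp : 0 < p := h₁.trans h₁p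
  have h₂ : 0 < p₂ := hp.trans hp₂
  set β := p / p₁ - 1 with hβ
  set α := 1 - p / p₂ with hα
  have hβ0 : 0 < β := by rw [hβ, sub_pos, one_lt_div h₁]; exact h₁p
  have hα0 : 0 < α := by rw [hα, sub_pos, div_lt_one h₂]; exact hp₂
  set D := tp β * (∑' i : ℤ, tp (-(min α β) * |(i : ℝ)|)) with hD
  have hDtop : D ≠ ⊤ := ENNReal.mul_ne_top (tp_ne_top _) (tsum_tp_neg_abs_ne_top (lt_min hα0 hβ0))
  refine ⟨D ^ p, ENNReal.rpow_ne_top_of_nonneg hp.le hDtop, fun g => ?_⟩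
  set X := ∑' i : ℤ, tp (i * p) * ((g i * tp (-i)) ^ p₁ + (g i * tp (-i)) ^ p₂) with hX
  have hterm : ∀ i : ℤ, tp (i * p) * ((g i * tp (-i)) ^ p₁ + (g i * tp (-i)) ^ p₂) ≤ X :=
    fun i => ENNReal.le_tsum i
  have gen : ∀ (q : ℝ) (_ : 0 < q) (i : ℤ), tp (i * p) * (g i * tp (-i)) ^ q ≤ X →
      g i ≤ (X ^ (1 / p)) ^ (p / q) * tp (i * (1 - p / q)) := by
    intro q hq i h
    have e1 : (g i * tp (-i)) ^ q ≤ X * tp (-(i * p)) := by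
      calc (g i * tp (-i)) ^ q = (tp (i * p) * (g i * tp (-i)) ^ q) * tp (-(i * p)) := by
            rw [mul_comm (tp _), mul_assoc, tp_mul_neg, mul_one]
        _ ≤ _ := by gcongr
    have e2 : g i * tp (-i) ≤ (X * tp (-(i * p))) ^ (1 / q) := by
      rw [one_div, ENNReal.le_rpow_inv_iff hq]; exact e1
    calc g i = (g i * tp (-i)) * tp i := by
          rw [mul_assoc, mul_comm (tp _), tp_mul_neg, mul_one]
      _ ≤ (X * tp (-(i * p))) ^ (1 / q) * tp i := by gcongr
      _ = _ := by
          rw [ENNReal.mul_rpow_of_nonneg _ _ (by positivity), tp_rpow, mul_assoc, ← tp_add,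
            ← ENNReal.rpow_mul]
          congr 2
          · field_simp
          · field_simp; ring
  rcases eq_or_ne X 0 with h0 | h0
  · have : ∀ i, g i = 0 := by
      intro i
      have := gen p₁ h₁ i (le_trans (by gcongr; exact le_self_add) (hterm i))
      rw [h0, ENNReal.zero_rpow_of_pos (by positivity),
        ENNReal.zero_rpow_of_pos (by positivity), zero_mul] at this
      exact le_antisymm this zero_le
    simp [this, hp]
  rcases eq_or_ne X ⊤ with h1 | h1
  · rw [h1, ENNReal.mul_top]
    · exact le_top
    · have : D ≠ 0 := by
        rw [hD]
        refine mul_ne_zero (tp_ne_zero _) (lt_of_lt_of_le ?_ (ENNReal.le_tsum 0)).ne'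
        exact tp_pos _
      simp [ENNReal.rpow_eq_zero_iff, this, hDtop]
  set Y := X ^ (1 / p) with hY
  have hY0 : Y ≠ 0 := by simp [hY, ENNReal.rpow_eq_zero_iff, h0, h1]
  have hY1 : Y ≠ ⊤ := ENNReal.rpow_ne_top_of_nonneg (by positivity) h1
  have hfin := tsum_min_tent_le hα0 hβ0 hY0 hY1 g (fun i => by
      have := gen p₂ h₂ i (le_trans (by gcongr; exact le_add_self) (hterm i))
      rwa [show p / p₂ = 1 - α by rw [hα]; ring,
        show (i : ℝ) * (1 - (1 - α)) = i * α by ring] at this)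
    (fun i => by
      have := gen p₁ h₁ i (le_trans (by gcongr; exact le_self_add) (hterm i))
      rwa [show p / p₁ = 1 + β by rw [hβ]; ring,
        show (i : ℝ) * (1 - (1 + β)) = -(i * β) by ring] at this)
  calc (∑' i, g i) ^ p ≤ (D * Y) ^ p := ENNReal.rpow_le_rpow hfin hp.le
    _ = D ^ p * X := by
        rw [ENNReal.mul_rpow_of_nonneg _ _ hp.le, hY, ← ENNReal.rpow_mul,
          one_div_mul_cancel hp.ne', ENNReal.rpow_one]

lemma lintegral_tsum_rpow_le_interp {p p₁ p₂ : ℝ} (h₁ : 0 < p₁) (h₁p : p₁ < p) (hp₂ : p < p₂) :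
    ∃ C : ℝ≥0∞, C ≠ ⊤ ∧ ∀ {α : Type} [MeasurableSpace α] (μ : Measure α) (g : ℤ → α → ℝ≥0∞)
      (_ : ∀ i, Measurable (g i)) (B : ℝ≥0∞) (_ : B ≠ 0) (_ : B ≠ ⊤) (m : ℤ → ℝ≥0∞)
      (_ : ∀ i : ℤ, ∫⁻ x, g i x ^ p₁ ∂μ ≤ B ^ p₁ * (tp (i * p₁) * m i))
      (_ : ∀ i : ℤ, ∫⁻ x, g i x ^ p₂ ∂μ ≤ B ^ p₂ * (tp (i * p₂) * m i)),
      ∫⁻ x, (∑' i, g i x) ^ p ∂μ ≤ C * B ^ p * ∑' i : ℤ, tp (i * p) * m i := by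
  obtain ⟨C, hC, h⟩ := tsum_le_interp h₁ h₁p hp₂
  have hp : 0 < p := h₁.trans h₁p
  have h₂ : 0 < p₂ := hp.trans hp₂
  refine ⟨C * 2, ENNReal.mul_ne_top hC (by norm_num), ?_⟩
  intro α _ μ g hg B hB0 hB1 m hm1 hm2
  have main : ∀ (q : ℝ) (_ : 0 < q) (i : ℤ),
      ∫⁻ x, g i x ^ q ∂μ ≤ B ^ q * (tp (i * q) * m i) →
      ∫⁻ x, (g i x * B⁻¹ * tp (-i)) ^ q ∂μ ≤ m i := by
    intro q hq i hi
    have e : ∀ x, (g i x * B⁻¹ * tp (-i)) ^ q = g i x ^ q * ((B ^ q)⁻¹ * tp (-(i * q))) := by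
      intro x
      rw [ENNReal.mul_rpow_of_nonneg _ _ hq.le, ENNReal.mul_rpow_of_nonneg _ _ hq.le,
        ENNReal.inv_rpow, tp_rpow, mul_assoc, neg_mul]
    simp_rw [e]
    rw [lintegral_mul_const _ ((hg i).pow_const q)]
    calc _ ≤ B ^ q * (tp (i * q) * m i) * ((B ^ q)⁻¹ * tp (-(i * q))) := by gcongr
      _ = (B ^ q * (B ^ q)⁻¹) * (tp (i * q) * tp (-(i * q))) * m i := by ring
      _ = m i := by
        rw [tp_mul_neg, ENNReal.mul_inv_cancel, one_mul, one_mul]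
        · simp [ENNReal.rpow_eq_zero_iff, hB0, hB1]
        · exact ENNReal.rpow_ne_top_of_nonneg hq.le hB1
  calc ∫⁻ x, (∑' i, g i x) ^ p ∂μ
      = ∫⁻ x, B ^ p * (∑' i, g i x * B⁻¹) ^ p ∂μ := by
        refine lintegral_congr fun x => ?_
        rw [← ENNReal.mul_rpow_of_nonneg _ _ hp.le, ENNReal.tsum_mul_right, mul_comm B,
          mul_assoc, ENNReal.inv_mul_cancel hB0 hB1, mul_one]
    _ ≤ ∫⁻ x, B ^ p * (C * ∑' i : ℤ, tp (i * p) *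
        ((g i x * B⁻¹ * tp (-i)) ^ p₁ + (g i x * B⁻¹ * tp (-i)) ^ p₂)) ∂μ := by
        gcongr with x
        exact h _
    _ = B ^ p * (C * ∑' i : ℤ, tp (i * p) * (∫⁻ x, (g i x * B⁻¹ * tp (-i)) ^ p₁ ∂μ +
          ∫⁻ x, (g i x * B⁻¹ * tp (-i)) ^ p₂ ∂μ)) := by
        have hmeas : ∀ (q : ℝ) (i : ℤ), Measurable fun x => (g i x * B⁻¹ * tp (-i)) ^ q := by
          intro q i
          exact (((hg i).mul_const _).mul_const _).pow_const _
        have hmeas2 : ∀ i : ℤ, Measurable fun x => tp (i * p) *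
            ((g i x * B⁻¹ * tp (-i)) ^ p₁ + (g i x * B⁻¹ * tp (-i)) ^ p₂) := by
          intro i
          exact ((hmeas p₁ i).add (hmeas p₂ i)).const_mul _
        rw [lintegral_const_mul, lintegral_const_mul, lintegral_tsum]
        · congr 3
          ext i
          rw [lintegral_const_mul' _ _ (tp_ne_top _), lintegral_add_left (hmeas p₁ i)]
        · exact fun i => (hmeas2 i).aemeasurable
        · exact Measurable.tsum hmeas2
        · exact (Measurable.tsum hmeas2).const_mul _
    _ ≤ B ^ p * (C * ∑' i : ℤ, tp (i * p) * (m i + m i)) := by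
        gcongr with i
        · exact main p₁ h₁ i (hm1 i)
        · exact main p₂ h₂ i (hm2 i)
    _ = _ := by
        have : ∀ i : ℤ, tp (i * p) * (m i + m i) = 2 * (tp (i * p) * m i) := fun i => by ring
        simp_rw [this]
        rw [ENNReal.tsum_mul_left]; ring

/-- Minkowski's inequality for finite sums. -/
lemma lintegral_finset_sum_rpow_le {α ι : Type*} [MeasurableSpace α] (μ : Measure α)
    {p : ℝ} (hp : 1 ≤ p) (s : Finset ι) (f : ι → α → ℝ≥0∞) (hf : ∀ i, AEMeasurable (f i) μ) :
    (∫⁻ x, (∑ i ∈ s, f i x) ^ p ∂μ) ^ (1 / p) ≤ ∑ i ∈ s, (∫⁻ x, f i x ^ p ∂μ) ^ (1 / p) := by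
  classical
  induction s using Finset.induction_on with
  | empty => simp [show 0 < p by linarith]
  | insert a s ha ih =>
    simp_rw [Finset.sum_insert ha]
    refine (ENNReal.lintegral_Lp_add_le (f := f a) (g := fun x => ∑ i ∈ s, f i x)
      (hf a) (Finset.aemeasurable_fun_sum s fun i _ => hf i) hp).trans ?_
    gcongr

/-- Minkowski's inequality for countable sums. -/
lemma lintegral_tsum_rpow_le {α ι : Type*} [Countable ι] [MeasurableSpace α] (μ : Measure α)
    {p : ℝ} (hp : 1 ≤ p) (f : ι → α → ℝ≥0∞) (hf : ∀ i, Measurable (f i)) :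
    (∫⁻ x, (∑' i, f i x) ^ p ∂μ) ^ (1 / p) ≤ ∑' i, (∫⁻ x, f i x ^ p ∂μ) ^ (1 / p) := by
  have hp0 : 0 < p := by linarith
  have e : ∀ x, (∑' i, f i x) ^ p = ⨆ s : Finset ι, (∑ i ∈ s, f i x) ^ p := by
    intro x
    rw [ENNReal.tsum_eq_iSup_sum]
    exact (ENNReal.orderIsoRpow p hp0).map_iSup _
  simp_rw [e]
  rw [lintegral_iSup_directed]
  · have : (⨆ s : Finset ι, ∫⁻ x, (∑ i ∈ s, f i x) ^ p ∂μ) ^ (1 / p) =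
        ⨆ s : Finset ι, (∫⁻ x, (∑ i ∈ s, f i x) ^ p ∂μ) ^ (1 / p) :=
      (ENNReal.orderIsoRpow (1 / p) (by positivity)).map_iSup _
    rw [this]
    refine iSup_le fun s => (lintegral_finset_sum_rpow_le μ hp s f
      fun i => (hf i).aemeasurable).trans (ENNReal.sum_le_tsum s)
  · intro s
    exact ((Finset.measurable_fun_sum s fun i _ => hf i).pow_const p).aemeasurable
  · refine Monotone.directed_le fun s t hst x => ?_
    dsimp only
    gcongr

/-- The (normalised) average of `g` over the closed ball of radius `2 ^ k` about `x`. -/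
def ballAvg {n : ℕ} (k : ℤ) (g : Rn n → ℝ≥0∞) (x : Rn n) : ℝ≥0∞ :=
  tp (-(k * n)) * ∫⁻ y in Metric.closedBall x ((2 : ℝ) ^ k), g y

/-- The dyadic-radius Hardy–Littlewood maximal function. -/
def maxFn {n : ℕ} (g : Rn n → ℝ≥0∞) (x : Rn n) : ℝ≥0∞ := ⨆ k : ℤ, ballAvg k g x

/-- The volume of the unit ball. -/
def unitVol (n : ℕ) : ℝ≥0∞ := volume (Metric.closedBall (0 : Rn n) 1)

lemma unitVol_ne_top (n : ℕ) : unitVol n ≠ ⊤ := measure_closedBall_lt_top.ne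

lemma unitVol_ne_zero (n : ℕ) : unitVol n ≠ 0 :=
  (Metric.measure_closedBall_pos volume _ one_pos).ne'

lemma volume_closedBall_mul {n : ℕ} (x : Rn n) {c : ℝ} (hc : 0 ≤ c) (k : ℤ) :
    volume (Metric.closedBall x (c * (2 : ℝ) ^ k)) =
      ENNReal.ofReal (c ^ n) * tp (k * n) * unitVol n := by
  rw [Measure.addHaar_closedBall' volume x (by positivity), unitVol, mul_pow,
    ENNReal.ofReal_mul (by positivity), tp_eq_ofReal]
  congr 2
  · simp
  · rw [finrank_euclideanSpace_fin, Real.rpow_mul (by norm_num), Real.rpow_natCast,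
      Real.rpow_intCast]

lemma volume_closedBall_zpow {n : ℕ} (x : Rn n) (k : ℤ) :
    volume (Metric.closedBall x ((2 : ℝ) ^ k)) = tp (k * n) * unitVol n := by
  have := volume_closedBall_mul x zero_le_one k
  simpa using this

lemma ballAvg_eq_lintegral {n : ℕ} (k : ℤ) (g : Rn n → ℝ≥0∞) (x : Rn n) :
    ballAvg k g x = tp (-(k * n)) *
      ∫⁻ y, {z : Rn n × Rn n | dist z.2 z.1 ≤ (2 : ℝ) ^ k}.indicator 1 (x, y) * g y := by
  rw [ballAvg, ← lintegral_indicator Metric.isClosed_closedBall.measurableSet]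
  congr 2
  ext y
  by_cases h : dist y x ≤ (2 : ℝ) ^ k
  · rw [indicator_of_mem (by simpa using h), indicator_of_mem (by simpa using h)]; simp
  · rw [indicator_of_notMem (by simpa using h), indicator_of_notMem (by simpa using h)]; simp

lemma measurableSet_dist_le {n : ℕ} (r : ℝ) :
    MeasurableSet {z : Rn n × Rn n | dist z.2 z.1 ≤ r} :=
  (isClosed_le (continuous_snd.dist continuous_fst) continuous_const).measurableSet

lemma measurable_ballAvg {n : ℕ} (k : ℤ) {g : Rn n → ℝ≥0∞} (hg : Measurable g) :
    Measurable (ballAvg k g) := by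
  have : ballAvg k g = fun x => tp (-(k * n)) *
      ∫⁻ y, {z : Rn n × Rn n | dist z.2 z.1 ≤ (2 : ℝ) ^ k}.indicator 1 (x, y) * g y := by
    ext x; exact ballAvg_eq_lintegral k g x
  rw [this]
  refine Measurable.const_mul ?_ _
  refine Measurable.lintegral_prod_right' (f := fun z : Rn n × Rn n =>
    {z : Rn n × Rn n | dist z.2 z.1 ≤ (2 : ℝ) ^ k}.indicator 1 z * g z.2) ?_
  exact (measurable_one.indicator (measurableSet_dist_le _)).mul (hg.comp measurable_snd)

lemma measurable_maxFn {n : ℕ} {g : Rn n → ℝ≥0∞} (hg : Measurable g) : Measurable (maxFn g) :=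
  Measurable.iSup fun k => measurable_ballAvg k hg

lemma ballAvg_le_maxFn {n : ℕ} (k : ℤ) (g : Rn n → ℝ≥0∞) (x : Rn n) :
    ballAvg k g x ≤ maxFn g x := le_iSup (fun k => ballAvg k g x) k

lemma ballAvg_mono {n : ℕ} (k : ℤ) {f g : Rn n → ℝ≥0∞} (h : ∀ y, f y ≤ g y) (x : Rn n) :
    ballAvg k f x ≤ ballAvg k g x := by
  unfold ballAvg
  gcongr with y
  exact h y

lemma ballAvg_const {n : ℕ} (k : ℤ) (c : ℝ≥0∞) (x : Rn n) :
    ballAvg k (fun _ => c) x = c * unitVol n := by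
  rw [ballAvg, setLIntegral_const, volume_closedBall_zpow]
  calc tp (-(k * n)) * (c * (tp (k * n) * unitVol n))
      = (tp (k * n) * tp (-(k * n))) * (c * unitVol n) := by ring
    _ = _ := by rw [tp_mul_neg, one_mul]

/-- `ballAvg` is self-adjoint. -/
lemma lintegral_ballAvg_mul {n : ℕ} (k : ℤ) {g w : Rn n → ℝ≥0∞} (hg : Measurable g)
    (hw : Measurable w) :
    ∫⁻ x, ballAvg k g x * w x = ∫⁻ x, g x * ballAvg k w x := by
  simp_rw [ballAvg_eq_lintegral]
  set S := {z : Rn n × Rn n | dist z.2 z.1 ≤ (2 : ℝ) ^ k} with hS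
  have hSm : MeasurableSet S := measurableSet_dist_le _
  have hSi : Measurable (S.indicator (1 : Rn n × Rn n → ℝ≥0∞)) := measurable_one.indicator hSm
  have hsymm : ∀ x y, S.indicator (1 : Rn n × Rn n → ℝ≥0∞) (x, y) = S.indicator 1 (y, x) := by
    intro x y
    by_cases h : dist y x ≤ (2 : ℝ) ^ k
    · rw [indicator_of_mem (by simpa [hS] using h),
        indicator_of_mem (by simpa [hS, dist_comm] using h)]; rfl
    · rw [indicator_of_notMem (by simpa [hS] using h),
        indicator_of_notMem (by simpa [hS, dist_comm] using h)]
  have m1 : ∀ x, Measurable fun y => S.indicator (1 : Rn n × Rn n → ℝ≥0∞) (x, y) := fun x =>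
    hSi.comp measurable_prodMk_left
  calc ∫⁻ x, tp (-(k * n)) * (∫⁻ y, S.indicator 1 (x, y) * g y) * w x
      = ∫⁻ x, ∫⁻ y, tp (-(k * n)) * S.indicator 1 (x, y) * g y * w x := by
        refine lintegral_congr fun x => ?_
        rw [← lintegral_const_mul _ ((m1 x).fun_mul hg), ← lintegral_mul_const]
        · simp_rw [mul_assoc]
        · exact ((m1 x).fun_mul hg).const_mul _
    _ = ∫⁻ y, ∫⁻ x, tp (-(k * n)) * S.indicator 1 (x, y) * g y * w x := by
        refine lintegral_lintegral_swap ?_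
        exact ((((hSi.const_mul _).mul (hg.comp measurable_snd)).mul
          (hw.comp measurable_fst))).aemeasurable
    _ = _ := by
        refine lintegral_congr fun y => ?_
        rw [← lintegral_const_mul _ ((m1 y).fun_mul hw), ← lintegral_const_mul]
        · refine lintegral_congr fun x => ?_
          rw [hsymm]; ring
        · exact ((m1 y).fun_mul hw).const_mul _

/-- The weak type `(1,1)` bound for the maximal function. -/
lemma maxFn_weak {n : ℕ} (hn : 1 ≤ n) (g : Rn n → ℝ≥0∞) (t : ℝ≥0∞) :
    t * volume {x | t < maxFn g x} ≤ ENNReal.ofReal (5 ^ n) * unitVol n * ∫⁻ x, g x := by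
  set A := ENNReal.ofReal (5 ^ n) * unitVol n with hA
  have hA0 : A ≠ 0 := mul_ne_zero (by simp) (unitVol_ne_zero n)
  rcases eq_or_ne t 0 with rfl | ht0
  · simp
  rcases eq_or_ne (∫⁻ x, g x) ⊤ with hI | hI
  · rw [hI, ENNReal.mul_top hA0]; exact le_top
  rcases eq_or_ne t ⊤ with rfl | ht1
  · simp
  set E := {x | t < maxFn g x} with hE
  have hk : ∀ x : Rn n, x ∈ E → ∃ k : ℤ, t < ballAvg k g x := fun x hx => lt_iSup_iff.1 hx
  choose! k hk using hk
  have hk2 : ∀ x ∈ E, t * tp (k x * n) ≤ ∫⁻ y in Metric.closedBall x ((2 : ℝ) ^ k x), g y := by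
    intro x hx
    have h := (hk x hx).le
    calc t * tp (k x * n) ≤ ballAvg (k x) g x * tp (k x * n) := by gcongr
      _ = (tp (k x * n) * tp (-(k x * n))) * ∫⁻ y in Metric.closedBall x ((2 : ℝ) ^ k x), g y := by
          rw [ballAvg]; ring
      _ = _ := by rw [tp_mul_neg, one_mul]
  obtain ⟨K, hK⟩ : ∃ K : ℤ, ∀ x ∈ E, k x ≤ K := by
    have hq : (∫⁻ x, g x) / t + 1 ≠ ⊤ := ENNReal.add_ne_top.2
      ⟨(ENNReal.div_lt_top hI ht0).ne, ENNReal.one_ne_top⟩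
    obtain ⟨m, -, hm⟩ := exists_tp_Ioc (a := (∫⁻ x, g x) / t + 1) (by simp) hq
    refine ⟨max (m + 1) 0, fun x hx => ?_⟩
    by_contra hcon
    rw [not_le, max_lt_iff] at hcon
    have h1 : (m : ℝ) + 1 < k x := by exact_mod_cast hcon.1
    have h0 : (0 : ℝ) < k x := by exact_mod_cast hcon.2
    have h2 : tp (k x * n) ≤ tp (m + 1) := by
      calc tp (k x * n) ≤ (∫⁻ x, g x) / t := by
            rw [ENNReal.le_div_iff_mul_le (Or.inl ht0) (Or.inl ht1), mul_comm]
            exact (hk2 x hx).trans (setLIntegral_le_lintegral _ _)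
        _ ≤ (∫⁻ x, g x) / t + 1 := le_self_add
        _ ≤ _ := hm
    have h3 : tp ((m : ℝ) + 1) < tp (k x * n) := by
      refine ENNReal.rpow_lt_rpow_of_exponent_lt (by norm_num) (by norm_num) ?_
      have : (1 : ℝ) ≤ n := by exact_mod_cast hn
      nlinarith
    exact absurd h2 (not_le.2 h3)
  obtain ⟨u, huE, hdisj, hcov⟩ := Vitali.exists_disjoint_subfamily_covering_enlargement_closedBall
    E (fun x => x) (fun x => (2 : ℝ) ^ k x) ((2 : ℝ) ^ K)
    (fun x hx => zpow_le_zpow_right₀ (by norm_num) (hK x hx)) 5 (by norm_num)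
  have hcount : u.Countable := by
    refine hdisj.countable_of_nonempty_interior fun x _ => ?_
    exact ⟨x, Metric.ball_subset_interior_closedBall (Metric.mem_ball_self (by positivity))⟩
  have hsub : E ⊆ ⋃ x ∈ u, Metric.closedBall x (5 * (2 : ℝ) ^ k x) := by
    intro x hx
    obtain ⟨b, hb, hsubs⟩ := hcov x hx
    exact mem_biUnion hb (hsubs (Metric.mem_closedBall_self (by positivity)))
  calc t * volume E ≤ t * ∑' x : u, volume (Metric.closedBall (x : Rn n) (5 * (2 : ℝ) ^ k x)) := by
        gcongr
        exact (measure_mono hsub).trans (measure_biUnion_le _ hcount _)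
    _ = A * ∑' x : u, t * tp (k x * n) := by
        rw [← ENNReal.tsum_mul_left, ← ENNReal.tsum_mul_left]
        refine tsum_congr fun x => ?_
        rw [volume_closedBall_mul _ (by norm_num)]; ring
    _ ≤ A * ∑' x : u, ∫⁻ y in Metric.closedBall (x : Rn n) ((2 : ℝ) ^ k x), g y := by
        gcongr with x
        exact hk2 x (huE x.2)
    _ = A * ∫⁻ y in ⋃ x ∈ u, Metric.closedBall (x : Rn n) ((2 : ℝ) ^ k x), g y := by
        rw [lintegral_biUnion hcount (fun x _ => Metric.isClosed_closedBall.measurableSet) hdisj]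
    _ ≤ A * ∫⁻ x, g x := by
        gcongr
        exact Measure.restrict_le_self

lemma maxFn_le_add {n : ℕ} (g : Rn n → ℝ≥0∞) (b : ℝ≥0∞) (x : Rn n) :
    maxFn g x ≤ maxFn ({y | b < g y}.indicator g) x + b * unitVol n := by
  refine iSup_le fun k => ?_
  calc ballAvg k g x ≤ ballAvg k (fun y => {y | b < g y}.indicator g y + b) x := by
        refine ballAvg_mono k (fun y => ?_) x
        by_cases h : b < g y
        · rw [indicator_of_mem (by exact h)]; exact le_self_add
        · exact (not_lt.1 h).trans le_add_self
    _ = ballAvg k ({y | b < g y}.indicator g) x + ballAvg k (fun _ => b) x := by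
        rw [ballAvg, lintegral_add_right _ measurable_const, mul_add]; rfl
    _ ≤ _ := by
        rw [ballAvg_const]
        gcongr
        exact ballAvg_le_maxFn _ _ _

lemma lintegral_rpow_le_tsum_measure {α : Type*} [MeasurableSpace α] (μ : Measure α) {s : ℝ}
    (hs : 0 < s) {g : α → ℝ≥0∞} (hg : Measurable g) :
    ∫⁻ x, g x ^ s ∂μ ≤ ∑' i : ℤ, tp ((i + 1) * s) * μ {x | tp i < g x} := by
  have hm : ∀ i : ℤ, MeasurableSet {x | tp i < g x} := fun i => measurableSet_lt measurable_const hg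
  have e : ∀ (i : ℤ) x, (Ioi (tp i)).indicator (1 : ℝ≥0∞ → ℝ≥0∞) (g x) =
      {x | tp i < g x}.indicator 1 x := fun i x => rfl
  calc ∫⁻ x, g x ^ s ∂μ
      ≤ ∫⁻ x, ∑' i : ℤ, tp ((i + 1) * s) * {x | tp i < g x}.indicator 1 x ∂μ :=
        lintegral_mono fun x => by
          simpa only [e] using rpow_le_tsum_levels hs (g x)
    _ = _ := by
        rw [lintegral_tsum fun i => ((measurable_one.indicator (hm i)).const_mul _).aemeasurable]
        refine tsum_congr fun i => ?_
        rw [lintegral_const_mul _ (measurable_one.indicator (hm i)), lintegral_indicator_one (hm i)]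

/-- The strong type bound for the maximal function. -/
lemma maxFn_strong {n : ℕ} (hn : 1 ≤ n) {s : ℝ} (hs : 1 < s) :
    ∃ C : ℝ≥0∞, C ≠ ⊤ ∧ ∀ g : Rn n → ℝ≥0∞, Measurable g →
      ∫⁻ x, maxFn g x ^ s ≤ C * ∫⁻ x, g x ^ s := by
  set A := ENNReal.ofReal (5 ^ n) * unitVol n with hA
  have hAtop : A ≠ ⊤ := ENNReal.mul_ne_top (by simp) (unitVol_ne_top n)
  set ω := unitVol n
  have hω0 : ω ≠ 0 := unitVol_ne_zero n
  have hω1 : ω ≠ ⊤ := unitVol_ne_top n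
  set S := ∑' i : ℤ, tp (-(s - 1) * |(i : ℝ)|)
  have hS : S ≠ ⊤ := tsum_tp_neg_abs_ne_top (by linarith)
  refine ⟨tp s * 2 * A * S * (2 * ω) ^ (s - 1), ?_, fun g hg => ?_⟩
  · refine ENNReal.mul_ne_top (ENNReal.mul_ne_top (ENNReal.mul_ne_top (ENNReal.mul_ne_top
      (tp_ne_top _) (by norm_num)) hAtop) hS) (ENNReal.rpow_ne_top_of_nonneg (by linarith) ?_)
    exact ENNReal.mul_ne_top (by norm_num) hω1
  have hlev : ∀ i : ℤ, volume {x | tp i < maxFn g x} ≤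
      2 * A * tp (-i) * ∫⁻ x, (Ioi (tp i)).indicator 1 (2 * ω * g x) * g x := by
    intro i
    set b := tp (i - 1) / ω
    have hb : b * ω = tp (i - 1) := ENNReal.div_mul_cancel hω0 hω1
    have hsub : {x | tp i < maxFn g x} ⊆
        {x | tp (i - 1) < maxFn ({y | b < g y}.indicator g) x} := by
      intro x hx
      have h1 := maxFn_le_add g b x
      rw [hb] at h1
      by_contra hcon
      have h2 : maxFn ({y | b < g y}.indicator g) x ≤ tp (i - 1) := not_lt.1 hcon
      have h3 : maxFn g x ≤ tp i := by
        calc maxFn g x ≤ tp (i - 1) + tp (i - 1) := h1.trans (by gcongr)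
          _ = tp (1 + (i - 1)) := by rw [tp_add, ← two_mul]; simp [tp]
          _ = tp i := by congr 1; ring
      exact absurd hx (not_lt.2 h3)
    have hint : ∫⁻ x, {y | b < g y}.indicator g x =
        ∫⁻ x, (Ioi (tp i)).indicator 1 (2 * ω * g x) * g x := by
      refine lintegral_congr fun x => ?_
      have hiff : b < g x ↔ tp i < 2 * ω * g x := by
        rw [ENNReal.div_lt_iff (Or.inl hω0) (Or.inl hω1)]
        rw [show (i : ℝ) = 1 + (i - 1) by ring, tp_add, show tp 1 = 2 by simp [tp], mul_assoc,
          show (1 : ℝ) + (i - 1) - 1 = i - 1 by ring, mul_comm ω]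
        exact (ENNReal.mul_lt_mul_iff_right (by norm_num) (by norm_num)).symm
      by_cases h : b < g x
      · rw [indicator_of_mem (by exact h), indicator_of_mem (by exact hiff.1 h)]; simp
      · rw [indicator_of_notMem (by exact h),
          indicator_of_notMem (by exact fun h' => h (hiff.2 h'))]; simp
    have hw := maxFn_weak hn ({y | b < g y}.indicator g) (tp (i - 1))
    rw [← hA, hint] at hw
    calc volume {x | tp i < maxFn g x}
        ≤ volume {x | tp (i - 1) < maxFn ({y | b < g y}.indicator g) x} := measure_mono hsub
      _ = tp (-(i - 1)) * (tp (i - 1) *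
            volume {x | tp (i - 1) < maxFn ({y | b < g y}.indicator g) x}) := by
          rw [← mul_assoc, mul_comm (tp _), tp_mul_neg, one_mul]
      _ ≤ tp (-(i - 1)) * (A * ∫⁻ x, (Ioi (tp i)).indicator 1 (2 * ω * g x) * g x) := by gcongr
      _ = _ := by
          rw [show -((i : ℝ) - 1) = 1 + -i by ring, tp_add, show tp 1 = 2 by simp [tp]]; ring
  have hmI : ∀ i : ℤ, Measurable fun x => (Ioi (tp i)).indicator (1 : ℝ≥0∞ → ℝ≥0∞) (2 * ω * g x) :=
    fun i => (measurable_one.indicator measurableSet_Ioi).comp (hg.const_mul _)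
  calc ∫⁻ x, maxFn g x ^ s
      ≤ ∑' i : ℤ, tp ((i + 1) * s) * volume {x | tp i < maxFn g x} :=
        lintegral_rpow_le_tsum_measure _ (by linarith) (measurable_maxFn hg)
    _ ≤ ∑' i : ℤ, tp ((i + 1) * s) * (2 * A * tp (-i) *
          ∫⁻ x, (Ioi (tp i)).indicator 1 (2 * ω * g x) * g x) := by
        gcongr with i
        exact hlev i
    _ = ∑' i : ℤ, ∫⁻ x, tp s * 2 * A *
          (tp (i * (s - 1)) * (Ioi (tp i)).indicator 1 (2 * ω * g x) * g x) := by
        refine tsum_congr fun i => ?_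
        simp_rw [mul_assoc (tp (i * (s - 1)))]
        rw [lintegral_const_mul _ (((hmI i).fun_mul hg).const_mul _),
          lintegral_const_mul _ ((hmI i).fun_mul hg),
          show ((i : ℝ) + 1) * s = s + i * (s - 1) + i by ring, tp_add, tp_add]
        calc _ = (tp i * tp (-i)) * (tp s * tp (i * (s - 1)) * (2 * A *
              ∫⁻ x, (Ioi (tp i)).indicator 1 (2 * ω * g x) * g x)) := by ring
          _ = _ := by rw [tp_mul_neg]; ring
    _ = ∫⁻ x, tp s * 2 * A * ((∑' i : ℤ, tp (i * (s - 1)) *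
          (Ioi (tp i)).indicator 1 (2 * ω * g x)) * g x) := by
        rw [← lintegral_tsum]
        · refine lintegral_congr fun x => ?_
          rw [ENNReal.tsum_mul_left, ENNReal.tsum_mul_right]
        · exact fun i => ((((hmI i).const_mul _).mul hg).const_mul _).aemeasurable
    _ ≤ ∫⁻ x, tp s * 2 * A * ((S * (2 * ω * g x) ^ (s - 1)) * g x) := by
        gcongr with x
        exact tsum_levels_le (by linarith) _
    _ = _ := by
        rw [← lintegral_const_mul _ (hg.pow_const s)]
        refine lintegral_congr fun x => ?_
        rw [ENNReal.mul_rpow_of_nonneg _ _ (by linarith : (0 : ℝ) ≤ s - 1)]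
        have : g x ^ s = g x ^ (s - 1) * g x := by
          have := ENNReal.rpow_add_of_nonneg (x := g x) (s - 1) 1 (by linarith) (by norm_num)
          rw [sub_add_cancel, ENNReal.rpow_one] at this
          exact this
        rw [this]; ring

/-- Coifman–Rochberg: powers `< 1` of maximal functions are `A₁` weights. -/
lemma ballAvg_maxFn_rpow {n : ℕ} (hn : 1 ≤ n) {δ : ℝ} (hδ0 : 0 ≤ δ) (hδ1 : δ < 1) :
    ∃ C : ℝ≥0∞, C ≠ ⊤ ∧ ∀ g : Rn n → ℝ≥0∞, Measurable g → ∀ (k : ℤ) (x : Rn n),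
      ballAvg k (fun y => maxFn g y ^ δ) x ≤ C * maxFn g x ^ δ := by
  rcases hδ0.eq_or_lt with rfl | hδ
  · refine ⟨unitVol n, unitVol_ne_top n, fun g _ k x => ?_⟩
    simp [ballAvg_const]
  set A := ENNReal.ofReal (5 ^ n) * unitVol n with hA
  have hAtop : A ≠ ⊤ := ENNReal.mul_ne_top (by simp) (unitVol_ne_top n)
  set ω := unitVol n
  set D := tp (1 - δ) * (∑' i : ℤ, tp (-(min δ (1 - δ)) * |(i : ℝ)|)) with hD
  have hDtop : D ≠ ⊤ := ENNReal.mul_ne_top (tp_ne_top _)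
    (tsum_tp_neg_abs_ne_top (lt_min hδ (by linarith)))
  set B := ω + A * tp n with hB
  have hBtop : B ≠ ⊤ := ENNReal.add_ne_top.2
    ⟨unitVol_ne_top n, ENNReal.mul_ne_top hAtop (tp_ne_top _)⟩
  have ht1 := tp_ne_top δ
  have ht2 := tp_ne_top (n * δ)
  have hω1 : ω ≠ ⊤ := unitVol_ne_top n
  refine ⟨tp δ * B * D + ω * tp (n * δ) + 1, by finiteness, fun g hg k x => ?_⟩
  set T := maxFn g x with hT
  rcases eq_or_ne T ⊤ with hT1 | hT1
  · rw [hT1, ENNReal.top_rpow_of_pos hδ, ENNReal.mul_top (by simp)]; exact le_top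
  have hfar : ∀ y ∈ Metric.closedBall x ((2 : ℝ) ^ k), ∀ m : ℤ, k ≤ m →
      ballAvg m g y ≤ tp n * T := by
    intro y hy m hm
    have hsub : Metric.closedBall y ((2 : ℝ) ^ m) ⊆ Metric.closedBall x ((2 : ℝ) ^ (m + 1)) := by
      refine Metric.closedBall_subset_closedBall' ?_
      have : (2 : ℝ) ^ k ≤ 2 ^ m := zpow_le_zpow_right₀ (by norm_num) hm
      rw [zpow_add_one₀ (by norm_num)]
      linarith [Metric.mem_closedBall.1 hy]
    calc ballAvg m g y ≤ tp (-(m * n)) * ∫⁻ z in Metric.closedBall x ((2 : ℝ) ^ (m + 1)), g z := by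
          rw [ballAvg]
          gcongr
      _ = tp n * ballAvg (m + 1) g x := by
          rw [ballAvg, ← mul_assoc, ← tp_add]
          congr 2
          push_cast; ring
      _ ≤ _ := by gcongr; exact ballAvg_le_maxFn _ _ _
  rcases eq_or_ne T 0 with hT0 | hT0
  · have hz : ∀ y, maxFn g y = 0 := by
      intro y
      rw [← le_zero_iff]
      refine iSup_le fun m => ?_
      obtain ⟨K, hK1, hK2⟩ : ∃ K : ℤ, m ≤ K ∧ dist y x ≤ (2 : ℝ) ^ K := by
        obtain ⟨N, hN⟩ := pow_unbounded_of_one_lt (dist y x) (one_lt_two)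
        refine ⟨max m N, le_max_left _ _, hN.le.trans ?_⟩
        rw [← zpow_natCast]
        exact zpow_le_zpow_right₀ (by norm_num) (le_max_right _ _)
      have hsub : Metric.closedBall y ((2 : ℝ) ^ m) ⊆ Metric.closedBall x ((2 : ℝ) ^ (K + 1)) := by
        refine Metric.closedBall_subset_closedBall' ?_
        have : (2 : ℝ) ^ m ≤ 2 ^ K := zpow_le_zpow_right₀ (by norm_num) hK1
        rw [zpow_add_one₀ (by norm_num)]
        linarith
      have h0 : ballAvg (K + 1) g x = 0 := le_zero_iff.1 ((ballAvg_le_maxFn _ _ _).trans hT0.le)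
      have h1 : ∫⁻ z in Metric.closedBall x ((2 : ℝ) ^ (K + 1)), g z = 0 := by
        rw [ballAvg] at h0
        exact (mul_eq_zero.1 h0).resolve_left (tp_ne_zero _)
      have h2 : ∫⁻ z in Metric.closedBall y ((2 : ℝ) ^ m), g z = 0 :=
        le_zero_iff.1 ((lintegral_mono_set hsub).trans h1.le)
      rw [ballAvg, h2, mul_zero]
    simp [hz, hδ, ballAvg]
  set F := (Metric.closedBall x ((2 : ℝ) ^ (k + 1))).indicator g with hF
  have hFm : Measurable F := hg.indicator Metric.isClosed_closedBall.measurableSet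
  have hFint : ∫⁻ y, F y ≤ tp (k * n) * tp n * T := by
    rw [hF, lintegral_indicator Metric.isClosed_closedBall.measurableSet]
    calc ∫⁻ y in Metric.closedBall x ((2 : ℝ) ^ (k + 1)), g y
        = (tp ((k + 1) * n) * tp (-((k + 1) * n))) *
            ∫⁻ y in Metric.closedBall x ((2 : ℝ) ^ (k + 1)), g y := by rw [tp_mul_neg, one_mul]
      _ = tp (k * n) * tp n * ballAvg (k + 1) g x := by
          rw [ballAvg, ← tp_add (k * n), show (k : ℝ) * n + n = (k + 1) * n by ring]
          push_cast; ring
      _ ≤ _ := by gcongr; exact ballAvg_le_maxFn _ _ _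
  have hloc : ∀ y ∈ Metric.closedBall x ((2 : ℝ) ^ k), maxFn g y ≤ max (maxFn F y) (tp n * T) := by
    intro y hy
    refine iSup_le fun m => ?_
    rcases le_total k m with hkm | hmk
    · exact (hfar y hy m hkm).trans (le_max_right _ _)
    · refine le_trans ?_ (le_max_left _ _)
      refine le_trans (le_of_eq ?_) (ballAvg_le_maxFn m F y)
      rw [ballAvg, ballAvg, hF]
      congr 1
      refine setLIntegral_congr_fun Metric.isClosed_closedBall.measurableSet fun z hz => ?_
      rw [indicator_of_mem]
      have : (2 : ℝ) ^ m ≤ 2 ^ k := zpow_le_zpow_right₀ (by norm_num) hmk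
      rw [Metric.mem_closedBall] at hz hy ⊢
      rw [zpow_add_one₀ (by norm_num)]
      linarith [dist_triangle z y x]
  have hMF : ∫⁻ y in Metric.closedBall x ((2 : ℝ) ^ k), maxFn F y ^ δ ≤
      tp δ * B * D * tp (k * n) * T ^ δ := by
    have hTi : T⁻¹ ≠ 0 := ENNReal.inv_ne_zero.2 hT1
    have e1 : ∀ y, maxFn F y ^ δ = T ^ δ * (T⁻¹ * maxFn F y) ^ δ := by
      intro y
      rw [← ENNReal.mul_rpow_of_nonneg _ _ hδ0, ← mul_assoc,
          ENNReal.mul_inv_cancel hT0 hT1, one_mul]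
    simp_rw [e1]
    rw [lintegral_const_mul _ (((measurable_maxFn hFm).const_mul _).pow_const _)]
    rw [mul_comm _ (T ^ δ)]
    gcongr
    refine (lintegral_rpow_le_tsum_measure _ hδ ((measurable_maxFn hFm).const_mul _)).trans ?_
    have hlev : ∀ i : ℤ, (volume.restrict (Metric.closedBall x ((2 : ℝ) ^ k)))
        {y | tp i < T⁻¹ * maxFn F y} ≤ B * tp (k * n) * min 1 (tp (-i)) := by
      intro i
      rw [mul_min_of_nonneg]
      swap
      · exact zero_le
      refine le_min ?_ ?_
      · refine (measure_mono (subset_univ _)).trans ?_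
        rw [Measure.restrict_apply_univ, volume_closedBall_zpow, mul_one, mul_comm]
        gcongr
        exact le_self_add
      · refine (Measure.restrict_apply_le _ _).trans ?_
        have hset : {y | tp i < T⁻¹ * maxFn F y} = {y | tp i * T < maxFn F y} := by
          ext y
          simp only [mem_ofPred_eq]
          rw [mul_comm, ← div_eq_mul_inv, ENNReal.lt_div_iff_mul_lt (Or.inl hT0) (Or.inl hT1)]
        rw [hset]
        have hw := maxFn_weak hn F (tp i * T)
        rw [← hA] at hw
        set v := volume {y | tp i * T < maxFn F y}
        calc v = (tp i * tp (-i)) * (T * T⁻¹) * v := by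
              rw [tp_mul_neg, ENNReal.mul_inv_cancel hT0 hT1, one_mul, one_mul]
          _ = tp (-i) * T⁻¹ * (tp i * T * v) := by ring
          _ ≤ tp (-i) * T⁻¹ * (A * (tp (k * n) * tp n * T)) := by
              refine mul_le_mul_right (hw.trans ?_) _
              gcongr
          _ = (T * T⁻¹) * ((A * tp n) * tp (k * n) * tp (-i)) := by ring
          _ ≤ _ := by
              rw [ENNReal.mul_inv_cancel hT0 hT1, one_mul]
              gcongr
              exact le_add_self
    calc _ ≤ ∑' i : ℤ, tp ((i + 1) * δ) * (B * tp (k * n) * min 1 (tp (-i))) := by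
          gcongr with i
          exact hlev i
      _ = (tp δ * B * tp (k * n)) * ∑' i : ℤ, tp (i * δ) * min 1 (tp (-i)) := by
          rw [← ENNReal.tsum_mul_left]
          refine tsum_congr fun i => ?_
          rw [show ((i : ℝ) + 1) * δ = i * δ + δ by ring, tp_add]; ring
      _ ≤ (tp δ * B * tp (k * n)) * (D * 1) := by
          gcongr
          refine tsum_min_tent_le hδ (by linarith : 0 < 1 - δ) one_ne_zero ENNReal.one_ne_top _
            (fun i => ?_) (fun i => ?_)
          · rw [ENNReal.one_rpow, one_mul]
            calc tp (i * δ) * min 1 (tp (-i)) ≤ tp (i * δ) * 1 := by gcongr; exact min_le_left _ _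
              _ = _ := mul_one _
          · rw [ENNReal.one_rpow, one_mul]
            calc tp (i * δ) * min 1 (tp (-i)) ≤ tp (i * δ) * tp (-i) := by
                  gcongr; exact min_le_right _ _
              _ = _ := by rw [← tp_add]; congr 1; ring
      _ = _ := by ring
  calc ballAvg k (fun y => maxFn g y ^ δ) x
      ≤ tp (-(k * n)) * ∫⁻ y in Metric.closedBall x ((2 : ℝ) ^ k),
          (maxFn F y ^ δ + (tp n * T) ^ δ) := by
        rw [ballAvg]
        gcongr 1
        refine setLIntegral_mono' Metric.isClosed_closedBall.measurableSet fun y hy => ?_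
        refine (ENNReal.rpow_le_rpow (hloc y hy) hδ0).trans ?_
        rcases le_total (maxFn F y) (tp n * T) with h | h
        · rw [max_eq_right h]; exact le_add_self
        · rw [max_eq_left h]; exact le_self_add
    _ = tp (-(k * n)) * (∫⁻ y in Metric.closedBall x ((2 : ℝ) ^ k), maxFn F y ^ δ) +
          ballAvg k (fun _ => (tp n * T) ^ δ) x := by
        rw [ballAvg, lintegral_add_right _ measurable_const, mul_add]
    _ ≤ tp (-(k * n)) * (tp δ * B * D * tp (k * n) * T ^ δ) + (tp n * T) ^ δ * ω := by
        rw [ballAvg_const]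
        gcongr
    _ = (tp (k * n) * tp (-(k * n))) * (tp δ * B * D * T ^ δ) + ω * tp (n * δ) * T ^ δ := by
        rw [ENNReal.mul_rpow_of_nonneg _ _ hδ0, tp_rpow]; ring
    _ ≤ _ := by
        rw [tp_mul_neg, one_mul, add_mul, add_mul]
        exact le_self_add

/-- The index of the dyadic cube of side `2 ^ k` containing `x`. -/
def cell {n : ℕ} (k : ℤ) (x : Rn n) : Fin n → ℤ := fun i => ⌊(2 : ℝ) ^ (-k) * x i⌋

/-- Averaging over dyadic cubes of side `2 ^ k`. -/
def dyE {n : ℕ} (k : ℤ) (f : Rn n → ℝ≥0∞) (x : Rn n) : ℝ≥0∞ :=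
  tp (-(k * n)) * ∫⁻ y in {y | cell k y = cell k x}, f y

/-- Functions that are constant on the dyadic cubes of side `2 ^ k`. -/
def CellConst {n : ℕ} {β : Type*} (k : ℤ) (g : Rn n → β) : Prop :=
  ∀ x y, cell k x = cell k y → g x = g y

lemma measurable_cell {n : ℕ} (k : ℤ) : Measurable (cell k : Rn n → Fin n → ℤ) := by
  refine measurable_pi_lambda _ fun i => ?_
  exact Int.measurable_floor.comp (measurable_const.mul
    (EuclideanSpace.proj (𝕜 := ℝ) i).continuous.measurable)

lemma measurableSet_cell {n : ℕ} (k : ℤ) (c : Fin n → ℤ) :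
    MeasurableSet {y : Rn n | cell k y = c} :=
  measurable_cell k (measurableSet_singleton c)

lemma CellConst.exists_eq_comp {n : ℕ} {β : Type*} [Inhabited β] {k : ℤ} {g : Rn n → β}
    (hg : CellConst k g) : ∃ H : (Fin n → ℤ) → β, ∀ x, g x = H (cell k x) := by
  have hf : Function.FactorsThrough g (cell k) := fun x y h => hg x y h
  exact ⟨Function.extend (cell k) g fun _ => default, fun x => (hf.extend_apply _ x).symm⟩

lemma CellConst.measurable {n : ℕ} {β : Type*} [Inhabited β] [MeasurableSpace β] {k : ℤ}
    {g : Rn n → β} (hg : CellConst k g) : Measurable g := by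
  obtain ⟨H, hH⟩ := hg.exists_eq_comp
  rw [show g = H ∘ cell k from funext hH]
  exact (measurable_of_countable H).comp (measurable_cell k)

lemma cellConst_dyE {n : ℕ} (k : ℤ) (f : Rn n → ℝ≥0∞) : CellConst k (dyE k f) := by
  intro x y h
  simp only [dyE, h]

lemma measurable_dyE {n : ℕ} (k : ℤ) (f : Rn n → ℝ≥0∞) : Measurable (dyE k f) :=
  (cellConst_dyE k f).measurable

lemma volume_cell {n : ℕ} (k : ℤ) (c : Fin n → ℤ) :
    volume {y : Rn n | cell k y = c} = tp (k * n) := by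
  have hpos : (0 : ℝ) < 2 ^ k := by positivity
  have hset : {y : Rn n | cell k y = c} = (WithLp.ofLp : Rn n → Fin n → ℝ) ⁻¹'
      (Set.pi univ fun i => Ico ((2 : ℝ) ^ k * c i) ((2 : ℝ) ^ k * (c i + 1))) := by
    ext y
    simp only [cell, mem_ofPred_eq, funext_iff, mem_preimage, Set.mem_pi, mem_univ, true_imp_iff,
      mem_Ico, Int.floor_eq_iff]
    refine forall_congr' fun i => ?_
    rw [zpow_neg, inv_mul_eq_div, le_div_iff₀ hpos, div_lt_iff₀ hpos, mul_comm (c i : ℝ),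
      mul_comm ((c i : ℝ) + 1)]
  rw [hset, (PiLp.volume_preserving_ofLp (Fin n)).measure_preimage
    (MeasurableSet.univ_pi fun i => measurableSet_Ico).nullMeasurableSet, Real.volume_pi_Ico]
  simp only [mul_add, mul_one, add_sub_cancel_left]
  rw [Finset.prod_const, Finset.card_univ, Fintype.card_fin, tp_eq_ofReal,
    ← ENNReal.ofReal_pow hpos.le, Real.rpow_mul (by norm_num), Real.rpow_natCast,
    Real.rpow_intCast]

lemma lintegral_eq_tsum_cell {n : ℕ} (k : ℤ) (f : Rn n → ℝ≥0∞) :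
    ∫⁻ x, f x = ∑' c : Fin n → ℤ, ∫⁻ x in {y : Rn n | cell k y = c}, f x := by
  rw [← lintegral_iUnion (fun c => measurableSet_cell k c)]
  · have : (⋃ c : Fin n → ℤ, {y : Rn n | cell k y = c}) = univ := by
      ext y; simp
    rw [this, Measure.restrict_univ]
  · intro c c' hcc'
    refine Set.disjoint_left.2 fun y hy hy' => hcc' ?_
    exact hy.symm.trans hy'

lemma lintegral_dyE_mul {n : ℕ} (k : ℤ) (f : Rn n → ℝ≥0∞) {g : Rn n → ℝ≥0∞}
    (hf : Measurable f) (hg : CellConst k g) :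
    ∫⁻ x, dyE k f x * g x = ∫⁻ x, f x * g x := by
  obtain ⟨H, hH⟩ := hg.exists_eq_comp
  simp_rw [hH]
  rw [lintegral_eq_tsum_cell k, lintegral_eq_tsum_cell k (fun x => f x * H (cell k x))]
  refine tsum_congr fun c => ?_
  have e1 : ∫⁻ x in {y : Rn n | cell k y = c}, dyE k f x * H (cell k x) =
      ∫⁻ _ in {y : Rn n | cell k y = c},
        tp (-(k * n)) * (∫⁻ y in {y | cell k y = c}, f y) * H c := by
    refine setLIntegral_congr_fun (measurableSet_cell k c) fun x hx => ?_
    have hx' : cell k x = c := hx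
    simp only [dyE, hx']
  have e2 : ∫⁻ x in {y : Rn n | cell k y = c}, f x * H (cell k x) =
      ∫⁻ x in {y : Rn n | cell k y = c}, f x * H c := by
    refine setLIntegral_congr_fun (measurableSet_cell k c) fun x hx => ?_
    have hx' : cell k x = c := hx
    simp only [hx']
  rw [e1, e2, setLIntegral_const, volume_cell, lintegral_mul_const _ hf]
  calc _ = (tp (k * n) * tp (-(k * n))) * ((∫⁻ y in {y | cell k y = c}, f y) * H c) := by ring
    _ = _ := by rw [tp_mul_neg, one_mul]

lemma cell_succ {n : ℕ} (k : ℤ) (x : Rn n) : cell (k + 1) x = fun i => cell k x i / 2 := by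
  ext i
  have h := Int.floor_div_natCast ((2 : ℝ) ^ (-k) * x i) 2
  simp only [cell]
  rw [show ((2 : ℕ) : ℤ) = 2 from rfl] at h
  rw [← h]
  congr 1
  rw [neg_add, zpow_add₀ (by norm_num)]
  push_cast
  rw [show (2 : ℝ) ^ (-1 : ℤ) = 1 / 2 by norm_num]
  ring

lemma CellConst.of_succ {n : ℕ} {β : Type*} {k : ℤ} {g : Rn n → β} (hg : CellConst (k + 1) g) :
    CellConst k g := by
  intro x y h
  exact hg x y (by rw [cell_succ, cell_succ, h])

lemma CellConst.of_le {n : ℕ} {β : Type*} {k m : ℤ} (hkm : k ≤ m) {g : Rn n → β}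
    (hg : CellConst m g) : CellConst k g := by
  obtain ⟨N, rfl⟩ := Int.le.dest hkm
  induction N with
  | zero => simpa using hg
  | succ N ih =>
    refine ih (by omega) (CellConst.of_succ ?_)
    have : k + (N : ℤ) + 1 = k + ((N + 1 : ℕ) : ℤ) := by push_cast; ring
    rw [this]; exact hg

lemma dyE_eq_lintegral {n : ℕ} (k : ℤ) (f : Rn n → ℝ≥0∞) (x : Rn n) :
    dyE k f x = tp (-(k * n)) * ∫⁻ y, f y * {y | cell k y = cell k x}.indicator 1 y := by
  rw [dyE, ← lintegral_indicator (measurableSet_cell k _)]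
  congr 2
  ext y
  by_cases h : cell k y = cell k x
  · rw [indicator_of_mem (by exact h), indicator_of_mem (by exact h)]; simp
  · rw [indicator_of_notMem (by exact h), indicator_of_notMem (by exact h)]; simp

lemma cellConst_indicator {n : ℕ} (k : ℤ) (c : Fin n → ℤ) :
    CellConst k ({y : Rn n | cell k y = c}.indicator (1 : Rn n → ℝ≥0∞)) := by
  intro x y h
  simp only [indicator, mem_ofPred_eq, h, Pi.one_apply]

lemma dyE_succ_dyE {n : ℕ} (k : ℤ) {f : Rn n → ℝ≥0∞} (hf : Measurable f) (x : Rn n) :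
    dyE (k + 1) (dyE k f) x = dyE (k + 1) f x := by
  rw [dyE_eq_lintegral, dyE_eq_lintegral,
    lintegral_dyE_mul k f hf (cellConst_indicator (k + 1) _).of_succ]

lemma lintegral_dyE {n : ℕ} (k : ℤ) {f : Rn n → ℝ≥0∞} (hf : Measurable f) :
    ∫⁻ x, dyE k f x = ∫⁻ x, f x := by
  have := lintegral_dyE_mul k f hf (g := fun _ => 1) (fun _ _ _ => rfl)
  simpa using this

lemma dyE_mono {n : ℕ} (k : ℤ) {f g : Rn n → ℝ≥0∞} (h : ∀ y, f y ≤ g y) (x : Rn n) :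
    dyE k f x ≤ dyE k g x := by
  unfold dyE
  gcongr with y
  exact h y

lemma dyE_const {n : ℕ} (k : ℤ) (c : ℝ≥0∞) (x : Rn n) : dyE k (fun _ => c) x = c := by
  rw [dyE, setLIntegral_const, volume_cell]
  calc tp (-(k * n)) * (c * tp (k * n)) = (tp (k * n) * tp (-(k * n))) * c := by ring
    _ = _ := by rw [tp_mul_neg, one_mul]

lemma dyE_le_succ {n : ℕ} (k : ℤ) (f : Rn n → ℝ≥0∞) (x : Rn n) :
    dyE k f x ≤ tp n * dyE (k + 1) f x := by
  have hsub : {y : Rn n | cell k y = cell k x} ⊆ {y | cell (k + 1) y = cell (k + 1) x} := by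
    intro y hy
    have hy' : cell k y = cell k x := hy
    simp only [mem_ofPred_eq, cell_succ, hy']
  rw [dyE, dyE, ← mul_assoc, ← tp_add]
  have : (n : ℝ) + -(((k + 1 : ℤ) : ℝ) * n) = -(k * n) := by push_cast; ring
  rw [this]
  gcongr

lemma dist_le_of_cell_eq {n : ℕ} {k : ℤ} {x y : Rn n} (h : cell k y = cell k x) :
    dist y x ≤ n * (2 : ℝ) ^ k := by
  have hpos : (0 : ℝ) < 2 ^ k := by positivity
  have hi : ∀ i, |(y - x) i| ≤ (2 : ℝ) ^ k := by
    intro i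
    have h1 := Int.abs_sub_lt_one_of_floor_eq_floor (congrFun h i)
    rw [← mul_sub, abs_mul, abs_of_pos (by positivity : (0 : ℝ) < 2 ^ (-k)), zpow_neg,
      inv_mul_eq_div, div_lt_one hpos] at h1
    exact h1.le
  rw [dist_eq_norm, EuclideanSpace.norm_eq]
  calc √(∑ i, ‖(y - x) i‖ ^ 2) ≤ √((n * (2 : ℝ) ^ k) ^ 2) := by
        refine Real.sqrt_le_sqrt ?_
        calc ∑ i, ‖(y - x) i‖ ^ 2 ≤ ∑ _i : Fin n, ((2 : ℝ) ^ k) ^ 2 := by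
              refine Finset.sum_le_sum fun i _ => ?_
              rw [Real.norm_eq_abs]
              exact pow_le_pow_left₀ (abs_nonneg _) (hi i) 2
          _ = n * ((2 : ℝ) ^ k) ^ 2 := by simp
          _ ≤ _ := by
              rw [mul_pow]
              gcongr
              rcases n with _ | m
              · simp
              · have : (1 : ℝ) ≤ ((m + 1 : ℕ) : ℝ) := by exact_mod_cast Nat.succ_pos m
                nlinarith
    _ = _ := Real.sqrt_sq (by positivity)

lemma dyE_le_maxFn {n : ℕ} (k : ℤ) (f : Rn n → ℝ≥0∞) (x : Rn n) :
    dyE k f x ≤ tp (n * n) * maxFn f x := by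
  have hsub : {y : Rn n | cell k y = cell k x} ⊆ Metric.closedBall x ((2 : ℝ) ^ (k + n)) := by
    intro y hy
    rw [Metric.mem_closedBall]
    refine (dist_le_of_cell_eq hy).trans ?_
    rw [zpow_add₀ (by norm_num), mul_comm, zpow_natCast]
    gcongr
    exact_mod_cast Nat.lt_two_pow_self.le
  calc dyE k f x ≤ tp (-(k * n)) * ∫⁻ y in Metric.closedBall x ((2 : ℝ) ^ (k + n)), f y := by
        rw [dyE]; gcongr
    _ = tp (n * n) * ballAvg (k + n) f x := by
        rw [ballAvg, ← mul_assoc, ← tp_add]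
        congr 2
        push_cast; ring
    _ ≤ _ := by gcongr; exact ballAvg_le_maxFn _ _ _

/-- Jensen's inequality for dyadic averages. -/
lemma dyE_rpow_le {n : ℕ} (k : ℤ) {p : ℝ} (hp : 1 < p) {f : Rn n → ℝ≥0∞} (hf : Measurable f)
    (x : Rn n) : dyE k f x ^ p ≤ dyE k (fun y => f y ^ p) x := by
  have hpq : p.HolderConjugate (p / (p - 1)) := Real.HolderConjugate.conjExponent hp
  have h := ENNReal.lintegral_mul_le_Lp_mul_Lq
    (volume.restrict {y | cell k y = cell k x}) hpq (f := f) (g := fun _ => 1)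
    hf.aemeasurable aemeasurable_const
  simp only [Pi.mul_apply, mul_one, ENNReal.one_rpow, lintegral_one, Measure.restrict_apply_univ,
    volume_cell] at h
  have hp0 : 0 < p := by linarith
  calc dyE k f x ^ p ≤ (tp (-(k * n)) * ((∫⁻ y in {y | cell k y = cell k x}, f y ^ p) ^ (1 / p) *
        tp (k * n) ^ (1 / (p / (p - 1))))) ^ p := by
        rw [dyE]
        gcongr
    _ = dyE k (fun y => f y ^ p) x := by
        rw [ENNReal.mul_rpow_of_nonneg _ _ hp0.le, ENNReal.mul_rpow_of_nonneg _ _ hp0.le,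
          tp_rpow, tp_rpow, tp_rpow, ← ENNReal.rpow_mul, one_div_mul_cancel hp0.ne',
          ENNReal.rpow_one, mul_left_comm, ← tp_add, mul_comm, dyE]
        congr 2
        have : p - 1 ≠ 0 := by linarith
        field_simp
        ring

/-- The dyadic martingale difference. -/
def dyD {n : ℕ} (k : ℤ) (f : Rn n → ℝ≥0∞) (x : Rn n) : ℝ :=
  (dyE k f x).toReal - (dyE (k + 1) f x).toReal

lemma cellConst_dyD {n : ℕ} (k : ℤ) (f : Rn n → ℝ≥0∞) : CellConst k (dyD k f) := by
  intro x y h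
  simp only [dyD]
  rw [cellConst_dyE k f x y h, (cellConst_dyE (k + 1) f).of_succ x y h]

lemma measurable_dyD {n : ℕ} (k : ℤ) (f : Rn n → ℝ≥0∞) : Measurable (dyD k f) :=
  (cellConst_dyD k f).measurable

lemma tsum_int_le_of_telescope {a b : ℤ → ℝ≥0∞} {B : ℝ≥0∞} (h : ∀ k, a k + b (k + 1) ≤ b k)
    (hB : ∀ k, b k ≤ B) : ∑' k, a k ≤ B := by
  have key : ∀ (m : ℤ) (N : ℕ), ∑ i ∈ Finset.range N, a (m + i) + b (m + N) ≤ b m := by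
    intro m N
    induction N with
    | zero => simp
    | succ N ih =>
      rw [Finset.sum_range_succ]
      calc _ = ∑ i ∈ Finset.range N, a (m + i) + (a (m + N) + b (m + N + 1)) := by
            push_cast; rw [add_assoc, add_assoc m]
        _ ≤ ∑ i ∈ Finset.range N, a (m + i) + b (m + N) := by gcongr; exact h _
        _ ≤ _ := ih
  rw [ENNReal.tsum_eq_iSup_sum]
  refine iSup_le fun s => ?_
  obtain ⟨N, hN⟩ : ∃ N : ℕ, ∀ k ∈ s, |k| ≤ N := by
    refine ⟨∑ k ∈ s, k.natAbs, fun k hk => ?_⟩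
    rw [Int.abs_eq_natAbs]
    exact_mod_cast Finset.single_le_sum (f := fun k : ℤ => k.natAbs) (fun _ _ => Nat.zero_le _) hk
  have hinj : Function.Injective fun i : ℕ => -(N : ℤ) + (i : ℤ) := fun i j hij => by
    simpa using hij
  calc ∑ k ∈ s, a k ≤ ∑ k ∈ (Finset.range (2 * N + 1)).map ⟨fun i : ℕ => -(N : ℤ) + (i : ℤ), hinj⟩,
        a k := by
        refine Finset.sum_le_sum_of_subset fun k hk => ?_
        have := abs_le.1 (hN k hk)
        refine Finset.mem_map.2 ⟨(k + N).toNat, ?_, ?_⟩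
        · rw [Finset.mem_range]; omega
        · simp only [Function.Embedding.coeFn_mk]; omega
    _ = ∑ i ∈ Finset.range (2 * N + 1), a (-N + i) := by rw [Finset.sum_map]; rfl
    _ ≤ b (-N) := le_self_add.trans (key (-N) (2 * N + 1))
    _ ≤ B := hB _

lemma sq_add_sq_eq {a b : ℝ≥0∞} (ha : a ≠ ⊤) (hb : b ≠ ⊤) :
    a ^ 2 + b ^ 2 = 2 * (a * b) + ‖a.toReal - b.toReal‖ₑ ^ 2 := by
  lift a to ℝ≥0 using ha
  lift b to ℝ≥0 using hb
  rw [← enorm_pow, Real.enorm_eq_ofReal (by positivity)]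
  simp only [ENNReal.coe_toReal]
  rw [show (a : ℝ≥0∞) = ENNReal.ofReal a by simp, show (b : ℝ≥0∞) = ENNReal.ofReal b by simp,
    ← ENNReal.ofReal_pow (NNReal.coe_nonneg a), ← ENNReal.ofReal_pow (NNReal.coe_nonneg b),
    ← ENNReal.ofReal_mul (NNReal.coe_nonneg a),
    show (2 : ℝ≥0∞) = ENNReal.ofReal 2 by simp, ← ENNReal.ofReal_mul (by norm_num),
    ← ENNReal.ofReal_add (by positivity) (by positivity),
    ← ENNReal.ofReal_add (by positivity) (by positivity)]
  congr 1
  ring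

lemma dyE_ne_top {n : ℕ} {f : Rn n → ℝ≥0∞} {M : ℝ≥0∞} (hM : M ≠ ⊤) (hf : ∀ x, f x ≤ M) (k : ℤ)
    (x : Rn n) : dyE k f x ≠ ⊤ :=
  ne_top_of_le_ne_top hM ((dyE_mono k hf x).trans (dyE_const k M x).le)

/-- Weighted square function estimate. -/
lemma tsum_lintegral_dyD_sq_weight_le {n : ℕ} {f : Rn n → ℝ≥0∞} {M : ℝ≥0∞} (hM : M ≠ ⊤)
    (hfM : ∀ x, f x ≤ M) (hf : Measurable f) {w : Rn n → ℝ≥0∞} (hw : Measurable w) :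
    ∑' k : ℤ, ∫⁻ x, ‖dyD k f x‖ₑ ^ 2 * w x ≤
      tp n * tp (n * n) * ∫⁻ x, f x ^ 2 * maxFn w x := by
  set ws : ℤ → Rn n → ℝ≥0∞ := fun k x => ⨆ i : ℕ, dyE (k + i) w x with hws
  have hwsC : ∀ k, CellConst k (ws k) := by
    intro k x y h
    simp only [hws]
    congr 1
    ext i
    exact (cellConst_dyE (k + i) w).of_le (by omega) x y h
  have hws_le : ∀ k x, ws k x ≤ tp (n * n) * maxFn w x :=
    fun k x => iSup_le fun i => dyE_le_maxFn _ _ _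
  have hws_anti : ∀ k x, ws (k + 1) x ≤ ws k x := by
    intro k x
    refine iSup_le fun i => ?_
    refine le_trans (le_of_eq ?_) (le_iSup (fun i : ℕ => dyE (k + i) w x) (i + 1))
    congr 1; push_cast; ring
  have hsqC : ∀ k, CellConst k fun x => ‖dyD k f x‖ₑ ^ 2 := by
    intro k x y h
    simp only [cellConst_dyD k f x y h]
  have step1 : ∀ k : ℤ, ∫⁻ x, ‖dyD k f x‖ₑ ^ 2 * w x ≤
      tp n * ∫⁻ x, ‖dyD k f x‖ₑ ^ 2 * ws (k + 1) x := by
    intro k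
    have := lintegral_dyE_mul k w hw (hsqC k)
    calc ∫⁻ x, ‖dyD k f x‖ₑ ^ 2 * w x = ∫⁻ x, dyE k w x * ‖dyD k f x‖ₑ ^ 2 := by
          rw [this]; simp_rw [mul_comm]
      _ ≤ ∫⁻ x, tp n * (‖dyD k f x‖ₑ ^ 2 * ws (k + 1) x) := by
          refine lintegral_mono fun x => ?_
          calc dyE k w x * ‖dyD k f x‖ₑ ^ 2 ≤ (tp n * dyE (k + 1) w x) * ‖dyD k f x‖ₑ ^ 2 := by
                gcongr; exact dyE_le_succ k w x
            _ ≤ (tp n * ws (k + 1) x) * ‖dyD k f x‖ₑ ^ 2 := by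
                gcongr
                refine le_trans (le_of_eq ?_) (le_iSup (fun i : ℕ => dyE (k + 1 + i) w x) 0)
                simp
            _ = _ := by ring
      _ = _ := lintegral_const_mul' _ _ (tp_ne_top _)
  rw [mul_assoc]
  refine (ENNReal.tsum_le_tsum step1).trans ?_
  rw [ENNReal.tsum_mul_left]
  refine mul_le_mul_right ?_ _
  rw [← lintegral_const_mul' _ _ (tp_ne_top _)]
  have hbd : ∀ k, ∫⁻ x, dyE k f x ^ 2 * ws k x ≤ ∫⁻ x, tp (n * n) * (f x ^ 2 * maxFn w x) := by
    intro k
    calc ∫⁻ x, dyE k f x ^ 2 * ws k x ≤ ∫⁻ x, dyE k (fun y => f y ^ 2) x * ws k x := by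
          refine lintegral_mono fun x => ?_
          gcongr
          have := dyE_rpow_le k one_lt_two hf x
          simpa only [ENNReal.rpow_two] using this
      _ = ∫⁻ x, f x ^ 2 * ws k x := lintegral_dyE_mul k _ (hf.pow_const 2) (hwsC k)
      _ ≤ _ := by
          refine lintegral_mono fun x => ?_
          calc f x ^ 2 * ws k x ≤ f x ^ 2 * (tp (n * n) * maxFn w x) := by
                gcongr; exact hws_le k x
            _ = _ := by ring
  rcases eq_or_ne (∫⁻ x, tp (n * n) * (f x ^ 2 * maxFn w x)) ⊤ with htop | htop
  · rw [htop]; exact le_top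
  refine tsum_int_le_of_telescope (b := fun k => ∫⁻ x, dyE k f x ^ 2 * ws k x) (fun k => ?_) hbd
  have hv := hwsC (k + 1)
  have hvm : Measurable (ws (k + 1)) := hv.measurable
  have hum : ∀ k, Measurable (dyE k f) := fun k => measurable_dyE k f
  have hfin : ∫⁻ x, dyE (k + 1) f x ^ 2 * ws (k + 1) x ≠ ⊤ := ne_top_of_le_ne_top htop (hbd _)
  have cross : ∫⁻ x, dyE k f x * (dyE (k + 1) f x * ws (k + 1) x) =
      ∫⁻ x, dyE (k + 1) f x ^ 2 * ws (k + 1) x := by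
    have hc : CellConst (k + 1) fun x => dyE (k + 1) f x * ws (k + 1) x := by
      intro x y h
      simp only [cellConst_dyE (k + 1) f x y h, hv x y h]
    have := lintegral_dyE_mul (k + 1) (dyE k f) (hum k) hc
    rw [← this]
    refine lintegral_congr fun x => ?_
    rw [dyE_succ_dyE k hf]; ring
  have ident : (∫⁻ x, dyE k f x ^ 2 * ws (k + 1) x) + (∫⁻ x, dyE (k + 1) f x ^ 2 * ws (k + 1) x) =
      2 * (∫⁻ x, dyE (k + 1) f x ^ 2 * ws (k + 1) x) +
        (∫⁻ x, ‖dyD k f x‖ₑ ^ 2 * ws (k + 1) x) := by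
    nth_rewrite 2 [← cross]
    rw [← lintegral_const_mul' _ _ (by norm_num : (2 : ℝ≥0∞) ≠ ⊤),
      ← lintegral_add_left (((hum k).pow_const 2).fun_mul hvm),
      ← lintegral_add_left (((hum k).fun_mul ((hum (k + 1)).fun_mul hvm)).const_mul 2)]
    refine lintegral_congr fun x => ?_
    have := sq_add_sq_eq (dyE_ne_top hM hfM k x) (dyE_ne_top hM hfM (k + 1) x)
    calc _ = (dyE k f x ^ 2 + dyE (k + 1) f x ^ 2) * ws (k + 1) x := by ring
      _ = _ := by rw [this, dyD]; ring
  have ident2 : ∫⁻ x, dyE k f x ^ 2 * ws (k + 1) x =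
      (∫⁻ x, dyE (k + 1) f x ^ 2 * ws (k + 1) x) + (∫⁻ x, ‖dyD k f x‖ₑ ^ 2 * ws (k + 1) x) := by
    rw [two_mul, add_assoc, add_comm] at ident
    exact (ENNReal.add_right_inj hfin).1 ident
  rw [add_comm, ← ident2]
  exact lintegral_mono fun x => mul_le_mul_right (hws_anti k x) _

lemma rpow_sub_sq_convexOn {p W : ℝ} (hp1 : 1 < p) (hp2 : p ≤ 2) (_hW : 0 < W) :
    ConvexOn ℝ (Icc 0 W) fun a : ℝ => a ^ p - p * (p - 1) / 2 * W ^ (p - 2) * a ^ 2 := by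
  have hd : ∀ a : ℝ, HasDerivAt (fun a : ℝ => a ^ p - p * (p - 1) / 2 * W ^ (p - 2) * a ^ 2)
      (p * a ^ (p - 1) - p * (p - 1) * W ^ (p - 2) * a) a := by
    intro a
    have h1 := Real.hasDerivAt_rpow_const (x := a) (p := p) (Or.inr hp1.le)
    have h2 := ((hasDerivAt_pow 2 a).const_mul (p * (p - 1) / 2 * W ^ (p - 2)))
    refine (h1.fun_sub h2).congr_deriv ?_
    simp; ring
  have hderiv : deriv (fun a : ℝ => a ^ p - p * (p - 1) / 2 * W ^ (p - 2) * a ^ 2) =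
      fun a => p * a ^ (p - 1) - p * (p - 1) * W ^ (p - 2) * a := funext fun a => (hd a).deriv
  have hd2 : ∀ a : ℝ, 0 < a → HasDerivAt
      (fun a => p * a ^ (p - 1) - p * (p - 1) * W ^ (p - 2) * a)
      (p * ((p - 1) * a ^ (p - 2)) - p * (p - 1) * W ^ (p - 2)) a := by
    intro a ha
    have h1 := (Real.hasDerivAt_rpow_const (x := a) (p := p - 1) (Or.inl ha.ne')).const_mul p
    have h2 := ((hasDerivAt_id a).const_mul (p * (p - 1) * W ^ (p - 2)))
    refine (h1.fun_sub h2).congr_deriv ?_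
    rw [show p - 1 - 1 = p - 2 by ring]; simp
  refine convexOn_of_deriv2_nonneg (convex_Icc _ _)
    (fun a _ => (hd a).continuousAt.continuousWithinAt)
    (fun a _ => (hd a).differentiableAt.differentiableWithinAt) ?_ ?_
  · rw [hderiv, interior_Icc]
    exact fun a ha => (hd2 a ha.1).differentiableAt.differentiableWithinAt
  · rw [interior_Icc]
    intro a ha
    rw [Function.iterate_succ, Function.comp_apply, hderiv, Function.iterate_one,
      (hd2 a ha.1).deriv]
    have : W ^ (p - 2) ≤ a ^ (p - 2) := Real.rpow_le_rpow_of_nonpos ha.1 ha.2.le (by linarith)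
    nlinarith [mul_pos (by linarith : 0 < p) (by linarith : 0 < p - 1)]

lemma rpow_strong_convexity {p W a b : ℝ} (hp1 : 1 < p) (hp2 : p ≤ 2) (hW : 0 < W)
    (ha : a ∈ Icc 0 W) (hb : b ∈ Icc 0 W) :
    p * b ^ (p - 1) * a + p * (p - 1) / 2 * (a - b) ^ 2 * W ^ (p - 2) ≤
      a ^ p + (p - 1) * b ^ p := by
  have hc := rpow_sub_sq_convexOn hp1 hp2 hW
  have hd : HasDerivAt (fun a : ℝ => a ^ p - p * (p - 1) / 2 * W ^ (p - 2) * a ^ 2)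
      (p * b ^ (p - 1) - p * (p - 1) * W ^ (p - 2) * b) b := by
    have h1 := Real.hasDerivAt_rpow_const (x := b) (p := p) (Or.inr hp1.le)
    have h2 := ((hasDerivAt_pow 2 b).const_mul (p * (p - 1) / 2 * W ^ (p - 2)))
    refine (h1.fun_sub h2).congr_deriv ?_
    simp; ring
  have hbp : b ^ p = b ^ (p - 1) * b := by
    rw [← Real.rpow_add_one' hb.1 (by linarith)]; ring_nf
  rcases lt_trichotomy b a with h | h | h
  · have := hc.le_slope_of_hasDerivAt hb ha h hd
    rw [slope_def_field, le_div_iff₀ (by linarith)] at this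
    nlinarith
  · subst h; rw [hbp]; apply le_of_eq; ring
  · have := hc.slope_le_of_hasDerivAt ha hb h hd
    rw [slope_def_field, div_le_iff₀ (by linarith)] at this
    nlinarith

lemma ennreal_strong_convexity {p : ℝ} {W a b : ℝ≥0∞} (hp1 : 1 < p) (hp2 : p ≤ 2)
    (hW : W ≠ ⊤) (ha : a ≤ W) (hb : b ≤ W) :
    ENNReal.ofReal p * (b ^ (p - 1) * a) +
      ENNReal.ofReal (p * (p - 1) / 2) * (‖a.toReal - b.toReal‖ₑ ^ 2 * W ^ (p - 2)) ≤
      a ^ p + ENNReal.ofReal (p - 1) * b ^ p := by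
  rcases eq_or_ne W 0 with h0 | h0
  · subst h0
    have ha0 : a = 0 := by simpa using ha
    have hb0 : b = 0 := by simpa using hb
    simp [ha0, hb0]
  have hWp : 0 < W.toReal := ENNReal.toReal_pos h0 hW
  have hat : a ≠ ⊤ := ne_top_of_le_ne_top hW ha
  have hbt : b ≠ ⊤ := ne_top_of_le_ne_top hW hb
  have haR : a = ENNReal.ofReal a.toReal := (ENNReal.ofReal_toReal hat).symm
  have hbR : b = ENNReal.ofReal b.toReal := (ENNReal.ofReal_toReal hbt).symm
  have hWR : W = ENNReal.ofReal W.toReal := (ENNReal.ofReal_toReal hW).symm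
  have key := rpow_strong_convexity hp1 hp2 hWp
    ⟨ENNReal.toReal_nonneg, (ENNReal.toReal_le_toReal hat hW).2 ha⟩
    ⟨ENNReal.toReal_nonneg, (ENNReal.toReal_le_toReal hbt hW).2 hb⟩
  have hA := ENNReal.toReal_nonneg (a := a)
  have hB := ENNReal.toReal_nonneg (a := b)
  rw [← enorm_pow, Real.enorm_eq_ofReal (by positivity)]
  set A := a.toReal
  set B := b.toReal
  rw [haR, hbR, hWR, ENNReal.ofReal_rpow_of_nonneg hB (by linarith),
    ENNReal.ofReal_rpow_of_pos hWp, ENNReal.ofReal_rpow_of_nonneg hA (by linarith),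
    ENNReal.ofReal_rpow_of_nonneg hB (by linarith), ← ENNReal.ofReal_mul (by positivity),
    ← ENNReal.ofReal_mul (by positivity), ← ENNReal.ofReal_mul (by positivity),
    ← ENNReal.ofReal_mul (by nlinarith), ← ENNReal.ofReal_mul (by linarith),
    ← ENNReal.ofReal_add (by positivity) (mul_nonneg (by nlinarith) (by positivity)),
    ← ENNReal.ofReal_add (by positivity) (mul_nonneg (by linarith) (by positivity))]
  refine ENNReal.ofReal_le_ofReal (le_trans (le_of_eq ?_) key)
  ring

/-- Square function estimate below `L²`, in weighted form. -/
lemma tsum_lintegral_dyD_sq_rpow_le {n : ℕ} {p : ℝ} (hp1 : 1 < p) (hp2 : p ≤ 2)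
    {f : Rn n → ℝ≥0∞} (hf : Measurable f)
    {W : Rn n → ℝ≥0∞} (hWt : ∀ x, W x ≠ ⊤) (hW : ∀ k x, dyE k f x ≤ W x) :
    ENNReal.ofReal (p * (p - 1) / 2) * ∑' k : ℤ, ∫⁻ x, ‖dyD k f x‖ₑ ^ 2 * W x ^ (p - 2) ≤
      ∫⁻ x, f x ^ p := by
  have hum : ∀ k, Measurable (dyE k f) := fun k => measurable_dyE k f
  have hbd : ∀ k, ∫⁻ x, dyE k f x ^ p ≤ ∫⁻ x, f x ^ p := by
    intro k
    calc ∫⁻ x, dyE k f x ^ p ≤ ∫⁻ x, dyE k (fun y => f y ^ p) x :=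
          lintegral_mono fun x => dyE_rpow_le k hp1 hf x
      _ = ∫⁻ x, f x ^ p := lintegral_dyE k (hf.pow_const p)
  rcases eq_or_ne (∫⁻ x, f x ^ p) ⊤ with htop | htop
  · rw [htop]; exact le_top
  rw [← ENNReal.tsum_mul_left]
  refine tsum_int_le_of_telescope (b := fun k => ∫⁻ x, dyE k f x ^ p) (fun k => ?_) hbd
  have hfin : ∫⁻ x, dyE (k + 1) f x ^ p ≠ ⊤ := ne_top_of_le_ne_top htop (hbd _)
  have cross : ∫⁻ x, dyE (k + 1) f x ^ (p - 1) * dyE k f x = ∫⁻ x, dyE (k + 1) f x ^ p := by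
    have hc : CellConst (k + 1) fun x => dyE (k + 1) f x ^ (p - 1) := by
      intro x y h
      simp only [cellConst_dyE (k + 1) f x y h]
    have := lintegral_dyE_mul (k + 1) (dyE k f) (hum k) hc
    calc _ = ∫⁻ x, dyE k f x * dyE (k + 1) f x ^ (p - 1) := by simp_rw [mul_comm]
      _ = _ := by
        rw [← this]
        refine lintegral_congr fun x => ?_
        rw [dyE_succ_dyE k hf]
        nth_rewrite 1 [← ENNReal.rpow_one (dyE (k + 1) f x)]
        rw [← ENNReal.rpow_add_of_nonneg _ _ (by norm_num) (by linarith)]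
        congr 1; ring
  have main : (∫⁻ x, ENNReal.ofReal p * (dyE (k + 1) f x ^ (p - 1) * dyE k f x)) +
      (∫⁻ x, ENNReal.ofReal (p * (p - 1) / 2) * (‖dyD k f x‖ₑ ^ 2 * W x ^ (p - 2))) ≤
      (∫⁻ x, dyE k f x ^ p) + (∫⁻ x, ENNReal.ofReal (p - 1) * dyE (k + 1) f x ^ p) := by
    rw [← lintegral_add_left (by
        exact (((hum _).pow_const _).fun_mul (hum k)).const_mul _),
      ← lintegral_add_left ((hum _).pow_const _)]
    exact lintegral_mono fun x => ennreal_strong_convexity hp1 hp2 (hWt x) (hW _ x) (hW _ x)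
  rw [lintegral_const_mul' _ _ ENNReal.ofReal_ne_top,
    lintegral_const_mul' _ _ ENNReal.ofReal_ne_top,
    lintegral_const_mul' _ _ ENNReal.ofReal_ne_top, cross,
    show p = 1 + (p - 1) by ring, ENNReal.ofReal_add (by norm_num) (by linarith), add_mul,
    ENNReal.ofReal_one, one_mul, show 1 + (p - 1) = p by ring, add_right_comm, add_comm (_ + _),
    add_comm (∫⁻ x, dyE k f x ^ p)] at main
  have h2 := (ENNReal.add_le_add_iff_left (ENNReal.mul_ne_top ENNReal.ofReal_ne_top hfin)).1 main
  rw [add_comm]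
  exact h2

lemma ENNReal.rpow_iSup {ι : Sort*} {q : ℝ} (hq : 0 < q) (g : ι → ℝ≥0∞) :
    (⨆ i, g i) ^ q = ⨆ i, g i ^ q :=
  (ENNReal.orderIsoRpow q hq).map_iSup g

lemma tsum_comp_le_of_encard_le {k : ℤ → ℤ} {N : ℕ∞} (hN : ∀ m, {j | k j = m}.encard ≤ N)
    (G : ℤ → ℝ≥0∞) : ∑' j, G (k j) ≤ N * ∑' m, G m := by
  classical
  calc ∑' j, G (k j) = ∑' j, ∑' m, ({j | k j = m}.indicator (fun _ => G m) j) := by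
        refine tsum_congr fun j => ?_
        rw [tsum_eq_single (k j)]
        · simp
        · intro m hm
          simp [hm.symm]
    _ = ∑' m, ∑' j, ({j | k j = m}.indicator (fun _ => G m) j) := ENNReal.tsum_comm
    _ ≤ ∑' m, N * G m := by
        refine ENNReal.tsum_le_tsum fun m => ?_
        rw [← tsum_subtype {j | k j = m} (fun _ => G m), ENNReal.tsum_set_const]
        gcongr
        exact_mod_cast hN m
    _ = _ := ENNReal.tsum_mul_left

lemma enorm_dyD_le {n : ℕ} (k : ℤ) (f : Rn n → ℝ≥0∞) (x : Rn n) :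
    ‖dyD k f x‖ₑ ≤ dyE k f x + dyE (k + 1) f x := by
  unfold dyD
  refine (enorm_sub_le).trans ?_
  rw [Real.enorm_eq_ofReal ENNReal.toReal_nonneg, Real.enorm_eq_ofReal ENNReal.toReal_nonneg]
  exact add_le_add ENNReal.ofReal_toReal_le ENNReal.ofReal_toReal_le

lemma ballAvg_sq_le {n : ℕ} (k : ℤ) {g h : Rn n → ℝ≥0∞} (hg : Measurable g) (hh : Measurable h)
    (x : Rn n) : ballAvg k (fun y => g y ^ (1 / 2 : ℝ) * h y ^ (1 / 2 : ℝ)) x ^ 2 ≤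
      ballAvg k g x * ballAvg k h x := by
  unfold ballAvg
  have := ENNReal.lintegral_mul_norm_pow_le
    (μ := volume.restrict (Metric.closedBall x ((2 : ℝ) ^ k))) hg.aemeasurable hh.aemeasurable
    (p := 1 / 2) (q := 1 / 2) (by norm_num) (by norm_num) (by norm_num)
  rw [mul_pow]
  calc _ ≤ tp (-(k * n)) ^ 2 * ((∫⁻ y in Metric.closedBall x ((2 : ℝ) ^ k), g y) ^ (1 / 2 : ℝ) *
        (∫⁻ y in Metric.closedBall x ((2 : ℝ) ^ k), h y) ^ (1 / 2 : ℝ)) ^ 2 := by gcongr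
    _ = _ := by
      rw [mul_pow, ← ENNReal.rpow_natCast (_ ^ (1 / 2 : ℝ)), ← ENNReal.rpow_mul,
        ← ENNReal.rpow_natCast (_ ^ (1 / 2 : ℝ)), ← ENNReal.rpow_mul]
      norm_num
      ring

lemma ballAvg_const_mul {n : ℕ} (k : ℤ) {c : ℝ≥0∞} (hc : c ≠ ⊤) (g : Rn n → ℝ≥0∞) (x : Rn n) :
    ballAvg k (fun y => c * g y) x = c * ballAvg k g x := by
  unfold ballAvg
  rw [lintegral_const_mul' _ _ hc]; ring

lemma lintegral_ballAvg {n : ℕ} (k : ℤ) {g : Rn n → ℝ≥0∞} (hg : Measurable g) :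
    ∫⁻ x, ballAvg k g x = unitVol n * ∫⁻ x, g x := by
  have := lintegral_ballAvg_mul k hg (w := fun _ => 1) measurable_const
  simp only [mul_one, ballAvg_const, one_mul] at this
  rw [this, lintegral_mul_const' _ _ (unitVol_ne_top n), mul_comm]

/-- Averaged square function bound below `L²`. -/
lemma lintegral_tsum_ballAvg_sq_rpow_le {n : ℕ} (hn : 1 ≤ n) {p : ℝ} (hp1 : 1 < p) (hp2 : p < 2) :
    ∃ C : ℝ≥0∞, C ≠ ⊤ ∧ ∀ (f : Rn n → ℝ≥0∞) (M : ℝ≥0∞), M ≠ ⊤ → (∀ x, f x ≤ M) → Measurable f →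
      ∀ a : ℤ, ∫⁻ x, (∑' m : ℤ, ballAvg (m + 1) (fun y => ‖dyD (m + a) f y‖ₑ) x ^ 2) ^ (p / 2) ≤
        C * ∫⁻ x, f x ^ p := by
  obtain ⟨C₁, hC₁, h₁⟩ := ballAvg_maxFn_rpow hn (δ := 2 - p) (by linarith) (by linarith)
  obtain ⟨C₂, hC₂, h₂⟩ := maxFn_strong hn hp1
  set D := tp (n * n) ^ (2 - p) * C₁ with hD
  have hDt : D ≠ ⊤ := ENNReal.mul_ne_top
    (ENNReal.rpow_ne_top_of_nonneg (by linarith) (tp_ne_top _)) hC₁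
  set κ := ENNReal.ofReal (p * (p - 1) / 2) with hκ
  have hκ0 : κ ≠ 0 := by
    rw [hκ, Ne, ENNReal.ofReal_eq_zero, not_le]; nlinarith
  have hκt : κ ≠ ⊤ := ENNReal.ofReal_ne_top
  refine ⟨D ^ (p / 2) * ((unitVol n * κ⁻¹) ^ (p / 2) * C₂ ^ (1 - p / 2)), ?_, ?_⟩
  · refine ENNReal.mul_ne_top (ENNReal.rpow_ne_top_of_nonneg (by linarith) hDt)
      (ENNReal.mul_ne_top (ENNReal.rpow_ne_top_of_nonneg (by linarith) ?_)
        (ENNReal.rpow_ne_top_of_nonneg (by linarith) hC₂))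
    exact ENNReal.mul_ne_top (unitVol_ne_top n) (ENNReal.inv_ne_top.2 hκ0)
  intro f M hM hfM hf a
  set W : Rn n → ℝ≥0∞ := fun x => tp (n * n) * maxFn f x with hWdef
  have hWm : Measurable W := (measurable_maxFn hf).const_mul _
  have hWt : ∀ x, W x ≠ ⊤ := by
    intro x
    refine ENNReal.mul_ne_top (tp_ne_top _) (ne_top_of_le_ne_top
      (ENNReal.mul_ne_top hM (unitVol_ne_top n)) (iSup_le fun k => ?_))
    exact (ballAvg_mono k hfM x).trans (ballAvg_const k M x).le
  have hW : ∀ k x, dyE k f x ≤ W x := fun k x => dyE_le_maxFn _ _ _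
  have hdm : ∀ m, Measurable fun y => ‖dyD m f y‖ₑ := fun m => (measurable_dyD m f).enorm
  set h : ℤ → Rn n → ℝ≥0∞ := fun m y => ‖dyD m f y‖ₑ ^ 2 * W y ^ (p - 2) with hh
  have hhm : ∀ m, Measurable (h m) := fun m => ((hdm m).pow_const 2).mul (hWm.pow_const _)
  set A : Rn n → ℝ≥0∞ := fun x => ∑' m : ℤ, ballAvg (m + 1) (h (m + a)) x with hA
  have hAm : Measurable A := Measurable.tsum fun m => measurable_ballAvg _ (hhm _)
  have pt : ∀ m x, ballAvg (m + 1) (fun y => ‖dyD (m + a) f y‖ₑ) x ^ 2 ≤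
      ballAvg (m + 1) (h (m + a)) x * (D * maxFn f x ^ (2 - p)) := by
    intro m x
    have e : (fun y => ‖dyD (m + a) f y‖ₑ) =
        fun y => h (m + a) y ^ (1 / 2 : ℝ) * (W y ^ (2 - p)) ^ (1 / 2 : ℝ) := by
      ext y
      rw [← ENNReal.mul_rpow_of_nonneg _ _ (by norm_num)]
      rcases eq_or_ne (W y) 0 with h0 | h0
      · have : ‖dyD (m + a) f y‖ₑ = 0 := by
          have := enorm_dyD_le (m + a) f y
          have h1 := hW (m + a) y
          have h2 := hW (m + a + 1) y
          rw [h0, nonpos_iff_eq_zero] at h1 h2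
          simpa [h1, h2] using this
        rw [this, hh]
        simp [this]
      · rw [hh]
        simp only
        rw [mul_assoc, ← ENNReal.rpow_add _ _ h0 (hWt y), show p - 2 + (2 - p) = 0 by ring,
          ENNReal.rpow_zero, mul_one, ← ENNReal.rpow_natCast, ← ENNReal.rpow_mul]
        norm_num
    rw [e]
    refine (ballAvg_sq_le (m + 1) (hhm _) (hWm.pow_const _) x).trans ?_
    refine mul_le_mul_right ?_ _
    simp only [hWdef]
    simp_rw [ENNReal.mul_rpow_of_nonneg _ _ (by linarith : (0 : ℝ) ≤ 2 - p)]
    rw [ballAvg_const_mul _ (ENNReal.rpow_ne_top_of_nonneg (by linarith) (tp_ne_top _)), hD,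
      mul_assoc]
    exact mul_le_mul_right (h₁ f hf _ _) _
  have pt2 : ∀ x, (∑' m : ℤ, ballAvg (m + 1) (fun y => ‖dyD (m + a) f y‖ₑ) x ^ 2) ^ (p / 2) ≤
      D ^ (p / 2) * (A x ^ (p / 2) * (maxFn f x ^ p) ^ (1 - p / 2)) := by
    intro x
    calc _ ≤ (∑' m, ballAvg (m + 1) (h (m + a)) x * (D * maxFn f x ^ (2 - p))) ^ (p / 2) := by
          gcongr with m; exact pt m x
      _ = (A x * (D * maxFn f x ^ (2 - p))) ^ (p / 2) := by rw [ENNReal.tsum_mul_right]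
      _ = _ := by
          rw [ENNReal.mul_rpow_of_nonneg _ _ (by linarith),
            ENNReal.mul_rpow_of_nonneg _ _ (by linarith), ← ENNReal.rpow_mul, ← ENNReal.rpow_mul,
            show (2 - p) * (p / 2) = p * (1 - p / 2) by ring]
          ring
  have hAint : ∫⁻ x, A x ≤ unitVol n * κ⁻¹ * ∫⁻ x, f x ^ p := by
    rw [hA, lintegral_tsum fun m => (measurable_ballAvg _ (hhm _)).aemeasurable]
    simp_rw [lintegral_ballAvg _ (hhm _)]
    rw [ENNReal.tsum_mul_left, mul_assoc]
    refine mul_le_mul_right ?_ _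
    have := tsum_lintegral_dyD_sq_rpow_le hp1 hp2.le hf hWt hW
    rw [← (Equiv.addRight a).tsum_eq] at this
    simp only [Equiv.coe_addRight] at this
    rw [← hκ] at this
    calc _ = κ⁻¹ * (κ * ∑' m : ℤ, ∫⁻ x, h (m + a) x) := by
          rw [← mul_assoc, ENNReal.inv_mul_cancel hκ0 hκt, one_mul]
      _ ≤ _ := mul_le_mul_right this _
  calc _ ≤ ∫⁻ x, D ^ (p / 2) * (A x ^ (p / 2) * (maxFn f x ^ p) ^ (1 - p / 2)) :=
        lintegral_mono pt2
    _ = D ^ (p / 2) * ∫⁻ x, A x ^ (p / 2) * (maxFn f x ^ p) ^ (1 - p / 2) :=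
        lintegral_const_mul' _ _ (ENNReal.rpow_ne_top_of_nonneg (by linarith) hDt)
    _ ≤ D ^ (p / 2) * ((∫⁻ x, A x) ^ (p / 2) * (∫⁻ x, maxFn f x ^ p) ^ (1 - p / 2)) := by
        gcongr
        exact ENNReal.lintegral_mul_norm_pow_le hAm.aemeasurable
          ((measurable_maxFn hf).pow_const _).aemeasurable (by linarith) (by linarith) (by ring)
    _ ≤ D ^ (p / 2) * ((unitVol n * κ⁻¹ * ∫⁻ x, f x ^ p) ^ (p / 2) *
          (C₂ * ∫⁻ x, f x ^ p) ^ (1 - p / 2)) := by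
        gcongr
        · linarith
        · exact h₂ f hf
    _ = D ^ (p / 2) * ((unitVol n * κ⁻¹) ^ (p / 2) * C₂ ^ (1 - p / 2)) *
        ((∫⁻ x, f x ^ p) ^ (p / 2) * (∫⁻ x, f x ^ p) ^ (1 - p / 2)) := by
        rw [ENNReal.mul_rpow_of_nonneg (unitVol n * κ⁻¹) _ (by linarith : 0 ≤ p / 2),
          ENNReal.mul_rpow_of_nonneg C₂ _ (by linarith : 0 ≤ 1 - p / 2)]
        ring
    _ = _ := by
        rw [← ENNReal.rpow_add_of_nonneg _ _ (by linarith) (by linarith)]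
        norm_num

/-- Averaged square function bound above `L²`. -/
lemma lintegral_tsum_ballAvg_sq_rpow_le' {n : ℕ} (hn : 1 ≤ n) {q : ℝ} (hq : 1 < q) :
    ∃ C : ℝ≥0∞, C ≠ ⊤ ∧ ∀ (f : Rn n → ℝ≥0∞) (M : ℝ≥0∞), M ≠ ⊤ → (∀ x, f x ≤ M) → Measurable f →
      ∫⁻ x, f x ≠ ⊤ →
      ∀ a : ℤ, ∫⁻ x, (∑' m : ℤ, ballAvg (m + 1) (fun y => ‖dyD (m + a) f y‖ₑ ^ 2) x) ^ q ≤
        C * ∫⁻ x, f x ^ (2 * q) := by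
  set q' := q / (q - 1) with hq'
  have hq1 : 0 < q - 1 := by linarith
  have hq'1 : 1 < q' := by rw [hq', lt_div_iff₀ hq1]; linarith
  obtain ⟨C₁, hC₁, h₁⟩ := maxFn_strong hn hq'1
  set D := tp n * tp (n * n) * (C₁ * C₁) ^ (1 - 1 / q) with hD
  have hiq : 0 < 1 - 1 / q := by rw [sub_pos, div_lt_one (by linarith)]; exact hq
  have hDt : D ≠ ⊤ := ENNReal.mul_ne_top (ENNReal.mul_ne_top (tp_ne_top _) (tp_ne_top _))
    (ENNReal.rpow_ne_top_of_nonneg hiq.le (ENNReal.mul_ne_top hC₁ hC₁))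
  refine ⟨D ^ q, ENNReal.rpow_ne_top_of_nonneg (by linarith) hDt, ?_⟩
  intro f M hM hfM hf hfi a
  set h : ℤ → Rn n → ℝ≥0∞ := fun m y => ‖dyD m f y‖ₑ ^ 2 with hh
  have hhm : ∀ m, Measurable (h m) := fun m => (measurable_dyD m f).enorm.pow_const 2
  set A : Finset ℤ → Rn n → ℝ≥0∞ := fun s x => ∑ m ∈ s, ballAvg (m + 1) (h (m + a)) x with hA
  have hAm : ∀ s, Measurable (A s) := fun s =>
    Finset.measurable_fun_sum _ fun m _ => measurable_ballAvg _ (hhm _)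
  have hEM : ∀ k x, dyE k f x ≤ M := fun k x => (dyE_mono k hfM x).trans (dyE_const k M x).le
  have hdM : ∀ m x, ‖dyD m f x‖ₑ ≤ 2 * M := fun m x => by
    rw [two_mul]; exact (enorm_dyD_le m f x).trans (add_le_add (hEM _ _) (hEM _ _))
  have hhM : ∀ m x, h m x ≤ (2 * M) ^ 2 := fun m x => by
    simp only [hh]; gcongr; exact hdM m x
  have hint : ∀ m, ∫⁻ x, h m x ≠ ⊤ := by
    intro m
    refine ne_top_of_le_ne_top (b := 2 * M * ((∫⁻ x, f x) + (∫⁻ x, f x))) (by finiteness) ?_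
    calc ∫⁻ x, h m x ≤ ∫⁻ x, 2 * M * (dyE m f x + dyE (m + 1) f x) := by
          refine lintegral_mono fun x => ?_
          simp only [hh]
          rw [pow_two]
          exact mul_le_mul' (hdM m x) (enorm_dyD_le m f x)
      _ = _ := by
          rw [lintegral_const_mul' _ _ (by finiteness), lintegral_add_left (measurable_dyE _ _),
            lintegral_dyE _ hf, lintegral_dyE _ hf]
  have hAfin : ∀ s, ∫⁻ x, A s x ^ q ≠ ⊤ := by
    intro s
    have hAb : ∀ x, A s x ≤ s.card * ((2 * M) ^ 2 * unitVol n) := by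
      intro x
      rw [← nsmul_eq_mul]
      refine Finset.sum_le_card_nsmul _ _ _ fun m _ => ?_
      exact (ballAvg_mono _ (hhM _) x).trans (ballAvg_const _ _ x).le
    have hu := unitVol_ne_top n
    have hAi : ∫⁻ x, A s x ≠ ⊤ := by
      rw [hA, lintegral_finsetSum _ fun m _ => measurable_ballAvg _ (hhm _)]
      simp_rw [lintegral_ballAvg _ (hhm _)]
      exact (ENNReal.sum_lt_top.2 fun m _ => (ENNReal.mul_ne_top hu (hint _)).lt_top).ne
    refine ne_top_of_le_ne_top
      (b := (s.card * ((2 * M) ^ 2 * unitVol n)) ^ (q - 1) * ∫⁻ x, A s x) ?_ ?_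
    · exact ENNReal.mul_ne_top (ENNReal.rpow_ne_top_of_nonneg hq1.le (by finiteness)) hAi
    · rw [← lintegral_const_mul _ (hAm s)]
      refine lintegral_mono fun x => ?_
      calc A s x ^ q = A s x ^ (q - 1) * A s x := by
            nth_rewrite 3 [← ENNReal.rpow_one (A s x)]
            rw [← ENNReal.rpow_add_of_nonneg _ _ hq1.le (by norm_num)]; norm_num
        _ ≤ _ := by gcongr; exact hAb x
  have main : ∀ s, ∫⁻ x, A s x ^ q ≤ D ^ q * ∫⁻ x, f x ^ (2 * q) := by
    intro s
    set w : Rn n → ℝ≥0∞ := fun x => A s x ^ (q - 1) with hw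
    have hwm : Measurable w := (hAm s).pow_const _
    have hwq : ∀ x, w x ^ q' = A s x ^ q := fun x => by
      rw [hw]; simp only; rw [← ENNReal.rpow_mul, hq']; congr 1; field_simp
    have k1 : ∫⁻ x, A s x ^ q ≤ tp n * tp (n * n) * ∫⁻ x, f x ^ 2 * maxFn (maxFn w) x := by
      calc ∫⁻ x, A s x ^ q = ∫⁻ x, ∑ m ∈ s, ballAvg (m + 1) (h (m + a)) x * w x := by
            refine lintegral_congr fun x => ?_
            rw [← Finset.sum_mul]
            change A s x ^ q = A s x * A s x ^ (q - 1)
            nth_rewrite 2 [← ENNReal.rpow_one (A s x)]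
            rw [← ENNReal.rpow_add_of_nonneg _ _ (by norm_num) hq1.le]; norm_num
        _ = ∑ m ∈ s, ∫⁻ x, h (m + a) x * ballAvg (m + 1) w x := by
            rw [lintegral_finsetSum _ fun m _ => (measurable_ballAvg _ (hhm _)).fun_mul hwm]
            exact Finset.sum_congr rfl fun m _ => lintegral_ballAvg_mul _ (hhm _) hwm
        _ ≤ ∑ m ∈ s, ∫⁻ x, h (m + a) x * maxFn w x := by
            gcongr with m _ x; exact ballAvg_le_maxFn _ _ _
        _ ≤ ∑' m, ∫⁻ x, h (m + a) x * maxFn w x := ENNReal.sum_le_tsum _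
        _ = ∑' m, ∫⁻ x, h m x * maxFn w x :=
            (Equiv.addRight a).tsum_eq fun m => ∫⁻ x, h m x * maxFn w x
        _ ≤ _ := tsum_lintegral_dyD_sq_weight_le hM hfM hf (measurable_maxFn hwm)
    have k2 : ∫⁻ x, f x ^ 2 * maxFn (maxFn w) x ≤
        (∫⁻ x, f x ^ (2 * q)) ^ (1 / q) * (∫⁻ x, maxFn (maxFn w) x ^ q') ^ (1 - 1 / q) := by
      have := ENNReal.lintegral_mul_norm_pow_le (μ := volume) (f := fun x => f x ^ (2 * q))
        (g := fun x => maxFn (maxFn w) x ^ q') (hf.pow_const _).aemeasurable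
        ((measurable_maxFn (measurable_maxFn hwm)).pow_const _).aemeasurable
        (p := 1 / q) (q := 1 - 1 / q) (by positivity) hiq.le (by ring)
      refine le_trans (le_of_eq (lintegral_congr fun x => ?_)) this
      rw [← ENNReal.rpow_mul, ← ENNReal.rpow_mul, show 2 * q * (1 / q) = (2 : ℝ) by field_simp,
        show q' * (1 - 1 / q) = 1 by rw [hq']; field_simp, ENNReal.rpow_one, ENNReal.rpow_two]
    have k3 : ∫⁻ x, maxFn (maxFn w) x ^ q' ≤ C₁ * C₁ * ∫⁻ x, A s x ^ q := by
      refine (h₁ _ (measurable_maxFn hwm)).trans ?_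
      rw [mul_assoc]
      refine mul_le_mul_right ((h₁ w hwm).trans (le_of_eq ?_)) _
      simp_rw [hwq]
    have k4 : ∫⁻ x, A s x ^ q ≤ D * (∫⁻ x, f x ^ (2 * q)) ^ (1 / q) *
        (∫⁻ x, A s x ^ q) ^ (1 - 1 / q) := by
      calc _ ≤ tp n * tp (n * n) * ((∫⁻ x, f x ^ (2 * q)) ^ (1 / q) *
            (C₁ * C₁ * ∫⁻ x, A s x ^ q) ^ (1 - 1 / q)) := by
              refine k1.trans (mul_le_mul_right (k2.trans ?_) _)
              gcongr
        _ = _ := by rw [ENNReal.mul_rpow_of_nonneg _ _ hiq.le, hD]; ring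
    rcases eq_or_ne (∫⁻ x, A s x ^ q) 0 with h0 | h0
    · rw [h0]; exact zero_le
    have k5 : (∫⁻ x, A s x ^ q) ^ (1 / q) ≤ D * (∫⁻ x, f x ^ (2 * q)) ^ (1 / q) := by
      have e : (∫⁻ x, A s x ^ q) =
          (∫⁻ x, A s x ^ q) ^ (1 / q) * (∫⁻ x, A s x ^ q) ^ (1 - 1 / q) := by
        rw [← ENNReal.rpow_add _ _ h0 (hAfin s)]; norm_num
      refine (ENNReal.mul_le_mul_iff_left ?_ ?_).1 (e.symm.trans_le k4)
      · exact (ENNReal.rpow_pos (pos_iff_ne_zero.2 h0) (hAfin s)).ne'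
      · exact ENNReal.rpow_ne_top_of_nonneg hiq.le (hAfin s)
    have k6 := ENNReal.rpow_le_rpow k5 (by linarith : 0 ≤ q)
    rwa [ENNReal.mul_rpow_of_nonneg _ _ (by linarith), ← ENNReal.rpow_mul, ← ENNReal.rpow_mul,
      one_div_mul_cancel (by linarith), ENNReal.rpow_one, ENNReal.rpow_one] at k6
  calc _ = ∫⁻ x, ⨆ s, A s x ^ q := by
        refine lintegral_congr fun x => ?_
        rw [ENNReal.tsum_eq_iSup_sum, ENNReal.rpow_iSup (by linarith)]
    _ = ⨆ s, ∫⁻ x, A s x ^ q := by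
        refine lintegral_iSup_directed (fun s => ((hAm s).pow_const _).aemeasurable) ?_
        refine Monotone.directed_le fun s t hst x => ?_
        refine ENNReal.rpow_le_rpow (Finset.sum_le_sum_of_subset hst) (by linarith)
    _ ≤ _ := iSup_le main

lemma cell_apply_eq_iff {n : ℕ} (k : ℤ) (y : Rn n) (i : Fin n) (c : ℤ) :
    cell k y i = c ↔ (2 : ℝ) ^ k * c ≤ y i ∧ y i < (2 : ℝ) ^ k * (c + 1) := by
  have hpos : (0 : ℝ) < 2 ^ k := by positivity
  simp only [cell, Int.floor_eq_iff]
  rw [zpow_neg, inv_mul_eq_div, le_div_iff₀ hpos, div_lt_iff₀ hpos, mul_comm (c : ℝ),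
    mul_comm ((c : ℝ) + 1)]

lemma volume_cell_coord_le {n : ℕ} (k : ℤ) (c : Fin n → ℤ) (i : Fin n) {a b : ℝ} :
    volume {y : Rn n | cell k y = c ∧ a ≤ y i ∧ y i < b} ≤
      ENNReal.ofReal (b - a) * (tp (-k) * tp (k * n)) := by
  have hpos : (0 : ℝ) < 2 ^ k := by positivity
  set lo : Fin n → ℝ := fun l => if l = i then a else (2 : ℝ) ^ k * c l with hlo
  set hi : Fin n → ℝ := fun l => if l = i then b else (2 : ℝ) ^ k * (c l + 1) with hhi
  have hsub : {y : Rn n | cell k y = c ∧ a ≤ y i ∧ y i < b} ⊆ (WithLp.ofLp : Rn n → Fin n → ℝ) ⁻¹'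
      (Set.pi univ fun l => Ico (lo l) (hi l)) := by
    intro y ⟨hy, ha, hb⟩
    simp only [cell, funext_iff, Int.floor_eq_iff] at hy
    simp only [mem_preimage, Set.mem_pi, mem_univ, true_imp_iff, mem_Ico]
    intro l
    by_cases h : l = i
    · subst h; simp [hlo, hhi, ha, hb]
    · have := hy l
      rw [zpow_neg, inv_mul_eq_div, le_div_iff₀ hpos, div_lt_iff₀ hpos, mul_comm (c l : ℝ),
        mul_comm ((c l : ℝ) + 1)] at this
      simpa [hlo, hhi, h] using this
  refine (measure_mono hsub).trans ?_
  rw [(PiLp.volume_preserving_ofLp (Fin n)).measure_preimage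
    (MeasurableSet.univ_pi fun i => measurableSet_Ico).nullMeasurableSet, Real.volume_pi_Ico,
    ← Finset.mul_prod_erase _ _ (Finset.mem_univ i)]
  have h1 : ∀ l ∈ Finset.univ.erase i, ENNReal.ofReal (hi l - lo l) = tp k := by
    intro l hl
    have := Finset.ne_of_mem_erase hl
    simp only [hlo, hhi, this, if_false]
    rw [tp_eq_ofReal, Real.rpow_intCast]
    congr 1; ring
  rw [Finset.prod_congr rfl h1, Finset.prod_const, Finset.card_erase_of_mem (Finset.mem_univ i),
    Finset.card_univ, Fintype.card_fin]
  simp only [hlo, hhi, if_true]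
  gcongr
  rw [← tp_add, ← ENNReal.rpow_natCast, tp_rpow]
  apply le_of_eq
  congr 1
  have : 1 ≤ n := i.pos
  push_cast [Nat.cast_sub this]
  ring

/-- The points whose `i`-th cell index changes under translation by `-t`. -/
def shiftSet {n : ℕ} (k : ℤ) (t : Rn n) (i : Fin n) : Set (Rn n) :=
  {x | cell k (x - t) i ≠ cell k x i}

lemma measurableSet_shiftSet {n : ℕ} (k : ℤ) (t : Rn n) (i : Fin n) :
    MeasurableSet (shiftSet k t i) := by
  have h1 : Measurable fun x : Rn n => cell k (x - t) i :=
    (measurable_pi_apply i).comp ((measurable_cell k).comp (measurable_id.sub_const t))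
  have h2 : Measurable fun x : Rn n => cell k x i :=
    (measurable_pi_apply i).comp (measurable_cell k)
  exact (measurableSet_eq_fun h1 h2).compl

lemma dyE_shiftSet_le {n : ℕ} (k : ℤ) (t : Rn n) (i : Fin n) (x : Rn n) :
    dyE k ((shiftSet k t i).indicator 1) x ≤ ENNReal.ofReal |t i| * tp (-k) := by
  have hpos : (0 : ℝ) < 2 ^ k := by positivity
  rw [dyE, ← lintegral_indicator (measurableSet_cell _ _)]
  have key : volume {y : Rn n | cell k y = cell k x ∧ y ∈ shiftSet k t i} ≤
      ENNReal.ofReal |t i| * (tp (-k) * tp (k * n)) := by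
    have hc : ∀ y : Rn n, cell k y = cell k x → y ∈ shiftSet k t i →
        ((2 : ℝ) ^ k * cell k x i ≤ y i ∧ y i < 2 ^ k * (cell k x i + 1)) ∧
        ¬ ((2 : ℝ) ^ k * cell k x i ≤ y i - t i ∧ y i - t i < 2 ^ k * (cell k x i + 1)) := by
      intro y hy hs
      rw [shiftSet, mem_ofPred_eq, hy, Ne, cell_apply_eq_iff] at hs
      exact ⟨(cell_apply_eq_iff k y i _).1 (by rw [hy]), hs⟩
    rcases le_total 0 (t i) with h0 | h0
    · have hsub : {y : Rn n | cell k y = cell k x ∧ y ∈ shiftSet k t i} ⊆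
          {y | cell k y = cell k x ∧ (2 : ℝ) ^ k * cell k x i ≤ y i ∧
            y i < 2 ^ k * cell k x i + t i} := by
        rintro y ⟨hy, hs⟩
        obtain ⟨⟨h1, h2⟩, h3⟩ := hc y hy hs
        refine ⟨hy, h1, ?_⟩
        by_contra hcon
        exact h3 ⟨by linarith, by linarith⟩
      refine (measure_mono hsub).trans ((volume_cell_coord_le k _ i).trans (le_of_eq ?_))
      rw [add_sub_cancel_left, abs_of_nonneg h0]
    · have hsub : {y : Rn n | cell k y = cell k x ∧ y ∈ shiftSet k t i} ⊆
          {y | cell k y = cell k x ∧ (2 : ℝ) ^ k * (cell k x i + 1) + t i ≤ y i ∧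
            y i < 2 ^ k * (cell k x i + 1)} := by
        rintro y ⟨hy, hs⟩
        obtain ⟨⟨h1, h2⟩, h3⟩ := hc y hy hs
        refine ⟨hy, ?_, h2⟩
        by_contra hcon
        exact h3 ⟨by linarith, by linarith⟩
      refine (measure_mono hsub).trans ((volume_cell_coord_le k _ i).trans (le_of_eq ?_))
      rw [sub_add_cancel_left, abs_of_nonpos h0]
  have hset : (fun y => {y | cell k y = cell k x}.indicator
      (fun y => (shiftSet k t i).indicator (1 : Rn n → ℝ≥0∞) y) y) =
      {y : Rn n | cell k y = cell k x ∧ y ∈ shiftSet k t i}.indicator 1 := by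
    ext y
    by_cases h1 : cell k y = cell k x <;> by_cases h2 : y ∈ shiftSet k t i <;>
      simp [h1, h2, indicator]
  have hm : MeasurableSet {y : Rn n | cell k y = cell k x ∧ y ∈ shiftSet k t i} :=
    (measurableSet_cell k (cell k x)).inter (measurableSet_shiftSet k t i)
  rw [hset, lintegral_indicator_one hm]
  calc _ ≤ tp (-(k * n)) * (ENNReal.ofReal |t i| * (tp (-k) * tp (k * n))) := by gcongr
    _ = ENNReal.ofReal |t i| * tp (-k) * (tp (k * n) * tp (-(k * n))) := by ring
    _ = _ := by rw [tp_mul_neg, mul_one]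

lemma lintegral_shift_sub_sq_le {n : ℕ} (k : ℤ) {g : Rn n → ℂ} (hg : CellConst k g) (t : Rn n) :
    ∫⁻ x, ‖g (x - t) - g x‖ₑ ^ 2 ≤
      (4 * ∑ i, ENNReal.ofReal |t i| * tp (-k)) * ∫⁻ x, ‖g x‖ₑ ^ 2 := by
  set G : Rn n → ℝ≥0∞ := fun x => ‖g x‖ₑ ^ 2 with hG
  have hgm : Measurable g := hg.measurable
  have hGm : Measurable G := hgm.enorm.pow_const 2
  have hGc : CellConst k G := fun x y h => by simp only [hG, hg x y h]
  have hind : ∀ (t : Rn n) (i : Fin n), Measurable ((shiftSet k t i).indicator (1 : Rn n → ℝ≥0∞)) :=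
    fun t i => measurable_one.indicator (measurableSet_shiftSet k t i)
  have h1 : ∀ (t : Rn n) (i : Fin n), ∫⁻ x, (shiftSet k t i).indicator 1 x * G x ≤
      ENNReal.ofReal |t i| * tp (-k) * ∫⁻ x, G x := by
    intro t i
    rw [← lintegral_dyE_mul k _ (hind t i) hGc, ← lintegral_const_mul _ hGm]
    gcongr with x
    exact dyE_shiftSet_le k t i x
  have h2 : ∀ i : Fin n, ∫⁻ x, (shiftSet k t i).indicator 1 x * G (x - t) ≤
      ENNReal.ofReal |t i| * tp (-k) * ∫⁻ x, G x := by
    intro i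
    have := h1 (-t) i
    rw [PiLp.neg_apply, abs_neg] at this
    refine le_trans (le_of_eq ?_) this
    rw [← lintegral_sub_right_eq_self (fun x => (shiftSet k (-t) i).indicator 1 x * G x) t]
    refine lintegral_congr fun x => ?_
    have : x ∈ shiftSet k t i ↔ x - t ∈ shiftSet k (-t) i := by
      simp only [shiftSet, mem_ofPred_eq, sub_neg_eq_add, sub_add_cancel, ne_comm]
    by_cases h : x ∈ shiftSet k t i
    · simp [h, this.1 h]
    · simp [h, mt this.2 h]
  calc ∫⁻ x, ‖g (x - t) - g x‖ₑ ^ 2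
      ≤ ∫⁻ x, ∑ i, 2 * ((shiftSet k t i).indicator 1 x * G (x - t) +
          (shiftSet k t i).indicator 1 x * G x) := by
        refine lintegral_mono fun x => ?_
        by_cases h : cell k (x - t) = cell k x
        · simp [hg _ _ h]
        · obtain ⟨i, hi⟩ := Function.ne_iff.1 h
          have hi' : x ∈ shiftSet k t i := hi
          refine le_trans ?_ (Finset.single_le_sum (f := fun i => 2 *
            ((shiftSet k t i).indicator 1 x * G (x - t) + (shiftSet k t i).indicator 1 x * G x))
            (fun _ _ => zero_le) (Finset.mem_univ i))
          simp only [indicator_of_mem hi', Pi.one_apply, one_mul, hG]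
          calc ‖g (x - t) - g x‖ₑ ^ 2 ≤ (‖g (x - t)‖ₑ + ‖g x‖ₑ) ^ 2 := by
                gcongr; exact enorm_sub_le
            _ ≤ _ := by
                have := ENNReal.rpow_add_le_mul_rpow_add_rpow ‖g (x - t)‖ₑ ‖g x‖ₑ
                  (p := 2) (by norm_num)
                norm_num at this
                simpa using this
    _ = ∑ i, 2 * ((∫⁻ x, (shiftSet k t i).indicator 1 x * G (x - t)) +
          (∫⁻ x, (shiftSet k t i).indicator 1 x * G x)) := by
        have hGt : Measurable fun x => G (x - t) := hGm.comp (measurable_id.sub_const t)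
        rw [lintegral_finsetSum]
        · refine Finset.sum_congr rfl fun i _ => ?_
          rw [lintegral_const_mul' _ _ (by norm_num), lintegral_add_left ((hind t i).fun_mul hGt)]
        · intro i _
          exact (((hind t i).fun_mul hGt).fun_add ((hind t i).fun_mul hGm)).const_mul 2
    _ ≤ ∑ i, 2 * ((ENNReal.ofReal |t i| * tp (-k) * ∫⁻ x, G x) +
          (ENNReal.ofReal |t i| * tp (-k) * ∫⁻ x, G x)) := by
        gcongr with i _ i _
        · exact h2 i
        · exact h1 t i
    _ = _ := by
        rw [Finset.mul_sum, Finset.sum_mul]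
        refine Finset.sum_congr rfl fun i _ => ?_
        ring

lemma lintegral_cell_dyE {n : ℕ} {k m : ℤ} (h : k ≤ m) {f : Rn n → ℝ≥0∞} (hf : Measurable f)
    (c : Fin n → ℤ) : ∫⁻ x in {y | cell m y = c}, dyE k f x = ∫⁻ x in {y | cell m y = c}, f x := by
  have hc : CellConst k ({y : Rn n | cell m y = c}.indicator (1 : Rn n → ℝ≥0∞)) := by
    refine CellConst.of_le h ?_
    intro x y hxy
    simp only [indicator, mem_ofPred_eq, hxy, Pi.one_apply]
  have := lintegral_dyE_mul k f hf hc
  rw [← lintegral_indicator (measurableSet_cell _ _),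
    ← lintegral_indicator (measurableSet_cell _ _)]
  refine Eq.trans (lintegral_congr fun x => ?_) (this.trans (lintegral_congr fun x => ?_)) <;>
    by_cases hx : cell m x = c <;> simp [hx, indicator]

section Bounded

variable {n : ℕ} {f : Rn n → ℝ≥0∞} {M : ℝ≥0∞}

lemma integrable_dyE (hf : Measurable f) (hfi : ∫⁻ x, f x ≠ ⊤)
    (k : ℤ) : Integrable fun x => (dyE k f x).toReal :=
  integrable_toReal_of_lintegral_ne_top (measurable_dyE k f).aemeasurable
    (by rwa [lintegral_dyE k hf])

lemma integrable_dyD (hf : Measurable f) (hfi : ∫⁻ x, f x ≠ ⊤)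
    (k : ℤ) : Integrable (dyD k f) :=
  (integrable_dyE hf hfi k).sub (integrable_dyE hf hfi (k + 1))

lemma setIntegral_cell_dyD (hM : M ≠ ⊤) (hfM : ∀ x, f x ≤ M) (hf : Measurable f)
    (hfi : ∫⁻ x, f x ≠ ⊤) (k : ℤ) (c : Fin n → ℤ) :
    ∫ x in {y | cell (k + 1) y = c}, dyD k f x = 0 := by
  have e : ∀ m, m ≤ k + 1 → ∫ x in {y | cell (k + 1) y = c}, (dyE m f x).toReal =
      (∫⁻ x in {y | cell (k + 1) y = c}, f x).toReal := by
    intro m hm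
    rw [integral_toReal (measurable_dyE m f).aemeasurable
      (Eventually.of_forall fun x => (dyE_ne_top hM hfM m x).lt_top), lintegral_cell_dyE hm hf]
  unfold dyD
  rw [integral_sub (integrable_dyE hf hfi k).integrableOn
    (integrable_dyE hf hfi (k + 1)).integrableOn, e k (by omega), e (k + 1) le_rfl, sub_self]

lemma integral_mul_dyD_eq_zero (hM : M ≠ ⊤) (hfM : ∀ x, f x ≤ M) (hf : Measurable f)
    (hfi : ∫⁻ x, f x ≠ ⊤) (k : ℤ) {c : Rn n → ℂ} (hc : CellConst (k + 1) c)
    (hi : Integrable fun x => c x * (dyD k f x : ℂ)) : ∫ x, c x * (dyD k f x : ℂ) = 0 := by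
  have hU : (⋃ z : Fin n → ℤ, {y : Rn n | cell (k + 1) y = z}) = univ := by ext y; simp
  rw [← setIntegral_univ, ← hU, integral_iUnion (fun z => measurableSet_cell _ _)
    (fun z z' hz => Set.disjoint_left.2 fun y hy hy' => hz (hy.symm.trans hy')) hi.integrableOn]
  have : ∀ z : Fin n → ℤ, ∫ x in {y : Rn n | cell (k + 1) y = z}, c x * (dyD k f x : ℂ) = 0 := by
    intro z
    obtain ⟨H, hH⟩ := hc.exists_eq_comp
    rw [setIntegral_congr_fun (g := fun x => H z * (dyD k f x : ℂ)) (measurableSet_cell _ _)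
      (fun x hx => by simp only; rw [hH, hx]), integral_const_mul, integral_complex_ofReal,
      setIntegral_cell_dyD hM hfM hf hfi]
    simp
  simp [this]

end Bounded

/-- Convolution of a kernel with a function. -/
def cv {n : ℕ} (h g : Rn n → ℂ) (x : Rn n) : ℂ := ∫ t, h t * g (x - t)

lemma cv_eq {n : ℕ} (h g : Rn n → ℂ) (x : Rn n) : cv h g x = ∫ y, h (x - y) * g y := by
  unfold cv
  rw [← integral_sub_left_eq_self (fun y => h (x - y) * g y) volume x]
  simp

lemma enorm_cv_le {n : ℕ} {h : Rn n → ℂ} (g : Rn n → ℂ) {k : ℤ} {B : ℝ} (hB : ∀ t, ‖h t‖ ≤ B)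
    (hs : ∀ t, (2 : ℝ) ^ k < ‖t‖ → h t = 0) (x : Rn n) :
    ‖cv h g x‖ₑ ≤ ENNReal.ofReal B * ∫⁻ y in Metric.closedBall x ((2 : ℝ) ^ k), ‖g y‖ₑ := by
  rw [cv_eq, ← lintegral_const_mul' _ _ ENNReal.ofReal_ne_top,
    ← lintegral_indicator Metric.isClosed_closedBall.measurableSet]
  refine (enorm_integral_le_lintegral_enorm _).trans (lintegral_mono fun y => ?_)
  by_cases hy : y ∈ Metric.closedBall x ((2 : ℝ) ^ k)
  · rw [indicator_of_mem hy, enorm_mul]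
    gcongr
    rw [← ofReal_norm]
    exact ENNReal.ofReal_le_ofReal (hB _)
  · rw [indicator_of_notMem hy, hs _ (by
      rw [← dist_eq_norm, dist_comm]; simpa using hy)]
    simp

lemma enorm_cv_le_ballAvg {n : ℕ} {h : Rn n → ℂ} (g : Rn n → ℂ) {k : ℤ} {B : ℝ}
    (hB : ∀ t, ‖h t‖ ≤ B) (hs : ∀ t, (2 : ℝ) ^ k < ‖t‖ → h t = 0) (x : Rn n) :
    ‖cv h g x‖ₑ ≤ ENNReal.ofReal B * tp (k * n) * ballAvg k (fun y => ‖g y‖ₑ) x := by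
  refine (enorm_cv_le g hB hs x).trans (le_of_eq ?_)
  rw [ballAvg, ← mul_assoc, mul_assoc _ _ (tp _), tp_mul_neg, mul_one]

lemma lintegral_ballAvg_sq_le {n : ℕ} (k : ℤ) {g : Rn n → ℝ≥0∞} (hg : Measurable g) :
    ∫⁻ x, ballAvg k g x ^ 2 ≤ unitVol n ^ 2 * ∫⁻ x, g x ^ 2 := by
  calc ∫⁻ x, ballAvg k g x ^ 2 ≤ ∫⁻ x, unitVol n * ballAvg k (fun y => g y ^ 2) x := by
        refine lintegral_mono fun x => ?_
        have := ballAvg_sq_le k (hg.pow_const 2) (h := fun _ => 1) measurable_const x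
        rw [ballAvg_const, one_mul, mul_comm] at this
        refine le_trans (le_of_eq ?_) this
        congr 2
        ext y
        rw [← ENNReal.rpow_natCast, ← ENNReal.rpow_mul]; norm_num
    _ = _ := by
        rw [lintegral_const_mul' _ _ (unitVol_ne_top n), lintegral_ballAvg _ (hg.pow_const 2)]
        ring

/-- A point of the cube with the given index. -/
def cellRep {n : ℕ} (k : ℤ) (y : Rn n) : Rn n :=
  WithLp.toLp 2 fun i => (2 : ℝ) ^ k * cell k y i

lemma cell_cellRep {n : ℕ} (k : ℤ) (y : Rn n) : cell k (cellRep k y) = cell k y := by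
  have hpos : (0 : ℝ) < 2 ^ k := by positivity
  ext i
  rw [cell_apply_eq_iff]
  simp only [cellRep]
  constructor <;> nlinarith

lemma cellConst_cellRep {n : ℕ} (k : ℤ) : CellConst k (cellRep k : Rn n → Rn n) := by
  intro x y h
  simp only [cellRep, h]

lemma dist_cellRep_le {n : ℕ} (k : ℤ) (y : Rn n) : dist (cellRep k y) y ≤ n * (2 : ℝ) ^ k :=
  dist_le_of_cell_eq (cell_cellRep k y)

lemma le_two_pow_cast (n : ℕ) : (n : ℝ) + 1 ≤ 2 ^ n := by
  exact_mod_cast Nat.lt_two_pow_self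

section Bounded

variable {n : ℕ} {f : Rn n → ℝ≥0∞} {M : ℝ≥0∞}

/-- Cancellation of martingale differences finer than the kernel scale. -/
lemma enorm_cv_dyD_le (hM : M ≠ ⊤) (hfM : ∀ x, f x ≤ M) (hf : Measurable f)
    (hfi : ∫⁻ x, f x ≠ ⊤) {h : Rn n → ℂ} (hc : Continuous h) {k m : ℤ} (hmk : m ≤ k) {Λ : ℝ}
    (hΛ : 0 ≤ Λ) (hL : ∀ t t', ‖h t - h t'‖ ≤ Λ * ‖t - t'‖) {B : ℝ} (hB : ∀ t, ‖h t‖ ≤ B)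
    (hs : ∀ t, (2 : ℝ) ^ (k + 1) < ‖t‖ → h t = 0) (x : Rn n) :
    ‖cv h (fun y => (dyD m f y : ℂ)) x‖ₑ ≤ ENNReal.ofReal (Λ * (n * (2 : ℝ) ^ (m + 1))) *
      ∫⁻ y in Metric.closedBall x ((2 : ℝ) ^ (k + 1 + n)), ‖dyD m f y‖ₑ := by
  have hdi : Integrable fun y => (dyD m f y : ℂ) := (integrable_dyD hf hfi m).ofReal
  set c : Rn n → ℂ := fun y => h (x - cellRep (m + 1) y) with hcdef
  have hcc : CellConst (m + 1) c := fun y z hyz => by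
    simp only [hcdef, cellConst_cellRep (m + 1) y z hyz]
  have i1 : Integrable fun y => h (x - y) * (dyD m f y : ℂ) :=
    hdi.bdd_mul (c := B) (by fun_prop) (Eventually.of_forall fun y => hB _)
  have i2 : Integrable fun y => c y * (dyD m f y : ℂ) :=
    hdi.bdd_mul (c := B) hcc.measurable.aestronglyMeasurable (Eventually.of_forall fun y => hB _)
  have e : cv h (fun y => (dyD m f y : ℂ)) x = ∫ y, (h (x - y) - c y) * (dyD m f y : ℂ) := by
    rw [cv_eq]
    simp_rw [sub_mul]
    rw [integral_sub i1 i2, integral_mul_dyD_eq_zero hM hfM hf hfi m hcc i2, sub_zero]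
  rw [e, ← lintegral_const_mul' _ _ ENNReal.ofReal_ne_top,
    ← lintegral_indicator Metric.isClosed_closedBall.measurableSet]
  refine (enorm_integral_le_lintegral_enorm _).trans (lintegral_mono fun y => ?_)
  have hd := dist_cellRep_le (m + 1) y
  have h2 : (0 : ℝ) < 2 ^ (k + 1) := by positivity
  by_cases hy : y ∈ Metric.closedBall x ((2 : ℝ) ^ (k + 1 + n))
  · rw [indicator_of_mem hy, enorm_mul, ← ofReal_norm (h (x - y) - c y)]
    gcongr
    · refine (hL _ _).trans ?_
      gcongr
      rw [sub_sub_sub_cancel_left, ← dist_eq_norm]; exact hd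
    · simp [enorm_eq_nnnorm]
  · rw [indicator_of_notMem hy]
    rw [Metric.mem_closedBall, not_le, zpow_add₀ (by norm_num : (2 : ℝ) ≠ 0), zpow_natCast] at hy
    have h1 : (2 : ℝ) ^ (m + 1) ≤ 2 ^ (k + 1) := zpow_le_zpow_right₀ (by norm_num) (by omega)
    have h3 : (2 : ℝ) ^ (k + 1) * (n + 1) < dist y x :=
      lt_of_le_of_lt (by gcongr; exact le_two_pow_cast n) hy
    have h4 : dist y x ≤ dist (cellRep (m + 1) y) x + dist (cellRep (m + 1) y) y := by
      rw [dist_comm (cellRep (m + 1) y) y, add_comm]; exact dist_triangle _ _ _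
    have h5 : (n : ℝ) * 2 ^ (m + 1) ≤ n * 2 ^ (k + 1) := by gcongr
    rw [hs (x - y) (by rw [← dist_eq_norm, dist_comm]; nlinarith [Nat.cast_nonneg (α := ℝ) n]),
      hcdef]
    simp only
    rw [hs (x - cellRep (m + 1) y) (by rw [← dist_eq_norm, dist_comm]; nlinarith)]
    simp

end Bounded

/-- Cauchy–Schwarz on a set. -/
lemma sq_setLIntegral_le {α : Type*} [MeasurableSpace α] {μ : Measure α} {D : α → ℝ≥0∞}
    (hm : Measurable D) (S : Set α) :
    (∫⁻ t in S, D t ∂μ) ^ 2 ≤ μ S * ∫⁻ t in S, D t ^ 2 ∂μ := by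
  have h := ENNReal.lintegral_mul_norm_pow_le (μ := μ.restrict S) (f := fun t => D t ^ 2)
    (g := fun _ => 1) (hm.pow_const 2).aemeasurable aemeasurable_const
    (p := 1 / 2) (q := 1 / 2) (by norm_num) (by norm_num) (by norm_num)
  simp only [ENNReal.one_rpow, mul_one, lintegral_one, Measure.restrict_apply_univ] at h
  have e2 : ∀ t, (D t ^ 2) ^ (1 / 2 : ℝ) = D t := fun t => by
    rw [← ENNReal.rpow_natCast, ← ENNReal.rpow_mul]; norm_num
  have e3 : ∀ y : ℝ≥0∞, (y ^ (1 / 2 : ℝ)) ^ 2 = y := fun y => by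
    rw [← ENNReal.rpow_natCast, ← ENNReal.rpow_mul]; norm_num
  simp_rw [e2] at h
  calc _ ≤ ((∫⁻ t in S, D t ^ 2 ∂μ) ^ (1 / 2 : ℝ) * μ S ^ (1 / 2 : ℝ)) ^ 2 := by gcongr
    _ = _ := by rw [mul_pow, e3, e3, mul_comm]

/-- Coarse functions are almost annihilated by mean zero kernels. -/
lemma lintegral_cv_coarse_sq_le {n : ℕ} {h : Rn n → ℂ} (hc : Continuous h) (hh : ∫ t, h t = 0)
    {k m : ℤ} {B : ℝ} (hB : ∀ t, ‖h t‖ ≤ B) (hs : ∀ t, (2 : ℝ) ^ k < ‖t‖ → h t = 0)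
    {g : Rn n → ℂ} (hg : CellConst m g) (hgi : Integrable g) :
    ∫⁻ x, ‖cv h g x‖ₑ ^ 2 ≤ (ENNReal.ofReal B * tp (k * n) * unitVol n) ^ 2 *
      (4 * n * (tp k * tp (-m))) * ∫⁻ x, ‖g x‖ₑ ^ 2 := by
  have hgm : Measurable g := hg.measurable
  set S := Metric.closedBall (0 : Rn n) ((2 : ℝ) ^ k) with hS
  have hSm : MeasurableSet S := Metric.isClosed_closedBall.measurableSet
  have hhi : Integrable h := by
    refine hc.integrable_of_hasCompactSupport (HasCompactSupport.of_support_subset_isCompact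
      (isCompact_closedBall (0 : Rn n) ((2 : ℝ) ^ k)) fun t ht => ?_)
    by_contra hcon
    exact ht (hs t (by simpa using hcon))
  have hgt : ∀ x, Integrable fun t => h t * g (x - t) := fun x =>
    (hgi.comp_sub_left x).bdd_mul (c := B) hc.aestronglyMeasurable
      (Eventually.of_forall fun y => hB _)
  have e : ∀ x, cv h g x = ∫ t, h t * (g (x - t) - g x) := by
    intro x
    simp_rw [mul_sub]
    rw [integral_sub (hgt x) (hhi.mul_const _), integral_mul_const, hh, zero_mul, sub_zero, cv]
  set D : Rn n → Rn n → ℝ≥0∞ := fun x t => ‖g (x - t) - g x‖ₑ with hD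
  have hDm : Measurable (Function.uncurry D) :=
    ((hgm.comp (measurable_fst.sub measurable_snd)).sub (hgm.comp measurable_fst)).enorm
  have b1 : ∀ x, ‖cv h g x‖ₑ ≤ ENNReal.ofReal B * ∫⁻ t in S, D x t := by
    intro x
    rw [e x, ← lintegral_const_mul' _ _ ENNReal.ofReal_ne_top, ← lintegral_indicator hSm]
    refine (enorm_integral_le_lintegral_enorm _).trans (lintegral_mono fun t => ?_)
    by_cases ht : t ∈ S
    · rw [indicator_of_mem ht, enorm_mul]
      gcongr
      rw [← ofReal_norm]
      exact ENNReal.ofReal_le_ofReal (hB _)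
    · rw [indicator_of_notMem ht, hs t (by simpa [hS] using ht)]
      simp
  have b2 : ∀ x, (∫⁻ t in S, D x t) ^ 2 ≤ volume S * ∫⁻ t in S, D x t ^ 2 := fun x =>
    sq_setLIntegral_le (hDm.comp (measurable_const.prodMk measurable_id)) S
  have b3 : ∫⁻ x, ∫⁻ t in S, D x t ^ 2 ≤
      volume S * ((4 * n * (tp k * tp (-m))) * ∫⁻ x, ‖g x‖ₑ ^ 2) := by
    rw [lintegral_lintegral_swap (hDm.pow_const 2).aemeasurable, mul_comm, ← setLIntegral_const]
    refine setLIntegral_mono measurable_const fun t ht => ?_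
    refine (lintegral_shift_sub_sq_le m hg t).trans ?_
    gcongr ?_ * _
    rw [mul_assoc]
    gcongr
    calc _ ≤ ∑ i : Fin n, tp k * tp (-m) := by
          gcongr with i
          rw [tp_eq_ofReal, Real.rpow_intCast]
          refine ENNReal.ofReal_le_ofReal ?_
          have h1 : ‖t i‖ ≤ ‖t‖ := PiLp.norm_apply_le t i
          have h2 : ‖t‖ ≤ 2 ^ k := by simpa [hS] using ht
          exact h1.trans h2
      _ = _ := by simp
  calc ∫⁻ x, ‖cv h g x‖ₑ ^ 2
      ≤ ∫⁻ x, ENNReal.ofReal B ^ 2 * volume S * ∫⁻ t in S, D x t ^ 2 := by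
        refine lintegral_mono fun x => ?_
        calc ‖cv h g x‖ₑ ^ 2 ≤ (ENNReal.ofReal B * ∫⁻ t in S, D x t) ^ 2 := by
              gcongr; exact b1 x
          _ ≤ _ := by rw [mul_pow, mul_assoc]; gcongr; exact b2 x
    _ = ENNReal.ofReal B ^ 2 * volume S * ∫⁻ x, ∫⁻ t in S, D x t ^ 2 := by
        refine lintegral_const_mul' _ _ ?_
        have : volume S ≠ ⊤ := measure_closedBall_lt_top.ne
        finiteness
    _ ≤ _ := by
        refine (mul_le_mul_right b3 _).trans (le_of_eq ?_)
        rw [hS, volume_closedBall_zpow]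
        ring

/-- A family of oscillatory kernels at scale `2^k` with oscillation parameter `lam`. -/
structure OscKernel {n : ℕ} (k : ℤ) (lam C : ℝ) (κ : ℝ → Rn n → ℂ) : Prop where
  C_nonneg : 0 ≤ C
  one_le : 1 ≤ lam
  cont : Continuous (Function.uncurry κ)
  supp : ∀ u t, (2 : ℝ) ^ (k + 1) < ‖t‖ → κ u t = 0
  bound : ∀ u ∈ Icc (1 / 2 : ℝ) 4, ∀ t, ‖κ u t‖ ≤ C * (2 : ℝ) ^ (-(k * n))
  lip : ∀ u ∈ Icc (1 / 2 : ℝ) 4, ∀ t t',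
    ‖κ u t - κ u t'‖ ≤ C * lam * (2 : ℝ) ^ (-(k * (n + 1))) * ‖t - t'‖
  mean : ∀ u ∈ Icc (1 / 2 : ℝ) 4, ∫ t, κ u t = 0
  l2 : ∀ u ∈ Icc (1 / 2 : ℝ) 4, ∀ g : Rn n → ℂ, Measurable g → (∃ M : ℝ, ∀ x, ‖g x‖ ≤ M) →
    Integrable g → ∫⁻ x, ‖cv (κ u) g x‖ₑ ^ 2 ≤
      ENNReal.ofReal C * ENNReal.ofReal lam ^ (-(n : ℝ)) * ∫⁻ x, ‖g x‖ₑ ^ 2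
  sq : ∀ g : Rn n → ℂ, Measurable g → (∃ M : ℝ, ∀ x, ‖g x‖ ≤ M) → ∀ x,
    ENNReal.ofReal lam * ∫⁻ u in Icc (1 / 2 : ℝ) 4, ‖cv (κ u) g x‖ₑ ^ 2 ≤
      ENNReal.ofReal C * ballAvg (k + 1) (fun y => ‖g y‖ₑ ^ 2) x

lemma OscKernel.continuous {n : ℕ} {k : ℤ} {lam C : ℝ} {κ : ℝ → Rn n → ℂ}
    (h : OscKernel k lam C κ) (u : ℝ) : Continuous (κ u) :=
  h.cont.comp (Continuous.prodMk_right u)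

lemma OscKernel.measurable_cv {n : ℕ} {k : ℤ} {lam C : ℝ} {κ : ℝ → Rn n → ℂ}
    (h : OscKernel k lam C κ) {g : Rn n → ℂ} (hg : Measurable g) :
    Measurable fun z : ℝ × Rn n => cv (κ z.1) g z.2 := by
  have : StronglyMeasurable (Function.uncurry fun (z : ℝ × Rn n) (t : Rn n) =>
      κ z.1 t * g (z.2 - t)) := by
    refine Measurable.stronglyMeasurable ?_
    have h1 : Measurable fun a : (ℝ × Rn n) × Rn n => κ a.1.1 a.2 :=
      h.cont.measurable.comp ((measurable_fst.comp measurable_fst).prodMk measurable_snd)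
    have h2 : Measurable fun a : (ℝ × Rn n) × Rn n => g (a.1.2 - a.2) :=
      hg.comp ((measurable_snd.comp measurable_fst).sub measurable_snd)
    exact h1.mul h2
  exact (StronglyMeasurable.integral_prod_right (ν := volume) this).measurable

/-- Size bound for a piece of an oscillatory operator. -/
lemma OscKernel.enorm_cv_le {n : ℕ} {k : ℤ} {lam C : ℝ} {κ : ℝ → Rn n → ℂ}
    (h : OscKernel k lam C κ) {u : ℝ} (hu : u ∈ Icc (1 / 2 : ℝ) 4) (g : Rn n → ℂ) (x : Rn n) :
    ‖cv (κ u) g x‖ₑ ≤ ENNReal.ofReal C * tp n * ballAvg (k + 1) (fun y => ‖g y‖ₑ) x := by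
  refine (enorm_cv_le_ballAvg g (h.bound u hu) (h.supp u) x).trans (le_of_eq ?_)
  have : (2 : ℝ) ^ (-(k * n)) = (2 : ℝ) ^ (-((k : ℝ) * n)) := by
    rw [← Real.rpow_intCast]; push_cast; rfl
  rw [ENNReal.ofReal_mul h.C_nonneg, this, ← tp_eq_ofReal, mul_assoc (ENNReal.ofReal C),
    ← tp_add]
  congr 3
  push_cast; ring

lemma ballAvg_self_le_sq {n : ℕ} (k : ℤ) {g : Rn n → ℝ≥0∞} (hg : Measurable g) (x : Rn n) :
    ballAvg k g x ^ 2 ≤ unitVol n * ballAvg k (fun y => g y ^ 2) x := by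
  have h := ballAvg_sq_le k (hg.pow_const 2) (measurable_const (a := (1 : ℝ≥0∞))) x
  have e2 : ∀ t, (g t ^ 2) ^ (1 / 2 : ℝ) = g t := fun t => by
    rw [← ENNReal.rpow_natCast, ← ENNReal.rpow_mul]; norm_num
  simp only [e2, ENNReal.one_rpow, mul_one, ballAvg_const, one_mul] at h
  rwa [mul_comm]

section Bounded

variable {n : ℕ} {f : Rn n → ℝ≥0∞} {M : ℝ≥0∞}

lemma norm_dyD_le (hM : M ≠ ⊤) (hfM : ∀ x, f x ≤ M) (k : ℤ) (x : Rn n) :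
    ‖(dyD k f x : ℂ)‖ ≤ (2 * M).toReal := by
  have h := enorm_dyD_le k f x
  have h1 := dyE_mono k hfM x
  have h2 := dyE_mono (k + 1) hfM x
  rw [dyE_const] at h1 h2
  have h3 : ‖dyD k f x‖ₑ ≤ 2 * M := h.trans (by rw [two_mul]; exact add_le_add h1 h2)
  have h4 := ENNReal.toReal_mono (by finiteness) h3
  rwa [toReal_enorm, ← Complex.norm_real] at h4

lemma measurable_dyD_complex (k : ℤ) (f : Rn n → ℝ≥0∞) :
    Measurable fun y => (dyD k f y : ℂ) :=
  Complex.measurable_ofReal.comp (measurable_dyD k f)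

lemma tp_zpow_eq (m : ℤ) : ENNReal.ofReal ((2 : ℝ) ^ m) = tp m := by
  rw [tp_eq_ofReal, Real.rpow_intCast]

/-- Fine martingale differences against an oscillatory kernel. -/
lemma OscKernel.lintegral_cv_dyD_sq_le_of_le {k : ℤ} {lam C : ℝ} {κ : ℝ → Rn n → ℂ}
    (h : OscKernel k lam C κ) (hM : M ≠ ⊤) (hfM : ∀ x, f x ≤ M) (hf : Measurable f)
    (hfi : ∫⁻ x, f x ≠ ⊤) {u : ℝ} (hu : u ∈ Icc (1 / 2 : ℝ) 4) {m : ℤ} (hmk : m ≤ k) :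
    ∫⁻ x, ‖cv (κ u) (fun y => (dyD m f y : ℂ)) x‖ₑ ^ 2 ≤
      (ENNReal.ofReal C * n * tp (1 + (1 + n) * n) * unitVol n) ^ 2 *
        (ENNReal.ofReal lam ^ 2 * tp (m - k) ^ 2) * ∫⁻ x, ‖dyD m f x‖ₑ ^ 2 := by
  have hl : 0 ≤ lam := zero_le_one.trans h.one_le
  have hΛ : 0 ≤ C * lam * (2 : ℝ) ^ (-(k * (n + 1))) :=
    mul_nonneg (mul_nonneg h.C_nonneg hl) (by positivity)
  have b : ∀ x, ‖cv (κ u) (fun y => (dyD m f y : ℂ)) x‖ₑ ≤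
      (ENNReal.ofReal C * n * tp (1 + (1 + n) * n)) * (ENNReal.ofReal lam * tp (m - k)) *
        ballAvg (k + 1 + n) (fun y => ‖dyD m f y‖ₑ) x := by
    intro x
    refine (enorm_cv_dyD_le hM hfM hf hfi (h.continuous u) hmk hΛ (h.lip u hu) (h.bound u hu)
      (h.supp u) x).trans (le_of_eq ?_)
    rw [ENNReal.ofReal_mul hΛ, ENNReal.ofReal_mul (mul_nonneg h.C_nonneg hl),
      ENNReal.ofReal_mul h.C_nonneg, ENNReal.ofReal_mul (by positivity), tp_zpow_eq, tp_zpow_eq,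
      ENNReal.ofReal_natCast, ballAvg]
    have e : tp ((-(k * (n + 1)) : ℤ) : ℝ) * tp ((m + 1 : ℤ) : ℝ) =
        tp (1 + (1 + n) * n) * tp (m - k) * tp (-((k + 1 + n : ℤ) * n)) := by
      rw [← tp_add, ← tp_add, ← tp_add]; congr 1; push_cast; ring
    calc _ = ENNReal.ofReal C * ENNReal.ofReal lam * n *
          (tp ((-(k * (n + 1)) : ℤ) : ℝ) * tp ((m + 1 : ℤ) : ℝ)) *
          ∫⁻ y in Metric.closedBall x ((2 : ℝ) ^ (k + 1 + n)), ‖dyD m f y‖ₑ := by ring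
      _ = _ := by rw [e]; ring
  calc _ ≤ ∫⁻ x, ((ENNReal.ofReal C * n * tp (1 + (1 + n) * n)) *
        (ENNReal.ofReal lam * tp (m - k))) ^ 2 *
        ballAvg (k + 1 + n) (fun y => ‖dyD m f y‖ₑ) x ^ 2 := by
        refine lintegral_mono fun x => ?_
        rw [← mul_pow]
        exact pow_le_pow_left' (b x) 2
    _ = ((ENNReal.ofReal C * n * tp (1 + (1 + n) * n)) *
        (ENNReal.ofReal lam * tp (m - k))) ^ 2 *
        ∫⁻ x, ballAvg (k + 1 + n) (fun y => ‖dyD m f y‖ₑ) x ^ 2 :=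
        lintegral_const_mul' _ _ (by finiteness)
    _ ≤ _ := by
        refine (mul_le_mul_right (lintegral_ballAvg_sq_le _ (measurable_dyD m f).enorm) _).trans
          (le_of_eq ?_)
        ring

/-- Coarse martingale differences against an oscillatory kernel. -/
lemma OscKernel.lintegral_cv_dyD_sq_le_of_ge {k : ℤ} {lam C : ℝ} {κ : ℝ → Rn n → ℂ}
    (h : OscKernel k lam C κ) (hf : Measurable f)
    (hfi : ∫⁻ x, f x ≠ ⊤) {u : ℝ} (hu : u ∈ Icc (1 / 2 : ℝ) 4) (m : ℤ) :
    ∫⁻ x, ‖cv (κ u) (fun y => (dyD m f y : ℂ)) x‖ₑ ^ 2 ≤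
      (ENNReal.ofReal C * tp n * unitVol n) ^ 2 * (8 * n) * tp (k - m) *
        ∫⁻ x, ‖dyD m f x‖ₑ ^ 2 := by
  refine (lintegral_cv_coarse_sq_le (h.continuous u) (h.mean u hu) (h.bound u hu) (h.supp u)
    (g := fun y => (dyD m f y : ℂ)) (m := m) ?_ (integrable_dyD hf hfi m).ofReal).trans
    (le_of_eq ?_)
  · intro x y hxy
    simp only [cellConst_dyD m f x y hxy]
  · rw [ENNReal.ofReal_mul h.C_nonneg, tp_zpow_eq, mul_assoc (ENNReal.ofReal C), ← tp_add,
      ← tp_add]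
    have e1 : ((-(k * n) : ℤ) : ℝ) + ((k + 1 : ℤ) : ℝ) * n = n := by push_cast; ring
    have e2 : ((k + 1 : ℤ) : ℝ) + -m = 1 + (k - m) := by push_cast; ring
    have e3 : tp 1 = 2 := by simp [tp]
    have e4 : ∀ x, ‖(dyD m f x : ℂ)‖ₑ = ‖dyD m f x‖ₑ := fun x => by
      rw [← ofReal_norm, Complex.norm_real, ofReal_norm]
    simp_rw [e4]
    rw [e1, e2, tp_add, e3]
    ring

/-- Interpolated `L²` bound: decay both in the oscillation parameter and in the distance between
the scale of the kernel and that of the martingale difference. -/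
lemma exists_lintegral_cv_dyD_sq_le (n : ℕ) (C : ℝ) : ∃ A : ℝ≥0∞, A ≠ ⊤ ∧
    ∀ (k : ℤ) (lam : ℝ) (κ : ℝ → Rn n → ℂ), OscKernel k lam C κ →
    ∀ (f : Rn n → ℝ≥0∞) (M : ℝ≥0∞), M ≠ ⊤ → (∀ x, f x ≤ M) → Measurable f → ∫⁻ x, f x ≠ ⊤ →
    ∀ u ∈ Icc (1 / 2 : ℝ) 4, ∀ m : ℤ, ∀ η ∈ Icc (0 : ℝ) 1,
    ∫⁻ x, ‖cv (κ u) (fun y => (dyD m f y : ℂ)) x‖ₑ ^ 2 ≤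
      A * ENNReal.ofReal lam ^ (-(n : ℝ) + (n + 2) * η) * tp (-η * |(m : ℝ) - k|) *
        ∫⁻ x, ‖dyD m f x‖ₑ ^ 2 := by
  set A₁ : ℝ≥0∞ := (ENNReal.ofReal C * n * tp (1 + (1 + n) * n) * unitVol n) ^ 2
  set A₂ : ℝ≥0∞ := (ENNReal.ofReal C * tp n * unitVol n) ^ 2 * (8 * n)
  have hU := unitVol_ne_top n
  refine ⟨ENNReal.ofReal C + A₁ + A₂, by finiteness, ?_⟩
  set A : ℝ≥0∞ := ENNReal.ofReal C + A₁ + A₂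
  intro k lam κ h f M hM hfM hf hfi u hu m η hη
  set X := ∫⁻ x, ‖cv (κ u) (fun y => (dyD m f y : ℂ)) x‖ₑ ^ 2
  set Y := ∫⁻ x, ‖dyD m f x‖ₑ ^ 2
  set Λ := ENNReal.ofReal lam
  have hl : 0 < lam := zero_lt_one.trans_le h.one_le
  have hΛ1 : 1 ≤ Λ := by
    rw [← ENNReal.ofReal_one]; exact ENNReal.ofReal_le_ofReal h.one_le
  have hΛ0 : Λ ≠ 0 := (zero_lt_one.trans_le hΛ1).ne'
  have hΛt : Λ ≠ ⊤ := ENNReal.ofReal_ne_top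
  have e4 : ∀ x, ‖(dyD m f x : ℂ)‖ₑ = ‖dyD m f x‖ₑ := fun x => by
    rw [← ofReal_norm, Complex.norm_real, ofReal_norm]
  have h1 : X ≤ A * Λ ^ (-(n : ℝ)) * Y := by
    have := h.l2 u hu (fun y => (dyD m f y : ℂ)) (measurable_dyD_complex m f)
      ⟨_, norm_dyD_le hM hfM m⟩ (integrable_dyD hf hfi m).ofReal
    simp_rw [e4] at this
    refine this.trans ?_
    gcongr
    exact le_add_right le_self_add
  have h2 : X ≤ A * (Λ ^ (2 : ℝ) * tp (-|(m : ℝ) - k|)) * Y := by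
    rcases le_total m k with hmk | hmk
    · refine (h.lintegral_cv_dyD_sq_le_of_le hM hfM hf hfi hu hmk).trans ?_
      have hmk' : (m : ℝ) - k ≤ 0 := by exact_mod_cast sub_nonpos.2 hmk
      rw [abs_of_nonpos hmk', ENNReal.rpow_two, neg_neg]
      gcongr
      · exact le_add_right le_add_self
      · have : tp (m - k) ≤ 1 := by rw [← tp_zero]; exact tp_mono hmk'
        rw [sq]; exact mul_le_of_le_one_left zero_le this
    · refine (h.lintegral_cv_dyD_sq_le_of_ge hf hfi hu m).trans ?_
      have hmk' : 0 ≤ (m : ℝ) - k := by exact_mod_cast sub_nonneg.2 hmk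
      rw [abs_of_nonneg hmk', neg_sub]
      gcongr
      · exact le_add_self
      · exact le_mul_of_one_le_left zero_le (ENNReal.one_le_rpow hΛ1 (by norm_num))
  have hη0 := hη.1
  have hη1 : 0 ≤ 1 - η := sub_nonneg.2 hη.2
  have e : ∀ Z : ℝ≥0∞, Z ^ (1 - η) * Z ^ η = Z := fun Z => by
    rw [← ENNReal.rpow_add_of_nonneg _ _ hη1 hη0, sub_add_cancel, ENNReal.rpow_one]
  calc X = X ^ (1 - η) * X ^ η := (e X).symm
    _ ≤ (A * Λ ^ (-(n : ℝ)) * Y) ^ (1 - η) *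
        (A * (Λ ^ (2 : ℝ) * tp (-|(m : ℝ) - k|)) * Y) ^ η := by gcongr
    _ = (A ^ (1 - η) * A ^ η) * ((Λ ^ (-(n : ℝ))) ^ (1 - η) * (Λ ^ (2 : ℝ)) ^ η) *
        tp (-|(m : ℝ) - k|) ^ η * (Y ^ (1 - η) * Y ^ η) := by
        rw [ENNReal.mul_rpow_of_nonneg _ _ hη1, ENNReal.mul_rpow_of_nonneg _ _ hη1,
          ENNReal.mul_rpow_of_nonneg _ _ hη0, ENNReal.mul_rpow_of_nonneg _ _ hη0,
          ENNReal.mul_rpow_of_nonneg _ _ hη0]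
        ring
    _ = _ := by
        rw [e, e, tp_rpow, ← ENNReal.rpow_mul, ← ENNReal.rpow_mul, ← ENNReal.rpow_add _ _ hΛ0 hΛt]
        congr 3
        · congr 1; ring
        · ring

end Bounded

/-- Hölder's inequality for sums with exponents adding up to at least one. -/
lemma tsum_rpow_mul_rpow_le {ι : Type*} {α β : ℝ} (hβ : 0 ≤ β) (hβ1 : β ≤ 1)
    (hαβ : 1 ≤ α + β) (x y : ι → ℝ≥0∞) :
    ∑' j, x j ^ α * y j ^ β ≤ (∑' j, x j) ^ α * (∑' j, y j) ^ β := by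
  set X := ∑' j, x j
  have h1 : 0 ≤ α - (1 - β) := by linarith
  have h2 : 0 ≤ 1 - β := by linarith
  have e : ∀ z : ℝ≥0∞, z ^ α = z ^ (α - (1 - β)) * z ^ (1 - β) := fun z => by
    rw [← ENNReal.rpow_add_of_nonneg _ _ h1 h2]; congr 1; ring
  let _ : MeasurableSpace ι := ⊤
  have := ENNReal.lintegral_mul_norm_pow_le (μ := Measure.count) (f := x) (g := y)
    measurable_from_top.aemeasurable measurable_from_top.aemeasurable h2 hβ (by ring)
  rw [lintegral_count, lintegral_count, lintegral_count] at this
  calc _ ≤ ∑' j, X ^ (α - (1 - β)) * (x j ^ (1 - β) * y j ^ β) := by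
        refine ENNReal.tsum_le_tsum fun j => ?_
        rw [e (x j), mul_assoc]
        gcongr
        exact ENNReal.le_tsum j
    _ ≤ _ := by
        rw [ENNReal.tsum_mul_left, e X, mul_assoc]
        gcongr

/-- A family of oscillatory kernels with uniform constants. -/
structure OscFamily {n : ℕ} (kk : ℤ → ℤ) (lam : ℤ → ℝ) (C : ℝ) (N : ℕ) (L : ℝ)
    (κ : ℤ → ℝ → Rn n → ℂ) : Prop where
  osc : ∀ j, OscKernel (kk j) (lam j) C (κ j)
  one_le : 1 ≤ L
  le_lam : ∀ j, L ≤ lam j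
  encard_le : ∀ m, {j | kk j = m}.encard ≤ N

/-- The mixed norm in the index and the parameter of a piece. -/
def pieceN {n : ℕ} (kk : ℤ → ℤ) (lam : ℤ → ℝ) (κ : ℤ → ℝ → Rn n → ℂ) (r : ℝ) (a : ℤ)
    (f : Rn n → ℝ≥0∞) (x : Rn n) : ℝ≥0∞ :=
  (∑' j, ENNReal.ofReal (lam j) * ∫⁻ u in Icc (1 / 2 : ℝ) 4,
    ‖cv (κ j u) (fun y => (dyD (kk j + a) f y : ℂ)) x‖ₑ ^ r) ^ (1 / r)

/-- The square function of a piece. -/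
def pieceQ {n : ℕ} (kk : ℤ → ℤ) (lam : ℤ → ℝ) (κ : ℤ → ℝ → Rn n → ℂ) (s : ℝ) (a : ℤ)
    (f : Rn n → ℝ≥0∞) (x : Rn n) : ℝ≥0∞ :=
  ∑' j, ENNReal.ofReal (lam j) ^ s * ∫⁻ u in Icc (1 / 2 : ℝ) 4,
    ‖cv (κ j u) (fun y => (dyD (kk j + a) f y : ℂ)) x‖ₑ ^ (2 : ℝ)

section

variable {n : ℕ} {kk : ℤ → ℤ} {lam : ℤ → ℝ} {C : ℝ} {N : ℕ} {L : ℝ} {κ : ℤ → ℝ → Rn n → ℂ}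

lemma OscFamily.measurable_inner (h : OscFamily kk lam C N L κ) (j : ℤ) {g : Rn n → ℂ}
    (hg : Measurable g) (q : ℝ) :
    Measurable fun x => ∫⁻ u in Icc (1 / 2 : ℝ) 4, ‖cv (κ j u) g x‖ₑ ^ q := by
  have h1 := (((h.osc j).measurable_cv hg).comp measurable_swap).enorm.pow_const q
  exact Measurable.lintegral_prod_right (ν := volume.restrict (Icc (1 / 2 : ℝ) 4)) h1

lemma OscFamily.measurable_pieceN (h : OscFamily kk lam C N L κ) (r : ℝ) (a : ℤ)
    (f : Rn n → ℝ≥0∞) : Measurable (pieceN kk lam κ r a f) :=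
  (Measurable.tsum fun j => (h.measurable_inner j (measurable_dyD_complex _ f) r).const_mul
    _).pow_const _

lemma OscFamily.measurable_pieceQ (h : OscFamily kk lam C N L κ) (s : ℝ) (a : ℤ)
    (f : Rn n → ℝ≥0∞) : Measurable (pieceQ kk lam κ s a f) :=
  Measurable.tsum fun j => (h.measurable_inner j (measurable_dyD_complex _ f) 2).const_mul _

lemma pieceN_rpow {r : ℝ} (hr : 0 < r) (a : ℤ) (f : Rn n → ℝ≥0∞) (x : Rn n) :
    pieceN kk lam κ r a f x ^ r = ∑' j, ENNReal.ofReal (lam j) * ∫⁻ u in Icc (1 / 2 : ℝ) 4,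
      ‖cv (κ j u) (fun y => (dyD (kk j + a) f y : ℂ)) x‖ₑ ^ r := by
  rw [pieceN, ← ENNReal.rpow_mul, one_div_mul_cancel hr.ne', ENNReal.rpow_one]

/-- The integrated square function gains in the oscillation and in the scale shift. -/
lemma exists_lintegral_pieceQ_le (n : ℕ) (C : ℝ) (N : ℕ) : ∃ A : ℝ≥0∞, A ≠ ⊤ ∧
    ∀ (kk : ℤ → ℤ) (lam : ℤ → ℝ) (L : ℝ) (κ : ℤ → ℝ → Rn n → ℂ), OscFamily kk lam C N L κ →
    ∀ (f : Rn n → ℝ≥0∞) (M : ℝ≥0∞), M ≠ ⊤ → (∀ x, f x ≤ M) → Measurable f → ∫⁻ x, f x ≠ ⊤ →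
    ∀ a : ℤ, ∀ s : ℝ, ∀ η ∈ Icc (0 : ℝ) 1, s - n + (n + 2) * η ≤ 0 →
    ∫⁻ x, pieceQ kk lam κ s a f x ≤
      A * ENNReal.ofReal L ^ (s - n + (n + 2) * η) * tp (-η * |(a : ℝ)|) * ∫⁻ x, f x ^ 2 := by
  obtain ⟨A, hA, H⟩ := exists_lintegral_cv_dyD_sq_le n C
  have hU := unitVol_ne_top n
  refine ⟨A * ENNReal.ofReal (4 - 1 / 2) * N * (tp n * tp (n * n) * unitVol n), by finiteness, ?_⟩
  intro kk lam L κ h f M hM hfM hf hfi a s η hη hs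
  set B := A * ENNReal.ofReal (4 - 1 / 2) * ENNReal.ofReal L ^ (s - n + (n + 2) * η) *
    tp (-η * |(a : ℝ)|)
  have e4 : ∀ m x, ‖(dyD m f x : ℂ)‖ₑ = ‖dyD m f x‖ₑ := fun m x => by
    rw [← ofReal_norm, Complex.norm_real, ofReal_norm]
  have hj : ∀ j, ∫⁻ x, ENNReal.ofReal (lam j) ^ s * ∫⁻ u in Icc (1 / 2 : ℝ) 4,
      ‖cv (κ j u) (fun y => (dyD (kk j + a) f y : ℂ)) x‖ₑ ^ (2 : ℝ) ≤
      B * ∫⁻ x, ‖dyD (kk j + a) f x‖ₑ ^ 2 := by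
    intro j
    have hl : 0 < lam j := zero_lt_one.trans_le (h.osc j).one_le
    have hΛ0 : ENNReal.ofReal (lam j) ≠ 0 := by simpa using hl
    rw [lintegral_const_mul _ (h.measurable_inner j (measurable_dyD_complex _ f) 2)]
    have hm := (((h.osc j).measurable_cv (measurable_dyD_complex (kk j + a) f)).comp
      measurable_swap).enorm.pow_const (2 : ℝ)
    rw [lintegral_lintegral_swap (f := fun x u =>
      ‖cv (κ j u) (fun y => (dyD (kk j + a) f y : ℂ)) x‖ₑ ^ (2 : ℝ)) hm.aemeasurable]
    set D := A * ENNReal.ofReal (lam j) ^ (-(n : ℝ) + (n + 2) * η) * tp (-η * |(a : ℝ)|) *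
      ∫⁻ x, ‖dyD (kk j + a) f x‖ₑ ^ 2
    have b : ∫⁻ u in Icc (1 / 2 : ℝ) 4, ∫⁻ x,
        ‖cv (κ j u) (fun y => (dyD (kk j + a) f y : ℂ)) x‖ₑ ^ (2 : ℝ) ≤
        D * ENNReal.ofReal (4 - 1 / 2) := by
      rw [← Real.volume_Icc, ← setLIntegral_const]
      refine setLIntegral_mono measurable_const fun u hu => ?_
      simp_rw [ENNReal.rpow_two]
      refine (H _ _ _ (h.osc j) f M hM hfM hf hfi u hu (kk j + a) η hη).trans (le_of_eq ?_)
      have : ((kk j + a : ℤ) : ℝ) - kk j = a := by push_cast; ring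
      rw [this]
    refine (mul_le_mul_right b _).trans ?_
    have e5 : ENNReal.ofReal (lam j) ^ s * ENNReal.ofReal (lam j) ^ (-(n : ℝ) + (n + 2) * η) ≤
        ENNReal.ofReal L ^ (s - n + (n + 2) * η) := by
      rw [← ENNReal.rpow_add _ _ hΛ0 ENNReal.ofReal_ne_top]
      have : s + (-(n : ℝ) + (n + 2) * η) = s - n + (n + 2) * η := by ring
      rw [this]
      rw [← neg_neg (s - n + (n + 2) * η), ENNReal.rpow_neg, ENNReal.rpow_neg _ (-_)]
      exact ENNReal.inv_le_inv.2 (ENNReal.rpow_le_rpow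
        (ENNReal.ofReal_le_ofReal (h.le_lam j)) (by linarith))
    calc _ = (ENNReal.ofReal (lam j) ^ s * ENNReal.ofReal (lam j) ^ (-(n : ℝ) + (n + 2) * η)) *
          (A * tp (-η * |(a : ℝ)|) *
      (∫⁻ x, ‖dyD (kk j + a) f x‖ₑ ^ 2) * ENNReal.ofReal (4 - 1 / 2)) := by ring
      _ ≤ ENNReal.ofReal L ^ (s - n + (n + 2) * η) * (A * tp (-η * |(a : ℝ)|) *
      (∫⁻ x, ‖dyD (kk j + a) f x‖ₑ ^ 2) * ENNReal.ofReal (4 - 1 / 2)) := by gcongr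
      _ = _ := by ring
  have hsum : ∑' m, ∫⁻ x, ‖dyD m f x‖ₑ ^ 2 ≤ tp n * tp (n * n) * unitVol n * ∫⁻ x, f x ^ 2 := by
    have := tsum_lintegral_dyD_sq_weight_le hM hfM hf (w := fun _ => 1) measurable_const
    simp only [mul_one] at this
    refine this.trans ?_
    have e : maxFn (fun _ : Rn n => (1 : ℝ≥0∞)) = fun _ => unitVol n := by
      ext x; simp [maxFn, ballAvg_const]
    rw [e, lintegral_mul_const _ (hf.pow_const 2)]
    exact le_of_eq (by ring)
  calc ∫⁻ x, pieceQ kk lam κ s a f x = ∑' j, ∫⁻ x, ENNReal.ofReal (lam j) ^ s *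
        ∫⁻ u in Icc (1 / 2 : ℝ) 4,
          ‖cv (κ j u) (fun y => (dyD (kk j + a) f y : ℂ)) x‖ₑ ^ (2 : ℝ) :=
        lintegral_tsum fun j =>
          ((h.measurable_inner j (measurable_dyD_complex _ f) 2).const_mul _).aemeasurable
    _ ≤ ∑' j, B * ∫⁻ x, ‖dyD (kk j + a) f x‖ₑ ^ 2 := ENNReal.tsum_le_tsum hj
    _ = B * ∑' j, ∫⁻ x, ‖dyD (kk j + a) f x‖ₑ ^ 2 := ENNReal.tsum_mul_left
    _ ≤ B * (N * ∑' m, ∫⁻ x, ‖dyD (m + a) f x‖ₑ ^ 2) := by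
        gcongr
        have := tsum_comp_le_of_encard_le h.encard_le
          (fun m => ∫⁻ x, ‖dyD (m + a) f x‖ₑ ^ (2 : ℕ))
        rwa [ENat.toENNReal_coe] at this
    _ = B * (N * ∑' m, ∫⁻ x, ‖dyD m f x‖ₑ ^ 2) := by
        rw [(Equiv.addRight a).tsum_eq (fun m => ∫⁻ x, ‖dyD m f x‖ₑ ^ (2 : ℕ)) |>.symm]
        rfl
    _ ≤ B * (N * (tp n * tp (n * n) * unitVol n * ∫⁻ x, f x ^ 2)) := by gcongr
    _ = _ := by ring

end

/-- On a finite measure space, `L^s` norms with `s ≤ 2` are controlled by the `L²` norm. -/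
lemma setLIntegral_rpow_le {α : Type*} [MeasurableSpace α] {μ : Measure α} {S : Set α} {β : ℝ}
    (hβ0 : 0 < β) (hβ1 : β ≤ 1) {g : α → ℝ≥0∞} (hg : Measurable g) :
    ∫⁻ u in S, g u ^ (2 * β) ∂μ ≤ (∫⁻ u in S, g u ^ (2 : ℝ) ∂μ) ^ β * μ S ^ (1 - β) := by
  have h := ENNReal.lintegral_mul_norm_pow_le (μ := μ.restrict S) (f := fun t => g t ^ (2 : ℝ))
    (g := fun _ => 1) (hg.pow_const 2).aemeasurable aemeasurable_const
    (p := β) (q := 1 - β) hβ0.le (by linarith) (by ring)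
  simp only [ENNReal.one_rpow, mul_one, lintegral_one, Measure.restrict_apply_univ,
    ← ENNReal.rpow_mul] at h
  exact h

section

variable {n : ℕ} {kk : ℤ → ℤ} {lam : ℤ → ℝ} {C : ℝ} {N : ℕ} {L : ℝ} {κ : ℤ → ℝ → Rn n → ℂ}

/-- Pointwise bound with averages of martingale differences. -/
lemma OscFamily.pieceN_rpow_le (h : OscFamily kk lam C N L κ) {r ϑ : ℝ} (hr : 2 < r)
    (hϑ0 : 0 < ϑ) (hϑr : r * ϑ ≤ 2) (a : ℤ) (f : Rn n → ℝ≥0∞) (x : Rn n) :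
    pieceN kk lam κ r a f x ^ r ≤
      (ENNReal.ofReal C * tp n) ^ (r * (1 - ϑ)) * ENNReal.ofReal (4 - 1 / 2) ^ (1 - r * ϑ / 2) *
      N ^ (r * (1 - ϑ) / 2) *
      (∑' m : ℤ, ballAvg (m + 1) (fun y => ‖dyD (m + a) f y‖ₑ) x ^ 2) ^ (r * (1 - ϑ) / 2) *
      pieceQ kk lam κ (2 / (r * ϑ)) a f x ^ (r * ϑ / 2) := by
  rw [pieceN_rpow (by linarith)]
  set A : ℤ → ℝ≥0∞ := fun j => ballAvg (kk j + 1) (fun y => ‖dyD (kk j + a) f y‖ₑ) x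
  have hα : 0 ≤ r * (1 - ϑ) := by nlinarith
  set D := (ENNReal.ofReal C * tp n) ^ (r * (1 - ϑ)) *
    ENNReal.ofReal (4 - 1 / 2) ^ (1 - r * ϑ / 2) with hD
  have e4 : ∀ m x, ‖(dyD m f x : ℂ)‖ₑ = ‖dyD m f x‖ₑ := fun m x => by
    rw [← ofReal_norm, Complex.norm_real, ofReal_norm]
  have hβ : 0 < r * ϑ / 2 := by positivity
  have hj : ∀ j, ENNReal.ofReal (lam j) * ∫⁻ u in Icc (1 / 2 : ℝ) 4,
      ‖cv (κ j u) (fun y => (dyD (kk j + a) f y : ℂ)) x‖ₑ ^ r ≤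
      D * ((A j ^ 2) ^ (r * (1 - ϑ) / 2) * (ENNReal.ofReal (lam j) ^ (2 / (r * ϑ)) *
        ∫⁻ u in Icc (1 / 2 : ℝ) 4,
        ‖cv (κ j u) (fun y => (dyD (kk j + a) f y : ℂ)) x‖ₑ ^ (2 : ℝ)) ^ (r * ϑ / 2)) := by
    intro j
    set F : ℝ → ℝ≥0∞ := fun u => ‖cv (κ j u) (fun y => (dyD (kk j + a) f y : ℂ)) x‖ₑ
    have hF : Measurable F := ((h.osc j).measurable_cv (measurable_dyD_complex _ f)).enorm.comp
      (measurable_id.prodMk measurable_const)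
    have b : ∫⁻ u in Icc (1 / 2 : ℝ) 4, F u ^ r ≤
        (ENNReal.ofReal C * tp n * A j) ^ (r * (1 - ϑ)) *
        ∫⁻ u in Icc (1 / 2 : ℝ) 4, F u ^ (2 * (r * ϑ / 2)) := by
      rw [← lintegral_const_mul _ (hF.pow_const _)]
      refine setLIntegral_mono ((hF.pow_const _).const_mul _) fun u hu => ?_
      have e : r = r * (1 - ϑ) + 2 * (r * ϑ / 2) := by ring
      conv_lhs => rw [e]
      rw [ENNReal.rpow_add_of_nonneg _ _ hα (by positivity)]
      gcongr
      simpa only [e4] using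
        (h.osc j).enorm_cv_le hu (fun y => (dyD (kk j + a) f y : ℂ)) x
    have b2 := setLIntegral_rpow_le (μ := volume) (S := Icc (1 / 2 : ℝ) 4) hβ (by linarith) hF
    rw [Real.volume_Icc] at b2
    have e5 : ENNReal.ofReal (lam j) =
        (ENNReal.ofReal (lam j) ^ (2 / (r * ϑ))) ^ (r * ϑ / 2) := by
      rw [← ENNReal.rpow_mul]
      have : 2 / (r * ϑ) * (r * ϑ / 2) = 1 := by field_simp
      rw [this, ENNReal.rpow_one]
    have e6 : (A j ^ 2) ^ (r * (1 - ϑ) / 2) = A j ^ (r * (1 - ϑ)) := by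
      rw [← ENNReal.rpow_natCast, ← ENNReal.rpow_mul]; congr 1; push_cast; ring
    rw [e6, ENNReal.mul_rpow_of_nonneg (ENNReal.ofReal (lam j) ^ (2 / (r * ϑ))) _ hβ.le, ← e5]
    refine (mul_le_mul_right (b.trans (mul_le_mul_right b2 _)) _).trans (le_of_eq ?_)
    rw [ENNReal.mul_rpow_of_nonneg _ (A j) hα, hD]
    ring
  refine (ENNReal.tsum_le_tsum hj).trans ?_
  rw [ENNReal.tsum_mul_left]
  have hAP := tsum_comp_le_of_encard_le h.encard_le
    (fun m => ballAvg (m + 1) (fun y => ‖dyD (m + a) f y‖ₑ) x ^ (2 : ℕ))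
  rw [ENat.toENNReal_coe] at hAP
  have hα2 : 0 ≤ r * (1 - ϑ) / 2 := by linarith
  refine (mul_le_mul_right ((tsum_rpow_mul_rpow_le (α := r * (1 - ϑ) / 2) hβ.le (by linarith)
    (by linarith) _ _).trans (mul_le_mul_left (ENNReal.rpow_le_rpow hAP hα2) _)) _).trans
    (le_of_eq ?_)
  rw [ENNReal.mul_rpow_of_nonneg _ _ hα2, pieceQ]
  ring

/-- Pointwise bound with averages of squares of martingale differences. -/
lemma OscFamily.pieceN_rpow_le' (h : OscFamily kk lam C N L κ) {r ϑ : ℝ} (hr : 2 < r)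
    (hϑ0 : 0 < ϑ) (hϑr : r * ϑ ≤ 2) (a : ℤ) {f : Rn n → ℝ≥0∞} {M : ℝ≥0∞} (hM : M ≠ ⊤)
    (hfM : ∀ x, f x ≤ M) (x : Rn n) :
    pieceN kk lam κ r a f x ^ r ≤
      (ENNReal.ofReal C * tp n) ^ (r - 2) * (unitVol n * N) ^ ((r - 2) / 2) *
      (ENNReal.ofReal C * N) ^ (1 - r * ϑ / 2) *
      (∑' m : ℤ, ballAvg (m + 1) (fun y => ‖dyD (m + a) f y‖ₑ ^ 2) x) ^ (r * (1 - ϑ) / 2) *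
      pieceQ kk lam κ 1 a f x ^ (r * ϑ / 2) := by
  rw [pieceN_rpow (by linarith)]
  set P := ∑' m : ℤ, ballAvg (m + 1) (fun y => ‖dyD (m + a) f y‖ₑ ^ 2) x
  set Q := pieceQ kk lam κ 1 a f x
  have e4 : ∀ m x, ‖(dyD m f x : ℂ)‖ₑ = ‖dyD m f x‖ₑ := fun m x => by
    rw [← ofReal_norm, Complex.norm_real, ofReal_norm]
  have hr2 : 0 ≤ r - 2 := by linarith
  have hβ1 : 0 ≤ 1 - r * ϑ / 2 := by linarith
  set A : ℤ → ℝ≥0∞ := fun j => ballAvg (kk j + 1) (fun y => ‖dyD (kk j + a) f y‖ₑ ^ 2) x with hA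
  have hAP : ∑' j, A j ≤ N * P := by
    have := tsum_comp_le_of_encard_le h.encard_le
      (fun m => ballAvg (m + 1) (fun y => ‖dyD (m + a) f y‖ₑ ^ (2 : ℕ)) x)
    rwa [ENat.toENNReal_coe] at this
  have hQP : Q ≤ ENNReal.ofReal C * N * P := by
    calc Q ≤ ∑' j, ENNReal.ofReal C * A j := by
          refine ENNReal.tsum_le_tsum fun j => ?_
          have := (h.osc j).sq (fun y => (dyD (kk j + a) f y : ℂ)) (measurable_dyD_complex _ f)
            ⟨_, norm_dyD_le hM hfM _⟩ x
          simp only [e4] at this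
          simpa only [ENNReal.rpow_one, ENNReal.rpow_two] using this
      _ ≤ _ := by rw [ENNReal.tsum_mul_left, mul_assoc]; gcongr
  have hj : ∀ j, ENNReal.ofReal (lam j) * ∫⁻ u in Icc (1 / 2 : ℝ) 4,
      ‖cv (κ j u) (fun y => (dyD (kk j + a) f y : ℂ)) x‖ₑ ^ r ≤
      ((ENNReal.ofReal C * tp n) ^ (r - 2) * (unitVol n * (N * P)) ^ ((r - 2) / 2)) *
      (ENNReal.ofReal (lam j) ^ (1 : ℝ) * ∫⁻ u in Icc (1 / 2 : ℝ) 4,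
        ‖cv (κ j u) (fun y => (dyD (kk j + a) f y : ℂ)) x‖ₑ ^ (2 : ℝ)) := by
    intro j
    set F : ℝ → ℝ≥0∞ := fun u => ‖cv (κ j u) (fun y => (dyD (kk j + a) f y : ℂ)) x‖ₑ
    have hF : Measurable F := ((h.osc j).measurable_cv (measurable_dyD_complex _ f)).enorm.comp
      (measurable_id.prodMk measurable_const)
    rw [ENNReal.rpow_one, mul_left_comm]
    gcongr
    rw [← lintegral_const_mul _ (hF.pow_const _)]
    refine setLIntegral_mono ((hF.pow_const _).const_mul _) fun u hu => ?_
    have e : r = (r - 2) + 2 := by ring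
    conv_lhs => rw [e]
    rw [ENNReal.rpow_add_of_nonneg _ _ hr2 (by positivity)]
    gcongr
    have b := (h.osc j).enorm_cv_le hu (fun y => (dyD (kk j + a) f y : ℂ)) x
    simp only [e4] at b
    have b2 : ballAvg (kk j + 1) (fun y => ‖dyD (kk j + a) f y‖ₑ) x ^ 2 ≤
        unitVol n * (N * P) :=
      (ballAvg_self_le_sq _ (measurable_dyD _ f).enorm x).trans
        (mul_le_mul_right ((ENNReal.le_tsum j).trans hAP) _)
    calc F u ^ (r - 2) ≤ (ENNReal.ofReal C * tp n *
          ballAvg (kk j + 1) (fun y => ‖dyD (kk j + a) f y‖ₑ) x) ^ (r - 2) := by gcongr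
      _ = (ENNReal.ofReal C * tp n) ^ (r - 2) *
          (ballAvg (kk j + 1) (fun y => ‖dyD (kk j + a) f y‖ₑ) x ^ 2) ^ ((r - 2) / 2) := by
          rw [ENNReal.mul_rpow_of_nonneg _ _ hr2, ← ENNReal.rpow_natCast, ← ENNReal.rpow_mul]
          congr 2; push_cast; ring
      _ ≤ _ := by gcongr
  refine (ENNReal.tsum_le_tsum hj).trans ?_
  rw [ENNReal.tsum_mul_left]
  change _ * Q ≤ _
  have eQ : Q = Q ^ (1 - r * ϑ / 2) * Q ^ (r * ϑ / 2) := by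
    rw [← ENNReal.rpow_add_of_nonneg _ _ hβ1 (by positivity), sub_add_cancel, ENNReal.rpow_one]
  have eP : P ^ (r * (1 - ϑ) / 2) = P ^ ((r - 2) / 2) * P ^ (1 - r * ϑ / 2) := by
    rw [← ENNReal.rpow_add_of_nonneg _ _ (by linarith) hβ1]; congr 1; ring
  calc _ ≤ (ENNReal.ofReal C * tp n) ^ (r - 2) * (unitVol n * (N * P)) ^ ((r - 2) / 2) *
        ((ENNReal.ofReal C * N * P) ^ (1 - r * ϑ / 2) * Q ^ (r * ϑ / 2)) := by
        conv_lhs => rw [eQ]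
        gcongr
    _ = _ := by
        rw [← mul_assoc (unitVol n), ENNReal.mul_rpow_of_nonneg _ P (by linarith : 0 ≤ (r - 2) / 2),
          ENNReal.mul_rpow_of_nonneg _ P hβ1, eP]
        ring

end

lemma lintegral_rpow_le_of_pointwise {α : Type*} [MeasurableSpace α] {μ : Measure α}
    {p r ϑ p₀ : ℝ} (hp : 0 < p) (hr : 0 < r) (hϑ0 : 0 < ϑ) (hϑ1 : ϑ < 1) (hp₀ : 0 < p₀)
    (he : 1 / p = (1 - ϑ) / p₀ + ϑ / 2) {D : ℝ≥0∞} (hD : D ≠ ⊤) {F P Q : α → ℝ≥0∞}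
    (hP : Measurable P) (hQ : Measurable Q)
    (h : ∀ x, F x ^ r ≤ D * P x ^ (r * (1 - ϑ) / 2) * Q x ^ (r * ϑ / 2)) :
    ∫⁻ x, F x ^ p ∂μ ≤ D ^ (p / r) * ((∫⁻ x, P x ^ (p₀ / 2) ∂μ) ^ (p * (1 - ϑ) / p₀) *
      (∫⁻ x, Q x ∂μ) ^ (p * ϑ / 2)) := by
  have h1 : 0 ≤ 1 - ϑ := by linarith
  have hsum : p * (1 - ϑ) / p₀ + p * ϑ / 2 = 1 := by
    have : p * (1 - ϑ) / p₀ + p * ϑ / 2 = p * ((1 - ϑ) / p₀ + ϑ / 2) := by ring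
    rw [this, ← he]; field_simp
  have H := ENNReal.lintegral_mul_norm_pow_le (μ := μ) (f := fun x => P x ^ (p₀ / 2)) (g := Q)
    (hP.pow_const _).aemeasurable hQ.aemeasurable (by positivity) (by positivity) hsum
  have hpr : 0 ≤ p / r := by positivity
  calc _ ≤ ∫⁻ x, D ^ (p / r) * ((P x ^ (p₀ / 2)) ^ (p * (1 - ϑ) / p₀) * Q x ^ (p * ϑ / 2)) ∂μ := by
        refine lintegral_mono fun x => ?_
        have e : F x ^ p = (F x ^ r) ^ (p / r) := by
          rw [← ENNReal.rpow_mul]; congr 1; field_simp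
        rw [e]
        refine (ENNReal.rpow_le_rpow (h x) hpr).trans (le_of_eq ?_)
        rw [ENNReal.mul_rpow_of_nonneg _ _ hpr, ENNReal.mul_rpow_of_nonneg _ _ hpr, mul_assoc,
          ← ENNReal.rpow_mul, ← ENNReal.rpow_mul, ← ENNReal.rpow_mul]
        congr 3 <;> field_simp
    _ = _ := lintegral_const_mul' _ _ (ENNReal.rpow_ne_top_of_nonneg hpr hD)
    _ ≤ _ := by gcongr

lemma lintegral_rpow_le_of_le {α : Type*} [MeasurableSpace α] {μ : Measure α} {f : α → ℝ≥0∞}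
    {b : ℝ≥0∞} (hf : Measurable f) (hfb : ∀ x, f x ≤ b) {q : ℝ} (hq : 0 < q) :
    ∫⁻ x, f x ^ q ∂μ ≤ b ^ q * μ {x | f x ≠ 0} := by
  have hS : MeasurableSet {x | f x ≠ 0} := hf (measurableSet_singleton 0).compl
  rw [← lintegral_indicator_const hS]
  refine lintegral_mono fun x => ?_
  by_cases hx : f x = 0
  · simp [hx, hq]
  · rw [indicator_of_mem (by exact hx)]
    exact ENNReal.rpow_le_rpow (hfb x) hq.le

/-- The interpolated bound for functions of a fixed size, given the pointwise domination. -/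
lemma lintegral_pieceN_rpow_le_aux {n : ℕ} {p r ϑ p₀ s : ℝ} (hp : 0 < p) (hr : 0 < r)
    (hϑ0 : 0 < ϑ) (hϑ1 : ϑ < 1) (hp₀ : 0 < p₀) (he : 1 / p = (1 - ϑ) / p₀ + ϑ / 2) (hs0 : 0 ≤ s)
    (hsn : s < n) {D A₁ : ℝ≥0∞} (hD : D ≠ ⊤) (hA₁ : A₁ ≠ ⊤) (C : ℝ) (N : ℕ) :
    ∃ ε : ℝ, 0 < ε ∧ ∃ A : ℝ≥0∞, A ≠ ⊤ ∧
    ∀ (kk : ℤ → ℤ) (lam : ℤ → ℝ) (L : ℝ) (κ : ℤ → ℝ → Rn n → ℂ), OscFamily kk lam C N L κ →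
    ∀ (f : Rn n → ℝ≥0∞) (i : ℤ), (∀ x, f x ≤ tp (i + 1)) → Measurable f → ∫⁻ x, f x ≠ ⊤ →
    ∀ (a : ℤ) (P : Rn n → ℝ≥0∞), Measurable P →
    ∫⁻ x, P x ^ (p₀ / 2) ≤ A₁ * ∫⁻ x, f x ^ p₀ →
    (∀ x, pieceN kk lam κ r a f x ^ r ≤
      D * P x ^ (r * (1 - ϑ) / 2) * pieceQ kk lam κ s a f x ^ (r * ϑ / 2)) →
    ∫⁻ x, pieceN kk lam κ r a f x ^ p ≤
      A * (ENNReal.ofReal L ^ (-ε) * tp (-ε * |(a : ℝ)|)) ^ p *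
        (tp (i * p) * volume {x | f x ≠ 0}) := by
  obtain ⟨A₂, hA₂, H⟩ := exists_lintegral_pieceQ_le n C N
  set η : ℝ := (n - s) / (n + 3) with hη
  have hη0 : 0 < η := div_pos (by linarith) (by positivity)
  have hη1 : η ≤ 1 := by rw [hη, div_le_one (by positivity)]; linarith
  have hηe : s - n + (n + 2) * η = -η := by rw [hη]; field_simp; ring
  have hα : 0 ≤ p * (1 - ϑ) / p₀ := div_nonneg (mul_nonneg hp.le (by linarith)) hp₀.le
  have hβ : 0 ≤ p * ϑ / 2 := by positivity
  have hsum : p * (1 - ϑ) / p₀ + p * ϑ / 2 = 1 := by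
    have : p * (1 - ϑ) / p₀ + p * ϑ / 2 = p * ((1 - ϑ) / p₀ + ϑ / 2) := by ring
    rw [this, ← he]; field_simp
  have hpr : 0 ≤ p / r := by positivity
  refine ⟨η * ϑ / 2, by positivity, D ^ (p / r) * ((A₁ * tp p₀) ^ (p * (1 - ϑ) / p₀) *
    (A₂ * tp 2) ^ (p * ϑ / 2)), by finiteness, ?_⟩
  intro kk lam L κ h f i hfi hf hfint a P hP hPi hpt
  set m := volume {x | f x ≠ 0}
  have h1 : ∫⁻ x, P x ^ (p₀ / 2) ≤ (A₁ * tp p₀) * (tp (i * p₀) * m) := by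
    refine hPi.trans ?_
    rw [mul_assoc]
    gcongr
    refine (lintegral_rpow_le_of_le hf hfi hp₀).trans (le_of_eq ?_)
    rw [tp_rpow, ← mul_assoc, ← tp_add]; congr 2; ring
  have h2 : ∫⁻ x, pieceQ kk lam κ s a f x ≤ (A₂ * tp 2) *
      (ENNReal.ofReal L ^ (-η) * tp (-η * |(a : ℝ)|)) * (tp (i * 2) * m) := by
    refine (H kk lam L κ h f _ (tp_ne_top _) hfi hf hfint a s η ⟨hη0.le, hη1⟩
      (by linarith)).trans ?_
    rw [hηe]
    have : ∫⁻ x, f x ^ 2 ≤ tp 2 * (tp (i * 2) * m) := by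
      have := lintegral_rpow_le_of_le (μ := volume) hf hfi (zero_lt_two (α := ℝ))
      simp_rw [ENNReal.rpow_two] at this
      refine this.trans (le_of_eq ?_)
      rw [← ENNReal.rpow_two, tp_rpow, ← mul_assoc, ← tp_add]; congr 2; ring
    refine (mul_le_mul_right this _).trans (le_of_eq ?_)
    ring
  refine (lintegral_rpow_le_of_pointwise hp hr hϑ0 hϑ1 hp₀ he hD hP (h.measurable_pieceQ s a f)
    hpt).trans ?_
  have eX : ENNReal.ofReal L ^ (-(η * ϑ / 2)) * tp (-(η * ϑ / 2) * |(a : ℝ)|) =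
      (ENNReal.ofReal L ^ (-η) * tp (-η * |(a : ℝ)|)) ^ (ϑ / 2) := by
    rw [ENNReal.mul_rpow_of_nonneg _ _ (by positivity : 0 ≤ ϑ / 2), ← ENNReal.rpow_mul, tp_rpow]
    congr 2 <;> ring
  have eY : (ENNReal.ofReal L ^ (-(η * ϑ / 2)) * tp (-(η * ϑ / 2) * |(a : ℝ)|)) ^ p =
      (ENNReal.ofReal L ^ (-η) * tp (-η * |(a : ℝ)|)) ^ (p * ϑ / 2) := by
    rw [eX, ← ENNReal.rpow_mul]; congr 1; ring
  rw [eY]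
  have eZ : tp (i * p) * m = (tp (i * p₀) * m) ^ (p * (1 - ϑ) / p₀) *
      (tp (i * 2) * m) ^ (p * ϑ / 2) := by
    rw [ENNReal.mul_rpow_of_nonneg _ _ hα, ENNReal.mul_rpow_of_nonneg _ _ hβ, tp_rpow, tp_rpow,
      mul_mul_mul_comm, ← tp_add, ← ENNReal.rpow_add_of_nonneg _ _ hα hβ, hsum, ENNReal.rpow_one]
    congr 2
    field_simp; ring
  calc _ ≤ D ^ (p / r) * (((A₁ * tp p₀) * (tp (i * p₀) * m)) ^ (p * (1 - ϑ) / p₀) *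
        ((A₂ * tp 2) * (ENNReal.ofReal L ^ (-η) * tp (-η * |(a : ℝ)|)) * (tp (i * 2) * m)) ^
          (p * ϑ / 2)) := by gcongr
    _ = _ := by
        rw [eZ, ENNReal.mul_rpow_of_nonneg (A₁ * tp p₀) _ hα,
          ENNReal.mul_rpow_of_nonneg _ (tp (i * 2) * m) hβ,
          ENNReal.mul_rpow_of_nonneg (A₂ * tp 2) _ hβ]
        ring

/-- Restricted strong type bound for a piece. -/
lemma exists_lintegral_pieceN_rpow_le {n : ℕ} (hn : 2 ≤ n) {p r : ℝ} (hp : 1 < p) (hp2 : p ≠ 2)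
    (hr : 2 < r) (hrp : p / (p - 1) / n < r) {C : ℝ} (N : ℕ) :
    ∃ ε : ℝ, 0 < ε ∧ ∃ A : ℝ≥0∞, A ≠ ⊤ ∧
    ∀ (kk : ℤ → ℤ) (lam : ℤ → ℝ) (L : ℝ) (κ : ℤ → ℝ → Rn n → ℂ), OscFamily kk lam C N L κ →
    ∀ (f : Rn n → ℝ≥0∞) (i : ℤ), (∀ x, f x ≤ tp (i + 1)) → Measurable f → ∫⁻ x, f x ≠ ⊤ →
    ∀ a : ℤ, ∫⁻ x, pieceN kk lam κ r a f x ^ p ≤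
      A * (ENNReal.ofReal L ^ (-ε) * tp (-ε * |(a : ℝ)|)) ^ p *
        (tp (i * p) * volume {x | f x ≠ 0}) := by
  have hn0 : (2 : ℝ) ≤ n := by exact_mod_cast hn
  have hU := unitVol_ne_top n
  have hr0 : 0 < r := by linarith
  have hp0 : 0 < p := by linarith
  rcases lt_or_gt_of_ne hp2 with hlt | hgt
  · have h1 : 2 / (n * r) < 2 * (p - 1) / p := by
      rw [div_div, div_lt_iff₀ (mul_pos (by linarith) (by linarith))] at hrp
      rw [div_lt_div_iff₀ (by positivity) hp0]
      nlinarith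
    have h2 : 2 / (n * r) < 2 / r := by
      apply div_lt_div_of_pos_left <;> nlinarith
    obtain ⟨ϑ, hϑ1, hϑ2⟩ := exists_between (lt_min h1 h2)
    have hϑa := hϑ2.trans_le (min_le_left _ _)
    have hϑb := hϑ2.trans_le (min_le_right _ _)
    have hϑ0 : 0 < ϑ := lt_trans (by positivity) hϑ1
    rw [lt_div_iff₀ hp0] at hϑa
    rw [lt_div_iff₀ hr0] at hϑb
    rw [div_lt_iff₀ (by positivity)] at hϑ1
    have hϑlt : ϑ < 1 := by nlinarith
    have hden : 0 < 2 - p * ϑ := by nlinarith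
    set p₀ := 2 * p * (1 - ϑ) / (2 - p * ϑ) with hp₀
    have hp₀1 : 1 < p₀ := by rw [hp₀, lt_div_iff₀ hden]; nlinarith
    have hp₀2 : p₀ < 2 := by rw [hp₀, div_lt_iff₀ hden]; nlinarith
    have he : 1 / p = (1 - ϑ) / p₀ + ϑ / 2 := by
      have : 1 - ϑ ≠ 0 := by linarith
      rw [hp₀]; field_simp; ring
    obtain ⟨A₁, hA₁, H₁⟩ := lintegral_tsum_ballAvg_sq_rpow_le (n := n) (by omega) hp₀1 hp₀2
    have hr1 : 0 ≤ r * (1 - ϑ) := mul_nonneg hr0.le (by linarith)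
    have hr2 : 0 ≤ r * (1 - ϑ) / 2 := by linarith
    have hr3 : 0 ≤ 1 - r * ϑ / 2 := by linarith
    obtain ⟨ε, hε, A, hA, H⟩ := lintegral_pieceN_rpow_le_aux (n := n) hp0 hr0 hϑ0 hϑlt
      (by linarith : 0 < p₀) he (by positivity : 0 ≤ 2 / (r * ϑ))
      (by rw [div_lt_iff₀ (by positivity)]; linarith)
      (D := (ENNReal.ofReal C * tp n) ^ (r * (1 - ϑ)) *
        ENNReal.ofReal (4 - 1 / 2) ^ (1 - r * ϑ / 2) * N ^ (r * (1 - ϑ) / 2))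
      (by finiteness) hA₁ C N
    refine ⟨ε, hε, A, hA, fun kk lam L κ h f i hfi hf hfint a => ?_⟩
    exact H kk lam L κ h f i hfi hf hfint a _
      (Measurable.tsum fun m => (measurable_ballAvg _ (measurable_dyD _ f).enorm).pow_const 2)
      (H₁ f _ (tp_ne_top _) hfi hf a)
      (fun x => h.pieceN_rpow_le hr hϑ0 (by linarith) a f x)
  · obtain ⟨ϑ, hϑ0, hϑ2⟩ := exists_between (lt_min (a := 0) (b := 2 / p) (c := 2 / r)
      (by positivity) (by positivity))
    have hϑa := hϑ2.trans_le (min_le_left _ _)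
    have hϑb := hϑ2.trans_le (min_le_right _ _)
    rw [lt_div_iff₀ hp0] at hϑa
    rw [lt_div_iff₀ hr0] at hϑb
    have hϑlt : ϑ < 1 := by nlinarith
    have hden : 0 < 2 - p * ϑ := by nlinarith
    set q := p * (1 - ϑ) / (2 - p * ϑ) with hq
    have hq1 : 1 < q := by rw [hq, lt_div_iff₀ hden]; nlinarith
    have he : 1 / p = (1 - ϑ) / (2 * q) + ϑ / 2 := by
      have : 1 - ϑ ≠ 0 := by linarith
      rw [hq]; field_simp; ring
    obtain ⟨A₁, hA₁, H₁⟩ := lintegral_tsum_ballAvg_sq_rpow_le' (n := n) (by omega) hq1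
    have hr2 : 0 ≤ r - 2 := by linarith
    have hr4 : 0 ≤ (r - 2) / 2 := by linarith
    have hr3 : 0 ≤ 1 - r * ϑ / 2 := by linarith
    obtain ⟨ε, hε, A, hA, H⟩ := lintegral_pieceN_rpow_le_aux (n := n) hp0 hr0 hϑ0 hϑlt
      (by linarith : 0 < 2 * q) he zero_le_one (by linarith)
      (D := (ENNReal.ofReal C * tp n) ^ (r - 2) * (unitVol n * N) ^ ((r - 2) / 2) *
      (ENNReal.ofReal C * N) ^ (1 - r * ϑ / 2))
      (by finiteness) hA₁ C N
    refine ⟨ε, hε, A, hA, fun kk lam L κ h f i hfi hf hfint a => ?_⟩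
    refine H kk lam L κ h f i hfi hf hfint a _
      (Measurable.tsum fun m => measurable_ballAvg _ ((measurable_dyD _ f).enorm.pow_const 2)) ?_
      (fun x => h.pieceN_rpow_le' hr hϑ0 (by linarith) a (tp_ne_top _) hfi x)
    rw [mul_div_cancel_left₀ _ (two_ne_zero)]
    exact H₁ f _ (tp_ne_top _) hfi hf hfint a

lemma enorm_le_tsum_of_tendsto {T : ℤ → ℂ} {L : ℂ} (h0 : Tendsto T atTop (𝓝 0))
    (hL : Tendsto T atBot (𝓝 L)) : ‖L‖ₑ ≤ ∑' m, ‖T m - T (m + 1)‖ₑ := by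
  have h1 : ∀ (a : ℤ) (N : ℕ), ‖T a‖ₑ ≤ ‖T (a + N)‖ₑ +
      ∑ i ∈ Finset.range N, ‖T (a + i) - T (a + i + 1)‖ₑ := by
    intro a N
    induction N with
    | zero => simp
    | succ N ih =>
      rw [Finset.sum_range_succ]
      refine ih.trans ?_
      have : ‖T (a + N)‖ₑ ≤ ‖T (a + (N + 1 : ℕ))‖ₑ + ‖T (a + N) - T (a + N + 1)‖ₑ := by
        have e : T (a + N) = T (a + (N + 1 : ℕ)) + (T (a + N) - T (a + N + 1)) := by
          push_cast; rw [← add_assoc]; ring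
        calc ‖T (a + N)‖ₑ = ‖T (a + (N + 1 : ℕ)) + (T (a + N) - T (a + N + 1))‖ₑ := by rw [← e]
          _ ≤ _ := enorm_add_le _ _
      calc _ ≤ (‖T (a + (N + 1 : ℕ))‖ₑ + ‖T (a + N) - T (a + N + 1)‖ₑ) +
            ∑ i ∈ Finset.range N, ‖T (a + i) - T (a + i + 1)‖ₑ := by gcongr
        _ = _ := by ring
  have h2 : ∀ (a : ℤ) (N : ℕ), ‖T a‖ₑ ≤ ‖T (a + N)‖ₑ + ∑' m, ‖T m - T (m + 1)‖ₑ := by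
    intro a N
    refine (h1 a N).trans ?_
    gcongr
    refine (ENNReal.sum_le_tsum _).trans ?_
    exact ENNReal.tsum_comp_le_tsum_of_injective (f := fun i : ℕ => a + (i : ℤ))
      (fun i j hij => by simpa using hij) (fun m => ‖T m - T (m + 1)‖ₑ)
  have h3 : ∀ a : ℤ, ‖T a‖ₑ ≤ ∑' m, ‖T m - T (m + 1)‖ₑ := by
    intro a
    have t : Tendsto (fun N : ℕ => ‖T (a + N)‖ₑ + ∑' m, ‖T m - T (m + 1)‖ₑ) atTop
        (𝓝 (‖(0 : ℂ)‖ₑ + ∑' m, ‖T m - T (m + 1)‖ₑ)) := by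
      refine Tendsto.add ?_ tendsto_const_nhds
      exact (h0.comp (tendsto_atTop_add_const_left _ a tendsto_natCast_atTop_atTop)).enorm
    have := ge_of_tendsto' t (h2 a)
    simpa using this
  exact le_of_tendsto' hL.enorm h3

section Bounded

variable {n : ℕ} {f : Rn n → ℝ≥0∞} {M : ℝ≥0∞}

lemma integral_mul_dyE_eq (hM : M ≠ ⊤) (hfM : ∀ x, f x ≤ M) (hf : Measurable f)
    (hfi : ∫⁻ x, f x ≠ ⊤) (k : ℤ) {c : Rn n → ℂ} (hc : CellConst k c) {B : ℝ}
    (hB : ∀ y, ‖c y‖ ≤ B) :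
    ∫ x, c x * ((dyE k f x).toReal : ℂ) = ∫ x, c x * ((f x).toReal : ℂ) := by
  have hfi' : Integrable fun x => (f x).toReal :=
    integrable_toReal_of_lintegral_ne_top hf.aemeasurable hfi
  have i1 : Integrable fun y => c y * ((dyE k f y).toReal : ℂ) :=
    (integrable_dyE hf hfi k).ofReal.bdd_mul (c := B) hc.measurable.aestronglyMeasurable
      (Eventually.of_forall fun y => hB _)
  have i2 : Integrable fun y => c y * ((f y).toReal : ℂ) :=
    hfi'.ofReal.bdd_mul (c := B) hc.measurable.aestronglyMeasurable
      (Eventually.of_forall fun y => hB _)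
  have hU : (⋃ z : Fin n → ℤ, {y : Rn n | cell k y = z}) = univ := by ext y; simp
  have hd : Pairwise (Function.onFun Disjoint fun z : Fin n → ℤ => {y : Rn n | cell k y = z}) :=
    fun z z' hz => Set.disjoint_left.2 fun y hy hy' => hz (hy.symm.trans hy')
  rw [← setIntegral_univ, ← setIntegral_univ (f := fun x => c x * ((f x).toReal : ℂ)), ← hU,
    integral_iUnion (fun z => measurableSet_cell _ _) hd i1.integrableOn,
    integral_iUnion (fun z => measurableSet_cell _ _) hd i2.integrableOn]
  refine tsum_congr fun z => ?_
  obtain ⟨H, hH⟩ := hc.exists_eq_comp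
  have e : ∀ g : Rn n → ℂ, ∫ x in {y : Rn n | cell k y = z}, c x * g x =
      H z * ∫ x in {y : Rn n | cell k y = z}, g x := fun g => by
    rw [setIntegral_congr_fun (g := fun x => H z * g x) (measurableSet_cell _ _)
      (fun x hx => by simp only; rw [hH, hx]), integral_const_mul]
  rw [e, e, integral_complex_ofReal, integral_complex_ofReal,
    integral_toReal (measurable_dyE k f).aemeasurable
      (Eventually.of_forall fun x => (dyE_ne_top hM hfM k x).lt_top),
    integral_toReal hf.aemeasurable
      (Eventually.of_forall fun x => ((hfM x).trans_lt hM.lt_top)), lintegral_cell_dyE le_rfl hf]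

lemma norm_cv_dyE_sub_le (hM : M ≠ ⊤) (hfM : ∀ x, f x ≤ M) (hf : Measurable f)
    (hfi : ∫⁻ x, f x ≠ ⊤) {h : Rn n → ℂ} (hc : Continuous h) {Λ : ℝ}
    (hL : ∀ t t', ‖h t - h t'‖ ≤ Λ * ‖t - t'‖) (hΛ : 0 ≤ Λ) {B : ℝ} (hB : ∀ t, ‖h t‖ ≤ B) (k : ℤ)
    (x : Rn n) :
    ‖cv h (fun y => ((dyE k f y).toReal : ℂ)) x - cv h (fun y => ((f y).toReal : ℂ)) x‖ ≤
      Λ * (n * (2 : ℝ) ^ k) * (2 * ∫ y, (f y).toReal) := by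
  have hfi' : Integrable fun x => (f x).toReal :=
    integrable_toReal_of_lintegral_ne_top hf.aemeasurable hfi
  have hgi : Integrable fun x => (dyE k f x).toReal := integrable_dyE hf hfi k
  set c : Rn n → ℂ := fun y => h (x - cellRep k y) with hcdef
  have hcc : CellConst k c := fun y z hyz => by
    simp only [hcdef, cellConst_cellRep k y z hyz]
  have hI : ∫ y, (dyE k f y).toReal = ∫ y, (f y).toReal := by
    rw [integral_toReal (measurable_dyE k f).aemeasurable
      (Eventually.of_forall fun x => (dyE_ne_top hM hfM k x).lt_top), lintegral_dyE k hf,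
      integral_toReal hf.aemeasurable
      (Eventually.of_forall fun x => ((hfM x).trans_lt hM.lt_top))]
  have key : ∀ g : Rn n → ℝ, Integrable g → (∀ y, 0 ≤ g y) →
      ‖cv h (fun y => (g y : ℂ)) x - ∫ y, c y * (g y : ℂ)‖ ≤ Λ * (n * (2 : ℝ) ^ k) * ∫ y, g y := by
    intro g hg hg0
    have i1 : Integrable fun y => h (x - y) * (g y : ℂ) :=
      hg.ofReal.bdd_mul (c := B) (by fun_prop) (Eventually.of_forall fun y => hB _)
    have i2 : Integrable fun y => c y * (g y : ℂ) :=
      hg.ofReal.bdd_mul (c := B) hcc.measurable.aestronglyMeasurable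
        (Eventually.of_forall fun y => hB _)
    rw [cv_eq, ← integral_sub i1 i2, ← integral_const_mul]
    refine norm_integral_le_of_norm_le (hg.const_mul _) (Eventually.of_forall fun y => ?_)
    rw [← sub_mul, norm_mul, Complex.norm_real, Real.norm_of_nonneg (hg0 y)]
    refine mul_le_mul_of_nonneg_right ((hL _ _).trans ?_) (hg0 y)
    gcongr
    rw [sub_sub_sub_cancel_left, ← dist_eq_norm]
    exact dist_cellRep_le k y
  have k1 := key _ hgi (fun y => ENNReal.toReal_nonneg)
  have k2 := key _ hfi' (fun y => ENNReal.toReal_nonneg)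
  rw [integral_mul_dyE_eq hM hfM hf hfi k hcc (fun y => hB _), hI] at k1
  rw [← sub_sub_sub_cancel_right _ _ (∫ y, c y * ((f y).toReal : ℂ))]
  refine (norm_sub_le _ _).trans ?_
  linarith

/-- The convolution is dominated by the convolutions with all martingale differences. -/
lemma enorm_cv_le_tsum (hn : 1 ≤ n) (hM : M ≠ ⊤) (hfM : ∀ x, f x ≤ M) (hf : Measurable f)
    (hfi : ∫⁻ x, f x ≠ ⊤) {h : Rn n → ℂ} (hc : Continuous h) (hs : HasCompactSupport h) {Λ : ℝ}
    (hL : ∀ t t', ‖h t - h t'‖ ≤ Λ * ‖t - t'‖) (hΛ : 0 ≤ Λ) {B : ℝ} (hB : ∀ t, ‖h t‖ ≤ B)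
    (x : Rn n) :
    ‖cv h (fun y => ((f y).toReal : ℂ)) x‖ₑ ≤
      ∑' m : ℤ, ‖cv h (fun y => (dyD m f y : ℂ)) x‖ₑ := by
  have hfi' : Integrable fun x => (f x).toReal :=
    integrable_toReal_of_lintegral_ne_top hf.aemeasurable hfi
  set T : ℤ → ℂ := fun m => cv h (fun y => ((dyE m f y).toReal : ℂ)) x with hT
  have hd : ∀ m, cv h (fun y => (dyD m f y : ℂ)) x = T m - T (m + 1) := by
    intro m
    have ib : ∀ m, Integrable fun y => h (x - y) * ((dyE m f y).toReal : ℂ) := fun m =>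
      (integrable_dyE hf hfi m).ofReal.bdd_mul (c := B) (by fun_prop)
        (Eventually.of_forall fun y => hB _)
    simp only [hT, cv_eq]
    rw [← integral_sub (ib m) (ib (m + 1))]
    refine integral_congr_ae (Eventually.of_forall fun y => ?_)
    simp only [dyD]
    push_cast; ring
  simp_rw [hd]
  have hhi : Integrable h := hc.integrable_of_hasCompactSupport hs
  refine enorm_le_tsum_of_tendsto ?_ ?_
  · have hb : ∀ m : ℤ, ‖T m‖ ≤ (∫ y, ‖h y‖) * (((2 : ℝ) ^ (-(m * n))) * ∫ y, (f y).toReal) := by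
      intro m
      simp only [hT, cv]
      rw [← integral_mul_const]
      refine norm_integral_le_of_norm_le (hhi.norm.mul_const _) (Eventually.of_forall fun y => ?_)
      rw [norm_mul, Complex.norm_real, Real.norm_of_nonneg ENNReal.toReal_nonneg]
      gcongr
      rw [integral_toReal hf.aemeasurable
        (Eventually.of_forall fun x => ((hfM x).trans_lt hM.lt_top))]
      have : (2 : ℝ) ^ (-(m * n)) = (tp (-(m * n))).toReal := by
        rw [tp_eq_ofReal, ENNReal.toReal_ofReal (by positivity), ← Real.rpow_intCast]
        push_cast; rfl
      rw [this, ← ENNReal.toReal_mul]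
      refine ENNReal.toReal_mono (by finiteness) ?_
      unfold dyE
      gcongr
      exact Measure.restrict_le_self
    refine squeeze_zero_norm hb ?_
    have t1 : Tendsto (fun m : ℤ => (2 : ℝ) ^ (-(m * n))) atTop (𝓝 0) := by
      have : Tendsto (fun x : ℝ => (2 : ℝ) ^ (-x)) atTop (𝓝 0) := by
        simp_rw [Real.rpow_neg (by norm_num : (0 : ℝ) ≤ 2)]
        exact (tendsto_rpow_atTop_of_base_gt_one 2 (by norm_num)).inv_tendsto_atTop
      have h2 := this.comp (tendsto_intCast_atTop_atTop.comp
        (tendsto_id.atTop_mul_const' (show (0 : ℤ) < n by omega)))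
      refine h2.congr fun m => ?_
      simp only [Function.comp, id]
      rw [← Int.cast_neg, Real.rpow_intCast]
    simpa using (t1.mul_const (∫ y, (f y).toReal)).const_mul (∫ y, ‖h y‖)
  · refine tendsto_iff_norm_sub_tendsto_zero.2 (squeeze_zero (fun _ => norm_nonneg _)
      (fun m => norm_cv_dyE_sub_le hM hfM hf hfi hc hL hΛ hB m x) ?_)
    have t1 : Tendsto (fun m : ℤ => (2 : ℝ) ^ m) atBot (𝓝 0) := by
      have := (tendsto_rpow_atBot_of_base_gt_one 2 (by norm_num : (1 : ℝ) < 2))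
      have h2 := this.comp (tendsto_intCast_atBot_iff.2 tendsto_id :
        Tendsto (fun m : ℤ => (m : ℝ)) atBot atBot)
      refine h2.congr fun m => ?_
      simp [Function.comp]
    have := ((t1.const_mul (n : ℝ)).const_mul Λ).mul_const (2 * ∫ y, (f y).toReal)
    simpa using this

end Bounded

/-- Minkowski's inequality for mixed weighted `ℓ^r(L^r)` norms. -/
lemma tsum_lintegral_rpow_le_tsum {ι : Type*} [Countable ι] {r : ℝ} (hr : 1 ≤ r) {S : Set ℝ}
    (hS : MeasurableSet S) (w : ℤ → ℝ≥0∞) {F : ℤ → ℝ → ℝ≥0∞} {G : ι → ℤ → ℝ → ℝ≥0∞}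
    (hG : ∀ ν j, Measurable (G ν j)) (h : ∀ j, ∀ u ∈ S, F j u ≤ ∑' ν, G ν j u) :
    (∑' j, w j * ∫⁻ u in S, F j u ^ r) ^ (1 / r) ≤
      ∑' ν, (∑' j, w j * ∫⁻ u in S, G ν j u ^ r) ^ (1 / r) := by
  set μ : Measure (ℤ × ℝ) := (Measure.count.withDensity w).prod (volume.restrict S) with hμ
  have hm : ∀ H : ℤ → ℝ → ℝ≥0∞, (∀ j, Measurable (H j)) →
      ∫⁻ z, H z.1 z.2 ^ r ∂μ = ∑' j, w j * ∫⁻ u in S, H j u ^ r := by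
    intro H hH
    have hm : Measurable fun z : ℤ × ℝ => H z.1 z.2 ^ r :=
      measurable_from_prod_countable_right fun j => (hH j).pow_const r
    rw [hμ, lintegral_prod _ hm.aemeasurable, lintegral_withDensity_eq_lintegral_mul _
      (measurable_of_countable _) (measurable_of_countable _), lintegral_count]
    rfl
  calc _ ≤ (∑' j, w j * ∫⁻ u in S, (∑' ν, G ν j u) ^ r) ^ (1 / r) := by
        refine ENNReal.rpow_le_rpow (ENNReal.tsum_le_tsum fun j => mul_le_mul_right ?_ _)
          (by positivity)
        exact setLIntegral_mono' hS fun u hu => ENNReal.rpow_le_rpow (h j u hu) (by linarith)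
    _ = (∫⁻ z, (∑' ν, G ν z.1 z.2) ^ r ∂μ) ^ (1 / r) := by
        rw [hm (fun j u => ∑' ν, G ν j u) fun j => Measurable.tsum fun ν => hG ν j]
    _ ≤ ∑' ν, (∫⁻ z, G ν z.1 z.2 ^ r ∂μ) ^ (1 / r) :=
        lintegral_tsum_rpow_le μ hr (fun ν z => G ν z.1 z.2)
          fun ν => measurable_from_prod_countable_right fun j => hG ν j
    _ = _ := tsum_congr fun ν => by rw [hm (G ν) (hG ν)]

/-- The dyadic level slice of `f` at height `2 ^ i`. -/
def slice {n : ℕ} (i : ℤ) (f : Rn n → ℝ≥0∞) (y : Rn n) : ℝ≥0∞ :=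
  (f ⁻¹' Ico (tp i) (tp (i + 1 : ℝ))).indicator f y

section Slice

variable {n : ℕ} {f : Rn n → ℝ≥0∞}

lemma measurable_slice (hf : Measurable f) (i : ℤ) : Measurable (slice i f) :=
  hf.indicator (hf measurableSet_Ico)

lemma slice_le (i : ℤ) (f : Rn n → ℝ≥0∞) (y : Rn n) : slice i f y ≤ f y :=
  indicator_le_self _ _ _

lemma slice_le_tp (i : ℤ) (f : Rn n → ℝ≥0∞) (y : Rn n) : slice i f y ≤ tp (i + 1) :=
  Set.indicator_apply_le' (fun h => (show f y ∈ Ico _ _ from h).2.le) fun _ => zero_le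

lemma exists_slice_eq_single {y : Rn n} (h1 : f y ≠ ⊤) :
    ∃ m : ℤ, ∀ i, slice i f y = if i = m then f y else 0 := by
  by_cases h0 : f y = 0
  · refine ⟨0, fun i => ?_⟩
    have : slice i f y ≤ 0 := h0 ▸ slice_le i f y
    simp [h0, le_zero_iff.1 this]
  obtain ⟨m, hm1, hm2⟩ := exists_tp_Ico h0 h1
  refine ⟨m, fun i => ?_⟩
  by_cases hi : i = m
  · rw [if_pos hi, hi]
    exact indicator_of_mem (s := f ⁻¹' Ico (tp m) (tp (m + 1 : ℝ))) (f := f) ⟨hm1, hm2⟩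
  · rw [if_neg hi]
    refine indicator_of_notMem (fun h => ?_) _
    obtain ⟨a, b⟩ : f y ∈ Ico _ _ := h
    rcases lt_or_gt_of_ne hi with hlt | hlt
    · have : ((i : ℝ) + 1) ≤ m := by exact_mod_cast hlt
      exact absurd (b.trans_le ((tp_mono this).trans hm1)) (lt_irrefl _)
    · have : ((m : ℝ) + 1) ≤ i := by exact_mod_cast hlt
      exact absurd (hm2.trans_le ((tp_mono this).trans a)) (lt_irrefl _)

lemma tsum_slice (h1 : ∀ y, f y ≠ ⊤) (y : Rn n) : ∑' i : ℤ, slice i f y = f y := by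
  obtain ⟨m, hm⟩ := exists_slice_eq_single (h1 y)
  simp [hm]

lemma hasSum_slice_toReal (h1 : ∀ y, f y ≠ ⊤) (y : Rn n) :
    HasSum (fun i : ℤ => ((slice i f y).toReal : ℂ)) ((f y).toReal : ℂ) := by
  obtain ⟨m, hm⟩ := exists_slice_eq_single (h1 y)
  convert hasSum_ite_eq m ((f y).toReal : ℂ) using 2 with i
  rw [hm]; split_ifs <;> simp

lemma tsum_tp_mul_volume_slice_le (hf : Measurable f) (h1 : ∀ y, f y ≠ ⊤) {p : ℝ} (hp : 0 < p) :
    ∑' i : ℤ, tp (i * p) * volume {y | slice i f y ≠ 0} ≤ ∫⁻ y, f y ^ p := by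
  have h : ∀ i : ℤ, tp (i * p) * volume {y | slice i f y ≠ 0} ≤ ∫⁻ y, slice i f y ^ p := by
    intro i
    have hs : MeasurableSet {y | slice i f y ≠ 0} :=
      measurable_slice hf i (measurableSet_singleton 0).compl
    rw [← setLIntegral_const]
    refine (setLIntegral_mono' hs fun y hy => ?_).trans (setLIntegral_le_lintegral _ _)
    have hy' : y ∈ f ⁻¹' Ico (tp i) (tp (i + 1 : ℝ)) := by
      by_contra hc; exact hy (indicator_of_notMem hc _)
    have hy2 : slice i f y = f y := indicator_of_mem hy' _
    rw [hy2, ← tp_rpow]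
    exact ENNReal.rpow_le_rpow hy'.1 hp.le
  refine (ENNReal.tsum_le_tsum h).trans ?_
  rw [← lintegral_tsum fun i => ((measurable_slice hf i).pow_const p).aemeasurable]
  refine lintegral_mono fun y => ?_
  obtain ⟨m, hm⟩ := exists_slice_eq_single (h1 y)
  rw [tsum_eq_single m fun i hi => by simp [hm, hi, hp]]
  simp [hm]

lemma enorm_cv_le_tsum_slice {M : ℝ≥0∞} (hM : M ≠ ⊤) (hfM : ∀ x, f x ≤ M) (hf : Measurable f)
    (hfi : ∫⁻ x, f x ≠ ⊤) {h : Rn n → ℂ} (hc : Continuous h) {B : ℝ} (hB : ∀ t, ‖h t‖ ≤ B)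
    (x : Rn n) :
    ‖cv h (fun y => ((f y).toReal : ℂ)) x‖ₑ ≤
      ∑' i : ℤ, ‖cv h (fun y => ((slice i f y).toReal : ℂ)) x‖ₑ := by
  have h1 : ∀ y, f y ≠ ⊤ := fun y => ne_top_of_le_ne_top hM (hfM y)
  have e : cv h (fun y => ((f y).toReal : ℂ)) x =
      ∑' i : ℤ, cv h (fun y => ((slice i f y).toReal : ℂ)) x := by
    simp_rw [cv_eq]
    rw [← integral_tsum]
    · refine integral_congr_ae (Eventually.of_forall fun y => ?_)
      simp only
      rw [tsum_mul_left, (hasSum_slice_toReal h1 y).tsum_eq]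
    · intro i
      have := (measurable_slice hf i).ennreal_toReal.complex_ofReal
      exact ((by fun_prop : Measurable fun y => h (x - y)).mul this).aestronglyMeasurable
    · have hb : ∀ i, ∫⁻ y, ‖h (x - y) * ((slice i f y).toReal : ℂ)‖ₑ ≤
          ENNReal.ofReal B * ∫⁻ y, slice i f y := by
        intro i
        rw [← lintegral_const_mul _ (measurable_slice hf i)]
        refine lintegral_mono fun y => ?_
        rw [enorm_mul, ← ofReal_norm (h (x - y)), ← ofReal_norm, Complex.norm_real,
          Real.norm_of_nonneg ENNReal.toReal_nonneg, ENNReal.ofReal_toReal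
          (ne_top_of_le_ne_top (h1 y) (slice_le i f y))]
        gcongr
        exact hB _
      refine ne_top_of_le_ne_top ?_ (ENNReal.tsum_le_tsum hb)
      rw [ENNReal.tsum_mul_left, ← lintegral_tsum fun i => (measurable_slice hf i).aemeasurable]
      simp_rw [tsum_slice h1]
      finiteness
  rw [e]
  exact enorm_tsum_le_tsum_enorm

end Slice

/-- The mixed norm of a family of convolutions. -/
def famN {n : ℕ} (lam : ℤ → ℝ) (κ : ℤ → ℝ → Rn n → ℂ) (r : ℝ) (f : Rn n → ℂ) (x : Rn n) : ℝ≥0∞ :=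
  (∑' j, ENNReal.ofReal (lam j) * ∫⁻ u in Icc (1 / 2 : ℝ) 4, ‖cv (κ j u) f x‖ₑ ^ r) ^ (1 / r)

section Family

variable {n : ℕ} {kk : ℤ → ℤ} {lam : ℤ → ℝ} {C : ℝ} {N : ℕ} {L : ℝ} {κ : ℤ → ℝ → Rn n → ℂ}

lemma OscFamily.measurable_famN (h : OscFamily kk lam C N L κ) (r : ℝ) {f : Rn n → ℂ}
    (hf : Measurable f) : Measurable (famN lam κ r f) := by
  refine Measurable.pow_const ?_ _
  exact Measurable.tsum fun j => (h.measurable_inner j hf r).const_mul _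

lemma OscKernel.hasCompactSupport {k : ℤ} {lam C : ℝ} {κ : ℝ → Rn n → ℂ}
    (h : OscKernel k lam C κ) (u : ℝ) : HasCompactSupport (κ u) :=
  HasCompactSupport.of_support_subset_isCompact (isCompact_closedBall 0 ((2 : ℝ) ^ (k + 1)))
    fun t ht => by
      rw [mem_closedBall_zero_iff]
      by_contra hc
      exact ht (h.supp u t (not_le.1 hc))

lemma OscFamily.famN_le_tsum (h : OscFamily kk lam C N L κ) (hn : 1 ≤ n) {r : ℝ} (hr : 1 ≤ r)
    {f : Rn n → ℝ≥0∞} {M : ℝ≥0∞} (hM : M ≠ ⊤) (hfM : ∀ x, f x ≤ M) (hf : Measurable f)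
    (hfi : ∫⁻ x, f x ≠ ⊤) (x : Rn n) :
    famN lam κ r (fun y => ((f y).toReal : ℂ)) x ≤
      ∑' i : ℤ, ∑' a : ℤ, pieceN kk lam κ r a (slice i f) x := by
  have key : ∀ j, ∀ u ∈ Icc (1 / 2 : ℝ) 4, ‖cv (κ j u) (fun y => ((f y).toReal : ℂ)) x‖ₑ ≤
      ∑' ν : ℤ × ℤ, ‖cv (κ j u) (fun y => (dyD (kk j + ν.2) (slice ν.1 f) y : ℂ)) x‖ₑ := by
    intro j u hu
    have hk := h.osc j
    have hC := hk.C_nonneg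
    have hl := hk.one_le
    refine (enorm_cv_le_tsum_slice hM hfM hf hfi (hk.continuous u) (hk.bound u hu) x).trans ?_
    rw [ENNReal.tsum_prod (f := fun i a =>
      ‖cv (κ j u) (fun y => (dyD (kk j + a) (slice i f) y : ℂ)) x‖ₑ)]
    refine ENNReal.tsum_le_tsum fun i => ?_
    refine (enorm_cv_le_tsum hn hM (fun y => (slice_le i f y).trans (hfM y)) (measurable_slice hf i)
      (ne_top_of_le_ne_top hfi (lintegral_mono (slice_le i f))) (hk.continuous u)
      (hk.hasCompactSupport u) (hk.lip u hu) (by positivity) (hk.bound u hu) x).trans ?_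
    rw [← (Equiv.addLeft (kk j)).tsum_eq]
    rfl
  refine (tsum_lintegral_rpow_le_tsum hr measurableSet_Icc (fun j => ENNReal.ofReal (lam j))
    (fun ν j => ?_) key).trans (le_of_eq ?_)
  · exact (((h.osc j).measurable_cv (measurable_dyD_complex _ _)).comp
      (measurable_id.prodMk measurable_const)).enorm
  · exact ENNReal.tsum_prod (f := fun i a => pieceN kk lam κ r a (slice i f) x)

/-- Minkowski's inequality over the martingale scales, for one level slice. -/
lemma exists_lintegral_tsum_pieceN_rpow_le (hn : 2 ≤ n) {p r : ℝ} (hp : 1 < p) (hp2 : p ≠ 2)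
    (hr : 2 < r) (hrp : p / (p - 1) / n < r) {C : ℝ} (N : ℕ) :
    ∃ ε : ℝ, 0 < ε ∧ ∃ A : ℝ≥0∞, A ≠ ⊤ ∧
    ∀ (kk : ℤ → ℤ) (lam : ℤ → ℝ) (L : ℝ) (κ : ℤ → ℝ → Rn n → ℂ), OscFamily kk lam C N L κ →
    ∀ (f : Rn n → ℝ≥0∞) (i : ℤ), (∀ x, f x ≤ tp (i + 1)) → Measurable f → ∫⁻ x, f x ≠ ⊤ →
    ∫⁻ x, (∑' a : ℤ, pieceN kk lam κ r a f x) ^ p ≤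
      (A * ENNReal.ofReal L ^ (-ε)) ^ p * (tp (i * p) * volume {x | f x ≠ 0}) := by
  obtain ⟨ε, hε, A, hA, H⟩ := exists_lintegral_pieceN_rpow_le hn hp hp2 hr hrp (C := C) N
  have hp0 : 0 < p := by linarith
  refine ⟨ε, hε, A ^ (1 / p) * ∑' a : ℤ, tp (-ε * |(a : ℝ)|), ENNReal.mul_ne_top
    (ENNReal.rpow_ne_top_of_nonneg (by positivity) hA) (tsum_tp_neg_abs_ne_top hε), ?_⟩
  intro kk lam L κ h f i hfi hf hf1
  set V := tp (i * p) * volume {x | f x ≠ 0}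
  have e : ∀ y : ℝ≥0∞, (y ^ (1 / p)) ^ p = y := fun y => by
    rw [← ENNReal.rpow_mul, one_div_mul_cancel hp0.ne', ENNReal.rpow_one]
  have e' : ∀ y : ℝ≥0∞, (y ^ p) ^ (1 / p) = y := fun y => by
    rw [← ENNReal.rpow_mul, mul_one_div_cancel hp0.ne', ENNReal.rpow_one]
  have hp1 : 0 ≤ 1 / p := by positivity
  have := lintegral_tsum_rpow_le (volume : Measure (Rn n)) hp.le
    (fun a : ℤ => pieceN kk lam κ r a f) (fun a => h.measurable_pieceN r a f)
  rw [← e (∫⁻ x, (∑' a : ℤ, pieceN kk lam κ r a f x) ^ p), ← e V,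
    ← ENNReal.mul_rpow_of_nonneg _ _ hp0.le]
  refine ENNReal.rpow_le_rpow (this.trans ?_) hp0.le
  calc _ ≤ ∑' a : ℤ, (A ^ (1 / p) * ENNReal.ofReal L ^ (-ε) * V ^ (1 / p)) *
        tp (-ε * |(a : ℝ)|) := by
        refine ENNReal.tsum_le_tsum fun a => ?_
        refine (ENNReal.rpow_le_rpow (H kk lam L κ h f i hfi hf hf1 a) hp1).trans (le_of_eq ?_)
        rw [ENNReal.mul_rpow_of_nonneg _ _ hp1, ENNReal.mul_rpow_of_nonneg _ _ hp1, e']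
        ring
    _ = _ := by rw [ENNReal.tsum_mul_left]; ring

lemma eventually_div_div_lt {n : ℕ} {p r : ℝ} (hp : 1 < p)
    (hrp : p / (p - 1) / n < r) : ∀ᶠ q in 𝓝 p, 1 < q ∧ q / (q - 1) / n < r := by
  have hc : ContinuousAt (fun q : ℝ => q / (q - 1) / n) p :=
    (continuousAt_id.div (continuousAt_id.sub continuousAt_const)
      (sub_ne_zero.2 hp.ne')).div_const _
  exact (lt_mem_nhds hp).and (hc.eventually (gt_mem_nhds hrp))

lemma exists_exponents {n : ℕ} {p r : ℝ} (hp : 1 < p) (hrp : p / (p - 1) / n < r) :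
    ∃ p₁ p₂ : ℝ, p₁ < p ∧ p < p₂ ∧ p₁ ≠ 2 ∧ p₂ ≠ 2 ∧ (1 < p₁ ∧ p₁ / (p₁ - 1) / n < r) ∧
      (1 < p₂ ∧ p₂ / (p₂ - 1) / n < r) := by
  have h := eventually_div_div_lt hp hrp
  have h2 : ∀ᶠ q in 𝓝[≠] p, q ≠ 2 := by
    by_cases hp2 : p = 2
    · subst hp2; exact eventually_mem_nhdsWithin
    · exact (eventually_ne_nhds hp2).filter_mono nhdsWithin_le_nhds
  have hlt : (𝓝[<] p) ≤ 𝓝[≠] p := nhdsWithin_mono _ fun x hx => ne_of_lt hx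
  have hgt : (𝓝[>] p) ≤ 𝓝[≠] p := nhdsWithin_mono _ fun x hx => ne_of_gt hx
  obtain ⟨p₁, ⟨a1, b1⟩, c1⟩ := ((h.filter_mono nhdsWithin_le_nhds).and (h2.filter_mono hlt)
    |>.and eventually_mem_nhdsWithin).exists
  obtain ⟨p₂, ⟨a2, b2⟩, c2⟩ := ((h.filter_mono nhdsWithin_le_nhds).and (h2.filter_mono hgt)
    |>.and eventually_mem_nhdsWithin).exists
  exact ⟨p₁, p₂, c1, c2, b1, b2, a1, a2⟩

lemma exists_lintegral_famN_toReal_le (hn : 2 ≤ n) {p r : ℝ} (hp : 1 < p)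
    (hr : 2 < r) (hrp : p / (p - 1) / n < r) (C : ℝ) (N : ℕ) :
    ∃ ε : ℝ, 0 < ε ∧ ∃ A : ℝ≥0∞, A ≠ ⊤ ∧
    ∀ (kk : ℤ → ℤ) (lam : ℤ → ℝ) (L : ℝ) (κ : ℤ → ℝ → Rn n → ℂ), OscFamily kk lam C N L κ →
    ∀ (f : Rn n → ℝ≥0∞) (M : ℝ≥0∞), M ≠ ⊤ → (∀ x, f x ≤ M) → Measurable f → ∫⁻ x, f x ≠ ⊤ →
    ∫⁻ x, famN lam κ r (fun y => ((f y).toReal : ℂ)) x ^ p ≤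
      A * (ENNReal.ofReal L ^ (-ε)) ^ p * ∫⁻ x, f x ^ p := by
  obtain ⟨p₁, p₂, h1, h2, n1, n2, ⟨a1, b1⟩, ⟨a2, b2⟩⟩ := exists_exponents hp hrp
  obtain ⟨ε₁, hε₁, A₁, hA₁, H₁⟩ := exists_lintegral_tsum_pieceN_rpow_le hn a1 n1 hr b1 (C := C) N
  obtain ⟨ε₂, hε₂, A₂, hA₂, H₂⟩ := exists_lintegral_tsum_pieceN_rpow_le hn a2 n2 hr b2 (C := C) N
  obtain ⟨D, hD, HD⟩ := lintegral_tsum_rpow_le_interp (by linarith : 0 < p₁) h1 h2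
  have hp0 : 0 < p := by linarith
  refine ⟨min ε₁ ε₂, lt_min hε₁ hε₂, D * (A₁ + A₂ + 1) ^ p, by finiteness, ?_⟩
  intro kk lam L κ h f M hM hfM hf hf1
  set ε := min ε₁ ε₂ with hε
  have hL1 : 1 ≤ ENNReal.ofReal L := by
    rw [← ENNReal.ofReal_one]; exact ENNReal.ofReal_le_ofReal h.one_le
  have hL0 : ENNReal.ofReal L ≠ 0 := (zero_lt_one.trans_le hL1).ne'
  have hneg : ∀ x : ℝ, ε ≤ x → ENNReal.ofReal L ^ (-x) ≤ ENNReal.ofReal L ^ (-ε) := fun x hx =>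
    ENNReal.rpow_le_rpow_of_exponent_le hL1 (by linarith)
  set B := (A₁ + A₂ + 1) * ENNReal.ofReal L ^ (-ε) with hB
  have hLne : ENNReal.ofReal L ^ (-ε) ≠ 0 := (ENNReal.rpow_pos (pos_iff_ne_zero.2 hL0)
    ENNReal.ofReal_ne_top).ne'
  have hLnt : ENNReal.ofReal L ^ (-ε) ≠ ⊤ :=
    ENNReal.rpow_ne_top_of_ne_zero hL0 ENNReal.ofReal_ne_top
  have hB0 : B ≠ 0 := mul_ne_zero (by simp) hLne
  have hBt : B ≠ ⊤ := ENNReal.mul_ne_top (by finiteness) hLnt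
  have hs1 : ∀ i : ℤ, ∫⁻ x, slice i f x ≠ ⊤ := fun i =>
    ne_top_of_le_ne_top hf1 (lintegral_mono (slice_le i f))
  have m : ∀ i : ℤ, Measurable fun x => ∑' a : ℤ, pieceN kk lam κ r a (slice i f) x := fun i =>
    Measurable.tsum fun a => h.measurable_pieceN r a _
  have := HD (volume : Measure (Rn n)) (fun i x => ∑' a : ℤ, pieceN kk lam κ r a (slice i f) x) m
    B hB0 hBt (fun i => volume {y | slice i f y ≠ 0})
    (fun i => (H₁ kk lam L κ h (slice i f) i (slice_le_tp i f) (measurable_slice hf i)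
      (hs1 i)).trans (by
        refine mul_le_mul_left (ENNReal.rpow_le_rpow (mul_le_mul' ?_ (hneg _ (min_le_left _ _)))
          (by linarith)) _
        exact le_self_add.trans le_self_add))
    (fun i => (H₂ kk lam L κ h (slice i f) i (slice_le_tp i f) (measurable_slice hf i)
      (hs1 i)).trans (by
        refine mul_le_mul_left (ENNReal.rpow_le_rpow (mul_le_mul' ?_ (hneg _ (min_le_right _ _)))
          (by linarith)) _
        exact le_add_self.trans le_self_add))
  calc _ ≤ _ := lintegral_mono fun x => ENNReal.rpow_le_rpow
        (h.famN_le_tsum (by omega) (by linarith) hM hfM hf hf1 x) hp0.le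
    _ ≤ _ := this
    _ ≤ D * B ^ p * ∫⁻ x, f x ^ p := by
        gcongr
        exact tsum_tp_mul_volume_slice_le hf (fun y => ne_top_of_le_ne_top hM (hfM y)) hp0
    _ = _ := by rw [hB, ENNReal.mul_rpow_of_nonneg _ _ hp0.le]; ring

lemma OscFamily.famN_sum_le (h : OscFamily kk lam C N L κ) {ι : Type*} [Fintype ι] {r : ℝ}
    (hr : 1 ≤ r) (c : ι → ℂ) (hc : ∀ i, ‖c i‖ = 1) {g : ι → Rn n → ℂ}
    (hg : ∀ i, Measurable (g i)) (hgi : ∀ i, Integrable (g i)) (x : Rn n) :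
    famN lam κ r (fun y => ∑ i, c i * g i y) x ≤ ∑ i, famN lam κ r (g i) x := by
  have key : ∀ j, ∀ u ∈ Icc (1 / 2 : ℝ) 4, ‖cv (κ j u) (fun y => ∑ i, c i * g i y) x‖ₑ ≤
      ∑' i, ‖cv (κ j u) (g i) x‖ₑ := by
    intro j u hu
    have e : cv (κ j u) (fun y => ∑ i, c i * g i y) x = ∑ i, c i * cv (κ j u) (g i) x := by
      simp_rw [cv_eq, Finset.mul_sum]
      rw [integral_finsetSum _ fun i _ => ?_]
      · refine Finset.sum_congr rfl fun i _ => ?_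
        rw [← integral_const_mul]
        refine integral_congr_ae (Eventually.of_forall fun y => ?_)
        simp only; ring
      · have hk := (h.osc j).continuous u
        exact ((hgi i).const_mul (c i)).bdd_mul (by fun_prop)
          (Eventually.of_forall fun y => (h.osc j).bound u hu _)
    rw [e, tsum_fintype]
    refine (enorm_sum_le _ _).trans (Finset.sum_le_sum fun i _ => ?_)
    rw [enorm_mul, ← ofReal_norm (c i), hc]; simp
  refine (tsum_lintegral_rpow_le_tsum hr measurableSet_Icc (fun j => ENNReal.ofReal (lam j))
    (G := fun i j u => ‖cv (κ j u) (g i) x‖ₑ) (fun i j => ?_) key).trans (le_of_eq ?_)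
  · exact (((h.osc j).measurable_cv (hg i)).comp (measurable_id.prodMk measurable_const)).enorm
  · rw [tsum_fintype]; rfl

/-- The mixed-norm bound for oscillatory families on bounded integrable functions. -/
lemma exists_lintegral_famN_le (hn : 2 ≤ n) {p r : ℝ} (hp : 1 < p)
    (hr : 2 < r) (hrp : p / (p - 1) / n < r) (C : ℝ) (N : ℕ) :
    ∃ ε : ℝ, 0 < ε ∧ ∃ A : ℝ≥0∞, A ≠ ⊤ ∧
    ∀ (kk : ℤ → ℤ) (lam : ℤ → ℝ) (L : ℝ) (κ : ℤ → ℝ → Rn n → ℂ), OscFamily kk lam C N L κ →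
    ∀ (f : Rn n → ℂ) (M : ℝ), (∀ x, ‖f x‖ ≤ M) → Measurable f → Integrable f →
    (∫⁻ x, famN lam κ r f x ^ p) ^ (1 / p) ≤
      A * ENNReal.ofReal L ^ (-ε) * (∫⁻ x, ‖f x‖ₑ ^ p) ^ (1 / p) := by
  obtain ⟨ε, hε, A, hA, H⟩ := exists_lintegral_famN_toReal_le hn hp hr hrp C N
  have hp0 : 0 < p := by linarith
  have hp1 : 0 ≤ 1 / p := by positivity
  refine ⟨ε, hε, 4 * A ^ (1 / p), ENNReal.mul_ne_top (by simp)
    (ENNReal.rpow_ne_top_of_nonneg hp1 hA), ?_⟩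
  intro kk lam L κ h f M hfM hf hfi
  set g : Fin 4 → Rn n → ℝ≥0∞ := ![fun y => ENNReal.ofReal (f y).re,
    fun y => ENNReal.ofReal (-(f y).re), fun y => ENNReal.ofReal (f y).im,
    fun y => ENNReal.ofReal (-(f y).im)] with hgdef
  set c : Fin 4 → ℂ := ![1, -1, Complex.I, -Complex.I] with hcdef
  have hgm : ∀ i, Measurable (g i) := by
    intro i; fin_cases i <;> simp only [hgdef] <;> simp <;> fun_prop
  have hgf : ∀ i y, g i y ≤ ‖f y‖ₑ := by
    intro i y
    have h1 := (abs_le.1 (Complex.abs_re_le_norm (f y)))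
    have h2 := (abs_le.1 (Complex.abs_im_le_norm (f y)))
    have h3 : ∀ a : ℝ, a ≤ ‖f y‖ → ENNReal.ofReal a ≤ ‖f y‖ₑ := fun a ha => by
      rw [← ofReal_norm]; exact ENNReal.ofReal_le_ofReal ha
    fin_cases i <;> exact h3 _ (by linarith)
  have hfs : f = fun y => ∑ i, c i * ((g i y).toReal : ℂ) := by
    have hr : ∀ x : ℝ, (max x 0 - max (-x) 0 : ℝ) = x := fun x => by
      rcases le_total x 0 with h | h <;> simp [h]
    ext y
    simp only [Fin.sum_univ_four, hgdef, hcdef]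
    simp [ENNReal.toReal_ofReal']
    apply Complex.ext
    · have := hr (f y).re; simp; linarith
    · have := hr (f y).im; simp; linarith
  have hgM : ∀ i y, g i y ≤ ENNReal.ofReal M := fun i y => (hgf i y).trans (by
    rw [← ofReal_norm]; exact ENNReal.ofReal_le_ofReal (hfM y))
  have hg1 : ∀ i, ∫⁻ y, g i y ≠ ⊤ := fun i =>
    ne_top_of_le_ne_top hfi.2.ne (lintegral_mono (hgf i))
  have hmi : ∀ i, Measurable fun y => ((g i y).toReal : ℂ) := fun i =>
    (hgm i).ennreal_toReal.complex_ofReal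
  have hii : ∀ i, Integrable fun y => ((g i y).toReal : ℂ) := fun i =>
    (integrable_toReal_of_lintegral_ne_top (hgm i).aemeasurable (hg1 i)).ofReal
  have hle : ∀ x, famN lam κ r f x ≤ ∑ i, famN lam κ r (fun y => ((g i y).toReal : ℂ)) x := by
    intro x
    conv_lhs => rw [hfs]
    exact h.famN_sum_le (by linarith) c (fun i => by fin_cases i <;> simp [hcdef]) hmi hii x
  have e' : ∀ y : ℝ≥0∞, (y ^ p) ^ (1 / p) = y := fun y => by
    rw [← ENNReal.rpow_mul, mul_one_div_cancel hp0.ne', ENNReal.rpow_one]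
  calc _ ≤ (∫⁻ x, (∑ i, famN lam κ r (fun y => ((g i y).toReal : ℂ)) x) ^ p) ^ (1 / p) :=
        ENNReal.rpow_le_rpow (lintegral_mono fun x => ENNReal.rpow_le_rpow (hle x) hp0.le) hp1
    _ ≤ ∑ i, (∫⁻ x, (famN lam κ r (fun y => ((g i y).toReal : ℂ)) x) ^ p) ^ (1 / p) :=
        lintegral_finset_sum_rpow_le _ hp.le _ (fun i => famN lam κ r fun y => ((g i y).toReal : ℂ))
          fun i => (h.measurable_famN r (hmi i)).aemeasurable
    _ ≤ ∑ i : Fin 4, A ^ (1 / p) * ENNReal.ofReal L ^ (-ε) * (∫⁻ x, ‖f x‖ₑ ^ p) ^ (1 / p) := by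
        refine Finset.sum_le_sum fun i _ => ?_
        refine (ENNReal.rpow_le_rpow (H kk lam L κ h (g i) _ ENNReal.ofReal_ne_top (hgM i) (hgm i)
          (hg1 i)) hp1).trans ?_
        rw [ENNReal.mul_rpow_of_nonneg _ _ hp1, ENNReal.mul_rpow_of_nonneg _ _ hp1, e']
        gcongr with x
        exact hgf i x
    _ = _ := by simp; ring

end Family

section Scale

variable {n : ℕ}

lemma lintegral_comp_smul_Rn {R : ℝ} (hR : 0 < R) (f : Rn n → ℝ≥0∞) :
    ∫⁻ x, f (R • x) = ENNReal.ofReal ((R ^ n)⁻¹) * ∫⁻ x, f x := by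
  have h1 := Measure.map_addHaar_smul (volume : Measure (Rn n)) hR.ne'
  have h2 : ∫⁻ x, f x ∂(Measure.map (fun x : Rn n => R • x) volume) = ∫⁻ x, f (R • x) :=
    lintegral_map_equiv f (Homeomorph.smulOfNeZero R hR.ne').toMeasurableEquiv
  rw [← h2, h1, lintegral_smul_measure, finrank_euclideanSpace, Fintype.card_fin,
    abs_of_pos (by positivity)]
  rfl

lemma lintegral_comp_inv_smul_Rn {R : ℝ} (hR : 0 < R) (f : Rn n → ℝ≥0∞) :
    ∫⁻ x, f (R⁻¹ • x) = ENNReal.ofReal (R ^ n) * ∫⁻ x, f x := by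
  rw [lintegral_comp_smul_Rn (inv_pos.2 hR), inv_pow, inv_inv]

lemma integral_comp_inv_smul_Rn {R : ℝ} (hR : 0 < R) (f : Rn n → ℂ) :
    ∫ x, f (R⁻¹ • x) = (R : ℂ) ^ n * ∫ x, f x := by
  rw [Measure.integral_comp_smul, finrank_euclideanSpace, Fintype.card_fin, inv_pow, inv_inv,
    abs_of_pos (pow_pos hR n), Complex.real_smul, Complex.ofReal_pow]

lemma cv_scale {R : ℝ} (hR : 0 < R) (h g : Rn n → ℂ) (x : Rn n) :
    cv (fun t => ((R : ℂ) ^ n)⁻¹ * h (R⁻¹ • t)) g x = cv h (fun y => g (R • y)) (R⁻¹ • x) := by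
  have hR' : (R : ℂ) ≠ 0 := by exact_mod_cast hR.ne'
  have := integral_comp_inv_smul_Rn hR (fun t => h t * g (R • (R⁻¹ • x - t)))
  simp only [smul_sub, smul_inv_smul₀ hR.ne'] at this
  simp only [cv, smul_sub, smul_inv_smul₀ hR.ne', mul_assoc]
  rw [integral_const_mul, this, inv_mul_cancel_left₀ (pow_ne_zero n hR')]

lemma ballAvg_scale (k : ℤ) (g : Rn n → ℝ≥0∞) (x : Rn n) :
    ballAvg (0 + 1) (fun y => g ((2 : ℝ) ^ k • y)) (((2 : ℝ) ^ k)⁻¹ • x) = ballAvg (k + 1) g x := by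
  have hR : (0 : ℝ) < (2 : ℝ) ^ k := by positivity
  have h0 : ∀ m : ℤ, MeasurableSet (Metric.closedBall x ((2 : ℝ) ^ m)) :=
    fun m => Metric.isClosed_closedBall.measurableSet
  have h1 := lintegral_comp_smul_Rn hR (Set.indicator (Metric.closedBall x ((2 : ℝ) ^ (k + 1))) g)
  rw [lintegral_indicator (h0 _)] at h1
  have h2 : (fun y : Rn n => Set.indicator (Metric.closedBall x ((2 : ℝ) ^ (k + 1))) g
      ((2 : ℝ) ^ k • y)) = Set.indicator
        (Metric.closedBall (((2 : ℝ) ^ k)⁻¹ • x) ((2 : ℝ) ^ (0 + 1 : ℤ)))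
        (fun y => g ((2 : ℝ) ^ k • y)) := by
    funext y
    have : dist ((2 : ℝ) ^ k • y) x = (2 : ℝ) ^ k * dist y (((2 : ℝ) ^ k)⁻¹ • x) := by
      conv_lhs => rw [← smul_inv_smul₀ hR.ne' x]
      rw [dist_smul₀, Real.norm_of_nonneg hR.le]
    have hm : (2 : ℝ) ^ k • y ∈ Metric.closedBall x ((2 : ℝ) ^ (k + 1)) ↔
        y ∈ Metric.closedBall (((2 : ℝ) ^ k)⁻¹ • x) ((2 : ℝ) ^ (0 + 1 : ℤ)) := by
      rw [Metric.mem_closedBall, Metric.mem_closedBall, this, zpow_add₀ (two_ne_zero' ℝ),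
        mul_le_mul_iff_right₀ hR, zero_add]
    by_cases hy : y ∈ Metric.closedBall (((2 : ℝ) ^ k)⁻¹ • x) ((2 : ℝ) ^ (0 + 1 : ℤ))
    · rw [Set.indicator_of_mem (hm.2 hy), Set.indicator_of_mem hy]
    · rw [Set.indicator_of_notMem (mt hm.1 hy), Set.indicator_of_notMem hy]
  rw [h2, lintegral_indicator Metric.isClosed_closedBall.measurableSet] at h1
  rw [ballAvg, ballAvg, h1, ← mul_assoc]
  congr 1
  rw [← zpow_natCast, ← zpow_mul, ← zpow_neg, tp_zpow_eq, ← tp_add]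
  congr 1
  push_cast
  ring

lemma OscKernel.scale {lam C : ℝ} {κ : ℝ → Rn n → ℂ} (h : OscKernel 0 lam C κ) (k : ℤ) :
    OscKernel k lam C
      (fun u t => ((((2 : ℝ) ^ k : ℝ) : ℂ) ^ n)⁻¹ * κ u (((2 : ℝ) ^ k)⁻¹ • t)) := by
  have hR : (0 : ℝ) < (2 : ℝ) ^ k := by positivity
  have hn : ‖((((2 : ℝ) ^ k : ℝ) : ℂ) ^ n)⁻¹‖ = (2 : ℝ) ^ (-(k * n)) := by
    rw [norm_inv, norm_pow, Complex.norm_real, Real.norm_of_nonneg hR.le, zpow_neg, zpow_mul,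
      zpow_natCast]
  refine ⟨h.C_nonneg, h.one_le, ?_, fun u t ht => ?_, fun u hu t => ?_, fun u hu t t' => ?_,
    fun u hu => ?_, fun u hu g hg hb hi => ?_, fun g hg hb x => ?_⟩
  · have h1 : Continuous fun z : ℝ × Rn n => (z.1, ((2 : ℝ) ^ k)⁻¹ • z.2) := by fun_prop
    exact continuous_const.mul (h.cont.comp h1)
  · rw [h.supp, mul_zero]
    rw [norm_smul, norm_inv, Real.norm_of_nonneg hR.le, lt_inv_mul_iff₀ hR]
    rwa [zpow_add₀ two_ne_zero] at ht
  · have := h.bound u hu (((2 : ℝ) ^ k)⁻¹ • t)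
    rw [norm_mul, hn]
    rw [zero_mul, neg_zero, zpow_zero, mul_one] at this
    rw [mul_comm]
    gcongr
  · have := h.lip u hu (((2 : ℝ) ^ k)⁻¹ • t) (((2 : ℝ) ^ k)⁻¹ • t')
    rw [← mul_sub, norm_mul, hn]
    rw [zero_mul, neg_zero, zpow_zero, mul_one, ← smul_sub, norm_smul, norm_inv,
      Real.norm_of_nonneg hR.le] at this
    refine (mul_le_mul_of_nonneg_left this (by positivity)).trans_eq ?_
    rw [mul_add, mul_one, neg_add, zpow_add₀ two_ne_zero, zpow_neg _ k]
    ring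
  · rw [integral_const_mul, integral_comp_inv_smul_Rn hR, h.mean u hu, mul_zero, mul_zero]
  · simp only [cv_scale hR]
    obtain ⟨M, hM⟩ := hb
    have hi' : Integrable fun y => g ((2 : ℝ) ^ k • y) := hi.comp_smul hR.ne'
    have h1 := h.l2 u hu (fun y => g ((2 : ℝ) ^ k • y)) (hg.comp (measurable_const_smul _))
      ⟨M, fun x => hM _⟩ hi'
    rw [lintegral_comp_inv_smul_Rn hR fun x => ‖cv (κ u) (fun y => g ((2 : ℝ) ^ k • y)) x‖ₑ ^ 2]
    refine (mul_le_mul_right h1 _).trans_eq ?_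
    rw [lintegral_comp_smul_Rn hR fun y => ‖g y‖ₑ ^ 2, mul_left_comm]
    congr 1
    rw [← mul_assoc, ← ENNReal.ofReal_mul (by positivity), mul_inv_cancel₀ (by positivity),
      ENNReal.ofReal_one, one_mul]
  · simp only [cv_scale hR]
    obtain ⟨M, hM⟩ := hb
    have h1 := h.sq (fun y => g ((2 : ℝ) ^ k • y)) (hg.comp (measurable_const_smul _))
      ⟨M, fun x => hM _⟩ (((2 : ℝ) ^ k)⁻¹ • x)
    exact h1.trans_eq (by rw [ballAvg_scale k fun y => ‖g y‖ₑ ^ 2])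

end Scale

/-- A family of smooth functions whose derivatives of each order are bounded uniformly over the
family. -/
def DB {ι V E : Type*} [NormedAddCommGroup V] [NormedSpace ℝ V] [NormedAddCommGroup E]
    [NormedSpace ℝ E] (F : ι → V → E) : Prop :=
  (∀ p, ContDiff ℝ (⊤ : ℕ∞) (F p)) ∧ ∀ N : ℕ, ∃ C : ℝ, ∀ p x, ‖iteratedFDeriv ℝ N (F p) x‖ ≤ C

namespace DB

variable {ι V E : Type*} [NormedAddCommGroup V] [NormedSpace ℝ V] [NormedAddCommGroup E]
  [NormedSpace ℝ E]

lemma le_infty (N : ℕ) : (N : WithTop ℕ∞) ≤ ((⊤ : ℕ∞) : WithTop ℕ∞) := mod_cast le_top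

lemma exists_bound {F : ι → V → E} (h : DB F) : ∃ C : ℝ, 0 ≤ C ∧ ∀ p x, ‖F p x‖ ≤ C := by
  obtain ⟨C, hC⟩ := h.2 0
  exact ⟨max C 0, le_max_right _ _, fun p x => by
    simpa using (hC p x).trans (le_max_left C 0)⟩

lemma exists_lip {F : ι → V → E} (h : DB F) :
    ∃ C : ℝ, 0 ≤ C ∧ ∀ p x y, ‖F p x - F p y‖ ≤ C * ‖x - y‖ := by
  obtain ⟨C, hC⟩ := h.2 1
  refine ⟨max C 0, le_max_right _ _, fun p x y => ?_⟩
  refine Convex.norm_image_sub_le_of_norm_fderiv_le (𝕜 := ℝ)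
    (fun z _ => ((h.1 p).differentiable (by simp)).differentiableAt) (fun z _ => ?_) convex_univ
    (mem_univ y) (mem_univ x)
  rw [← norm_iteratedFDeriv_one]
  exact (hC p z).trans (le_max_left _ _)

lemma of_hasCompactSupport {f : V → E} (hf : ContDiff ℝ (⊤ : ℕ∞) f) (hs : HasCompactSupport f) :
    DB fun _ : ι => f := by
  refine ⟨fun _ => hf, fun N => ?_⟩
  obtain ⟨C, hC⟩ := (hs.iteratedFDeriv (𝕜 := ℝ) N).exists_bound_of_continuous
    (hf.continuous_iteratedFDeriv (le_infty N))
  exact ⟨C, fun _ x => hC x⟩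

lemma reindex {ι' : Type*} {F : ι → V → E} (h : DB F) (σ : ι' → ι) : DB fun q => F (σ q) :=
  ⟨fun _ => h.1 _, fun N => (h.2 N).imp fun _ hC _ => hC _⟩

lemma add {F G : ι → V → E} (hF : DB F) (hG : DB G) : DB fun p x => F p x + G p x := by
  refine ⟨fun p => (hF.1 p).add (hG.1 p), fun N => ?_⟩
  obtain ⟨A, hA⟩ := hF.2 N
  obtain ⟨B, hB⟩ := hG.2 N
  refine ⟨A + B, fun p x => ?_⟩
  have := iteratedFDeriv_add_apply (x := x) (i := N) (f := F p) (g := G p)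
    ((hF.1 p).of_le (le_infty N)).contDiffAt ((hG.1 p).of_le (le_infty N)).contDiffAt
  change ‖iteratedFDeriv ℝ N (F p + G p) x‖ ≤ _
  rw [this]
  exact norm_add_le_of_le (hA p x) (hB p x)

lemma zero : DB fun (_ : ι) (_ : V) => (0 : E) :=
  of_hasCompactSupport contDiff_const HasCompactSupport.zero

lemma sum {α : Type*} (s : Finset α) {F : α → ι → V → E} (h : ∀ i, DB (F i)) :
    DB fun p x => ∑ i ∈ s, F i p x := by
  classical
  induction s using Finset.induction_on with
  | empty => simpa using zero
  | insert i s hi ih => simpa [Finset.sum_insert hi] using (h i).add ih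

lemma mul {F G : ι → V → ℝ} (hF : DB F) (hG : DB G) : DB fun p x => F p x * G p x := by
  refine ⟨fun p => (hF.1 p).mul (hG.1 p), fun N => ?_⟩
  choose A hA using hF.2
  choose B hB using hG.2
  refine ⟨∑ i ∈ Finset.range (N + 1), (N.choose i : ℝ) * A i * B (N - i), fun p x => ?_⟩
  refine (norm_iteratedFDeriv_mul_le (hF.1 p) (hG.1 p) x (le_infty N)).trans
    (Finset.sum_le_sum fun i _ => ?_)
  have := (norm_nonneg _).trans (hA i p x)
  gcongr
  · exact hA i p x
  · exact hB _ p x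

lemma dir {F : ι → V → ℝ} (hF : DB F) (v : V) : DB fun p x => fderiv ℝ (F p) x v := by
  have h1 : ∀ p, ContDiff ℝ (⊤ : ℕ∞) (fderiv ℝ (F p)) := fun p => (hF.1 p).fderiv_right (by simp)
  refine ⟨fun p => (h1 p).clm_apply contDiff_const, fun N => ?_⟩
  obtain ⟨A, hA⟩ := hF.2 (N + 1)
  refine ⟨‖ContinuousLinearMap.apply ℝ ℝ v‖ * A, fun p x => ?_⟩
  refine ((ContinuousLinearMap.apply ℝ ℝ v).norm_iteratedFDeriv_comp_left (h1 p).contDiffAt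
    (le_infty N)).trans ?_
  rw [norm_iteratedFDeriv_fderiv]
  gcongr
  exact hA p x

lemma translate {F : ι → V → E} (hF : DB F) : DB fun (q : ι × V) x => F q.1 (x + q.2) :=
  ⟨fun q => (hF.1 q.1).comp (contDiff_id.add contDiff_const), fun N =>
    (hF.2 N).imp fun C hC q x => by rw [iteratedFDeriv_comp_add_right]; exact hC _ _⟩

lemma comp {H : ι → ℝ → ℝ} {F : ι → V → ℝ} (hH : DB H) (hF : DB F) :
    DB fun p x => H p (F p x) := by
  refine ⟨fun p => (hH.1 p).comp (hF.1 p), fun N => ?_⟩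
  choose A hA using hH.2
  choose B hB using hF.2
  refine ⟨N.factorial * (∑ i ∈ Finset.range (N + 1), |A i|) *
    (1 + ∑ i ∈ Finset.range (N + 1), |B i|) ^ N, fun p x => ?_⟩
  refine norm_iteratedFDeriv_comp_le (hH.1 p) (hF.1 p) (le_infty N) x (fun i hi => ?_)
    (fun i hi hi' => ?_)
  · exact (hA i p _).trans ((le_abs_self _).trans
      (Finset.single_le_sum (f := fun i => |A i|) (fun _ _ => abs_nonneg _)
        (Finset.mem_range.2 (by omega))))
  · have h1 := Finset.single_le_sum (f := fun i => |B i|) (fun _ _ => abs_nonneg _)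
      (Finset.mem_range.2 (by omega : i < N + 1))
    have h2 : 0 ≤ ∑ i ∈ Finset.range (N + 1), |B i| := Finset.sum_nonneg fun _ _ => abs_nonneg _
    calc ‖iteratedFDeriv ℝ i (F p) x‖ ≤ 1 + ∑ i ∈ Finset.range (N + 1), |B i| := by
          linarith [hB i p x, le_abs_self (B i)]
      _ ≤ _ := le_self_pow₀ (by linarith) (by omega)

lemma diffQuot {F : ι → V → ℝ} (hF : DB F) :
    DB fun (q : ι × V) x => ‖q.2‖⁻¹ * (F q.1 (x + q.2) - F q.1 x) := by
  have h0 : ∀ q : ι × V, ContDiff ℝ (⊤ : ℕ∞) fun x => F q.1 (x + q.2) :=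
    fun q => hF.translate.1 q
  refine ⟨fun q => contDiff_const.mul ((h0 q).sub (hF.1 q.1)), fun N => ?_⟩
  obtain ⟨A, hA⟩ := hF.2 (N + 1)
  refine ⟨max A 0, fun q x => ?_⟩
  have h1 : iteratedFDeriv ℝ N (fun x => ‖q.2‖⁻¹ * (F q.1 (x + q.2) - F q.1 x)) x =
      ‖q.2‖⁻¹ • (iteratedFDeriv ℝ N (F q.1) (x + q.2) - iteratedFDeriv ℝ N (F q.1) x) := by
    have h2 := ((h0 q).of_le (le_infty N)).contDiffAt (x := x)
    have h3 := ((hF.1 q.1).of_le (le_infty N)).contDiffAt (x := x)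
    have := iteratedFDeriv_const_smul_apply (a := ‖q.2‖⁻¹) (h2.sub h3)
    refine this.trans ?_
    rw [show (fun x => F q.1 (x + q.2) - F q.1 x) = (fun x => F q.1 (x + q.2)) - F q.1 from rfl,
      iteratedFDeriv_sub_apply h2 h3, iteratedFDeriv_comp_add_right]
  rw [h1, norm_smul, norm_inv, norm_norm]
  have h4 : ‖iteratedFDeriv ℝ N (F q.1) (x + q.2) - iteratedFDeriv ℝ N (F q.1) x‖ ≤
      max A 0 * ‖x + q.2 - x‖ := by
    refine Convex.norm_image_sub_le_of_norm_fderiv_le (𝕜 := ℝ) (fun z _ => ?_) (fun z _ => ?_)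
      convex_univ (mem_univ x) (mem_univ _)
    · exact ((hF.1 q.1).differentiable_iteratedFDeriv (by exact_mod_cast ENat.natCast_lt_top N)) z
    · rw [norm_fderiv_iteratedFDeriv]
      exact (hA _ z).trans (le_max_left _ _)
  rw [add_sub_cancel_left] at h4
  refine (mul_le_mul_of_nonneg_left h4 (by positivity)).trans ?_
  rcases (norm_nonneg q.2).eq_or_lt with h | h
  · rw [← h]; simp
  · rw [mul_comm, mul_assoc, mul_inv_cancel₀ h.ne', mul_one]

end DB

section Smooth

lemma contDiff_mul_of_tsupport_subset {V : Type*} [NormedAddCommGroup V] [NormedSpace ℝ V]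
    {θ f : V → ℝ} {U : Set V} (hU : IsOpen U) (hθ : ContDiff ℝ (⊤ : ℕ∞) θ) (hs : tsupport θ ⊆ U)
    (hf : ContDiffOn ℝ (⊤ : ℕ∞) f U) : ContDiff ℝ (⊤ : ℕ∞) fun x => θ x * f x := by
  refine contDiff_iff_contDiffAt.2 fun x => ?_
  by_cases hx : x ∈ tsupport θ
  · exact hθ.contDiffAt.mul (hf.contDiffAt (hU.mem_nhds (hs hx)))
  · have h1 : (fun x => θ x * f x) =ᶠ[𝓝 x] fun _ => 0 := by
      filter_upwards [notMem_tsupport_iff_eventuallyEq.1 hx] with y hy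
      simp [hy]
    exact contDiffAt_const.congr_of_eventuallyEq h1

lemma exists_smooth_cutoff {a b δ : ℝ} (hab : a < b) (hδ : 0 < δ) : ∃ θ : ℝ → ℝ,
    ContDiff ℝ (⊤ : ℕ∞) θ ∧ (∀ x ∈ Icc a b, θ x = 1) ∧ tsupport θ ⊆ Icc (a - δ) (b + δ) := by
  let f : ContDiffBump ((a + b) / 2) := ⟨(b - a) / 2, (b - a) / 2 + δ, by linarith, by linarith⟩
  refine ⟨f, f.contDiff, fun x hx => f.one_of_mem_closedBall ?_, ?_⟩
  · rw [Real.closedBall_eq_Icc]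
    constructor <;> simp only [f] <;> linarith [hx.1, hx.2]
  · rw [f.tsupport_eq, Real.closedBall_eq_Icc]
    refine Icc_subset_Icc ?_ ?_ <;> simp only [f] <;> linarith

lemma exists_smooth_inv {c M : ℝ} (hc : 0 < c) : ∃ h : ℝ → ℝ,
    ContDiff ℝ (⊤ : ℕ∞) h ∧ HasCompactSupport h ∧ ∀ x ∈ Icc c M, h x * x = 1 := by
  obtain ⟨θ, h1, h2, h3⟩ := exists_smooth_cutoff (a := c) (b := max M (c + 1)) (δ := c / 2)
    (lt_max_of_lt_right (by linarith)) (half_pos hc)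
  have h4 : tsupport θ ⊆ Ioi 0 := fun x hx => by
    have := (h3 hx).1
    exact (by linarith : (0 : ℝ) < x)
  refine ⟨fun x => θ x * x⁻¹, contDiff_mul_of_tsupport_subset isOpen_Ioi h1 h4
    (contDiffOn_id.inv fun x hx => ne_of_gt hx), ?_, fun x hx => ?_⟩
  · exact (HasCompactSupport.of_support_subset_isCompact isCompact_Icc
      ((subset_tsupport θ).trans h3)).mul_right
  · simp only
    rw [h2 x ⟨hx.1, hx.2.trans (le_max_left _ _)⟩, one_mul, inv_mul_cancel₀ (by linarith [hx.1])]

end Smooth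

section Nonstationary

variable {n : ℕ}

/-- The square of the norm of the gradient. -/
def gradSq (Φ : Rn n → ℝ) (x : Rn n) : ℝ :=
  ∑ i : Fin n, fderiv ℝ Φ x (EuclideanSpace.single i 1) * fderiv ℝ Φ x (EuclideanSpace.single i 1)

lemma integral_cexp_mul_fderiv {Φ b : Rn n → ℝ} (hΦ : ContDiff ℝ (⊤ : ℕ∞) Φ)
    (hb : ContDiff ℝ (⊤ : ℕ∞) b) (hs : HasCompactSupport b) (μ : ℝ) (v : Rn n) :
    ∫ x, Complex.exp (Complex.I * ((μ * Φ x : ℝ) : ℂ)) * (fderiv ℝ b x v : ℝ) =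
      -(Complex.I * μ) * ∫ x, Complex.exp (Complex.I * ((μ * Φ x : ℝ) : ℂ)) *
        ((fderiv ℝ Φ x v * b x : ℝ) : ℂ) := by
  have h1 : ∀ x, HasFDerivAt (fun x => ((b x : ℝ) : ℂ))
      (Complex.ofRealCLM.comp (fderiv ℝ b x)) x := fun x =>
    Complex.ofRealCLM.hasFDerivAt.comp x ((hb.differentiable (by simp)) x).hasFDerivAt
  have h2 : ∀ x, HasFDerivAt (fun x => Complex.exp (Complex.I * ((μ * Φ x : ℝ) : ℂ)))
      (Complex.exp (Complex.I * ((μ * Φ x : ℝ) : ℂ)) •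
        (Complex.I • Complex.ofRealCLM.comp (μ • fderiv ℝ Φ x))) x := fun x =>
    ((Complex.ofRealCLM.hasFDerivAt.comp x
      (((hΦ.differentiable (by simp)) x).hasFDerivAt.const_mul μ)).const_mul Complex.I).cexp
  have c1 : Continuous Φ := hΦ.continuous
  have c2 : Continuous b := hb.continuous
  have c3 : Continuous fun x => fderiv ℝ Φ x v :=
    (hΦ.continuous_fderiv (by simp)).clm_apply continuous_const
  have c4 : Continuous fun x => fderiv ℝ b x v :=
    (hb.continuous_fderiv (by simp)).clm_apply continuous_const
  have s1 : HasCompactSupport fun x => ((b x : ℝ) : ℂ) := hs.comp_left Complex.ofReal_zero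
  have s2 : HasCompactSupport fun x => ((fderiv ℝ b x v : ℝ) : ℂ) :=
    (hs.fderiv_apply (𝕜 := ℝ) v).comp_left Complex.ofReal_zero
  have key := integral_mul_fderiv_eq_neg_fderiv_mul_of_integrable (μ := volume) (v := v)
    (f := fun x => Complex.exp (Complex.I * ((μ * Φ x : ℝ) : ℂ)))
    (g := fun x => ((b x : ℝ) : ℂ)) ?_ ?_ ?_ (fun x _ => (h2 x).differentiableAt)
    (fun x _ => (h1 x).differentiableAt)
  · simp only [(h1 _).fderiv, (h2 _).fderiv] at key
    refine key.trans ?_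
    rw [← integral_neg, ← integral_const_mul]
    congr 1 with x
    simp
    ring
  · simp only [(h2 _).fderiv]
    refine Continuous.integrable_of_hasCompactSupport ?_ s1.mul_left
    simp
    fun_prop
  · simp only [(h1 _).fderiv]
    refine Continuous.integrable_of_hasCompactSupport ?_ (HasCompactSupport.mul_left s2)
    simp
    fun_prop
  · refine Continuous.integrable_of_hasCompactSupport ?_ s1.mul_left
    fun_prop

lemma integral_cexp_mul_div {Φ a : Rn n → ℝ} {X : Fin n → Rn n → ℝ}
    (hΦ : ContDiff ℝ (⊤ : ℕ∞) Φ) (ha : ContDiff ℝ (⊤ : ℕ∞) a) (hs : HasCompactSupport a)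
    (hX : ∀ i, ContDiff ℝ (⊤ : ℕ∞) (X i)) (μ : ℝ)
    (h1 : ∀ x ∈ tsupport a, ∑ i, fderiv ℝ Φ x (EuclideanSpace.single i 1) * X i x = 1) :
    ∫ x, Complex.exp (Complex.I * ((μ * Φ x : ℝ) : ℂ)) *
        ((∑ i : Fin n, fderiv ℝ (fun x => a x * X i x) x (EuclideanSpace.single i 1) : ℝ) : ℂ) =
      -(Complex.I * μ) * ∫ x, Complex.exp (Complex.I * ((μ * Φ x : ℝ) : ℂ)) * (a x : ℝ) := by
  have e0 : Continuous fun x => Complex.exp (Complex.I * ((μ * Φ x : ℝ) : ℂ)) := by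
    have := hΦ.continuous
    fun_prop
  have int : ∀ b : Rn n → ℝ, Continuous b → HasCompactSupport b → Integrable fun x =>
      Complex.exp (Complex.I * ((μ * Φ x : ℝ) : ℂ)) * ((b x : ℝ) : ℂ) := fun b hb hbs =>
    (e0.mul (Complex.continuous_ofReal.comp hb)).integrable_of_hasCompactSupport
      (HasCompactSupport.mul_left (hbs.comp_left Complex.ofReal_zero))
  have haX : ∀ i, ContDiff ℝ (⊤ : ℕ∞) fun x => a x * X i x := fun i => ha.mul (hX i)
  have hsX : ∀ i, HasCompactSupport fun x => a x * X i x := fun i => hs.mul_right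
  have e1 := fun i => int _
    (((haX i).continuous_fderiv (by simp)).clm_apply
      (continuous_const (y := EuclideanSpace.single i (1 : ℝ))))
    ((hsX i).fderiv_apply (𝕜 := ℝ) (EuclideanSpace.single i (1 : ℝ)))
  have e2 := fun i => int (fun x => fderiv ℝ Φ x (EuclideanSpace.single i 1) * (a x * X i x))
    (((hΦ.continuous_fderiv (by simp)).clm_apply continuous_const).mul (haX i).continuous)
    (hsX i).mul_left
  simp_rw [Complex.ofReal_sum, Finset.mul_sum]
  rw [integral_finsetSum _ fun i _ => e1 i,
    Finset.sum_congr rfl fun i _ => integral_cexp_mul_fderiv hΦ (haX i) (hsX i) μ _,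
    ← Finset.mul_sum, ← integral_finsetSum _ fun i _ => e2 i]
  congr 2 with x
  rw [← Finset.mul_sum, ← Complex.ofReal_sum]
  congr 2
  by_cases hx : x ∈ tsupport a
  · simp_rw [mul_left_comm _ (a x)]
    rw [← Finset.mul_sum, h1 x hx, mul_one]
  · simp [image_eq_zero_of_notMem_tsupport hx]

lemma exists_integral_mul_le {ι : Type*} {R : ℝ} {a : ι → Rn n → ℝ} (ha : DB a)
    (hs : ∀ p, tsupport (a p) ⊆ Metric.closedBall 0 R) : ∃ C : ℝ, 0 ≤ C ∧
      ∀ p, ∀ e : Rn n → ℂ, (∀ x, ‖e x‖ ≤ 1) → ‖∫ x, e x * (a p x : ℝ)‖ ≤ C := by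
  obtain ⟨A, hA0, hA⟩ := ha.exists_bound
  refine ⟨A * volume.real (Metric.closedBall (0 : Rn n) R), by positivity, fun p e he => ?_⟩
  rw [← setIntegral_eq_integral_of_forall_compl_eq_zero (s := Metric.closedBall (0 : Rn n) R)]
  · refine norm_setIntegral_le_of_norm_le_const measure_closedBall_lt_top fun x _ => ?_
    rw [norm_mul, Complex.norm_real]
    exact (mul_le_mul (he x) (hA p x) (norm_nonneg _) zero_le_one).trans_eq (one_mul A)
  · intro x hx
    rw [image_eq_zero_of_notMem_tsupport fun h => hx (hs p h)]
    simp

lemma exists_nonstationary {ι : Type*} {R c : ℝ} (hc : 0 < c) {Φ : ι → Rn n → ℝ} (hΦ : DB Φ)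
    (N : ℕ) : ∀ {a : ι → Rn n → ℝ}, DB a → (∀ p, tsupport (a p) ⊆ Metric.closedBall 0 R) →
    (∀ p, ∀ x ∈ tsupport (a p), c ≤ gradSq (Φ p) x) →
    ∃ C : ℝ, 0 ≤ C ∧ ∀ p, ∀ μ : ℝ, 0 < μ →
      μ ^ N * ‖∫ x, Complex.exp (Complex.I * ((μ * Φ p x : ℝ) : ℂ)) * (a p x : ℝ)‖ ≤ C := by
  induction N with
  | zero =>
    intro a ha hs _
    obtain ⟨C, hC0, hC⟩ := exists_integral_mul_le ha hs
    refine ⟨C, hC0, fun p μ _ => ?_⟩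
    rw [pow_zero, one_mul]
    exact hC p _ fun x => by rw [mul_comm Complex.I, Complex.norm_exp_ofReal_mul_I]
  | succ N ih =>
    intro a ha hs hg
    have hd : ∀ i : Fin n, DB fun p x => fderiv ℝ (Φ p) x (EuclideanSpace.single i 1) :=
      fun i => hΦ.dir _
    have hS : DB fun p x => gradSq (Φ p) x := DB.sum Finset.univ fun i => (hd i).mul (hd i)
    obtain ⟨M, -, hM⟩ := hS.exists_bound
    obtain ⟨h, h1, h2, h3⟩ := exists_smooth_inv (M := M) hc
    obtain ⟨X, hX, hX1⟩ : ∃ X : Fin n → ι → Rn n → ℝ, (∀ i, DB (X i)) ∧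
        ∀ p, ∀ x ∈ tsupport (a p),
          ∑ i, fderiv ℝ (Φ p) x (EuclideanSpace.single i 1) * X i p x = 1 := by
      refine ⟨fun i p x => fderiv ℝ (Φ p) x (EuclideanSpace.single i 1) * h (gradSq (Φ p) x),
        fun i => (hd i).mul ((DB.of_hasCompactSupport h1 h2).comp hS), fun p x hx => ?_⟩
      simp_rw [← mul_assoc]
      rw [← Finset.sum_mul, mul_comm]
      exact h3 _ ⟨hg p x hx, (le_abs_self _).trans (hM p x)⟩
    have haX : ∀ i, DB fun p x => a p x * X i p x := fun i => ha.mul (hX i)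
    have hb := DB.sum Finset.univ fun i => (haX i).dir (EuclideanSpace.single i (1 : ℝ))
    have hsb : ∀ p, tsupport (fun x => ∑ i : Fin n, fderiv ℝ (fun x => a p x * X i p x) x
          (EuclideanSpace.single i 1)) ⊆ tsupport (a p) := by
      intro p
      refine closure_minimal (fun x hx => ?_) (isClosed_tsupport _)
      obtain ⟨i, -, hi⟩ := Finset.exists_ne_zero_of_sum_ne_zero hx
      exact tsupport_mul_subset_left
        (tsupport_fderiv_apply_subset ℝ (EuclideanSpace.single i (1 : ℝ)) (subset_tsupport _ hi))
    obtain ⟨C, hC0, hC⟩ := ih hb (fun p => (hsb p).trans (hs p))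
      (fun p x hx => hg p x (hsb p hx))
    refine ⟨C, hC0, fun p μ hμ => le_trans (le_of_eq ?_) (hC p μ hμ)⟩
    rw [integral_cexp_mul_div (hΦ.1 p) (ha.1 p)
      ((isCompact_closedBall 0 R).of_isClosed_subset (isClosed_tsupport _) (hs p))
      (fun i => (hX i).1 p) μ (hX1 p), norm_mul, norm_neg, norm_mul, Complex.norm_I, one_mul,
      Complex.norm_real, Real.norm_of_nonneg hμ.le, pow_succ]
    ring

end Nonstationary

section Schur

open scoped ComplexConjugate

lemma ennreal_mul_le_sq_add_sq (a b : ℝ≥0∞) : a * b ≤ a ^ 2 + b ^ 2 := by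
  rcases le_total a b with h | h
  · exact (mul_le_mul_left h b).trans (by rw [← sq]; exact le_add_self)
  · exact (mul_le_mul_right h a).trans (by rw [← sq]; exact le_self_add)

lemma lintegral_sq_le_of_schur {Z Y : Type*} [MeasurableSpace Z] [MeasurableSpace Y]
    {μ : Measure Z} {ν : Measure Y} [SFinite μ] [SFinite ν] {k : Z → Y → ℂ} {F : Y → ℂ}
    (hF : Measurable F) {m : Y → Y → ℝ≥0∞} (hm : Measurable (Function.uncurry m))
    (hsymm : ∀ y y', m y y' = m y' y)
    (hint : Integrable (fun w : Z × (Y × Y) =>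
      (k w.1 w.2.1 * F w.2.1) * conj (k w.1 w.2.2 * F w.2.2)) (μ.prod (ν.prod ν)))
    (hk : ∀ y y', F y ≠ 0 → F y' ≠ 0 → ‖∫ z, k z y * conj (k z y') ∂μ‖ₑ ≤ m y y')
    {A : ℝ≥0∞} (hA : ∀ y, F y ≠ 0 → ∫⁻ y', m y y' ∂ν ≤ A) :
    ∫⁻ z, ‖∫ y, k z y * F y ∂ν‖ₑ ^ 2 ∂μ ≤ 2 * A * ∫⁻ y, ‖F y‖ₑ ^ 2 ∂ν := by
  set T : Z → ℂ := fun z => ∫ y, k z y * F y ∂ν with hT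
  have hQ : ∀ z, ∫ w : Y × Y, (k z w.1 * F w.1) * conj (k z w.2 * F w.2) ∂(ν.prod ν) =
      ((‖T z‖ ^ 2 : ℝ) : ℂ) := fun z => by
    rw [integral_prod_mul (fun y => k z y * F y) (fun y => conj (k z y * F y)), integral_conj,
      Complex.mul_conj', Complex.ofReal_pow]
  have hi : Integrable (fun z => ((‖T z‖ ^ 2 : ℝ) : ℂ)) μ := by
    simpa only [hQ] using hint.integral_prod_left
  have h1 : ∫⁻ z, ‖T z‖ₑ ^ 2 ∂μ = ‖∫ z, ((‖T z‖ ^ 2 : ℝ) : ℂ) ∂μ‖ₑ := by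
    have hi' : Integrable (fun z => ‖T z‖ ^ 2) μ := hi.re
    rw [integral_complex_ofReal, ← ofReal_norm, Complex.norm_real,
      Real.norm_of_nonneg (integral_nonneg fun z => by positivity),
      ofReal_integral_eq_lintegral_ofReal hi' (ae_of_all _ fun z => by positivity)]
    simp [ENNReal.ofReal_pow]
  have h2 : ∫ z, ((‖T z‖ ^ 2 : ℝ) : ℂ) ∂μ =
      ∫ w : Y × Y, F w.1 * conj (F w.2) * ∫ z, k z w.1 * conj (k z w.2) ∂μ ∂(ν.prod ν) := by
    simp_rw [← hQ]
    rw [integral_integral_swap hint]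
    congr 1 with w
    rw [← integral_const_mul]
    congr 1 with z
    rw [map_mul]
    ring
  rw [h1, h2]
  have h3 : ∀ w : Y × Y, ‖F w.1 * conj (F w.2) * ∫ z, k z w.1 * conj (k z w.2) ∂μ‖ₑ ≤
      ‖F w.1‖ₑ ^ 2 * m w.1 w.2 + ‖F w.2‖ₑ ^ 2 * m w.2 w.1 := fun w => by
    by_cases h : F w.1 = 0
    · simp [h]
    by_cases h' : F w.2 = 0
    · simp [h']
    rw [hsymm w.2, ← add_mul, enorm_mul, enorm_mul, RCLike.enorm_conj]
    exact mul_le_mul' (ennreal_mul_le_sq_add_sq _ _) (hk _ _ h h')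
  have h4 : Measurable fun w : Y × Y => ‖F w.1‖ₑ ^ 2 * m w.1 w.2 :=
    ((hF.comp measurable_fst).enorm.pow_const 2).mul hm
  have h5 : ∫⁻ w : Y × Y, ‖F w.1‖ₑ ^ 2 * m w.1 w.2 ∂(ν.prod ν) ≤ A * ∫⁻ y, ‖F y‖ₑ ^ 2 ∂ν := by
    rw [lintegral_prod _ h4.aemeasurable, ← lintegral_const_mul _ (hF.enorm.pow_const 2)]
    refine lintegral_mono fun y => ?_
    simp only
    by_cases h : F y = 0
    · simp [h]
    · have h0 : Measurable (m y) := hm.comp measurable_prodMk_left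
      rw [lintegral_const_mul _ h0, mul_comm]
      exact mul_le_mul_left (hA y h) _
  have h6 : ∫⁻ w : Y × Y, ‖F w.2‖ₑ ^ 2 * m w.2 w.1 ∂(ν.prod ν) =
      ∫⁻ w : Y × Y, ‖F w.1‖ₑ ^ 2 * m w.1 w.2 ∂(ν.prod ν) :=
    lintegral_prod_swap (fun w : Y × Y => ‖F w.1‖ₑ ^ 2 * m w.1 w.2)
  refine (enorm_integral_le_lintegral_enorm _).trans ((lintegral_mono h3).trans ?_)
  rw [lintegral_add_left h4, h6, two_mul, add_mul]
  exact add_le_add h5 h5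

end Schur

/-- A family of radial phases `G` with profiles `g`, `d = g'`, satisfying uniform nondegeneracy
conditions on the annulus `1/2 ≤ ‖s‖ ≤ 2`, together with amplitudes `a` supported there. -/
structure PhaseFam {ι : Type*} {n : ℕ} (c : ℝ) (G a : ι → Rn n → ℝ) (g d : ι → ℝ → ℝ) :
    Prop where
  c_pos : 0 < c
  dbG : DB G
  dba : DB a
  supp : ∀ p, tsupport (a p) ⊆ {s | ‖s‖ ∈ Icc (1 / 2 : ℝ) 2}
  radial : ∀ p s, ‖s‖ ∈ Icc (1 / 2 : ℝ) 2 → G p s = g p ‖s‖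
  grad : ∀ p s, ‖s‖ ∈ Icc (1 / 2 : ℝ) 2 → ∀ i,
    fderiv ℝ (G p) s (EuclideanSpace.single i 1) = d p ‖s‖ / ‖s‖ * s i
  d_ge : ∀ p, ∀ ρ ∈ Icc (1 / 2 : ℝ) 2, c ≤ d p ρ
  d_sub : ∀ p, ∀ ρ ∈ Icc (1 / 2 : ℝ) 2, ∀ ρ' ∈ Icc (1 / 2 : ℝ) 2,
    c * |ρ - ρ'| ≤ |d p ρ - d p ρ'|
  g_sub : ∀ p, ∀ ρ ∈ Icc (1 / 2 : ℝ) 2, ∀ ρ' ∈ Icc (1 / 2 : ℝ) 2,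
    c * |ρ - ρ'| ≤ |g p ρ - g p ρ'|
  mean : ∀ p, ∀ μ : ℝ, ∫ s, Complex.exp (Complex.I * ((μ * G p s : ℝ) : ℂ)) * (a p s : ℝ) = 0

section L2

open scoped ComplexConjugate

variable {ι : Type*} {n : ℕ} {c : ℝ} {G a : ι → Rn n → ℝ} {g d : ι → ℝ → ℝ}

lemma sq_mul_norm_sub_sq_le {c α β : ℝ} {x y : Rn n} (hc : 0 < c)
    (hx : ‖x‖ ∈ Icc (1 / 2 : ℝ) 2) (hy : ‖y‖ ∈ Icc (1 / 2 : ℝ) 2) (hα : c ≤ α) (hβ : c ≤ β)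
    (hαβ : c * |‖x‖ - ‖y‖| ≤ |α - β|) :
    c ^ 2 / 4 * ‖x - y‖ ^ 2 ≤ ∑ i, (α / ‖x‖ * x i - β / ‖y‖ * y i) ^ 2 := by
  have h1 : ∑ i, (α / ‖x‖ * x i - β / ‖y‖ * y i) ^ 2 =
      ‖(α / ‖x‖) • x - (β / ‖y‖) • y‖ ^ 2 := by
    rw [EuclideanSpace.norm_sq_eq]
    simp
  have hα0 : 0 < α := hc.trans_le hα
  have hβ0 : 0 < β := hc.trans_le hβ
  have hx0 : 0 < ‖x‖ := by linarith [hx.1]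
  have hy0 : 0 < ‖y‖ := by linarith [hy.1]
  rw [h1, norm_sub_sq_real, norm_sub_sq_real, inner_smul_left, inner_smul_right, norm_smul,
    norm_smul, Real.norm_of_nonneg (by positivity), Real.norm_of_nonneg (by positivity),
    div_mul_cancel₀ _ hx0.ne', div_mul_cancel₀ _ hy0.ne']
  set s := inner ℝ x y
  set ρ := ‖x‖
  set σ := ‖y‖
  have hs : s ≤ ρ * σ := real_inner_le_norm x y
  obtain ⟨q, hq⟩ : ∃ q, s = ρ * σ * (1 - q) := ⟨1 - s / (ρ * σ), by field_simp; ring⟩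
  have hq0 : 0 ≤ q := by
    by_contra! h
    nlinarith [mul_pos hx0 hy0]
  have h2 : c ^ 2 * (ρ - σ) ^ 2 ≤ (α - β) ^ 2 := by
    rw [← sq_abs (α - β), ← sq_abs (ρ - σ), ← mul_pow]
    gcongr
  have h3 : c ^ 2 * q ≤ α * β * q := by
    rw [sq]; gcongr
  have h4 : ρ * σ * q ≤ 2 * 2 * q := by
    gcongr
    exacts [hx.2, hy.2]
  have h5 : α / ρ * (β / σ * s) = α * β * (1 - q) := by
    rw [hq]; field_simp
  simp only [conj_trivial]
  rw [h5, hq]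
  nlinarith [sq_nonneg (ρ - σ), mul_le_mul_of_nonneg_left h4 (sq_nonneg c), sq_nonneg c,
    mul_nonneg (sq_nonneg c) (sq_nonneg (ρ - σ))]

namespace PhaseFam

/-- The oscillatory kernel `e^{iμG} a`. -/
def ker (G a : ι → Rn n → ℝ) (p : ι) (μ : ℝ) (t : Rn n) : ℂ :=
  Complex.exp (Complex.I * ((μ * G p t : ℝ) : ℂ)) * (a p t : ℝ)

lemma supp_ball (h : PhaseFam c G a g d) (p : ι) : tsupport (a p) ⊆ Metric.closedBall 0 2 :=
  fun s hs => by simpa using (h.supp p hs).2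

lemma ker_mul_conj (p : ι) (μ : ℝ) (t t' : Rn n) : ker G a p μ t * conj (ker G a p μ t') =
    Complex.exp (Complex.I * ((μ * (G p t - G p t') : ℝ) : ℂ)) * ((a p t * a p t' : ℝ) : ℂ) := by
  rw [ker, ker, map_mul, ← Complex.exp_conj, map_mul, Complex.conj_I, Complex.conj_ofReal,
    Complex.conj_ofReal, mul_mul_mul_comm, ← Complex.exp_add, ← Complex.ofReal_mul]
  congr 2
  push_cast
  ring

lemma norm_ker (p : ι) (μ : ℝ) (t : Rn n) : ‖ker G a p μ t‖ = |a p t| := by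
  rw [ker, norm_mul, mul_comm Complex.I, Complex.norm_exp_ofReal_mul_I, one_mul,
    Complex.norm_real, Real.norm_eq_abs]

lemma le_gradSq_diffQuot (h : PhaseFam c G a g d) (p : ι) {w x : Rn n} (hw : w ≠ 0)
    (hx : ‖x‖ ∈ Icc (1 / 2 : ℝ) 2) (hxw : ‖x + w‖ ∈ Icc (1 / 2 : ℝ) 2) :
    c ^ 2 / 4 ≤ gradSq (fun x => ‖w‖⁻¹ * (G p (x + w) - G p x)) x := by
  have hG := (h.dbG.1 p).differentiable (by simp)
  have h0 : ∀ v, fderiv ℝ (fun x => ‖w‖⁻¹ * (G p (x + w) - G p x)) x v =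
      ‖w‖⁻¹ * (fderiv ℝ (G p) (x + w) v - fderiv ℝ (G p) x v) := fun v => by
    have h1 : HasFDerivAt (fun x => G p (x + w)) (fderiv ℝ (G p) (x + w)) x :=
      (hasFDerivAt_comp_add_right w).2 (hG (x + w)).hasFDerivAt
    rw [((h1.fun_sub (hG x).hasFDerivAt).const_mul ‖w‖⁻¹).fderiv]
    simp
  have hw0 : 0 < ‖w‖ := norm_pos_iff.2 hw
  have h2 := sq_mul_norm_sub_sq_le h.c_pos hxw hx (h.d_ge p _ hxw) (h.d_ge p _ hx)
    (h.d_sub p _ hxw _ hx)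
  rw [add_sub_cancel_left] at h2
  simp only [gradSq, h0, h.grad p _ hx, h.grad p _ hxw]
  simp_rw [mul_mul_mul_comm, ← sq]
  rw [← Finset.mul_sum, inv_pow, le_inv_mul_iff₀ (by positivity), mul_comm]
  exact h2

lemma exists_corr_le (h : PhaseFam c G a g d) : ∃ D : ℝ, 0 ≤ D ∧ ∀ p, ∀ μ : ℝ, 0 < μ → ∀ w,
    (1 + ‖μ • w‖) ^ (n + 1) * ‖∫ t, ker G a p μ (t + w) * conj (ker G a p μ t)‖ ≤ D := by
  have hA : DB fun (q : ι × Rn n) x => a q.1 (x + q.2) * a q.1 x :=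
    h.dba.translate.mul (h.dba.reindex Prod.fst)
  have hs1 : ∀ q : ι × Rn n, tsupport (fun x => a q.1 (x + q.2) * a q.1 x) ⊆ tsupport (a q.1) :=
    fun q => tsupport_mul_subset_right
  have hs2 : ∀ q : ι × Rn n, tsupport (fun x => a q.1 (x + q.2) * a q.1 x) ⊆
      {x | x + q.2 ∈ tsupport (a q.1)} := fun q => by
    refine closure_minimal (fun x hx => subset_tsupport _ (left_ne_zero_of_mul hx)) ?_
    exact (isClosed_tsupport _).preimage (continuous_id.add continuous_const)
  obtain ⟨C0, hC0, h0⟩ := exists_integral_mul_le hA fun q => (hs1 q).trans (h.supp_ball q.1)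
  obtain ⟨C1, hC1, h1⟩ := exists_nonstationary (ι := ι × {w : Rn n // w ≠ 0}) (R := 2)
    (c := c ^ 2 / 4) (by have := h.c_pos; positivity)
    (h.dbG.diffQuot.reindex fun q : ι × {w : Rn n // w ≠ 0} => (q.1, (q.2 : Rn n))) (n + 1)
    (hA.reindex fun q : ι × {w : Rn n // w ≠ 0} => (q.1, (q.2 : Rn n)))
    (fun q => (hs1 (q.1, (q.2 : Rn n))).trans (h.supp_ball q.1))
    (fun q x hx => h.le_gradSq_diffQuot q.1 q.2.2 (h.supp _ (hs1 (q.1, (q.2 : Rn n)) hx))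
      (h.supp _ (hs2 (q.1, (q.2 : Rn n)) hx)))
  refine ⟨2 ^ (n + 1) * (C0 + C1), by positivity, fun p μ hμ w => ?_⟩
  have b0 : ‖∫ t, ker G a p μ (t + w) * conj (ker G a p μ t)‖ ≤ C0 := by
    simp_rw [ker_mul_conj]
    exact h0 (p, w) _ fun x => by rw [mul_comm Complex.I, Complex.norm_exp_ofReal_mul_I]
  have b1 : ‖μ • w‖ ^ (n + 1) * ‖∫ t, ker G a p μ (t + w) * conj (ker G a p μ t)‖ ≤ C1 := by
    by_cases hw : w = 0
    · simpa [hw] using hC1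
    have hw0 : 0 < ‖w‖ := norm_pos_iff.2 hw
    have := h1 (p, ⟨w, hw⟩) (μ * ‖w‖) (by positivity)
    simp_rw [ker_mul_conj]
    rw [norm_smul, Real.norm_of_nonneg hμ.le]
    convert this using 6
    simp only
    field_simp
  set J := ‖∫ t, ker G a p μ (t + w) * conj (ker G a p μ t)‖
  have hJ : 0 ≤ J := norm_nonneg _
  rcases le_total ‖μ • w‖ 1 with h2 | h2
  · calc (1 + ‖μ • w‖) ^ (n + 1) * J ≤ (1 + 1) ^ (n + 1) * C0 := by gcongr
      _ ≤ _ := by norm_num; nlinarith [pow_pos (two_pos (α := ℝ)) (n + 1)]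
  · calc (1 + ‖μ • w‖) ^ (n + 1) * J ≤ (2 * ‖μ • w‖) ^ (n + 1) * J := by gcongr; linarith
      _ = 2 ^ (n + 1) * (‖μ • w‖ ^ (n + 1) * J) := by rw [mul_pow, mul_assoc]
      _ ≤ 2 ^ (n + 1) * C1 := by gcongr
      _ ≤ _ := by gcongr; linarith

end PhaseFam

end L2

section AssembleOsc

open scoped ComplexConjugate

lemma exists_lintegral_annulus_gaussian_le {n : ℕ} (hn : 2 ≤ n) : ∃ C : ℝ, 0 ≤ C ∧
    ∀ b : ℝ, 0 < b → ∀ ρ : ℝ,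
    ∫⁻ s : Rn n, (if ‖s‖ ∈ Icc (1 / 2 : ℝ) 2 then
      ENNReal.ofReal (Real.exp (-b * (‖s‖ - ρ) ^ 2)) else 0) ≤ ENNReal.ofReal (C / √b) := by
  have : Nonempty (Fin n) := ⟨⟨0, by omega⟩⟩
  refine ⟨n * volume.real (Metric.ball (0 : Rn n) 1) * (2 ^ (n - 1) * √Real.pi), by positivity,
    fun b hb ρ => ?_⟩
  set φ : ℝ → ℝ := (Icc (1 / 2 : ℝ) 2).indicator fun y => Real.exp (-b * (y - ρ) ^ 2)
  have hφ0 : ∀ y, 0 ≤ φ y := fun y => indicator_nonneg (fun _ _ => (Real.exp_pos _).le) y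
  have hgi : Integrable fun y : ℝ => Real.exp (-b * (y - ρ) ^ 2) :=
    (integrable_exp_neg_mul_sq hb).comp_sub_right ρ
  have hφm : Measurable φ := Measurable.indicator (by fun_prop) measurableSet_Icc
  have hle : ∀ y ∈ Ioi (0 : ℝ), y ^ (n - 1) * φ y ≤
      2 ^ (n - 1) * Real.exp (-b * (y - ρ) ^ 2) := fun y hy => by
    by_cases h : y ∈ Icc (1 / 2 : ℝ) 2
    · have hy0 : (0 : ℝ) < y := hy
      simp only [φ, indicator_of_mem h]
      gcongr
      exact h.2
    · simp only [φ, indicator_of_notMem h, mul_zero]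
      positivity
  have hint : IntegrableOn (fun y : ℝ => y ^ (n - 1) * φ y) (Ioi 0) := by
    refine Integrable.mono' (hgi.const_mul (2 ^ (n - 1))).integrableOn
      ((measurable_id.pow_const _).mul hφm).aestronglyMeasurable ?_
    filter_upwards [ae_restrict_mem measurableSet_Ioi] with y hy
    have hy0 : (0 : ℝ) < y := hy
    rw [Real.norm_of_nonneg (mul_nonneg (by positivity) (hφ0 y))]
    exact hle y hy
  have hi : Integrable (fun s : Rn n => φ ‖s‖) := by
    rw [integrable_fun_norm_addHaar]
    simpa using hint
  have h1 : ∀ s : Rn n, (if ‖s‖ ∈ Icc (1 / 2 : ℝ) 2 then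
      ENNReal.ofReal (Real.exp (-b * (‖s‖ - ρ) ^ 2)) else 0) = ENNReal.ofReal (φ ‖s‖) :=
    fun s => by
    by_cases h : ‖s‖ ∈ Icc (1 / 2 : ℝ) 2
    · simp only [φ, if_pos h, indicator_of_mem h]
    · simp only [φ, if_neg h, indicator_of_notMem h, ENNReal.ofReal_zero]
  simp_rw [h1]
  rw [← ofReal_integral_eq_lintegral_ofReal hi (Eventually.of_forall fun s => hφ0 _)]
  refine ENNReal.ofReal_le_ofReal ?_
  rw [integral_fun_norm_addHaar, finrank_euclideanSpace_fin]
  simp only [smul_eq_mul, nsmul_eq_mul]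
  rw [mul_div_assoc, mul_assoc]
  have h2 : ∫ y in Ioi (0 : ℝ), y ^ (n - 1) * φ y ≤ 2 ^ (n - 1) * √Real.pi / √b := by
    calc ∫ y in Ioi (0 : ℝ), y ^ (n - 1) * φ y
        ≤ ∫ y in Ioi (0 : ℝ), 2 ^ (n - 1) * Real.exp (-b * (y - ρ) ^ 2) :=
          setIntegral_mono_on hint (hgi.const_mul _).integrableOn measurableSet_Ioi hle
      _ ≤ ∫ y : ℝ, 2 ^ (n - 1) * Real.exp (-b * (y - ρ) ^ 2) :=
          setIntegral_le_integral (hgi.const_mul _)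
            (Eventually.of_forall fun y => by positivity)
      _ = 2 ^ (n - 1) * √Real.pi / √b := by
          rw [integral_const_mul, integral_sub_right_eq_self (fun y => Real.exp (-b * y ^ 2)) ρ,
            integral_gaussian, Real.sqrt_div Real.pi_pos.le, mul_div_assoc]
  gcongr

lemma norm_integral_gaussian_mul_cexp_le (x : ℝ) :
    ‖∫ u : ℝ, Complex.exp (Complex.I * ((u * x : ℝ) : ℂ)) * (Real.exp (-2 * u ^ 2) : ℝ)‖ ≤
      2 * Real.exp (-(x ^ 2 / 8)) := by
  have h := fourierIntegral_gaussian (b := 2) (by simp) (x : ℂ)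
  have h1 : (fun u : ℝ => Complex.exp (Complex.I * ((u * x : ℝ) : ℂ)) *
      ((Real.exp (-2 * u ^ 2) : ℝ) : ℂ)) =
      fun u : ℝ => Complex.exp (Complex.I * x * u) * Complex.exp (-2 * (u : ℂ) ^ 2) := by
    funext u
    push_cast
    ring_nf
  rw [h1, h, norm_mul]
  have h2 : (-(x : ℂ) ^ 2 / (4 * 2)) = ((-(x ^ 2 / 8) : ℝ) : ℂ) := by push_cast; ring
  have h3 : ((Real.pi : ℂ) / 2) = ((Real.pi / 2 : ℝ) : ℂ) := by push_cast; rfl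
  have h4 : (1 / 2 : ℂ) = ((1 / 2 : ℝ) : ℂ) := by push_cast; rfl
  rw [h2, ← Complex.ofReal_exp, Complex.norm_real, Real.norm_of_nonneg (Real.exp_pos _).le, h3, h4,
    ← Complex.ofReal_cpow (by positivity), Complex.norm_real, Real.norm_of_nonneg (by positivity)]
  gcongr
  calc (Real.pi / 2) ^ (1 / 2 : ℝ) ≤ 4 ^ (1 / 2 : ℝ) := by
        gcongr
        linarith [Real.pi_le_four]
    _ = 2 := by
        rw [← Real.sqrt_eq_rpow, show (4 : ℝ) = 2 ^ 2 by norm_num, Real.sqrt_sq (by norm_num)]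

namespace PhaseFam

variable {ι : Type*} {n : ℕ} {c : ℝ} {G a : ι → Rn n → ℝ} {g d : ι → ℝ → ℝ}

lemma hasCompactSupport (h : PhaseFam c G a g d) (p : ι) : HasCompactSupport (a p) :=
  (isCompact_closedBall (0 : Rn n) 2).of_isClosed_subset (isClosed_tsupport _) (h.supp_ball p)

lemma continuous_ker (h : PhaseFam c G a g d) (p : ι) :
    Continuous fun z : ℝ × Rn n => ker G a p z.1 z.2 := by
  have h1 := (h.dbG.1 p).continuous
  have h2 := (h.dba.1 p).continuous
  unfold ker
  fun_prop

lemma integrable_ker (h : PhaseFam c G a g d) (p : ι) (μ : ℝ) : Integrable (ker G a p μ) := by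
  refine ((h.continuous_ker p).comp (Continuous.prodMk_right μ)).integrable_of_hasCompactSupport ?_
  refine (h.hasCompactSupport p).mono fun x hx => ?_
  simp only [Function.comp, Function.mem_support, ker] at hx ⊢
  intro h0
  simp [h0] at hx

lemma exists_l2 (h : PhaseFam c G a g d) : ∃ C : ℝ, 0 ≤ C ∧ ∀ p, ∀ μ : ℝ, 0 < μ →
    ∀ f : Rn n → ℂ, Measurable f → (∃ M : ℝ, ∀ x, ‖f x‖ ≤ M) → Integrable f →
    ∫⁻ x, ‖cv (ker G a p μ) f x‖ₑ ^ 2 ≤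
      ENNReal.ofReal (C * (μ ^ n)⁻¹) * ∫⁻ x, ‖f x‖ₑ ^ 2 := by
  obtain ⟨D, hD, hcorr⟩ := h.exists_corr_le
  have hfin : ∫⁻ w : Rn n, ENNReal.ofReal ((1 + ‖w‖) ^ (-((n : ℝ) + 1))) < ∞ :=
    finite_integral_one_add_norm (by simp)
  set J := ∫⁻ w : Rn n, ENNReal.ofReal ((1 + ‖w‖) ^ (-((n : ℝ) + 1)))
  refine ⟨2 * D * J.toReal, by positivity, fun p μ hμ f hf hb hi => ?_⟩
  have hkm : Measurable (ker G a p μ) :=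
    ((h.continuous_ker p).comp (Continuous.prodMk_right μ)).measurable
  set m : Rn n → Rn n → ℝ≥0∞ := fun y y' =>
    ENNReal.ofReal D * ENNReal.ofReal ((1 + ‖μ • (y' - y)‖) ^ (-((n : ℝ) + 1)))
  have hJ : ∀ y, ∫⁻ y', m y y' = ENNReal.ofReal D * (ENNReal.ofReal ((μ ^ n)⁻¹) * J) := fun y => by
    simp only [m]
    rw [lintegral_const_mul' _ _ (by finiteness),
      lintegral_sub_right_eq_self
        (fun w : Rn n => ENNReal.ofReal ((1 + ‖μ • w‖) ^ (-((n : ℝ) + 1)))) y,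
      lintegral_comp_smul_Rn hμ fun w => ENNReal.ofReal ((1 + ‖w‖) ^ (-((n : ℝ) + 1)))]
  have key := lintegral_sq_le_of_schur (μ := (volume : Measure (Rn n)))
    (ν := (volume : Measure (Rn n))) (k := fun z y => ker G a p μ (z - y)) (F := f) hf
    (m := m) (A := ENNReal.ofReal D * (ENNReal.ofReal ((μ ^ n)⁻¹) * J)) ?_ ?_ ?_ ?_
    fun y _ => (hJ y).le
  · simp_rw [cv_eq]
    refine key.trans_eq ?_
    congr 1
    rw [ENNReal.ofReal_mul (by positivity), ENNReal.ofReal_mul (by positivity),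
      ENNReal.ofReal_mul (by positivity), ENNReal.ofReal_toReal hfin.ne, ENNReal.ofReal_ofNat]
    ring
  · simp only [m, Function.uncurry_def]
    fun_prop
  · intro y y'
    simp only [m]
    rw [← neg_sub, smul_neg, norm_neg]
  · have h1 : Measurable fun w : Rn n × Rn n × Rn n => (ker G a p μ (w.1 - w.2.1) * f w.2.1) *
        conj (ker G a p μ (w.1 - w.2.2) * f w.2.2) := by
      have e1 : Measurable fun w : Rn n × Rn n × Rn n => ker G a p μ (w.1 - w.2.1) :=
        hkm.comp (by fun_prop)
      have e2 : Measurable fun w : Rn n × Rn n × Rn n => ker G a p μ (w.1 - w.2.2) :=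
        hkm.comp (by fun_prop)
      have e3 : Measurable fun w : Rn n × Rn n × Rn n => f w.2.1 := hf.comp (by fun_prop)
      have e4 : Measurable fun w : Rn n × Rn n × Rn n => f w.2.2 := hf.comp (by fun_prop)
      exact (e1.mul e3).mul (Complex.continuous_conj.measurable.comp (e2.mul e4))
    obtain ⟨A0, hA0, hA⟩ := h.dba.exists_bound
    have hdom : Integrable (fun w : Rn n × Rn n × Rn n =>
        ker G a p μ (w.1 - w.2.1) * (f w.2.1 * f w.2.2)) := by
      have e0 : Integrable (fun w : Rn n × Rn n × Rn n =>
          ker G a p μ w.1 * (f w.2.1 * f w.2.2)) (volume.prod (volume.prod volume)) :=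
        (h.integrable_ker p μ).mul_prod (hi.mul_prod hi)
      have e1 : MeasurePreserving (fun w : (Rn n × Rn n) × Rn n => (w.2 - w.1.1, w.1))
          ((volume.prod volume).prod volume) (volume.prod (volume.prod volume)) := by
        have e2 : MeasurePreserving (fun w : (Rn n × Rn n) × Rn n => (w.1, w.2 - w.1.1))
            ((volume.prod volume).prod volume) ((volume.prod volume).prod volume) := by
          refine MeasurePreserving.skew_product (f := id)
            (g := fun (y : Rn n × Rn n) z => z - y.1) (MeasurePreserving.id _) ?_ ?_
          · fun_prop
          · exact Eventually.of_forall fun y => (measurePreserving_sub_right volume y.1).map_eq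
        exact Measure.measurePreserving_swap.comp e2
      have e2 := e1.comp Measure.measurePreserving_swap
      exact e2.integrable_comp_of_integrable e0
    refine (hdom.mul_const (A0 : ℂ)).mono h1.aestronglyMeasurable (Eventually.of_forall fun w => ?_)
    simp only [norm_mul, RCLike.norm_conj, norm_ker, Complex.norm_real, Real.norm_eq_abs,
      abs_of_nonneg hA0]
    have := hA p (w.1 - w.2.2)
    rw [Real.norm_eq_abs] at this
    calc |a p (w.1 - w.2.1)| * ‖f w.2.1‖ * (|a p (w.1 - w.2.2)| * ‖f w.2.2‖)
        ≤ |a p (w.1 - w.2.1)| * ‖f w.2.1‖ * (A0 * ‖f w.2.2‖) := by gcongr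
      _ = _ := by ring
  · intro y y' _ _
    have h1 : ∫ z, ker G a p μ (z - y) * conj (ker G a p μ (z - y')) =
        ∫ t, ker G a p μ (t + (y' - y)) * conj (ker G a p μ t) := by
      rw [← integral_add_right_eq_self _ y']
      congr 1
      funext t
      rw [add_sub_cancel_right, add_sub_assoc]
    rw [h1, ← ofReal_norm]
    simp only [m]
    rw [← ENNReal.ofReal_mul hD]
    refine ENNReal.ofReal_le_ofReal ?_
    have h2 := hcorr p μ hμ (y' - y)
    rw [Real.rpow_neg (by positivity), ← div_eq_mul_inv, le_div_iff₀ (by positivity), mul_comm]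
    exact_mod_cast h2

lemma exists_sq (hn : 2 ≤ n) (h : PhaseFam c G a g d) : ∃ C : ℝ, 0 ≤ C ∧ ∀ p, ∀ lam : ℝ,
    0 < lam → ∀ f : Rn n → ℂ, Measurable f → (∃ M : ℝ, ∀ x, ‖f x‖ ≤ M) → ∀ x,
    ENNReal.ofReal lam * ∫⁻ u in Icc (1 / 2 : ℝ) 4, ‖cv (ker G a p (u * lam)) f x‖ₑ ^ 2 ≤
      ENNReal.ofReal C * ∫⁻ y in Metric.closedBall x 2, ‖f y‖ₑ ^ 2 := by
  obtain ⟨C0, hC0, hgauss⟩ := exists_lintegral_annulus_gaussian_le hn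
  obtain ⟨A0, hA0, hA⟩ := h.dba.exists_bound
  have hc := h.c_pos
  set E : ℝ := Real.exp 16
  refine ⟨E ^ 2 * (2 * (2 * (C0 * (√8 / c))) * A0 ^ 2), by positivity, fun p lam hl f hf hb x => ?_⟩
  set b : ℝ := (lam * c) ^ 2 / 8
  have hb0 : 0 < b := by positivity
  have hsb : lam * (C0 / √b) = C0 * (√8 / c) := by
    have : √b = lam * c / √8 := by
      rw [Real.sqrt_div (by positivity), Real.sqrt_sq (by positivity)]
    rw [this]
    field_simp
  set F : Rn n → ℂ := fun t => (a p t : ℝ) * f (x - t)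
  have hac := (h.dba.1 p).continuous
  have hGc := (h.dbG.1 p).continuous
  have hFm : Measurable F := by
    have e1 : Measurable fun t => ((a p t : ℝ) : ℂ) :=
      (Complex.continuous_ofReal.comp hac).measurable
    exact e1.mul (hf.comp (by fun_prop))
  have hai : Integrable fun t => ((a p t : ℝ) : ℂ) :=
    (hac.integrable_of_hasCompactSupport (h.hasCompactSupport p)).ofReal
  obtain ⟨M, hM⟩ := hb
  have hFi : Integrable F := by
    refine (hai.mul_const (M : ℂ)).mono hFm.aestronglyMeasurable (Eventually.of_forall fun t => ?_)
    simp only [F, norm_mul, Complex.norm_real]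
    gcongr
    exact (hM _).trans (le_abs_self _)
  have hFsupp : ∀ t, F t ≠ 0 → ‖t‖ ∈ Icc (1 / 2 : ℝ) 2 := fun t ht =>
    h.supp p (subset_tsupport _ fun h0 => ht (by simp [F, h0]))
  set m : Rn n → Rn n → ℝ≥0∞ := fun t s => if ‖t‖ ∈ Icc (1 / 2 : ℝ) 2 then
    2 * (if ‖s‖ ∈ Icc (1 / 2 : ℝ) 2 then ENNReal.ofReal (Real.exp (-b * (‖s‖ - ‖t‖) ^ 2)) else 0)
    else 0
  set k : ℝ → Rn n → ℂ := fun u t =>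
    (Real.exp (-u ^ 2) : ℝ) * Complex.exp (Complex.I * ((u * lam * G p t : ℝ) : ℂ))
  have hkm : Measurable (Function.uncurry k) := by
    simp only [k, Function.uncurry_def]
    exact Continuous.measurable (by fun_prop)
  have hkn : ∀ u t, ‖k u t‖ = Real.exp (-u ^ 2) := fun u t => by
    simp only [k]
    rw [norm_mul, mul_comm Complex.I, Complex.norm_exp_ofReal_mul_I, mul_one, Complex.norm_real,
      Real.norm_of_nonneg (Real.exp_pos _).le]
  have hkk : ∀ u t s, k u t * conj (k u s) = Complex.exp (Complex.I *
      ((u * (lam * (G p t - G p s)) : ℝ) : ℂ)) * (Real.exp (-2 * u ^ 2) : ℝ) := fun u t s => by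
    simp only [k]
    rw [map_mul, ← Complex.exp_conj, map_mul, Complex.conj_I, Complex.conj_ofReal,
      Complex.conj_ofReal, mul_mul_mul_comm, ← Complex.exp_add, ← Complex.ofReal_mul,
      ← Real.exp_add, mul_comm]
    congr 2
    · push_cast; ring
    · congr 1; ring
  have key := lintegral_sq_le_of_schur (μ := (volume : Measure ℝ))
    (ν := (volume : Measure (Rn n))) (k := k) (F := F) hFm (m := m)
    (A := 2 * ENNReal.ofReal (C0 / √b)) ?_ ?_ ?_ ?_ ?_
  · have hF2 : ∫⁻ y, ‖F y‖ₑ ^ 2 ≤ ENNReal.ofReal (A0 ^ 2) *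
        ∫⁻ y in Metric.closedBall x 2, ‖f y‖ₑ ^ 2 := by
      rw [← lintegral_indicator Metric.isClosed_closedBall.measurableSet,
        ← lintegral_sub_left_eq_self
          ((Metric.closedBall x 2).indicator fun y => ‖f y‖ₑ ^ 2) x,
        ← lintegral_const_mul' _ _ (by finiteness)]
      refine lintegral_mono fun t => ?_
      by_cases ht : F t = 0
      · simp [ht]
      have hx : x - t ∈ Metric.closedBall x 2 := by
        simpa [dist_eq_norm] using (hFsupp t ht).2
      rw [indicator_of_mem hx]
      simp only [F, enorm_mul, mul_pow]
      gcongr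
      rw [ENNReal.ofReal_pow hA0, ← ofReal_norm, Complex.norm_real]
      gcongr
      exact hA p t
    have hcv : ∀ u ∈ Icc (1 / 2 : ℝ) 4, ‖cv (ker G a p (u * lam)) f x‖ₑ ^ 2 ≤
        ENNReal.ofReal (E ^ 2) * ‖∫ y, k u y * F y‖ₑ ^ 2 := fun u hu => by
      have h1 : ∫ y, k u y * F y = (Real.exp (-u ^ 2) : ℝ) * cv (ker G a p (u * lam)) f x := by
        rw [cv, ← integral_const_mul]
        congr 1
        funext t
        simp only [k, F, ker]
        ring
      rw [h1, enorm_mul, mul_pow, ← mul_assoc, ENNReal.ofReal_pow (by positivity), ← mul_pow,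
        ← ofReal_norm (Complex.ofReal _), Complex.norm_real,
        Real.norm_of_nonneg (Real.exp_pos _).le, ← ENNReal.ofReal_mul (by positivity),
        ← Real.exp_add]
      refine le_mul_of_one_le_left (zero_le) (one_le_pow₀ ?_)
      rw [ENNReal.one_le_ofReal]
      refine Real.one_le_exp ?_
      nlinarith [hu.1, hu.2]
    calc ENNReal.ofReal lam * ∫⁻ u in Icc (1 / 2 : ℝ) 4, ‖cv (ker G a p (u * lam)) f x‖ₑ ^ 2
        ≤ ENNReal.ofReal lam * ∫⁻ u in Icc (1 / 2 : ℝ) 4,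
            ENNReal.ofReal (E ^ 2) * ‖∫ y, k u y * F y‖ₑ ^ 2 :=
          mul_le_mul_right (setLIntegral_mono' measurableSet_Icc hcv) _
      _ ≤ ENNReal.ofReal lam * (ENNReal.ofReal (E ^ 2) * ∫⁻ u, ‖∫ y, k u y * F y‖ₑ ^ 2) := by
          rw [lintegral_const_mul' _ _ (by finiteness)]
          gcongr
          exact Measure.restrict_le_self
      _ ≤ ENNReal.ofReal lam * (ENNReal.ofReal (E ^ 2) *
            (2 * (2 * ENNReal.ofReal (C0 / √b)) * (ENNReal.ofReal (A0 ^ 2) *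
              ∫⁻ y in Metric.closedBall x 2, ‖f y‖ₑ ^ 2))) := by
          gcongr
          exact key.trans (by gcongr)
      _ = _ := by
          rw [← hsb, ENNReal.ofReal_mul (by positivity), ENNReal.ofReal_mul (by positivity),
            ENNReal.ofReal_mul (by positivity), ENNReal.ofReal_mul (by positivity),
            ENNReal.ofReal_mul (by positivity), ENNReal.ofReal_ofNat]
          ring
  · simp only [m, Function.uncurry_def]
    refine Measurable.ite (measurableSet_Icc.preimage (by fun_prop)) ?_ measurable_const
    refine Measurable.const_mul ?_ _
    exact Measurable.ite (measurableSet_Icc.preimage (by fun_prop)) (by fun_prop) measurable_const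
  · intro t s
    simp only [m]
    rw [← neg_sub ‖s‖, neg_sq]
    split_ifs <;> simp
  · have hgi : Integrable fun u : ℝ => ((Real.exp (-2 * u ^ 2) : ℝ) : ℂ) :=
      (integrable_exp_neg_mul_sq (by norm_num : (0 : ℝ) < 2)).ofReal
    refine (hgi.mul_prod (hFi.mul_prod hFi)).mono ?_ (Eventually.of_forall fun w => ?_)
    · have e1 : Measurable fun w : ℝ × Rn n × Rn n => k w.1 w.2.1 :=
        hkm.comp (g := Function.uncurry k) (f := fun w : ℝ × Rn n × Rn n => (w.1, w.2.1))
          (by fun_prop)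
      have e2 : Measurable fun w : ℝ × Rn n × Rn n => k w.1 w.2.2 :=
        hkm.comp (g := Function.uncurry k) (f := fun w : ℝ × Rn n × Rn n => (w.1, w.2.2))
          (by fun_prop)
      have e3 : Measurable fun w : ℝ × Rn n × Rn n => F w.2.1 := hFm.comp (by fun_prop)
      have e4 : Measurable fun w : ℝ × Rn n × Rn n => F w.2.2 := hFm.comp (by fun_prop)
      exact ((e1.mul e3).mul
        (Complex.continuous_conj.measurable.comp (e2.mul e4))).aestronglyMeasurable
    · simp only [norm_mul, RCLike.norm_conj, hkn, Complex.norm_real,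
        Real.norm_of_nonneg (Real.exp_pos _).le]
      rw [mul_mul_mul_comm, ← Real.exp_add]
      apply le_of_eq
      congr 2
      ring
  · intro t s ht hs
    have h1 := norm_integral_gaussian_mul_cexp_le (lam * (G p t - G p s))
    simp only [m, if_pos (hFsupp t ht), if_pos (hFsupp s hs)]
    simp_rw [hkk]
    rw [← ofReal_norm]
    refine (ENNReal.ofReal_le_ofReal (h1.trans ?_)).trans_eq (b := ENNReal.ofReal
      (2 * Real.exp (-b * (‖s‖ - ‖t‖) ^ 2)))
      (by rw [ENNReal.ofReal_mul (by norm_num), ENNReal.ofReal_ofNat])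
    gcongr
    have h2 := h.g_sub p _ (hFsupp s hs) _ (hFsupp t ht)
    rw [← h.radial p s (hFsupp s hs), ← h.radial p t (hFsupp t ht)] at h2
    have h3 : (c * (‖s‖ - ‖t‖)) ^ 2 ≤ (G p s - G p t) ^ 2 := by
      rw [← sq_abs (G p s - G p t), ← sq_abs (c * _), abs_mul, abs_of_pos hc]
      gcongr
    simp only [b]
    nlinarith [mul_le_mul_of_nonneg_left h3 (sq_nonneg lam)]
  · intro t _
    simp only [m]
    split_ifs with ht
    · rw [lintegral_const_mul' _ _ (by finiteness)]
      gcongr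
      exact hgauss b hb0 _
    · simp

/-- The rescaled oscillatory kernels are admissible, uniformly in the family. -/
lemma exists_oscKernel (hn : 2 ≤ n) (h : PhaseFam c G a g d) : ∃ C : ℝ, ∀ p, ∀ lam : ℝ, 1 ≤ lam →
    OscKernel 0 lam C fun u t => ker G a p (u * lam) t := by
  obtain ⟨C1, hC1, hl2⟩ := h.exists_l2
  obtain ⟨C2, hC2, hsq⟩ := h.exists_sq hn
  obtain ⟨A0, hA0, hA⟩ := h.dba.exists_bound
  obtain ⟨A1, hA1, hA'⟩ := h.dba.exists_lip
  obtain ⟨B1, hB1, hB⟩ := h.dbG.exists_lip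
  refine ⟨C1 * 2 ^ n + 2 ^ n * C2 + A0 + (4 * B1 * A0 + A1), fun p lam hl => ?_⟩
  have hl0 : 0 < lam := by linarith
  set C := C1 * 2 ^ n + 2 ^ n * C2 + A0 + (4 * B1 * A0 + A1)
  have i1 : 0 ≤ C1 * 2 ^ n := by positivity
  have i2 : 0 ≤ 2 ^ n * C2 := by positivity
  have i3 : 0 ≤ 4 * B1 * A0 := by positivity
  refine ⟨by positivity, hl, ?_, fun u t ht => ?_, fun u hu t => ?_, fun u hu t t' => ?_,
    fun u hu => h.mean p _, fun u hu f hf hb hi => ?_, fun f hf hb x => ?_⟩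
  · exact (h.continuous_ker p).comp (f := fun z : ℝ × Rn n => (z.1 * lam, z.2)) (by fun_prop)
  · have h0 : a p t = 0 := by
      by_contra h0
      have := h.supp_ball p (subset_tsupport _ h0)
      simp at this ht
      linarith
    simp [ker, h0]
  · rw [norm_ker, zero_mul, neg_zero, zpow_zero, mul_one]
    exact (hA p t).trans (by simp only [C]; linarith)
  · rw [zero_mul, neg_zero, zpow_zero, mul_one]
    have e1 : ker G a p (u * lam) t - ker G a p (u * lam) t' =
        (Complex.exp (Complex.I * ((u * lam * G p t : ℝ) : ℂ)) -
          Complex.exp (Complex.I * ((u * lam * G p t' : ℝ) : ℂ))) * (a p t : ℝ) +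
        Complex.exp (Complex.I * ((u * lam * G p t' : ℝ) : ℂ)) * ((a p t - a p t' : ℝ) : ℂ) := by
      simp only [ker]
      push_cast
      ring
    have e2 : ‖Complex.exp (Complex.I * ((u * lam * G p t : ℝ) : ℂ)) -
          Complex.exp (Complex.I * ((u * lam * G p t' : ℝ) : ℂ))‖ ≤
        4 * lam * (B1 * ‖t - t'‖) := by
      have e3 : Complex.exp (Complex.I * ((u * lam * G p t : ℝ) : ℂ)) =
          Complex.exp (Complex.I * ((u * lam * (G p t - G p t') : ℝ) : ℂ)) *
          Complex.exp (Complex.I * ((u * lam * G p t' : ℝ) : ℂ)) := by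
        rw [← Complex.exp_add]
        congr 1
        push_cast
        ring
      rw [e3, ← sub_one_mul, norm_mul, mul_comm Complex.I ((u * lam * G p t' : ℝ) : ℂ),
        Complex.norm_exp_ofReal_mul_I, mul_one]
      refine (Real.norm_exp_I_mul_ofReal_sub_one_le).trans ?_
      rw [norm_mul, Real.norm_of_nonneg (by nlinarith [hu.1])]
      gcongr
      · exact hu.2
      · exact hB p t t'
    rw [e1]
    refine (norm_add_le _ _).trans ?_
    have e4 : ‖Complex.exp (Complex.I * ((u * lam * G p t' : ℝ) : ℂ))‖ = 1 := by
      rw [mul_comm, Complex.norm_exp_ofReal_mul_I]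
    rw [norm_mul, norm_mul, e4, one_mul, Complex.norm_real, Complex.norm_real]
    calc _ ≤ 4 * lam * (B1 * ‖t - t'‖) * A0 + A1 * ‖t - t'‖ :=
          add_le_add (mul_le_mul e2 (hA p t) (norm_nonneg _) (by positivity)) (hA' p t t')
      _ ≤ 4 * lam * (B1 * ‖t - t'‖) * A0 + A1 * lam * ‖t - t'‖ := by
          gcongr
          exact le_mul_of_one_le_right hA1 hl
      _ = (4 * B1 * A0 + A1) * lam * ‖t - t'‖ := by ring
      _ ≤ C * lam * ‖t - t'‖ := by
          gcongr
          simp only [C]; linarith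
  · have hu0 : 0 < u := by linarith [hu.1]
    refine (hl2 p (u * lam) (by positivity) f hf hb hi).trans ?_
    gcongr
    rw [ENNReal.ofReal_rpow_of_pos hl0, ← ENNReal.ofReal_mul (by positivity)]
    refine ENNReal.ofReal_le_ofReal ?_
    rw [Real.rpow_neg hl0.le, Real.rpow_natCast]
    calc C1 * ((u * lam) ^ n)⁻¹ ≤ C1 * ((2⁻¹ * lam) ^ n)⁻¹ := by
          gcongr
          linarith [hu.1]
      _ = C1 * 2 ^ n * (lam ^ n)⁻¹ := by
          rw [mul_pow, mul_inv, inv_pow, inv_inv, mul_assoc]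
      _ ≤ C * (lam ^ n)⁻¹ := by
          gcongr
          simp only [C]; linarith
  · refine (hsq p lam hl0 f hf hb x).trans ?_
    rw [ballAvg, zero_add, zpow_one, ← mul_assoc]
    gcongr
    rw [tp_eq_ofReal, ← ENNReal.ofReal_mul (by positivity)]
    refine ENNReal.ofReal_le_ofReal ?_
    have : (2 : ℝ) ^ (-(((1 : ℤ) : ℝ) * (n : ℝ))) = (2 ^ n)⁻¹ := by
      rw [Int.cast_one, one_mul, Real.rpow_neg (by norm_num), Real.rpow_natCast]
    rw [this, ← div_eq_mul_inv, le_div_iff₀ (by positivity), mul_comm]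
    simp only [C]; linarith

end PhaseFam

end AssembleOsc

namespace IsGammaU

variable {Γ : ℝ → ℝ}

lemma strictMonoOn (h : IsGammaU Γ) : StrictMonoOn Γ (Ici 0) :=
  strictMonoOn_of_deriv_pos (convex_Ici 0) h.continuousOn fun s hs =>
    h.deriv_pos s (by simpa using hs)

lemma pos (h : IsGammaU Γ) {s : ℝ} (hs : 0 < s) : 0 < Γ s := by
  have := h.strictMonoOn (mem_Ici.2 le_rfl) (mem_Ici.2 hs.le) hs
  rwa [h.map_zero] at this

lemma differentiableAt (h : IsGammaU Γ) {s : ℝ} (hs : 0 < s) : DifferentiableAt ℝ Γ s :=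
  (h.smooth.contDiffAt (Ioi_mem_nhds hs)).differentiableAt (by simp)

lemma exists_log_deriv (h : IsGammaU Γ) : ∃ c₁ > 0, ∃ c₂ > 0, ∀ s > 0,
    c₁ * Γ s ≤ s * deriv Γ s ∧ s * deriv Γ s ≤ c₂ * Γ s := by
  obtain ⟨c₁, h1, h1'⟩ := h.lower 1 (by simp)
  obtain ⟨c₂, h2, h2'⟩ := h.upper 1 le_rfl
  refine ⟨c₁, h1, c₂, h2, fun s hs => ?_⟩
  have e1 := h1' s hs
  have e2 := h2' s hs
  have e3 : 0 < s ^ 1 * iteratedDeriv 1 Γ s / Γ s := by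
    rw [iteratedDeriv_one]
    exact div_pos (mul_pos (by simpa using hs) (h.deriv_pos s hs)) (h.pos hs)
  rw [abs_of_pos e3, iteratedDeriv_one, pow_one] at e1 e2
  exact ⟨(le_div_iff₀ (h.pos hs)).1 e1, (div_le_iff₀ (h.pos hs)).1 e2⟩

lemma hasDerivAt_mul_rpow (h : IsGammaU Γ) (c : ℝ) {s : ℝ} (hs : 0 < s) :
    HasDerivAt (fun s => Γ s * s ^ (-c)) ((s * deriv Γ s - c * Γ s) * s ^ (-c - 1)) s := by
  refine ((h.differentiableAt hs).hasDerivAt.mul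
    (Real.hasDerivAt_rpow_const (p := -c) (Or.inl hs.ne'))).congr_deriv ?_
  rw [Real.rpow_sub_one hs.ne']
  field_simp
  ring

lemma rpow_mul_le (h : IsGammaU Γ) {c : ℝ} (hc : ∀ s > 0, c * Γ s ≤ s * deriv Γ s) {R ρ : ℝ}
    (hR : 0 < R) (hρ : 1 ≤ ρ) : ρ ^ c * Γ R ≤ Γ (ρ * R) := by
  have hρ0 : 0 < ρ := by linarith
  have hm : MonotoneOn (fun s => Γ s * s ^ (-c)) (Ioi 0) := by
    refine monotoneOn_of_deriv_nonneg (convex_Ioi 0)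
      (fun s hs => (h.hasDerivAt_mul_rpow c hs).continuousAt.continuousWithinAt)
      (fun s hs => ?_) fun s hs => ?_
    all_goals rw [interior_Ioi] at hs
    · exact (h.hasDerivAt_mul_rpow c hs).differentiableAt.differentiableWithinAt
    · rw [(h.hasDerivAt_mul_rpow c hs).deriv]
      exact mul_nonneg (by linarith [hc s hs]) (Real.rpow_nonneg (le_of_lt hs) _)
  have h1 := hm (mem_Ioi.2 hR) (mem_Ioi.2 (by positivity : 0 < ρ * R))
    (le_mul_of_one_le_left hR.le hρ)
  simp only at h1
  rw [Real.mul_rpow hρ0.le hR.le, Real.rpow_neg hρ0.le, ← mul_assoc] at h1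
  have h2 := le_of_mul_le_mul_right h1 (Real.rpow_pos_of_pos hR _)
  rwa [← div_eq_mul_inv, le_div_iff₀ (by positivity), mul_comm] at h2

lemma le_rpow_mul (h : IsGammaU Γ) {c : ℝ} (hc : ∀ s > 0, s * deriv Γ s ≤ c * Γ s) {R ρ : ℝ}
    (hR : 0 < R) (hρ : 1 ≤ ρ) : Γ (ρ * R) ≤ ρ ^ c * Γ R := by
  have hρ0 : 0 < ρ := by linarith
  have hm : AntitoneOn (fun s => Γ s * s ^ (-c)) (Ioi 0) := by
    refine antitoneOn_of_deriv_nonpos (convex_Ioi 0)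
      (fun s hs => (h.hasDerivAt_mul_rpow c hs).continuousAt.continuousWithinAt)
      (fun s hs => ?_) fun s hs => ?_
    all_goals rw [interior_Ioi] at hs
    · exact (h.hasDerivAt_mul_rpow c hs).differentiableAt.differentiableWithinAt
    · rw [(h.hasDerivAt_mul_rpow c hs).deriv]
      exact mul_nonpos_of_nonpos_of_nonneg (by linarith [hc s hs])
        (Real.rpow_nonneg (le_of_lt hs) _)
  have h1 := hm (mem_Ioi.2 hR) (mem_Ioi.2 (by positivity : 0 < ρ * R))
    (le_mul_of_one_le_left hR.le hρ)
  simp only at h1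
  rw [Real.mul_rpow hρ0.le hR.le, Real.rpow_neg hρ0.le, ← mul_assoc] at h1
  have h2 := le_of_mul_le_mul_right h1 (Real.rpow_pos_of_pos hR _)
  rwa [← div_eq_mul_inv, div_le_iff₀ (by positivity), mul_comm (Γ R)] at h2

section Kstar

variable {c₁ c₂ : ℝ}

lemma bddAbove_kstar (h : IsGammaU Γ) (hc₁ : 0 < c₁) (h1 : ∀ s > 0, c₁ * Γ s ≤ s * deriv Γ s)
    (j : ℤ) : BddAbove {m : ℤ | (2 : ℝ) ^ j * Γ ((2 : ℝ) ^ m) ≤ 1} := by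
  have hΓ := h.pos one_pos
  have ht : Tendsto (fun m : ℕ => (2 : ℝ) ^ j * Γ 1 * ((2 : ℝ) ^ c₁) ^ m) atTop atTop :=
    (tendsto_pow_atTop_atTop_of_one_lt (Real.one_lt_rpow one_lt_two hc₁)).const_mul_atTop
      (by positivity)
  obtain ⟨M, hM⟩ := (ht.eventually_gt_atTop 1).exists
  refine ⟨M, fun m hm => ?_⟩
  by_contra! hlt
  have e1 := h.rpow_mul_le h1 one_pos (ρ := (2 : ℝ) ^ M) (one_le_pow₀ one_le_two)
  have e2 : Γ ((2 : ℝ) ^ M * 1) ≤ Γ ((2 : ℝ) ^ m) := by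
    refine h.strictMonoOn.monotoneOn (by simp) (mem_Ici.2 (by positivity)) ?_
    rw [mul_one, ← zpow_natCast]
    exact zpow_le_zpow_right₀ one_le_two hlt.le
  have e3 : ((2 : ℝ) ^ M) ^ c₁ = ((2 : ℝ) ^ c₁) ^ M := by
    rw [← Real.rpow_natCast, ← Real.rpow_mul (by norm_num), ← Real.rpow_natCast,
      ← Real.rpow_mul (by norm_num), mul_comm]
  have e4 : (2 : ℝ) ^ j * Γ ((2 : ℝ) ^ m) ≤ 1 := hm
  rw [e3] at e1
  have : (2 : ℝ) ^ j * (((2 : ℝ) ^ c₁) ^ M * Γ 1) ≤ (2 : ℝ) ^ j * Γ ((2 : ℝ) ^ m) := by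
    gcongr
    exact e1.trans e2
  nlinarith

lemma nonempty_kstar (h : IsGammaU Γ) (hc₁ : 0 < c₁) (h1 : ∀ s > 0, c₁ * Γ s ≤ s * deriv Γ s)
    (j : ℤ) : {m : ℤ | (2 : ℝ) ^ j * Γ ((2 : ℝ) ^ m) ≤ 1}.Nonempty := by
  have hΓ := h.pos one_pos
  obtain ⟨M, hM⟩ := ((tendsto_pow_atTop_atTop_of_one_lt
    (Real.one_lt_rpow one_lt_two hc₁)).eventually_ge_atTop ((2 : ℝ) ^ j * Γ 1)).exists
  refine ⟨-M, ?_⟩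
  have e1 := h.rpow_mul_le h1 (R := (2 : ℝ) ^ (-(M : ℤ))) (by positivity) (ρ := (2 : ℝ) ^ M)
    (one_le_pow₀ one_le_two)
  have e3 : ((2 : ℝ) ^ M) ^ c₁ = ((2 : ℝ) ^ c₁) ^ M := by
    rw [← Real.rpow_natCast, ← Real.rpow_mul (by norm_num), ← Real.rpow_natCast,
      ← Real.rpow_mul (by norm_num), mul_comm]
  rw [e3, zpow_neg, zpow_natCast, mul_inv_cancel₀ (by positivity)] at e1
  rw [mem_ofPred_eq, zpow_neg, zpow_natCast]
  have hp : 0 < ((2 : ℝ) ^ c₁) ^ M := by positivity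
  refine le_of_mul_le_mul_left ?_ hp
  calc ((2 : ℝ) ^ c₁) ^ M * ((2 : ℝ) ^ j * Γ ((2 : ℝ) ^ M)⁻¹)
      = (2 : ℝ) ^ j * (((2 : ℝ) ^ c₁) ^ M * Γ ((2 : ℝ) ^ M)⁻¹) := by ring
    _ ≤ (2 : ℝ) ^ j * Γ 1 := by gcongr
    _ ≤ _ := by rw [mul_one]; exact hM

lemma mul_kstar_le (h : IsGammaU Γ) (hc₁ : 0 < c₁) (h1 : ∀ s > 0, c₁ * Γ s ≤ s * deriv Γ s)
    (j : ℤ) : (2 : ℝ) ^ j * Γ ((2 : ℝ) ^ kstar Γ j) ≤ 1 :=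
  Int.csSup_mem (h.nonempty_kstar hc₁ h1 j) (h.bddAbove_kstar hc₁ h1 j)

lemma lt_mul_kstar (h : IsGammaU Γ) (hc₁ : 0 < c₁) (h1 : ∀ s > 0, c₁ * Γ s ≤ s * deriv Γ s)
    (h2 : ∀ s > 0, s * deriv Γ s ≤ c₂ * Γ s) (j : ℤ) :
    1 < (2 : ℝ) ^ c₂ * ((2 : ℝ) ^ j * Γ ((2 : ℝ) ^ kstar Γ j)) := by
  have e1 : kstar Γ j + 1 ∉ {m : ℤ | (2 : ℝ) ^ j * Γ ((2 : ℝ) ^ m) ≤ 1} := fun hm => by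
    have : kstar Γ j + 1 ≤ kstar Γ j := le_csSup (h.bddAbove_kstar hc₁ h1 j) hm
    omega
  rw [mem_ofPred_eq, not_le] at e1
  refine e1.trans_le ?_
  rw [mul_left_comm, zpow_add_one₀ two_ne_zero, mul_comm _ (2 : ℝ)]
  gcongr
  exact h.le_rpow_mul h2 (by positivity) one_le_two

/-- The normalized size of the phase `2^j Γ` on the scale `2^{l + j_*}`. -/
lemma rpow_le_phase (h : IsGammaU Γ) (hc₁ : 0 < c₁) (h1 : ∀ s > 0, c₁ * Γ s ≤ s * deriv Γ s)
    (h2 : ∀ s > 0, s * deriv Γ s ≤ c₂ * Γ s) {l : ℤ} (hl : 1 ≤ l) (j : ℤ) :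
    (2 : ℝ) ^ (c₁ * l) ≤ (2 : ℝ) ^ c₂ * ((2 : ℝ) ^ j * Γ ((2 : ℝ) ^ (l + kstar Γ j))) := by
  have e1 := h.rpow_mul_le h1 (R := (2 : ℝ) ^ kstar Γ j) (by positivity) (ρ := (2 : ℝ) ^ l)
    (one_le_zpow₀ one_le_two (by omega))
  rw [← zpow_add₀ two_ne_zero, ← Real.rpow_intCast, ← Real.rpow_mul (by norm_num),
    mul_comm (l : ℝ)] at e1
  calc (2 : ℝ) ^ (c₁ * l) = (2 : ℝ) ^ (c₁ * l) * 1 := (mul_one _).symm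
    _ ≤ (2 : ℝ) ^ (c₁ * l) * ((2 : ℝ) ^ c₂ * ((2 : ℝ) ^ j * Γ ((2 : ℝ) ^ kstar Γ j))) := by
        gcongr
        exact (h.lt_mul_kstar hc₁ h1 h2 j).le
    _ = (2 : ℝ) ^ c₂ * ((2 : ℝ) ^ j * ((2 : ℝ) ^ (c₁ * l) * Γ ((2 : ℝ) ^ kstar Γ j))) := by ring
    _ ≤ _ := by gcongr

lemma encard_kstar_le (h : IsGammaU Γ) (hc₁ : 0 < c₁) (h1 : ∀ s > 0, c₁ * Γ s ≤ s * deriv Γ s)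
    (h2 : ∀ s > 0, s * deriv Γ s ≤ c₂ * Γ s) (l m : ℤ) :
    {j : ℤ | l + kstar Γ j = m}.encard ≤ ((2 * ⌈c₂⌉₊ + 1 : ℕ) : ℕ∞) := by
  rcases {j : ℤ | l + kstar Γ j = m}.eq_empty_or_nonempty with h0 | ⟨j₀, hj₀⟩
  · simp [h0]
  have key : ∀ i j : ℤ, kstar Γ i = kstar Γ j → i ≤ j + ⌈c₂⌉₊ := fun i j hij => by
    have e1 := h.mul_kstar_le hc₁ h1 i
    have e2 := h.lt_mul_kstar hc₁ h1 h2 j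
    rw [hij] at e1
    have hΓ : 0 < Γ ((2 : ℝ) ^ kstar Γ j) := h.pos (by positivity)
    have e3 := e1.trans_lt e2
    rw [← mul_assoc] at e3
    have e4 := lt_of_mul_lt_mul_right e3 hΓ.le
    rw [← Real.rpow_intCast, ← Real.rpow_intCast, ← Real.rpow_add two_pos,
      Real.rpow_lt_rpow_left_iff one_lt_two] at e4
    have e5 := Nat.le_ceil c₂
    have e6 : (i : ℝ) < ((j + ⌈c₂⌉₊ : ℤ) : ℝ) := by push_cast; linarith
    exact (Int.cast_lt.1 e6).le
  have hsub : {j : ℤ | l + kstar Γ j = m} ⊆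
      (Finset.Icc (j₀ - ⌈c₂⌉₊) (j₀ + ⌈c₂⌉₊) : Finset ℤ) := fun j hj => by
    simp only [mem_ofPred_eq] at hj hj₀
    have hjj : kstar Γ j = kstar Γ j₀ := by omega
    have := key j j₀ hjj
    have := key j₀ j hjj.symm
    simp only [Finset.coe_Icc, mem_Icc]
    omega
  refine (encard_le_encard hsub).trans ?_
  rw [encard_coe_eq_coe_finsetCard, Int.card_Icc]
  exact_mod_cast le_of_eq (by omega)

end Kstar

end IsGammaU

section PhaseConstruction

lemma integral_norm_mul_homogeneous_eq_zero {n : ℕ} {Ω : Rn n → ℝ}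
    (hΩ : ∀ c : ℝ, 0 < c → ∀ t : Rn n, Ω (c • t) = Ω t)
    (h0 : ∫ θ : Metric.sphere (0 : Rn n) 1, Ω θ ∂((volume : Measure (Rn n)).toSphere) = 0)
    (hn : 2 ≤ n) (φ : ℝ → ℂ) : ∫ s : Rn n, φ ‖s‖ * (Ω s : ℝ) = 0 := by
  have : Nonempty (Fin n) := ⟨⟨0, by omega⟩⟩
  calc ∫ s : Rn n, φ ‖s‖ * (Ω s : ℝ)
      = ∫ s : ({(0)}ᶜ : Set (Rn n)), φ ‖s.1‖ * (Ω s.1 : ℝ)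
          ∂((volume : Measure (Rn n)).comap Subtype.val) := by
        rw [integral_subtype_comap (measurableSet_singleton _).compl
          fun s : Rn n => φ ‖s‖ * (Ω s : ℝ), restrict_compl_singleton]
    _ = ∫ z : Metric.sphere (0 : Rn n) 1 × Ioi (0 : ℝ), (Ω z.1 : ℂ) * φ z.2
          ∂(volume : Measure (Rn n)).toSphere.prod (.volumeIoiPow (Module.finrank ℝ (Rn n) - 1)) := by
        rw [← (volume : Measure (Rn n)).measurePreserving_homeomorphUnitSphereProd.integral_comp
          (Homeomorph.measurableEmbedding _)
          (fun z : Metric.sphere (0 : Rn n) 1 × Ioi (0 : ℝ) => (Ω z.1 : ℂ) * φ z.2)]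
        congr 1
        funext s
        have hs : 0 < ‖s.1‖⁻¹ := by
          have : s.1 ≠ 0 := s.2
          positivity
        simp [mul_comm, hΩ _ hs]
    _ = 0 := by
        rw [integral_prod_mul (fun z : Metric.sphere (0 : Rn n) 1 => (Ω z : ℂ))
          (fun z : Ioi (0 : ℝ) => φ z), integral_complex_ofReal, h0, Complex.ofReal_zero, zero_mul]

lemma iteratedDeriv_scaled (Γ : ℝ → ℝ) (η R : ℝ) (j : ℕ) :
    iteratedDeriv j (fun ρ => η * (Γ (R * ρ) / Γ R)) =
      fun ρ => η * (R ^ j * iteratedDeriv j Γ (R * ρ) / Γ R) := by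
  induction j with
  | zero => simp
  | succ j ih =>
    rw [iteratedDeriv_succ, ih]
    funext ρ
    rw [deriv_const_mul_field, deriv_div_const, deriv_const_mul_field, iteratedDeriv_succ,
      deriv_comp_mul_left R (iteratedDeriv j Γ) ρ, smul_eq_mul]
    ring

namespace IsGammaU

variable {Γ : ℝ → ℝ}

lemma exists_ratio_bound (h : IsGammaU Γ) : ∃ b > 0, ∃ B > 0, ∀ R > 0, ∀ ρ ∈ Icc (1 / 8 : ℝ) 8,
    b ≤ Γ (R * ρ) / Γ R ∧ Γ (R * ρ) / Γ R ≤ B := by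
  obtain ⟨c₁, hc₁, c₂, hc₂, hc⟩ := h.exists_log_deriv
  refine ⟨((8 : ℝ) ^ c₂)⁻¹, by positivity, (8 : ℝ) ^ c₂, by positivity, fun R hR ρ hρ => ?_⟩
  have hρ0 : 0 < ρ := by linarith [hρ.1]
  have hm := h.strictMonoOn.monotoneOn
  have hΓR := h.pos hR
  constructor
  · have e1 := h.le_rpow_mul (fun s hs => (hc s hs).2) (R := R * ρ) (by positivity)
      (ρ := 8) (by norm_num)
    have e2 : Γ R ≤ Γ (8 * (R * ρ)) :=
      hm (mem_Ici.2 hR.le) (mem_Ici.2 (by positivity)) (by nlinarith [hρ.1])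
    rw [le_div_iff₀ hΓR, inv_mul_le_iff₀ (by positivity)]
    exact e2.trans e1
  · have e1 := h.le_rpow_mul (fun s hs => (hc s hs).2) (R := R) hR (ρ := 8) (by norm_num)
    have e2 : Γ (R * ρ) ≤ Γ (8 * R) :=
      hm (mem_Ici.2 (by positivity)) (mem_Ici.2 (by positivity)) (by nlinarith [hρ.2])
    rw [div_le_iff₀ hΓR]
    exact e2.trans e1

lemma exists_iteratedDeriv_bound (h : IsGammaU Γ) (η : ℝ) (j : ℕ) : ∃ A : ℝ, 0 ≤ A ∧
    ∀ R > 0, ∀ ρ ∈ Icc (1 / 8 : ℝ) 8,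
      |iteratedDeriv j (fun ρ => η * (Γ (R * ρ) / Γ R)) ρ| ≤ A := by
  obtain ⟨b, hb, B, hB, hr⟩ := h.exists_ratio_bound
  rcases Nat.eq_zero_or_pos j with rfl | hj
  · refine ⟨|η| * B, by positivity, fun R hR ρ hρ => ?_⟩
    rw [iteratedDeriv_zero, abs_mul]
    gcongr
    rw [abs_of_nonneg (hb.le.trans (hr R hR ρ hρ).1)]
    exact (hr R hR ρ hρ).2
  · obtain ⟨C, hC, hC'⟩ := h.upper j hj
    refine ⟨|η| * (8 ^ j * C * B), by positivity, fun R hR ρ hρ => ?_⟩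
    have hρ0 : 0 < ρ := by linarith [hρ.1]
    have hΓ := h.pos (s := R * ρ) (by positivity)
    have hΓR := h.pos hR
    rw [iteratedDeriv_scaled]
    have e1 : R ^ j * iteratedDeriv j Γ (R * ρ) / Γ R =
        ρ⁻¹ ^ j * ((R * ρ) ^ j * iteratedDeriv j Γ (R * ρ) / Γ (R * ρ)) *
          (Γ (R * ρ) / Γ R) := by
      rw [mul_pow, inv_pow]
      field_simp
    rw [abs_mul, e1, abs_mul, abs_mul, abs_of_pos (pow_pos (inv_pos.2 hρ0) j),
      abs_of_nonneg (hb.le.trans (hr R hR ρ hρ).1)]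
    gcongr
    · rw [inv_le_comm₀ hρ0 (by norm_num)]
      linarith [hρ.1]
    · exact hC' _ (by positivity)
    · exact (hr R hR ρ hρ).2

lemma contDiffOn_scaled (h : IsGammaU Γ) (η : ℝ) {R : ℝ} (hR : 0 < R) :
    ContDiffOn ℝ (⊤ : ℕ∞) (fun ρ => η * (Γ (R * ρ) / Γ R)) (Ioi 0) := by
  refine contDiffOn_const.mul (ContDiffOn.div_const ?_ _)
  exact h.smooth.comp (contDiffOn_const.mul contDiffOn_id) fun ρ hρ => mul_pos hR hρ

lemma db_profile (h : IsGammaU Γ) {θ : ℝ → ℝ} (hθ : ContDiff ℝ (⊤ : ℕ∞) θ)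
    (hs : tsupport θ ⊆ Icc (1 / 8) 8) (η : ℝ) :
    DB fun (R : {R : ℝ // 0 < R}) ρ => θ ρ * (η * (Γ (R * ρ) / Γ R)) := by
  have hpos : tsupport θ ⊆ Ioi 0 := fun x hx => by
    have := (hs hx).1
    simp only [mem_Ioi]; linarith
  refine ⟨fun R => contDiff_mul_of_tsupport_subset isOpen_Ioi hθ hpos
    (h.contDiffOn_scaled η R.2), fun N => ?_⟩
  choose A hA0 hA using h.exists_iteratedDeriv_bound η
  have hcs : HasCompactSupport θ := isCompact_Icc.of_isClosed_subset (isClosed_tsupport _) hs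
  choose B hB using (DB.of_hasCompactSupport (ι := Unit) hθ hcs).2
  refine ⟨∑ i ∈ Finset.range (N + 1), (N.choose i : ℝ) * |B i| * A (N - i), fun R x => ?_⟩
  by_cases hx : x ∈ tsupport θ
  · have hx0 := hpos hx
    rw [← iteratedFDerivWithin_of_isOpen N isOpen_Ioi hx0]
    refine (norm_iteratedFDerivWithin_mul_le hθ.contDiffOn (h.contDiffOn_scaled η R.2)
      isOpen_Ioi.uniqueDiffOn hx0 (DB.le_infty N)).trans ?_
    refine Finset.sum_le_sum fun i _ => ?_
    rw [iteratedFDerivWithin_of_isOpen _ isOpen_Ioi hx0,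
      iteratedFDerivWithin_of_isOpen _ isOpen_Ioi hx0, norm_iteratedFDeriv_eq_norm_iteratedDeriv
        (f := fun ρ => η * (Γ (R * ρ) / Γ R))]
    gcongr
    · exact (hB i () x).trans (le_abs_self _)
    · exact hA _ R R.2 x (hs hx)
  · have h0 : iteratedFDeriv ℝ N (fun ρ => θ ρ * (η * (Γ (R * ρ) / Γ R))) x = 0 := by
      by_contra hne
      exact hx (tsupport_mul_subset_left (support_iteratedFDeriv_subset N hne))
    rw [h0, norm_zero]
    exact Finset.sum_nonneg fun i _ => by have := hA0 (N - i); positivity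

end IsGammaU

lemma exists_norm_cutoff (n : ℕ) : ∃ θ : Rn n → ℝ, ContDiff ℝ (⊤ : ℕ∞) θ ∧ HasCompactSupport θ ∧
    tsupport θ ⊆ {s | s ≠ 0} ∧ ∀ s, ‖s‖ ∈ Icc (1 / 4 : ℝ) 4 → θ s = 1 := by
  obtain ⟨θ, h1, h2, h3⟩ := exists_smooth_cutoff (a := 1 / 16) (b := 16) (δ := 1 / 32)
    (by norm_num) (by norm_num)
  have hsub : tsupport (fun s : Rn n => θ (‖s‖ ^ 2)) ⊆ {s | ‖s‖ ^ 2 ∈ Icc (1 / 32 : ℝ) 17} := by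
    refine closure_minimal (fun s hs => ?_) (isClosed_Icc.preimage (by fun_prop))
    have := h3 (subset_tsupport _ hs)
    exact ⟨by linarith [this.1], by linarith [this.2]⟩
  refine ⟨fun s => θ (‖s‖ ^ 2), h1.comp (contDiff_norm_sq ℝ), ?_, fun s hs h0 => ?_,
    fun s hs => h2 _ ⟨?_, ?_⟩⟩
  · refine (isCompact_closedBall (0 : Rn n) 5).of_isClosed_subset (isClosed_tsupport _)
      fun s hs => ?_
    have := (hsub hs).2
    rw [mem_closedBall_zero_iff]
    nlinarith [norm_nonneg s]
  · have := (hsub hs).1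
    norm_num [h0] at this
  · nlinarith [hs.1]
  · nlinarith [hs.1, hs.2]

lemma hasFDerivAt_norm_single {n : ℕ} {s : Rn n} (hs : s ≠ 0) : ∃ N : Rn n →L[ℝ] ℝ,
    HasFDerivAt (fun s : Rn n => ‖s‖) N s ∧
      ∀ i, N (EuclideanSpace.single i 1) = s i / ‖s‖ := by
  have h1 : DifferentiableAt ℝ (fun s : Rn n => ‖s‖) s :=
    (contDiffAt_norm ℝ hs (n := 1)).differentiableAt (by simp)
  refine ⟨_, h1.hasFDerivAt, fun i => ?_⟩
  have hs0 : 0 < ‖s‖ := norm_pos_iff.2 hs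
  have h2 := (h1.hasFDerivAt.pow 2).fderiv
  rw [fderiv_norm_sq_apply] at h2
  have h3 := DFunLike.congr_fun h2 (EuclideanSpace.single i (1 : ℝ))
  rw [eq_div_iff hs0.ne']
  simp [EuclideanSpace.inner_single_right] at h3
  linarith

/-- The amplitude `ψ(‖s‖) K(s)`. -/
lemma exists_amplitude {n : ℕ} {K : Rn n → ℝ} (hK : IsHomCZKernel n K) {ψ : ℝ → ℝ}
    (hψ : IsLPCutoff ψ) : ContDiff ℝ (⊤ : ℕ∞) (fun s : Rn n => ψ ‖s‖ * K s) ∧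
      HasCompactSupport (fun s : Rn n => ψ ‖s‖ * K s) ∧
      tsupport (fun s : Rn n => ψ ‖s‖ * K s) ⊆ {s | ‖s‖ ∈ Icc (1 / 2 : ℝ) 2} := by
  obtain ⟨Ω, hΩ, -, -, hKΩ⟩ := hK
  obtain ⟨θ, h1, h2, h3, h4⟩ := exists_norm_cutoff n
  have hsub : tsupport (fun s : Rn n => ψ ‖s‖ * K s) ⊆ {s | ‖s‖ ∈ Icc (1 / 2 : ℝ) 2} := by
    refine closure_minimal (fun s hs => ?_) (isClosed_Icc.preimage continuous_norm)
    simpa using hψ.2.2.1 _ (left_ne_zero_of_mul hs)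
  have heq : (fun s : Rn n => ψ ‖s‖ * K s) = fun s => θ s * (ψ ‖s‖ * (Ω s / ‖s‖ ^ n)) := by
    funext s
    by_cases hs : ψ ‖s‖ = 0
    · simp [hs]
    have hs' := hψ.2.2.1 _ hs
    rw [abs_norm] at hs'
    have hs0 : s ≠ 0 := norm_pos_iff.1 (by linarith [hs'.1])
    rw [h4 s ⟨by linarith [hs'.1], by linarith [hs'.2]⟩, one_mul, hKΩ s hs0]
  refine ⟨?_, ?_, hsub⟩
  · rw [heq]
    refine contDiff_mul_of_tsupport_subset isOpen_ne h1 h3 ?_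
    have hnorm : ContDiffOn ℝ (⊤ : ℕ∞) (fun s : Rn n => ‖s‖) {s | s ≠ 0} := fun s hs =>
      (contDiffAt_norm ℝ hs).contDiffWithinAt
    exact (hψ.1.comp_contDiffOn hnorm).mul
      (hΩ.div (hnorm.pow n) fun s hs => pow_ne_zero n (norm_ne_zero_iff.2 hs))
  · exact (isCompact_closedBall (0 : Rn n) 2).of_isClosed_subset (isClosed_tsupport _)
      fun s hs => by simpa using (hsub hs).2

/-- The phases `η Γ(R‖s‖)/Γ(R)`, `R > 0`, with amplitudes `ψ(‖s‖) K(s) e_R(‖s‖)`. -/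
lemma exists_phaseFam {n : ℕ} (hn : 2 ≤ n) {Γ : ℝ → ℝ} (hΓ : IsGammaU Γ) {K : Rn n → ℝ}
    (hK : IsHomCZKernel n K) {ψ : ℝ → ℝ} (hψ : IsLPCutoff ψ) {η : ℝ} (hη : 0 < η) :
    ∃ c, ∃ G : {R : ℝ // 0 < R} → Rn n → ℝ, ∃ g d,
      (∀ R s, ‖s‖ ∈ Icc (1 / 2 : ℝ) 2 → G R s = η * (Γ (R * ‖s‖) / Γ R)) ∧
      PhaseFam c G (fun _ s => ψ ‖s‖ * K s) g d ∧
      PhaseFam c G (fun R s => ψ ‖s‖ * K s * (η⁻¹ * G R s)) g d := by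
  obtain ⟨θ₁, hθ₁, hθ₁1, hθ₁s⟩ := exists_smooth_cutoff (a := 1 / 4) (b := 4) (δ := 1 / 8)
    (by norm_num) (by norm_num)
  obtain ⟨θ, hθ, hθc, hθ0, hθ1⟩ := exists_norm_cutoff n
  obtain ⟨ha1, ha2, ha3⟩ := exists_amplitude hK hψ
  obtain ⟨b, hb, B, hB, hr⟩ := hΓ.exists_ratio_bound
  obtain ⟨c₁, hc₁, c₂, hc₂, hc⟩ := hΓ.exists_log_deriv
  obtain ⟨c₃, hc₃, hc₃'⟩ := hΓ.lower 2 (by simp)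
  set g : {R : ℝ // 0 < R} → ℝ → ℝ := fun R ρ => η * (Γ (R * ρ) / Γ R)
  set d : {R : ℝ // 0 < R} → ℝ → ℝ := fun R => deriv (g R)
  set G : {R : ℝ // 0 < R} → Rn n → ℝ := fun R s => θ₁ (θ s * ‖s‖) * g R (θ s * ‖s‖)
  have hGg : ∀ R s, ‖s‖ ∈ Icc (1 / 4 : ℝ) 4 → G R s = g R ‖s‖ := fun R s hs => by
    simp only [G]
    rw [hθ1 s hs, one_mul, hθ₁1 _ hs, one_mul]
  have hsub : Icc (1 / 2 : ℝ) 2 ⊆ Icc (1 / 4) 4 := Icc_subset_Icc (by norm_num) (by norm_num)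
  have hgsm : ∀ R, ContDiffOn ℝ (⊤ : ℕ∞) (g R) (Ioi 0) := fun R => hΓ.contDiffOn_scaled η R.2
  have hgd : ∀ R, ∀ ρ > 0, HasDerivAt (g R) (d R ρ) ρ := fun R ρ hρ =>
    (((hgsm R).contDiffAt (Ioi_mem_nhds hρ)).differentiableAt (by simp)).hasDerivAt
  have hdd : ∀ R, ∀ ρ > 0, DifferentiableAt ℝ (d R) ρ := fun R ρ hρ => by
    have h1 : ContDiffOn ℝ 1 (d R) (Ioi 0) :=
      (hgsm R).deriv_of_isOpen (m := 1) isOpen_Ioi (by exact_mod_cast DB.le_infty 2)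
    exact (h1.contDiffAt (Ioi_mem_nhds hρ)).differentiableAt (by simp)
  have hd1 : ∀ R ρ, d R ρ = η * (R * deriv Γ (R * ρ) / Γ R) := fun R ρ => by
    have := congrFun (iteratedDeriv_scaled Γ η R 1) ρ
    simp only [iteratedDeriv_one, pow_one] at this
    exact this
  have hd2 : ∀ R ρ, deriv (d R) ρ = η * (R ^ 2 * iteratedDeriv 2 Γ (R * ρ) / Γ R) := fun R ρ => by
    have := congrFun (iteratedDeriv_scaled Γ η R 2) ρ
    rw [iteratedDeriv_succ, iteratedDeriv_one] at this
    exact this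
  set c := min (η * (c₁ * b / 2)) (η * (c₃ * b / 4))
  have hc0 : 0 < c := lt_min (by positivity) (by positivity)
  have hdge : ∀ R, ∀ ρ ∈ Icc (1 / 2 : ℝ) 2, c ≤ d R ρ := fun R ρ hρ => by
    have hρ0 : 0 < ρ := by linarith [hρ.1]
    have hR := R.2
    refine (min_le_left _ _).trans ?_
    rw [hd1]
    gcongr η * ?_
    have e1 := (hc (R * ρ) (by positivity)).1
    have e2 := (hr R hR ρ ⟨by linarith [hρ.1], by linarith [hρ.2]⟩).1
    rw [le_div_iff₀ (hΓ.pos hR)] at e2 ⊢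
    have hd : 0 < deriv Γ (R * ρ) := hΓ.deriv_pos _ (by positivity)
    have e4 : (R : ℝ) * ρ * deriv Γ (R * ρ) ≤ R * 2 * deriv Γ (R * ρ) := by gcongr; exact hρ.2
    nlinarith [mul_le_mul_of_nonneg_left e2 hc₁.le]
  have hd2ge : ∀ R, ∀ ρ ∈ Icc (1 / 2 : ℝ) 2, c ≤ |deriv (d R) ρ| := fun R ρ hρ => by
    have hρ0 : 0 < ρ := by linarith [hρ.1]
    have hR := R.2
    refine (min_le_right _ _).trans ?_
    rw [hd2, abs_mul, abs_of_pos hη]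
    gcongr η * ?_
    have e1 := hc₃' (R * ρ) (by positivity)
    have e2 := (hr R hR ρ ⟨by linarith [hρ.1], by linarith [hρ.2]⟩).1
    have hp := hΓ.pos (s := R * ρ) (by positivity)
    rw [abs_div, abs_of_pos hp, le_div_iff₀ hp, abs_mul, abs_of_pos (by positivity)] at e1
    rw [abs_div, abs_of_pos (hΓ.pos hR), le_div_iff₀ (hΓ.pos hR), abs_mul,
      abs_of_pos (by positivity)]
    rw [le_div_iff₀ (hΓ.pos hR)] at e2
    have e4 : ((R : ℝ) * ρ) ^ 2 * |iteratedDeriv 2 Γ (R * ρ)| ≤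
        (R * 2) ^ 2 * |iteratedDeriv 2 Γ (R * ρ)| := by gcongr; exact hρ.2
    nlinarith [mul_le_mul_of_nonneg_left e2 hc₃.le]
  have hmvt : ∀ F : ℝ → ℝ, (∀ ρ > 0, DifferentiableAt ℝ F ρ) →
      (∀ ρ ∈ Icc (1 / 2 : ℝ) 2, c ≤ |deriv F ρ|) → ∀ ρ ∈ Icc (1 / 2 : ℝ) 2,
      ∀ ρ' ∈ Icc (1 / 2 : ℝ) 2, c * |ρ - ρ'| ≤ |F ρ - F ρ'| := fun F hF hF' ρ hρ ρ' hρ' => by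
    wlog hlt : ρ < ρ' generalizing ρ ρ'
    · rcases (not_lt.1 hlt).eq_or_lt with rfl | hlt'
      · simp
      · rw [abs_sub_comm, abs_sub_comm (F ρ)]
        exact this ρ' hρ' ρ hρ hlt'
    have hpos : ∀ x, ρ ≤ x → 0 < x := fun x hx => by linarith [hρ.1]
    obtain ⟨ξ, hξ, hξ'⟩ := exists_deriv_eq_slope F hlt
      (fun x hx => (hF x (hpos x hx.1)).continuousAt.continuousWithinAt)
      (fun x hx => (hF x (hpos x hx.1.le)).differentiableWithinAt)
    have h1 := hF' ξ ⟨hρ.1.trans hξ.1.le, hξ.2.le.trans hρ'.2⟩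
    rw [hξ', abs_div, le_div_iff₀ (abs_pos.2 (by linarith))] at h1
    rw [abs_sub_comm, abs_sub_comm (F ρ)]
    exact h1
  have hDBG : DB G := by
    have hnorm : ContDiff ℝ (⊤ : ℕ∞) fun s : Rn n => θ s * ‖s‖ :=
      contDiff_mul_of_tsupport_subset isOpen_ne hθ hθ0 fun s hs =>
        (contDiffAt_norm ℝ hs).contDiffWithinAt
    exact DB.comp (hΓ.db_profile hθ₁ (hθ₁s.trans (Icc_subset_Icc (by norm_num) (by norm_num))) η)
      (DB.of_hasCompactSupport hnorm hθc.mul_right)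
  have hDBa : DB fun (_ : {R : ℝ // 0 < R}) (s : Rn n) => ψ ‖s‖ * K s :=
    DB.of_hasCompactSupport ha1 ha2
  have hgrad : ∀ R s, ‖s‖ ∈ Icc (1 / 2 : ℝ) 2 → ∀ i,
      fderiv ℝ (G R) s (EuclideanSpace.single i 1) = d R ‖s‖ / ‖s‖ * s i := fun R s hs i => by
    have hs0 : 0 < ‖s‖ := by linarith [hs.1]
    obtain ⟨N, hN, hN'⟩ := hasFDerivAt_norm_single (norm_pos_iff.1 hs0)
    have hev : G R =ᶠ[𝓝 s] fun s => g R ‖s‖ := by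
      have : {s : Rn n | ‖s‖ ∈ Ioo (1 / 4 : ℝ) 4} ∈ 𝓝 s :=
        (isOpen_Ioo.preimage continuous_norm).mem_nhds
          ⟨by linarith [hs.1], by linarith [hs.2]⟩
      filter_upwards [this] with x hx using hGg R x (Ioo_subset_Icc_self hx)
    have h5 : HasFDerivAt (fun s => g R ‖s‖) _ s := (hgd R _ hs0).comp_hasFDerivAt s hN
    rw [hev.fderiv_eq, h5.fderiv]
    simp [hN']
    ring
  obtain ⟨Ω, -, hΩh, hΩ0, hKΩ⟩ := hK
  have hmean : ∀ φ : ℝ → ℂ, ∀ e : Rn n → ℂ, (∀ s, ‖s‖ ∈ Icc (1 / 2 : ℝ) 2 → e s = φ ‖s‖) →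
      ∫ s, e s * ((ψ ‖s‖ * K s : ℝ) : ℂ) = 0 := fun φ e he => by
    rw [← integral_norm_mul_homogeneous_eq_zero hΩh hΩ0 hn fun ρ => φ ρ * (ψ ρ / ρ ^ n : ℝ)]
    congr 1
    funext s
    by_cases hs : ψ ‖s‖ = 0
    · simp [hs]
    have hs' := hψ.2.2.1 _ hs
    rw [abs_norm] at hs'
    rw [he s hs', hKΩ s (norm_pos_iff.1 (by linarith [hs'.1]))]
    push_cast
    ring
  refine ⟨c, G, g, d, fun R s hs => hGg R s (hsub hs), ?_, ?_⟩
  · exact ⟨hc0, hDBG, hDBa, fun _ => ha3, fun R s hs => hGg R s (hsub hs), hgrad, hdge,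
      fun R => hmvt _ (hdd R) (hd2ge R),
      fun R => hmvt _ (fun ρ hρ => (hgd R ρ hρ).differentiableAt)
        fun ρ hρ => (hdge R ρ hρ).trans (le_abs_self _),
      fun R μ => hmean (fun ρ => Complex.exp (Complex.I * ((μ * g R ρ : ℝ) : ℂ))) _
        fun s hs => by rw [hGg R s (hsub hs)]⟩
  · refine ⟨hc0, hDBG, hDBa.mul ?_, fun _ => tsupport_mul_subset_left.trans ha3,
      fun R s hs => hGg R s (hsub hs), hgrad, hdge,
      fun R => hmvt _ (hdd R) (hd2ge R),
      fun R => hmvt _ (fun ρ hρ => (hgd R ρ hρ).differentiableAt)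
        fun ρ hρ => (hdge R ρ hρ).trans (le_abs_self _), fun R μ => ?_⟩
    · refine DB.mul ⟨fun _ => contDiff_const, fun N => ?_⟩ hDBG
      refine ⟨|η⁻¹|, fun _ x => ?_⟩
      rcases Nat.eq_zero_or_pos N with rfl | hN
      · simp
      · rw [iteratedFDeriv_const_of_ne hN.ne']
        simp
    · rw [← hmean (fun ρ => Complex.exp (Complex.I * ((μ * g R ρ : ℝ) : ℂ)) *
        (η⁻¹ * g R ρ : ℝ)) (fun s => Complex.exp (Complex.I * ((μ * G R s : ℝ) : ℂ)) *
        (η⁻¹ * G R s : ℝ)) fun s hs => by rw [hGg R s (hsub hs)]]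
      congr 1
      funext s
      push_cast
      ring

end PhaseConstruction

section LocalKernel

/-- The kernel `e^{ivΓ(‖t‖)} ψ(2^{-k}‖t‖) K(t) w(‖t‖)`. -/
def localKer {n : ℕ} (Γ : ℝ → ℝ) (K : Rn n → ℝ) (ψ : ℝ → ℝ) (w : ℝ → ℝ) (k : ℤ) (v : ℝ)
    (t : Rn n) : ℂ :=
  Complex.exp (Complex.I * Complex.ofReal (v * Γ ‖t‖)) *
    Complex.ofReal (ψ ((2 : ℝ) ^ (-k) * ‖t‖) * K t * w ‖t‖)

variable {n : ℕ} {Γ : ℝ → ℝ} {K : Rn n → ℝ} {ψ : ℝ → ℝ}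

lemma Hloc_eq_cv (v : ℝ) (k : ℤ) (f : Rn n → ℂ) (x : Rn n) :
    Hloc Γ K ψ v k f x = cv (localKer Γ K ψ (fun _ => 1) k v) f x := by
  simp only [Hloc, cv, localKer, mul_one]
  refine integral_congr_ae (Eventually.of_forall fun t => ?_)
  ring

lemma localKer_eq_scale (hΓ : IsGammaU Γ) (hK : IsHomCZKernel n K) (hψ : IsLPCutoff ψ) {η : ℝ}
    (hη : 0 < η) (k : ℤ) {G a : {R : ℝ // 0 < R} → Rn n → ℝ} {w b : ℝ → ℝ}
    (hG : ∀ R s, ‖s‖ ∈ Icc (1 / 2 : ℝ) 2 → G R s = η * (Γ (R * ‖s‖) / Γ R))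
    (ha : ∀ s, a ⟨(2 : ℝ) ^ k, by positivity⟩ s = ψ ‖s‖ * K s * b ‖s‖)
    (hw : ∀ ρ ∈ Icc (1 / 2 : ℝ) 2, w ((2 : ℝ) ^ k * ρ) = b ρ) (j : ℤ) (u : ℝ) (t : Rn n) :
    localKer Γ K ψ w k ((2 : ℝ) ^ j * u) t = ((((2 : ℝ) ^ k : ℝ) : ℂ) ^ n)⁻¹ *
      PhaseFam.ker G a ⟨(2 : ℝ) ^ k, by positivity⟩
        (u * (η⁻¹ * ((2 : ℝ) ^ j * Γ ((2 : ℝ) ^ k)))) (((2 : ℝ) ^ k)⁻¹ • t) := by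
  set R : ℝ := (2 : ℝ) ^ k
  have hR : 0 < R := by positivity
  have hΓR := hΓ.pos hR
  obtain ⟨s, rfl⟩ : ∃ s, t = R • s := ⟨R⁻¹ • t, by rw [smul_inv_smul₀ hR.ne']⟩
  have hns : ‖R • s‖ = R * ‖s‖ := by rw [norm_smul, Real.norm_of_nonneg hR.le]
  have h1 : (2 : ℝ) ^ (-k) * ‖R • s‖ = ‖s‖ := by
    rw [hns, zpow_neg, inv_mul_cancel_left₀ hR.ne']
  simp only [localKer, PhaseFam.ker]
  rw [inv_smul_smul₀ hR.ne', h1, ha]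
  by_cases hs : ψ ‖s‖ = 0
  · simp [hs]
  have hs' := hψ.2.2.1 _ hs
  rw [abs_norm] at hs'
  have hs0 : s ≠ 0 := norm_pos_iff.1 (by linarith [hs'.1])
  have hKs : K (R • s) = (R ^ n)⁻¹ * K s := by
    obtain ⟨Ω, -, hΩ, -, hKΩ⟩ := hK
    rw [hKΩ s hs0, hKΩ _ (smul_ne_zero hR.ne' hs0), hΩ R hR, hns, mul_pow]
    field_simp
  have hph : u * (η⁻¹ * ((2 : ℝ) ^ j * Γ R)) * G ⟨R, hR⟩ s = (2 : ℝ) ^ j * u * Γ ‖R • s‖ := by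
    rw [hG _ _ hs', hns]
    field_simp
  rw [hph, hKs, hns, hw _ hs']
  have hRk : ((2 : ℂ) ^ k) = (R : ℂ) := by simp [R]
  push_cast
  rw [hRk]
  ring

lemma exists_oscFamily_localKer (hn : 2 ≤ n) (hΓ : IsGammaU Γ) (hK : IsHomCZKernel n K)
    (hψ : IsLPCutoff ψ) : ∃ B > 0, ∃ c > 0, ∃ C C' : ℝ, ∃ N : ℕ, ∀ l : ℤ, 1 ≤ l →
      OscFamily (fun j => l + kstar Γ j)
        (fun j => B * ((2 : ℝ) ^ j * Γ ((2 : ℝ) ^ (l + kstar Γ j)))) C N ((2 : ℝ) ^ (c * (l : ℝ)))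
        (fun j u => localKer Γ K ψ (fun _ => 1) (l + kstar Γ j) ((2 : ℝ) ^ j * u)) ∧
      OscFamily (fun j => l + kstar Γ j)
        (fun j => B * ((2 : ℝ) ^ j * Γ ((2 : ℝ) ^ (l + kstar Γ j)))) C' N ((2 : ℝ) ^ (c * (l : ℝ)))
        (fun j u => localKer Γ K ψ (fun ρ => Γ ρ / Γ ((2 : ℝ) ^ (l + kstar Γ j)))
          (l + kstar Γ j) ((2 : ℝ) ^ j * u)) := by
  obtain ⟨c₁, hc₁, c₂, -, hc⟩ := hΓ.exists_log_deriv
  have h1 := fun s hs => (hc s hs).1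
  have h2 := fun s hs => (hc s hs).2
  have hη : (0 : ℝ) < ((2 : ℝ) ^ c₂)⁻¹ := by positivity
  obtain ⟨_, G, _, _, hG, hF1, hF2⟩ := exists_phaseFam hn hΓ hK hψ hη
  obtain ⟨C₁, hC₁⟩ := hF1.exists_oscKernel hn
  obtain ⟨C₂, hC₂⟩ := hF2.exists_oscKernel hn
  have key : ∀ (C : ℝ) (a : {R : ℝ // 0 < R} → Rn n → ℝ), (∀ p, ∀ lam : ℝ, 1 ≤ lam →
      OscKernel 0 lam C fun u t => PhaseFam.ker G a p (u * lam) t) → ∀ w : ℤ → ℝ → ℝ,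
      ∀ b : {R : ℝ // 0 < R} → ℝ → ℝ, (∀ R s, a R s = ψ ‖s‖ * K s * b R ‖s‖) →
      (∀ k, ∀ ρ ∈ Icc (1 / 2 : ℝ) 2, w k ((2 : ℝ) ^ k * ρ) = b ⟨(2 : ℝ) ^ k, by positivity⟩ ρ) →
      ∀ l : ℤ, 1 ≤ l → OscFamily (fun j => l + kstar Γ j)
        (fun j => (2 : ℝ) ^ c₂ * ((2 : ℝ) ^ j * Γ ((2 : ℝ) ^ (l + kstar Γ j)))) C
        (2 * ⌈c₂⌉₊ + 1) ((2 : ℝ) ^ (c₁ * l))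
        (fun j u => localKer Γ K ψ (w (l + kstar Γ j)) (l + kstar Γ j) ((2 : ℝ) ^ j * u)) := by
    intro C a hC w b hab hw l hl
    have hL : (1 : ℝ) ≤ (2 : ℝ) ^ (c₁ * l) :=
      Real.one_le_rpow one_le_two (mul_nonneg hc₁.le (by exact_mod_cast (by omega : 0 ≤ l)))
    have hlam := hΓ.rpow_le_phase hc₁ h1 h2 hl
    refine ⟨fun j => ?_, hL, hlam, hΓ.encard_kstar_le hc₁ h1 h2 l⟩
    have := (hC ⟨(2 : ℝ) ^ (l + kstar Γ j), by positivity⟩ _ (hL.trans (hlam j))).scale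
      (l + kstar Γ j)
    convert this using 3 with u t
    rw [localKer_eq_scale hΓ hK hψ hη _ hG (hab _) (hw _), inv_inv]
  refine ⟨(2 : ℝ) ^ c₂, by positivity, c₁, hc₁, C₁, C₂, 2 * ⌈c₂⌉₊ + 1, fun l hl => ⟨?_, ?_⟩⟩
  · exact key C₁ _ hC₁ (fun _ _ => 1) (fun _ _ => 1) (fun R s => by simp) (fun _ _ _ => rfl) l hl
  · refine key C₂ _ hC₂ (fun k ρ => Γ ρ / Γ ((2 : ℝ) ^ k)) (fun R ρ => ?_) (fun R s => ?_)
      (fun k ρ hρ => ?_) l hl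
    · exact Γ (R * ρ) / Γ R
    · by_cases hs : ψ ‖s‖ = 0
      · simp [hs]
      have hs' := hψ.2.2.1 _ hs
      rw [abs_norm] at hs'
      rw [hG R s hs', inv_mul_cancel_left₀ hη.ne']
    · rfl

end LocalKernel

section Multipliers

lemma lintegral_conv_rpow_le {r : ℝ} (hr : 1 < r) {k a : ℝ → ℝ≥0∞} (hk : Measurable k)
    (ha : Measurable a) :
    ∫⁻ x, (∫⁻ y, k (x - y) * a y) ^ r ≤ (∫⁻ x, k x) ^ r * ∫⁻ y, a y ^ r := by
  have hr0 : 0 < r := by linarith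
  have hkm : ∀ x, Measurable fun y => k (x - y) := fun x =>
    hk.comp (measurable_const.sub measurable_id)
  have h1 : ∀ x, (∫⁻ y, k (x - y) * a y) ^ r ≤
      (∫⁻ y, k y) ^ (r - 1) * ∫⁻ y, k (x - y) * a y ^ r := fun x => by
    have h := ENNReal.lintegral_mul_norm_pow_le (μ := volume)
      (f := fun y => k (x - y) * a y ^ r) (g := fun y => k (x - y))
      ((hkm x).mul (ha.pow_const r)).aemeasurable (hkm x).aemeasurable
      (p := 1 / r) (q := 1 - 1 / r) (by positivity)
      (by rw [sub_nonneg, div_le_one hr0]; exact hr.le) (by ring)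
    have e1 : ∀ y, (k (x - y) * a y ^ r) ^ (1 / r) * k (x - y) ^ (1 - 1 / r) =
        k (x - y) * a y := fun y => by
      rw [ENNReal.mul_rpow_of_nonneg _ _ (by positivity), ← ENNReal.rpow_mul,
        mul_one_div_cancel hr0.ne', ENNReal.rpow_one, mul_right_comm,
        ← ENNReal.rpow_add_of_nonneg _ _ (by positivity)
          (by rw [sub_nonneg, div_le_one hr0]; exact hr.le)]
      simp
    simp_rw [e1] at h
    rw [lintegral_sub_left_eq_self k x] at h
    calc _ ≤ _ := ENNReal.rpow_le_rpow h hr0.le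
      _ = _ := by
        rw [ENNReal.mul_rpow_of_nonneg _ _ hr0.le, ← ENNReal.rpow_mul, ← ENNReal.rpow_mul,
          one_div_mul_cancel hr0.ne', ENNReal.rpow_one, mul_comm, sub_mul,
          one_div_mul_cancel hr0.ne', one_mul]
  calc _ ≤ ∫⁻ x, (∫⁻ y, k y) ^ (r - 1) * ∫⁻ y, k (x - y) * a y ^ r := lintegral_mono h1
    _ = (∫⁻ y, k y) ^ (r - 1) * ∫⁻ y, (∫⁻ x, k (x - y)) * a y ^ r := by
      have hm : Measurable (Function.uncurry fun x y : ℝ => k (x - y) * a y ^ r) :=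
        (hk.comp (measurable_fst.sub measurable_snd)).mul ((ha.comp measurable_snd).pow_const r)
      have hm' : Measurable fun x => ∫⁻ y, k (x - y) * a y ^ r := hm.lintegral_prod_right'
      rw [lintegral_const_mul _ hm', lintegral_lintegral_swap hm.aemeasurable]
      congr 1
      refine lintegral_congr fun y => ?_
      have hm' : Measurable fun x => k (x - y) := hk.comp (measurable_id.sub measurable_const)
      rw [lintegral_mul_const _ hm']
    _ = _ := by
      simp_rw [lintegral_sub_right_eq_self k]
      rw [lintegral_const_mul _ (ha.pow_const r), ← mul_assoc]
      congr 1
      nth_rw 2 [← ENNReal.rpow_one (∫⁻ y, k y)]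
      rw [← ENNReal.rpow_add_of_nonneg _ _ (by linarith) zero_le_one, sub_add_cancel]

lemma fourierInv_mul_fourier {m g : ℝ → ℂ} (hm : Integrable m) (hg : Integrable g) (x : ℝ) :
    𝓕⁻ (fun τ => m τ * 𝓕 g τ) x = ∫ y, 𝓕⁻ m (x - y) * g y := by
  have hx : Integrable fun τ : ℝ => Real.fourierChar (x * τ) • m τ := by
    refine (integrable_norm_iff ?_).1 ?_
    · exact (Continuous.aestronglyMeasurable (by fun_prop)).smul hm.1
    · simpa using hm.norm
  have h := VectorFourier.integral_fourierIntegral_smul_eq_flip (L := innerₗ ℝ)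
      (μ := volume) (ν := volume) Real.continuous_fourierChar continuous_inner hg hx
  rw [Real.fourierInv_eq]
  trans ∫ τ, 𝓕 g τ • (Real.fourierChar (x * τ) • m τ)
  · refine integral_congr_ae (Eventually.of_forall fun τ => ?_)
    have e : inner ℝ τ x = x * τ := by simp
    simp only [e, Circle.smul_def, smul_eq_mul]
    ring
  refine h.trans (integral_congr_ae (Eventually.of_forall fun y => ?_))
  have e : VectorFourier.fourierIntegral Real.fourierChar volume (innerₗ ℝ).flip
      (fun τ : ℝ => Real.fourierChar (x * τ) • m τ) y = 𝓕⁻ m (x - y) := by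
    rw [Real.fourierInv_eq, VectorFourier.fourierIntegral]
    refine integral_congr_ae (Eventually.of_forall fun τ => ?_)
    have e1 : (innerₗ ℝ).flip τ y = y * τ := by simp
    have e2 : inner ℝ τ (x - y) = -(y * τ) + x * τ := by simp; ring
    simp only [e1, e2, smul_smul, AddChar.map_add_eq_mul]
  simp only [e, smul_eq_mul]
  ring

lemma fourierInv_dilate (m : ℝ → ℂ) {c : ℝ} (hc : 0 < c) (a : ℂ) (x : ℝ) :
    𝓕⁻ (fun τ => a * m (c * τ)) x = a * ((c : ℂ)⁻¹ * 𝓕⁻ m (c⁻¹ * x)) := by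
  have h := Measure.integral_comp_mul_left
    (fun s : ℝ => Real.fourierChar (s * (c⁻¹ * x)) • m s) c
  rw [abs_of_pos (inv_pos.2 hc)] at h
  rw [Real.fourierInv_eq, Real.fourierInv_eq]
  have e : ∀ s y : ℝ, inner ℝ s y = s * y := fun s y => by simp [mul_comm]
  simp only [e]
  have e2 : ((c : ℂ))⁻¹ * ∫ s : ℝ, Real.fourierChar (s * (c⁻¹ * x)) • m s =
      c⁻¹ • ∫ s : ℝ, Real.fourierChar (s * (c⁻¹ * x)) • m s := by
    rw [Complex.real_smul, Complex.ofReal_inv]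
  rw [e2, ← h, ← integral_const_mul]
  refine integral_congr_ae (Eventually.of_forall fun τ => ?_)
  have e3 : c * τ * (c⁻¹ * x) = τ * x := by field_simp
  simp only [e3, Circle.smul_def, smul_eq_mul]
  ring

lemma exists_eLpNorm_multiplier_le {m : ℝ → ℂ} (hm : ContDiff ℝ (⊤ : ℕ∞) m)
    (hmc : HasCompactSupport m) : ∃ A : ℝ≥0∞, A ≠ ⊤ ∧ ∀ r : ℝ, 1 < r → ∀ c : ℝ, 0 < c →
      ∀ (a : ℂ) (g : ℝ → ℂ), Continuous g → Integrable g →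
        eLpNorm (𝓕⁻ fun τ => a * m (c * τ) * 𝓕 g τ) (ENNReal.ofReal r) volume ≤
          ‖a‖ₑ * A * eLpNorm g (ENNReal.ofReal r) volume := by
  set M : SchwartzMap ℝ ℂ := hmc.toSchwartzMap hm
  have hMm : (M : ℝ → ℂ) = m := rfl
  have hcoe : 𝓕⁻ m = ((𝓕⁻ M : SchwartzMap ℝ ℂ) : ℝ → ℂ) := by
    rw [SchwartzMap.fourierInv_coe, hMm]
  have hFi : Integrable (𝓕⁻ m) := by rw [hcoe]; exact SchwartzMap.integrable _
  have hFc : Continuous (𝓕⁻ m) := by rw [hcoe]; exact SchwartzMap.continuous _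
  refine ⟨∫⁻ x, ‖𝓕⁻ m x‖ₑ, hFi.2.ne, fun r hr c hc a g hgc hg => ?_⟩
  have hr0 : 0 < r := by linarith
  have hmi : Integrable fun τ => a * m (c * τ) :=
    (((hm.continuous.integrable_of_hasCompactSupport hmc).comp_mul_left' hc.ne')).const_mul a
  set k : ℝ → ℂ := 𝓕⁻ fun τ => a * m (c * τ)
  have hk : k = fun x => a * ((c : ℂ)⁻¹ * 𝓕⁻ m (c⁻¹ * x)) := funext fun x =>
    fourierInv_dilate m hc a x
  have hkm : Measurable k := by
    rw [hk]; exact Continuous.measurable (by fun_prop)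
  have hk1 : ∫⁻ x, ‖k x‖ₑ = ‖a‖ₑ * ∫⁻ x, ‖𝓕⁻ m x‖ₑ := by
    have hi : Integrable fun x => 𝓕⁻ m (c⁻¹ * x) := hFi.comp_mul_left' (inv_ne_zero hc.ne')
    simp_rw [hk, enorm_mul]
    rw [lintegral_const_mul' _ _ (by finiteness), lintegral_const_mul' _ _ (by finiteness),
      ← ofReal_integral_norm_eq_lintegral_enorm hi, ← ofReal_integral_norm_eq_lintegral_enorm hFi,
      Measure.integral_comp_mul_left (fun x => ‖𝓕⁻ m x‖) c⁻¹, inv_inv, abs_of_pos hc, smul_eq_mul,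
      ← ofReal_norm (c : ℂ)⁻¹, norm_inv, Complex.norm_real, Real.norm_of_nonneg hc.le,
      ← ENNReal.ofReal_mul (inv_nonneg.2 hc.le), inv_mul_cancel_left₀ hc.ne']
  have hr1 : ENNReal.ofReal r ≠ 0 := by simpa using hr0
  rw [eLpNorm_eq_lintegral_rpow_enorm_toReal hr1 ENNReal.ofReal_ne_top,
    eLpNorm_eq_lintegral_rpow_enorm_toReal hr1 ENNReal.ofReal_ne_top,
    ENNReal.toReal_ofReal hr0.le, ← hk1]
  calc _ ≤ ((∫⁻ x, ‖k x‖ₑ) ^ r * ∫⁻ y, ‖g y‖ₑ ^ r) ^ (1 / r) := by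
        gcongr
        refine le_trans (lintegral_mono fun x => ?_)
          (lintegral_conv_rpow_le hr hkm.enorm hgc.measurable.enorm)
        gcongr
        rw [fourierInv_mul_fourier hmi hg]
        refine (enorm_integral_le_lintegral_enorm _).trans_eq ?_
        simp_rw [enorm_mul]
        rfl
    _ = _ := by
        rw [ENNReal.mul_rpow_of_nonneg _ _ (by positivity), ← ENNReal.rpow_mul,
          mul_one_div_cancel hr0.ne', ENNReal.rpow_one]

end Multipliers

section Besov

lemma ofReal_cutoff {m : ℝ → ℝ} (hm : ContDiffOn ℝ (⊤ : ℕ∞) m {τ | τ ≠ 0}) (b R : ℝ)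
    (h0 : ∀ τ, |τ| < 1 / 2 → m τ = b) (hR : ∀ τ, R < |τ| → m τ = 0) :
    ContDiff ℝ (⊤ : ℕ∞) (fun τ => (m τ : ℂ)) ∧ HasCompactSupport fun τ => (m τ : ℂ) := by
  have h : ContDiff ℝ (⊤ : ℕ∞) m := contDiff_iff_contDiffAt.2 fun τ => by
    by_cases hτ : τ = 0
    · have : {x : ℝ | |x| < 1 / 2} ∈ 𝓝 τ :=
        (isOpen_Iio.preimage continuous_abs).mem_nhds (by simp [hτ])
      refine (contDiffAt_const (c := b)).congr_of_eventuallyEq ?_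
      filter_upwards [this] with x hx using h0 x hx
    · exact hm.contDiffAt (isOpen_ne.mem_nhds hτ)
  exact ⟨Complex.ofRealCLM.contDiff.comp h,
    HasCompactSupport.intro (isCompact_closedBall (0 : ℝ) R) fun τ hτ => by
      rw [hR τ (by simpa [Real.dist_eq] using hτ), Complex.ofReal_zero]⟩

variable {ψ : ℝ → ℝ}

lemma IsLPCutoff.contDiffOn_abs (hψ : IsLPCutoff ψ) (c : ℝ) :
    ContDiffOn ℝ (⊤ : ℕ∞) (fun τ : ℝ => ψ (c * |τ|)) {τ | τ ≠ 0} :=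
  hψ.1.comp_contDiffOn (contDiffOn_const.mul fun _ hτ => (contDiffAt_abs hτ).contDiffWithinAt)

lemma IsLPCutoff.eq_zero (hψ : IsLPCutoff ψ) {s : ℝ} (hs : |s| < 1 / 2 ∨ 2 < |s|) : ψ s = 0 := by
  by_contra h
  have := hψ.2.2.1 s h
  rcases hs with hs | hs
  · exact absurd this.1 (not_le.2 hs)
  · exact absurd this.2 (not_le.2 hs)

lemma IsLPCutoff.highpass (hψ : IsLPCutoff ψ) :
    ContDiff ℝ (⊤ : ℕ∞) (fun τ : ℝ => (ψ |τ| : ℂ)) ∧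
      HasCompactSupport fun τ : ℝ => (ψ |τ| : ℂ) := by
  refine ofReal_cutoff ?_ 0 2 (fun τ hτ => hψ.eq_zero (Or.inl (by rwa [abs_abs])))
    fun τ hτ => hψ.eq_zero (Or.inr (by rwa [abs_abs]))
  simpa using hψ.contDiffOn_abs 1

lemma IsLPCutoff.highpass_div (hψ : IsLPCutoff ψ) :
    ContDiff ℝ (⊤ : ℕ∞) (fun τ : ℝ => ((ψ |τ| / τ : ℝ) : ℂ)) ∧
      HasCompactSupport fun τ : ℝ => ((ψ |τ| / τ : ℝ) : ℂ) := by
  refine ofReal_cutoff (m := fun τ => ψ |τ| / τ) ?_ 0 2 (fun τ hτ => ?_) fun τ hτ => ?_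
  · have h := hψ.contDiffOn_abs 1
    simp only [one_mul] at h
    exact h.div contDiffOn_id fun τ hτ => hτ
  · simp only [hψ.eq_zero (s := |τ|) (Or.inl (by rwa [abs_abs])), zero_div]
  · simp only [hψ.eq_zero (s := |τ|) (Or.inr (by rwa [abs_abs])), zero_div]

lemma IsLPCutoff.lowpass (hψ : IsLPCutoff ψ) :
    ContDiff ℝ (⊤ : ℕ∞) (fun τ : ℝ =>
        ((1 - ∑' i : ℕ, ψ ((2 : ℝ) ^ (-(i : ℤ)) * |τ|) : ℝ) : ℂ)) ∧
      HasCompactSupport fun τ : ℝ =>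
        ((1 - ∑' i : ℕ, ψ ((2 : ℝ) ^ (-(i : ℤ)) * |τ|) : ℝ) : ℂ) := by
  have hfin : ∀ τ : ℝ, |τ| < 4 → ∑' i : ℕ, ψ ((2 : ℝ) ^ (-(i : ℤ)) * |τ|) =
      ∑ i ∈ Finset.range 3, ψ ((2 : ℝ) ^ (-(i : ℤ)) * |τ|) := fun τ hτ => by
    refine tsum_eq_sum fun i hi => hψ.eq_zero (Or.inl ?_)
    have h3 : (2 : ℝ) ^ (-(i : ℤ)) ≤ 2 ^ (-3 : ℤ) :=
      zpow_le_zpow_right₀ one_le_two (by simp at hi; omega)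
    rw [abs_of_nonneg (by positivity)]
    have : (2 : ℝ) ^ (-3 : ℤ) = 1 / 8 := by norm_num
    rw [this] at h3
    nlinarith [abs_nonneg τ]
  have hlarge : ∀ τ : ℝ, 1 < |τ| → ∑' i : ℕ, ψ ((2 : ℝ) ^ (-(i : ℤ)) * |τ|) = 1 := fun τ hτ => by
    refine HasSum.tsum_eq ?_
    have h := hψ.2.2.2 |τ| (by linarith)
    have hz : ∀ l ∉ range ((↑) : ℕ → ℤ), ψ ((2 : ℝ) ^ (-l) * |τ|) = 0 := fun l hl =>
      hψ.eq_zero (Or.inr ?_)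
    · exact (Function.Injective.hasSum_iff Nat.cast_injective hz).2 h
    have hl1 : 1 ≤ -l := by
      by_contra hc
      exact hl ⟨l.toNat, by omega⟩
    have h1 : (2 : ℝ) ^ (1 : ℤ) ≤ 2 ^ (-l) := zpow_le_zpow_right₀ one_le_two hl1
    rw [abs_of_nonneg (by positivity)]
    rw [zpow_one] at h1
    nlinarith
  refine ofReal_cutoff (m := fun τ => 1 - ∑' i : ℕ, ψ ((2 : ℝ) ^ (-(i : ℤ)) * |τ|))
    (fun τ hτ => ?_) 1 1 (fun τ hτ => ?_) fun τ hτ => ?_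
  · refine ContDiffAt.contDiffWithinAt ?_
    rcases lt_or_ge |τ| 4 with h4 | h4
    · have hs : ContDiffOn ℝ (⊤ : ℕ∞) (fun τ : ℝ => 1 -
          ∑ i ∈ Finset.range 3, ψ ((2 : ℝ) ^ (-(i : ℤ)) * |τ|)) {τ | τ ≠ 0} :=
        contDiffOn_const.sub (ContDiffOn.sum fun i _ => hψ.contDiffOn_abs _)
      refine (hs.contDiffAt (isOpen_ne.mem_nhds hτ)).congr_of_eventuallyEq ?_
      filter_upwards [(isOpen_Iio.preimage continuous_abs).mem_nhds h4] with x hx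
      rw [hfin x hx]
    · refine (contDiffAt_const (c := (0 : ℝ))).congr_of_eventuallyEq ?_
      filter_upwards [(isOpen_Ioi.preimage continuous_abs).mem_nhds
        (show |τ| ∈ Ioi 1 by simp only [mem_Ioi]; linarith)] with x hx
      rw [hlarge x hx, sub_self]
  · rw [hfin τ (by linarith), Finset.sum_eq_zero, sub_zero]
    refine fun i _ => hψ.eq_zero (Or.inl ?_)
    have h1 : (2 : ℝ) ^ (-(i : ℤ)) ≤ 1 := zpow_le_one_of_nonpos₀ one_le_two (by simp)
    rw [abs_of_nonneg (by positivity)]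
    nlinarith [abs_nonneg τ]
  · simp only [hlarge τ hτ, sub_self]

end Besov

section Besov

lemma tsum_min_tp_le {r : ℝ} (hr : 1 < r) : ∃ T : ℝ≥0∞, T ≠ ⊤ ∧ ∀ Y : ℝ≥0∞, Y ≠ 0 → Y ≠ ⊤ →
    ∑' i : ℕ, min (tp (i / r)) (Y * tp (i / r - i)) ≤ T * Y ^ (1 / r) := by
  have hr0 : 0 < r := by linarith
  have hα : 0 < 1 / r := by positivity
  have hα1 : 0 < 1 - 1 / r := by rw [sub_pos, div_lt_one hr0]; exact hr
  refine ⟨tp (1 - 1 / r) * ∑' i : ℤ, tp (-(min (1 / r) (1 - 1 / r)) * |(i : ℝ)|), ?_,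
    fun Y h0 h1 => ?_⟩
  · exact ENNReal.mul_ne_top (tp_ne_top _) (tsum_tp_neg_abs_ne_top (lt_min hα hα1))
  have h := tsum_min_tent_le hα hα1 h0 h1
    (fun i => Y ^ (1 - 1 / r) * min (tp (i / r)) (Y * tp (i / r - i))) (fun i => ?_) fun i => ?_
  · rw [ENNReal.tsum_mul_left] at h
    have h2 : ∑' i : ℕ, min (tp (i / r)) (Y * tp (i / r - i)) ≤
        ∑' i : ℤ, min (tp (i / r)) (Y * tp (i / r - i)) := by
      have := ENNReal.tsum_comp_le_tsum_of_injective (f := ((↑) : ℕ → ℤ)) Nat.cast_injective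
        fun i : ℤ => min (tp (i / r)) (Y * tp (i / r - i))
      simpa using this
    refine h2.trans ?_
    have h3 := mul_le_mul_right h (Y ^ (-(1 - 1 / r)))
    rw [← mul_assoc, ← ENNReal.rpow_add _ _ h0 h1, neg_add_cancel, ENNReal.rpow_zero, one_mul] at h3
    refine h3.trans_eq ?_
    rw [mul_left_comm]
    congr 1
    nth_rw 2 [← ENNReal.rpow_one Y]
    rw [← ENNReal.rpow_add _ _ h0 h1]
    congr 1
    ring
  · rw [mul_one_div]
    gcongr
    exact min_le_left _ _
  · refine (mul_le_mul_right (min_le_right _ _) _).trans_eq ?_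
    rw [← mul_assoc]
    nth_rw 2 [← ENNReal.rpow_one Y]
    rw [← ENNReal.rpow_add _ _ h0 h1]
    congr 2 <;> ring

variable {ψ : ℝ → ℝ}

lemma exists_besovNorm_le (hψ : IsLPCutoff ψ) {r : ℝ} (hr : 1 < r) : ∃ A : ℝ≥0∞, A ≠ ⊤ ∧
    ∀ g : ℝ → ℂ, ContDiff ℝ 1 g → HasCompactSupport g → ∀ lam : ℝ, 1 ≤ lam →
      besovNorm ψ r g ≤ A * ENNReal.ofReal lam ^ (1 / r) * (eLpNorm g (ENNReal.ofReal r) volume +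
        (ENNReal.ofReal lam)⁻¹ * eLpNorm (deriv g) (ENNReal.ofReal r) volume) := by
  obtain ⟨A₀, hA₀, h0⟩ := exists_eLpNorm_multiplier_le hψ.lowpass.1 hψ.lowpass.2
  obtain ⟨A₁, hA₁, h1⟩ := exists_eLpNorm_multiplier_le hψ.highpass.1 hψ.highpass.2
  obtain ⟨A₂, hA₂, h2⟩ := exists_eLpNorm_multiplier_le hψ.highpass_div.1 hψ.highpass_div.2
  obtain ⟨T, hT, hTs⟩ := tsum_min_tp_le hr
  refine ⟨A₀ + T * (A₁ + A₂), by finiteness, fun g hg hgc lam hlam => ?_⟩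
  set Y := ENNReal.ofReal lam
  have hY1 : 1 ≤ Y := by simpa [Y] using hlam
  have hY0 : Y ≠ 0 := (zero_lt_one.trans_le hY1).ne'
  have hYt : Y ≠ ⊤ := ENNReal.ofReal_ne_top
  have hgi : Integrable g := hg.continuous.integrable_of_hasCompactSupport hgc
  have hg'c : Continuous (deriv g) := hg.continuous_deriv le_rfl
  have hg'i : Integrable (deriv g) := hg'c.integrable_of_hasCompactSupport hgc.deriv
  set X := eLpNorm g (ENNReal.ofReal r) volume
  set D := eLpNorm (deriv g) (ENNReal.ofReal r) volume
  set M := X + Y⁻¹ * D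
  have hlow : eLpNorm (deltaLow ψ g) (ENNReal.ofReal r) volume ≤ A₀ * X := by
    simpa [deltaLow] using h0 r hr 1 one_pos 1 g hg.continuous hgi
  have habs : ∀ (i : ℕ) (τ : ℝ), |(2 : ℝ) ^ (-(i : ℤ)) * τ| = (2 : ℝ) ^ (-(i : ℤ)) * |τ| :=
    fun i τ => by rw [abs_mul, abs_of_pos (by positivity)]
  have hhigh1 : ∀ i : ℕ, eLpNorm (deltaHigh ψ i g) (ENNReal.ofReal r) volume ≤ A₁ * X := fun i => by
    have := h1 r hr ((2 : ℝ) ^ (-(i : ℤ))) (by positivity) 1 g hg.continuous hgi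
    simp only [habs, one_mul, enorm_one] at this
    exact this
  have hhigh2 : ∀ i : ℕ, eLpNorm (deltaHigh ψ i g) (ENNReal.ofReal r) volume ≤
      tp (-i) * A₂ * D := fun i => by
    have := h2 r hr ((2 : ℝ) ^ (-(i : ℤ))) (by positivity)
      (((2 : ℝ) ^ (-(i : ℤ)) : ℝ) / (2 * Real.pi * Complex.I)) (deriv g) hg'c hg'i
    have e : (fun τ : ℝ => (((2 : ℝ) ^ (-(i : ℤ)) : ℝ) / (2 * Real.pi * Complex.I) : ℂ) *
        ((ψ |(2 : ℝ) ^ (-(i : ℤ)) * τ| / ((2 : ℝ) ^ (-(i : ℤ)) * τ) : ℝ) : ℂ) *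
        𝓕 (deriv g) τ) = fun τ => Complex.ofReal (ψ ((2 : ℝ) ^ (-(i : ℤ)) * |τ|)) * 𝓕 g τ := by
      rw [Real.fourier_deriv hgi (hg.differentiable one_ne_zero) hg'i]
      funext τ
      rw [habs]
      by_cases hτ : τ = 0
      · rw [hτ, hψ.eq_zero (Or.inl (by simp))]
        simp
      have hτ' : (τ : ℂ) ≠ 0 := Complex.ofReal_ne_zero.2 hτ
      have hπ : (Real.pi : ℂ) ≠ 0 := Complex.ofReal_ne_zero.2 Real.pi_ne_zero
      generalize ψ ((2 : ℝ) ^ (-(i : ℤ)) * |τ|) = q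
      have hc : (((2 : ℝ) ^ (-(i : ℤ)) : ℝ) : ℂ) ≠ 0 := Complex.ofReal_ne_zero.2 (by positivity)
      generalize (2 : ℝ) ^ (-(i : ℤ)) = c at hc
      simp only [smul_eq_mul]
      push_cast
      field_simp
    rw [e] at this
    refine this.trans ?_
    gcongr
    rw [tp_eq_ofReal, ← ofReal_norm]
    refine ENNReal.ofReal_le_ofReal ?_
    rw [norm_div, Complex.norm_real, Real.norm_of_nonneg (by positivity)]
    have hp : (1 : ℝ) ≤ ‖(2 * Real.pi * Complex.I : ℂ)‖ := by
      simp [abs_of_pos Real.pi_pos]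
      linarith [Real.pi_gt_three]
    refine (div_le_self (by positivity) hp).trans_eq ?_
    rw [← Real.rpow_intCast]
    simp
  have hD : D ≤ Y * M := by
    have : Y * (Y⁻¹ * D) = D := by rw [← mul_assoc, ENNReal.mul_inv_cancel hY0 hYt, one_mul]
    rw [← this]
    gcongr
    exact le_add_self
  have hX : X ≤ M := le_self_add
  have hterm : ∀ i : ℕ, ENNReal.ofReal ((2 : ℝ) ^ ((i : ℝ) / r)) *
      eLpNorm (deltaHigh ψ i g) (ENNReal.ofReal r) volume ≤
        min (tp (i / r)) (Y * tp (i / r - i)) * ((A₁ + A₂) * M) := fun i => by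
    rw [← tp_eq_ofReal]
    rcases min_choice (tp (i / r)) (Y * tp (i / r - i)) with h | h <;> rw [h]
    · gcongr
      exact (hhigh1 i).trans (by gcongr; exact le_self_add)
    · refine (mul_le_mul_right (hhigh2 i) _).trans ?_
      calc tp (i / r) * (tp (-i) * A₂ * D) = tp (i / r - i) * (A₂ * D) := by
            rw [sub_eq_add_neg, tp_add]; ring
        _ ≤ tp (i / r - i) * ((A₁ + A₂) * (Y * M)) := by
            gcongr
            exact le_add_self
        _ = _ := by ring
  calc besovNorm ψ r g ≤ A₀ * X + ∑' i : ℕ,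
        min (tp (i / r)) (Y * tp (i / r - i)) * ((A₁ + A₂) * M) :=
        add_le_add hlow (ENNReal.tsum_le_tsum hterm)
    _ ≤ A₀ * Y ^ (1 / r) * M + T * Y ^ (1 / r) * ((A₁ + A₂) * M) := by
        rw [ENNReal.tsum_mul_right]
        have hYr : 1 ≤ Y ^ (1 / r) := ENNReal.one_le_rpow hY1 (by positivity)
        gcongr
        · exact le_mul_of_one_le_right' hYr
        · exact hTs Y hY0 hYt
    _ = _ := by ring

end Besov

section ParameterDerivative

variable {n : ℕ} {k : ℤ} {lam C C' lam' : ℝ} {κ κ' : ℝ → Rn n → ℂ} {f : Rn n → ℂ}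

lemma OscKernel.exists_dominating (h : OscKernel k lam C κ) {M : ℝ} (hM : ∀ x, ‖f x‖ ≤ M)
    (u₀ : ℝ) : ∃ b : Rn n → ℝ, Integrable b ∧
      ∀ u ∈ Metric.ball u₀ 1, ∀ x t, ‖κ u t * f (x - t)‖ ≤ b t := by
  have hM0 : 0 ≤ M := (norm_nonneg _).trans (hM 0)
  obtain ⟨D, hD⟩ := ((isCompact_closedBall u₀ 1).prod
    (isCompact_closedBall (0 : Rn n) ((2 : ℝ) ^ (k + 1)))).exists_bound_of_continuousOn
    h.cont.continuousOn
  refine ⟨(Metric.closedBall (0 : Rn n) ((2 : ℝ) ^ (k + 1))).indicator fun _ => D * M,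
    (integrable_indicator_iff Metric.isClosed_closedBall.measurableSet).2
      (integrableOn_const measure_closedBall_lt_top.ne), fun u hu x t => ?_⟩
  by_cases ht : t ∈ Metric.closedBall (0 : Rn n) ((2 : ℝ) ^ (k + 1))
  · rw [indicator_of_mem ht, norm_mul]
    have := hD (u, t) ⟨Metric.ball_subset_closedBall hu, ht⟩
    exact mul_le_mul this (hM _) (norm_nonneg _) ((norm_nonneg _).trans this)
  · rw [indicator_of_notMem ht, h.supp u t (by simpa using ht)]
    simp

lemma OscKernel.aestronglyMeasurable_mul (h : OscKernel k lam C κ) (hf : Measurable f) (u : ℝ)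
    (x : Rn n) : AEStronglyMeasurable (fun t => κ u t * f (x - t)) volume :=
  ((h.continuous u).measurable.mul (hf.comp (measurable_const.sub measurable_id)))
    |>.aestronglyMeasurable

lemma OscKernel.continuous_cv (h : OscKernel k lam C κ) (hf : Measurable f) {M : ℝ}
    (hM : ∀ x, ‖f x‖ ≤ M) (x : Rn n) : Continuous fun u => cv (κ u) f x := by
  refine continuous_iff_continuousAt.2 fun u₀ => ?_
  obtain ⟨b, hb, hle⟩ := h.exists_dominating hM u₀
  refine continuousAt_of_dominated
    (Eventually.of_forall fun u => h.aestronglyMeasurable_mul hf u x) ?_ hb ?_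
  · filter_upwards [Metric.ball_mem_nhds u₀ one_pos] with u hu
    exact Eventually.of_forall (hle u hu x)
  · exact Eventually.of_forall fun t =>
      ((h.cont.comp (Continuous.prodMk_left t)).mul continuous_const).continuousAt

lemma OscKernel.hasDerivAt_cv (h : OscKernel k lam C κ) (h' : OscKernel k lam' C' κ') {c : ℂ}
    (hd : ∀ u t, HasDerivAt (fun u => κ u t) (c * κ' u t) u) (hf : Measurable f) {M : ℝ}
    (hM : ∀ x, ‖f x‖ ≤ M) (x : Rn n) (u₀ : ℝ) :
    HasDerivAt (fun u => cv (κ u) f x) (c * cv (κ' u₀) f x) u₀ := by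
  obtain ⟨b, hb, hle⟩ := h.exists_dominating hM u₀
  obtain ⟨b', hb', hle'⟩ := h'.exists_dominating hM u₀
  have key := hasDerivAt_integral_of_dominated_loc_of_deriv_le
    (F := fun u t => κ u t * f (x - t)) (F' := fun u t => c * κ' u t * f (x - t))
    (bound := fun t => ‖c‖ * b' t) (μ := volume) (Metric.ball_mem_nhds u₀ one_pos)
    (Eventually.of_forall fun u => h.aestronglyMeasurable_mul hf u x)
    (hb.mono' (h.aestronglyMeasurable_mul hf u₀ x)
      (Eventually.of_forall (hle u₀ (Metric.mem_ball_self one_pos) x)))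
    (by simpa only [mul_assoc] using (h'.aestronglyMeasurable_mul hf u₀ x).const_mul c)
    (Eventually.of_forall fun t u hu => by
      rw [mul_assoc, norm_mul]
      exact mul_le_mul_of_nonneg_left (hle' u hu x t) (norm_nonneg c))
    (hb'.const_mul _) (Eventually.of_forall fun t u _ => (hd u t).mul_const _)
  refine key.2.congr_deriv ?_
  simp only [cv, mul_assoc]
  exact integral_const_mul c _

end ParameterDerivative

section LocalBesov

variable {n : ℕ} {Γ : ℝ → ℝ} {K : Rn n → ℝ} {ψ χ : ℝ → ℝ}

lemma hasDerivAt_localKer {a b : ℝ} (hb : b ≠ 0) (k : ℤ) (u : ℝ) (t : Rn n) :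
    HasDerivAt (fun u => localKer Γ K ψ (fun _ => 1) k (a * u) t)
      ((Complex.I * ((a * b : ℝ) : ℂ)) *
        localKer Γ K ψ (fun ρ => Γ ρ / b) k (a * u) t) u := by
  have hb' : (b : ℂ) ≠ 0 := Complex.ofReal_ne_zero.2 hb
  have h1 : HasDerivAt (fun u : ℝ => Complex.I * Complex.ofReal (a * u * Γ ‖t‖))
      (Complex.I * ((a * Γ ‖t‖ : ℝ) : ℂ)) u := by
    refine HasDerivAt.const_mul _ (HasDerivAt.ofReal_comp ?_)
    simpa using ((hasDerivAt_id u).const_mul a).mul_const (Γ ‖t‖)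
  refine (h1.cexp.mul_const _).congr_deriv ?_
  simp only [localKer]
  push_cast
  field_simp

/-- The Besov norm of `χ H`, when `H' = i μ H̃` with `μ` comparable to `lam`. -/
lemma exists_besovNorm_mul_le (hψ : IsLPCutoff ψ) (hχ : IsChiCutoff χ) {r B : ℝ} (hr : 1 < r)
    (hB : 0 < B) : ∃ A : ℝ≥0∞, A ≠ ⊤ ∧ ∀ (H H' : ℝ → ℂ) (μ : ℝ), 0 ≤ μ → 1 ≤ B * μ →
      Continuous H' → (∀ u, HasDerivAt H (Complex.I * μ * H' u) u) →
      besovNorm ψ r (fun u => Complex.ofReal (χ u) * H u) ^ r ≤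
        A * (ENNReal.ofReal (B * μ) * (∫⁻ u in Icc (1 / 2 : ℝ) 4, ‖H u‖ₑ ^ r) +
          ENNReal.ofReal (B * μ) * ∫⁻ u in Icc (1 / 2 : ℝ) 4, ‖H' u‖ₑ ^ r) := by
  have hr0 : 0 < r := by linarith
  obtain ⟨A₀, hA₀, hbes⟩ := exists_besovNorm_le hψ hr
  have hχd : Differentiable ℝ χ := hχ.1.differentiable (by simp)
  have hχc : Continuous (deriv χ) := hχ.1.continuous_deriv (by simp)
  have hsupp : ∀ u, u ∉ Icc (1 / 2 : ℝ) 4 → χ u = 0 := fun u hu => by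
    by_contra h; exact hu (hχ.2.2.1 u h)
  have htsupp : tsupport χ ⊆ Icc (1 / 2 : ℝ) 4 :=
    closure_minimal (fun u hu => hχ.2.2.1 u hu) isClosed_Icc
  have hsupp' : ∀ u, u ∉ Icc (1 / 2 : ℝ) 4 → deriv χ u = 0 := fun u hu => by
    by_contra h
    exact hu (htsupp (support_deriv_subset h))
  obtain ⟨D, hD⟩ := (isCompact_Icc (a := (1 / 2 : ℝ)) (b := 4)).exists_bound_of_continuousOn
    hχc.continuousOn
  set E : ℝ≥0∞ := 1 + ENNReal.ofReal D + (ENNReal.ofReal B)⁻¹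
  have hEt : E ≠ ⊤ := by
    have : (ENNReal.ofReal B)⁻¹ ≠ ⊤ := ENNReal.inv_ne_top.2 (by simpa using hB)
    finiteness
  refine ⟨A₀ ^ r * E ^ r * (2 : ℝ≥0∞) ^ (r - 1), by finiteness, fun H H' μ hμ hlam hc' hd => ?_⟩
  have hHc : Continuous H := continuous_iff_continuousAt.2 fun u => (hd u).continuousAt
  set g : ℝ → ℂ := fun u => Complex.ofReal (χ u) * H u with hg
  have hgd : ∀ u, HasDerivAt g (((deriv χ u : ℝ) : ℂ) * H u + χ u * (Complex.I * μ * H' u)) u :=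
    fun u => (hχd u).hasDerivAt.ofReal_comp.mul (hd u)
  have hgd' : deriv g = fun u => ((deriv χ u : ℝ) : ℂ) * H u + χ u * (Complex.I * μ * H' u) :=
    funext fun u => (hgd u).deriv
  have hg1 : ContDiff ℝ 1 g := by
    refine contDiff_one_iff_deriv.2 ⟨fun u => (hgd u).differentiableAt, ?_⟩
    rw [hgd']
    have := hχd.continuous
    fun_prop
  have hgs : HasCompactSupport g := HasCompactSupport.intro (K := Icc (1 / 2 : ℝ) 4) isCompact_Icc
    fun u hu => by simp [hg, hsupp u hu]
  set X : ℝ≥0∞ := eLpNorm H (ENNReal.ofReal r) (volume.restrict (Icc (1 / 2 : ℝ) 4))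
  set X' : ℝ≥0∞ := eLpNorm H' (ENNReal.ofReal r) (volume.restrict (Icc (1 / 2 : ℝ) 4))
  have hres : ∀ G : ℝ → ℂ, (∀ u, u ∉ Icc (1 / 2 : ℝ) 4 → G u = 0) →
      eLpNorm G (ENNReal.ofReal r) volume =
        eLpNorm G (ENNReal.ofReal r) (volume.restrict (Icc (1 / 2 : ℝ) 4)) := fun G hG => by
    rw [← eLpNorm_indicator_eq_eLpNorm_restrict measurableSet_Icc]
    congr 1
    funext u
    by_cases hu : u ∈ Icc (1 / 2 : ℝ) 4
    · rw [indicator_of_mem hu]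
    · rw [indicator_of_notMem hu, hG u hu]
  have hχ1 : ∀ u, ‖((χ u : ℝ) : ℂ)‖ ≤ 1 := fun u => by
    rw [Complex.norm_real, Real.norm_of_nonneg (hχ.2.1 u).1]; exact (hχ.2.1 u).2
  have hgX : eLpNorm g (ENNReal.ofReal r) volume ≤ X := by
    rw [hres g fun u hu => by simp [hg, hsupp u hu]]
    refine eLpNorm_mono fun u => ?_
    rw [hg, norm_mul]
    exact mul_le_of_le_one_left (norm_nonneg _) (hχ1 u)
  have hgX' : eLpNorm (deriv g) (ENNReal.ofReal r) volume ≤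
      ENNReal.ofReal D * X + ENNReal.ofReal μ * X' := by
    rw [hres _ fun u hu => by simp [hgd', hsupp u hu, hsupp' u hu], hgd']
    refine (eLpNorm_add_le (f := fun u => ((deriv χ u : ℝ) : ℂ) * H u)
      (g := fun u => χ u * (Complex.I * μ * H' u)) ?_ ?_ ?_).trans ?_
    · exact (by fun_prop : Continuous fun u => ((deriv χ u : ℝ) : ℂ) * H u).aestronglyMeasurable
    · have := hχd.continuous
      exact (by fun_prop : Continuous fun u =>
        (χ u : ℂ) * (Complex.I * μ * H' u)).aestronglyMeasurable
    · rw [← ENNReal.ofReal_one]; exact ENNReal.ofReal_le_ofReal hr.le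
    refine add_le_add ?_ ?_
    · refine eLpNorm_le_mul_eLpNorm_of_ae_le_mul ?_ _
      refine (ae_restrict_iff' measurableSet_Icc).2 (Eventually.of_forall fun u hu => ?_)
      rw [norm_mul, Complex.norm_real]
      exact mul_le_mul_of_nonneg_right (hD u hu) (norm_nonneg _)
    · refine eLpNorm_le_mul_eLpNorm_of_ae_le_mul (Eventually.of_forall fun u => ?_) _
      have hn : ‖Complex.I * μ * H' u‖ = μ * ‖H' u‖ := by
        rw [norm_mul, norm_mul, Complex.norm_I, one_mul, Complex.norm_real,
          Real.norm_of_nonneg hμ]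
      rw [norm_mul, hn]
      exact mul_le_of_le_one_left (by positivity) (hχ1 u)
  have hLX : ∀ G : ℝ → ℂ, eLpNorm G (ENNReal.ofReal r)
      (volume.restrict (Icc (1 / 2 : ℝ) 4)) ^ r = ∫⁻ u in Icc (1 / 2 : ℝ) 4, ‖G u‖ₑ ^ r :=
    fun G => by
      rw [eLpNorm_eq_lintegral_rpow_enorm_toReal (by simpa using hr0) ENNReal.ofReal_ne_top,
        ENNReal.toReal_ofReal hr0.le, ← ENNReal.rpow_mul, one_div_mul_cancel hr0.ne',
        ENNReal.rpow_one]
  set Y : ℝ≥0∞ := ENNReal.ofReal (B * μ)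
  have hY1 : 1 ≤ Y := by
    rw [← ENNReal.ofReal_one]; exact ENNReal.ofReal_le_ofReal hlam
  have hYt : Y ≠ ⊤ := ENNReal.ofReal_ne_top
  have hYμ : Y⁻¹ * ENNReal.ofReal μ = (ENNReal.ofReal B)⁻¹ := by
    have hμ' : 0 < μ := by nlinarith
    simp only [Y]
    rw [ENNReal.ofReal_mul hB.le, ENNReal.mul_inv (by simp) (by simp), mul_assoc,
      ENNReal.inv_mul_cancel (by simpa using hμ') (by simp), mul_one]
  have hsum : eLpNorm g (ENNReal.ofReal r) volume +
      Y⁻¹ * eLpNorm (deriv g) (ENNReal.ofReal r) volume ≤ E * (X + X') := by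
    calc _ ≤ X + Y⁻¹ * (ENNReal.ofReal D * X + ENNReal.ofReal μ * X') := by gcongr
      _ = X + Y⁻¹ * (ENNReal.ofReal D * X) + (ENNReal.ofReal B)⁻¹ * X' := by
          rw [mul_add, ← mul_assoc Y⁻¹ (ENNReal.ofReal μ), hYμ, add_assoc]
      _ ≤ X + ENNReal.ofReal D * X + (ENNReal.ofReal B)⁻¹ * X' := by
          gcongr X + ?_ + _
          exact mul_le_of_le_one_left' (ENNReal.inv_le_one.2 hY1)
      _ = (1 + ENNReal.ofReal D) * X + (ENNReal.ofReal B)⁻¹ * X' := by ring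
      _ ≤ E * X + E * X' := by
          gcongr
          · exact le_self_add
          · exact le_add_self
      _ = E * (X + X') := by ring
  calc besovNorm ψ r g ^ r ≤ (A₀ * Y ^ (1 / r) * (E * (X + X'))) ^ r := by
        gcongr
        refine (hbes g hg1 hgs (B * μ) hlam).trans ?_
        gcongr
    _ = A₀ ^ r * E ^ r * (Y * (X + X') ^ r) := by
        rw [ENNReal.mul_rpow_of_nonneg _ _ hr0.le, ENNReal.mul_rpow_of_nonneg _ _ hr0.le,
          ENNReal.mul_rpow_of_nonneg _ _ hr0.le, ← ENNReal.rpow_mul,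
          one_div_mul_cancel hr0.ne', ENNReal.rpow_one]
        ring
    _ ≤ A₀ ^ r * E ^ r * (Y * ((2 : ℝ≥0∞) ^ (r - 1) * (X ^ r + X' ^ r))) := by
        gcongr
        exact ENNReal.rpow_add_le_mul_rpow_add_rpow _ _ hr.le
    _ = _ := by
        simp only [X, X', hLX]
        ring

end LocalBesov

section Main

variable {n : ℕ} {Γ : ℝ → ℝ} {K : Rn n → ℝ} {ψ χ : ℝ → ℝ}

/-- Pointwise domination of the Besov square function. -/
lemma exists_tsum_besovNorm_le (hn : 2 ≤ n) (hΓ : IsGammaU Γ) (hK : IsHomCZKernel n K)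
    (hψ : IsLPCutoff ψ) (hχ : IsChiCutoff χ) {r : ℝ} (hr : 1 < r) :
    ∃ c > 0, ∃ C C' : ℝ, ∃ N : ℕ, ∃ A : ℝ≥0∞, A ≠ ⊤ ∧ ∀ l : ℤ, 1 ≤ l →
      ∃ lam : ℤ → ℝ, ∃ κ κ' : ℤ → ℝ → Rn n → ℂ,
        OscFamily (fun j => l + kstar Γ j) lam C N ((2 : ℝ) ^ (c * (l : ℝ))) κ ∧
        OscFamily (fun j => l + kstar Γ j) lam C' N ((2 : ℝ) ^ (c * (l : ℝ))) κ' ∧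
        ∀ f : Rn n → ℂ, Measurable f → (∃ M : ℝ, ∀ x, ‖f x‖ ≤ M) → ∀ x,
          (∑' j : ℤ, besovNorm ψ r (fun u => Complex.ofReal (χ u) *
            Hloc Γ K ψ ((2 : ℝ) ^ j * u) (l + kstar Γ j) f x) ^ r) ^ (1 / r) ≤
              A * (famN lam κ r f x + famN lam κ' r f x) := by
  obtain ⟨B, hB, c, hc, C, C', N, h⟩ := exists_oscFamily_localKer hn hΓ hK hψ
  obtain ⟨A, hA, hbes⟩ := exists_besovNorm_mul_le hψ hχ hr hB
  have hr0 : 0 < r := by linarith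
  refine ⟨c, hc, C, C', N, A ^ (1 / r), by finiteness, fun l hl =>
    ⟨_, _, _, (h l hl).1, (h l hl).2, fun f hf ⟨M, hM⟩ x => ?_⟩⟩
  obtain ⟨h1, h2⟩ := h l hl
  simp only [Hloc_eq_cv, famN]
  have hterm : ∀ j : ℤ, _ := fun j =>
    hbes (fun u => cv (localKer Γ K ψ (fun _ => 1) (l + kstar Γ j) ((2 : ℝ) ^ j * u)) f x)
      (fun u => cv (localKer Γ K ψ (fun ρ => Γ ρ / Γ ((2 : ℝ) ^ (l + kstar Γ j)))
        (l + kstar Γ j) ((2 : ℝ) ^ j * u)) f x) ((2 : ℝ) ^ j * Γ ((2 : ℝ) ^ (l + kstar Γ j)))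
      (mul_nonneg (by positivity) (hΓ.pos (by positivity)).le) (h1.osc j).one_le
      ((h2.osc j).continuous_cv hf hM x) ((h1.osc j).hasDerivAt_cv (h2.osc j)
        (fun u t => hasDerivAt_localKer (hΓ.pos (by positivity)).ne' _ u t) hf hM x)
  refine (ENNReal.rpow_le_rpow (ENNReal.tsum_le_tsum hterm) (by positivity)).trans ?_
  rw [ENNReal.tsum_mul_left, ENNReal.tsum_add, ENNReal.mul_rpow_of_nonneg _ _ (by positivity)]
  gcongr
  exact ENNReal.rpow_add_le_add_rpow _ _ (by positivity)
    ((div_le_one hr0).2 hr.le)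

end Main

/-- Lemma 5.2. -/
theorem Hjl_besov_estimate (n : ℕ) (hn : 2 ≤ n) (Γ : ℝ → ℝ) (hΓ : IsGammaU Γ)
    (K : Rn n → ℝ) (hK : IsHomCZKernel n K) (ψ : ℝ → ℝ) (hψ : IsLPCutoff ψ)
    (χ : ℝ → ℝ) (hχ : IsChiCutoff χ)
    (p r : ℝ) (hp : 1 < p) (hr : 2 < r) (hrp : p / (p - 1) / n < r) :
    ∃ ε > (0 : ℝ), ∃ C > (0 : ℝ), ∀ l : ℤ, 1 ≤ l → ∀ f : SchwartzMap (Rn n) ℂ,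
      lpNormENN p
          (fun x => (∑' j : ℤ,
            besovNorm ψ r (fun u =>
              Complex.ofReal (χ u) * Hloc Γ K ψ ((2 : ℝ) ^ j * u) (l + kstar Γ j) (⇑f) x) ^ r)
              ^ (1 / r)) volume
        ≤ ENNReal.ofReal (C * (2 : ℝ) ^ (-(ε * (l : ℝ)))) *
            eLpNorm (⇑f) (ENNReal.ofReal p) volume := by
  obtain ⟨c, hc, C, C', N, A, hA, h⟩ :=
    exists_tsum_besovNorm_le hn hΓ hK hψ hχ (show 1 < r by linarith)
  obtain ⟨ε₁, hε₁, A₁, hA₁, h₁⟩ := exists_lintegral_famN_le hn hp hr hrp C N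
  obtain ⟨ε₂, hε₂, A₂, hA₂, h₂⟩ := exists_lintegral_famN_le hn hp hr hrp C' N
  have hp0 : 0 < p := by linarith
  have hS : A * (A₁ + A₂) ≠ ⊤ := by finiteness
  refine ⟨c * min ε₁ ε₂, by positivity, (A * (A₁ + A₂)).toReal + 1, by positivity,
    fun l hl f => ?_⟩
  obtain ⟨lam, κ, κ', hκ, hκ', hle⟩ := h l hl
  have hfm : Measurable f := f.continuous.measurable
  obtain ⟨M, hM⟩ : ∃ M : ℝ, ∀ x, ‖f x‖ ≤ M :=
    ⟨_, fun x => f.toBoundedContinuousFunction.norm_coe_le_norm x⟩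
  have hL : ∀ ε, min ε₁ ε₂ ≤ ε → ENNReal.ofReal ((2 : ℝ) ^ (c * (l : ℝ))) ^ (-ε) ≤
      tp (-(c * min ε₁ ε₂ * l)) := fun ε hε => by
    rw [← tp_eq_ofReal, tp_rpow]
    refine tp_mono ?_
    have hl' : (0 : ℝ) ≤ l := by exact_mod_cast (by omega : 0 ≤ l)
    nlinarith [mul_le_mul_of_nonneg_left hε (mul_nonneg hc.le hl')]
  have hF : (∫⁻ x, ‖f x‖ₑ ^ p) ^ (1 / p) = eLpNorm f (ENNReal.ofReal p) volume := by
    rw [eLpNorm_eq_lintegral_rpow_enorm_toReal (by simpa using hp0) ENNReal.ofReal_ne_top,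
      ENNReal.toReal_ofReal hp0.le]
  set T := tp (-(c * min ε₁ ε₂ * l))
  set F := eLpNorm f (ENNReal.ofReal p) volume
  have e₁ : (∫⁻ x, famN lam κ r f x ^ p) ^ (1 / p) ≤ A₁ * T * F := by
    refine (h₁ _ _ _ _ hκ f M hM hfm f.integrable).trans ?_
    rw [hF]
    gcongr
    exact hL _ (min_le_left _ _)
  have e₂ : (∫⁻ x, famN lam κ' r f x ^ p) ^ (1 / p) ≤ A₂ * T * F := by
    refine (h₂ _ _ _ _ hκ' f M hM hfm f.integrable).trans ?_
    rw [hF]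
    gcongr
    exact hL _ (min_le_right _ _)
  calc _ ≤ (∫⁻ x, (A * (famN lam κ r f x + famN lam κ' r f x)) ^ p) ^ (1 / p) := by
        refine ENNReal.rpow_le_rpow (lintegral_mono fun x => ?_) (by positivity)
        exact ENNReal.rpow_le_rpow (hle f hfm ⟨M, hM⟩ x) hp0.le
    _ = A * (∫⁻ x, (famN lam κ r f x + famN lam κ' r f x) ^ p) ^ (1 / p) := by
        simp_rw [ENNReal.mul_rpow_of_nonneg _ _ hp0.le]
        rw [lintegral_const_mul' _ _ (by finiteness),
          ENNReal.mul_rpow_of_nonneg _ _ (by positivity), ← ENNReal.rpow_mul,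
          mul_one_div_cancel hp0.ne', ENNReal.rpow_one]
    _ ≤ A * (A₁ * T * F + A₂ * T * F) := by
        gcongr
        exact (ENNReal.lintegral_Lp_add_le (hκ.measurable_famN r hfm).aemeasurable
          (hκ'.measurable_famN r hfm).aemeasurable hp.le).trans (add_le_add e₁ e₂)
    _ = A * (A₁ + A₂) * T * F := by ring
    _ ≤ _ := by
        rw [ENNReal.ofReal_mul (by positivity), ← tp_eq_ofReal]
        gcongr
        rw [← ENNReal.ofReal_toReal hS]
        refine ENNReal.ofReal_le_ofReal ?_
        rw [ENNReal.toReal_ofReal ENNReal.toReal_nonneg]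
        linarith
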